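/- For every real x ≥ 1 one has |ψ(x) − x| ≤ (π/(3·10^12))·x + 113.67·√x, and |∑_{n ≤ x} Λ(n)/n − (log x − γ)| ≤ π/(3·10^12) + 113.67/√x. (These follow from the verification that the Riemann hypothesis holds up to height 3·10^12.) -/

import Mathlib

open Real Finset

/-- The Chebyshev function `ψ(x) = ∑_{n ≤ x} Λ(n)`. -/
noncomputable def chebyshevPsi (x : ℝ) : ℝ :=
  ∑ n ∈ Finset.Icc 1 ⌊x⌋₊, ArithmeticFunction.vonMangoldt n

namespace PB
open Filter Topology Metric

/-- pointwise bounded convergence of holomorphic functions gives convergence of derivatives -/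
lemma deriv_tendsto_of_bounded {f : ℕ → ℂ → ℂ} {g : ℂ → ℂ} {c : ℂ} {R B : ℝ} (hR : 0 < R)
    (hf : ∀ n, DiffContOnCl ℂ (f n) (ball c R)) (hg : DiffContOnCl ℂ g (ball c R))
    (hB : ∀ᶠ n in atTop, ∀ z ∈ sphere c R, ‖f n z‖ ≤ B)
    (hlim : ∀ z ∈ sphere c R, Tendsto (fun n => f n z) atTop (𝓝 (g z))) :
    Tendsto (fun n => deriv (f n) c) atTop (𝓝 (deriv g c)) := by
  have h1 : ∀ n, deriv (f n) c = (2 * π * Complex.I : ℂ)⁻¹ • ∮ z in C(c, R), (1 / (z - c) ^ 2) • f n z :=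
    fun n => by
      rw [(hf n).deriv_eq_smul_circleIntegral hR, smul_smul, inv_mul_cancel₀ Complex.two_pi_I_ne_zero, one_smul]
  have h2 : deriv g c = (2 * π * Complex.I : ℂ)⁻¹ • ∮ z in C(c, R), (1 / (z - c) ^ 2) • g z := by
    rw [hg.deriv_eq_smul_circleIntegral hR, smul_smul, inv_mul_cancel₀ Complex.two_pi_I_ne_zero, one_smul]
  rw [h2]; simp_rw [h1]
  refine Tendsto.const_smul ?_ _
  unfold circleIntegral
  have hcm : ∀ θ : ℝ, circleMap c R θ ∈ sphere c R := fun θ => circleMap_mem_sphere c hR.le θ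
  refine intervalIntegral.tendsto_integral_filter_of_dominated_convergence
    (fun _ => R * (1 / R ^ 2 * B)) ?_ ?_ (by simp) ?_
  · refine Eventually.of_forall fun n => ?_
    refine Continuous.aestronglyMeasurable ?_
    have hc : Continuous fun θ : ℝ => f n (circleMap c R θ) := by
      have := (hf n).continuousOn
      rw [closure_ball c hR.ne'] at this
      exact this.comp_continuous (continuous_circleMap c R) (fun θ => sphere_subset_closedBall (hcm θ))
    have h0 : ∀ θ : ℝ, circleMap c R θ - c ≠ 0 := fun θ => by
      rw [sub_ne_zero]; exact circleMap_ne_center hR.ne'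
    simp only [deriv_circleMap, smul_eq_mul]
    refine ((continuous_circleMap 0 R).mul continuous_const).mul (Continuous.mul ?_ hc)
    exact continuous_const.div₀ (((continuous_circleMap c R).sub continuous_const).pow 2) (fun θ => pow_ne_zero 2 (h0 θ))
  · filter_upwards [hB] with n hn
    refine Eventually.of_forall fun θ _ => ?_
    have h3 := hn _ (hcm θ)
    have : ‖circleMap c R θ - c‖ = R := by simpa [dist_eq_norm] using hcm θ
    rw [norm_smul, norm_smul, norm_div, norm_one, norm_pow, this, deriv_circleMap]
    simp only [norm_mul, Complex.norm_I, norm_circleMap_zero, abs_of_pos hR, mul_one]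
    gcongr
  · refine Eventually.of_forall fun θ _ => ?_
    exact ((hlim _ (hcm θ)).const_smul _).const_smul _

lemma norm_GammaSeq_le {z : ℂ} (hz : 0 < z.re) {n : ℕ} (hn : n ≠ 0) :
    ‖Complex.GammaSeq z n‖ ≤ Real.Gamma z.re := by
  have h1 : ‖Complex.GammaSeq z n‖ ≤ Real.exp (Real.BohrMollerup.logGammaSeq z.re n) := by
    unfold Complex.GammaSeq Real.BohrMollerup.logGammaSeq
    have hn0 : (0:ℝ) < n := by positivity
    have hp : ∀ j ∈ range (n+1), 0 < z.re + (j:ℝ) := fun j _ => by positivity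
    rw [Real.exp_sub, Real.exp_add, Real.exp_log (by positivity), mul_comm z.re, ← Real.rpow_def_of_pos hn0,
      Real.exp_sum, Finset.prod_congr rfl (fun j hj => Real.exp_log (hp j hj))]
    rw [norm_div, norm_mul, Complex.norm_natCast_cpow_of_pos (by positivity), norm_prod]
    simp only [Complex.norm_natCast]
    have : ∏ j ∈ range (n+1), (z.re + (j:ℝ)) ≤ ∏ j ∈ range (n+1), ‖z + j‖ := by
      refine Finset.prod_le_prod (fun j hj => (hp j hj).le) fun j _ => ?_
      have := Complex.re_le_norm (z + j)
      simpa using this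
    have h0 : 0 < ∏ j ∈ range (n+1), (z.re + (j:ℝ)) := Finset.prod_pos hp
    gcongr
  refine h1.trans ?_
  have h2 := Real.BohrMollerup.ge_logGammaSeq (f := Real.log ∘ Real.Gamma) (x := z.re) (n := n)
    Real.convexOn_log_Gamma (fun {y} hy => by
      simp only [Function.comp]
      rw [Real.Gamma_add_one hy.ne', Real.log_mul hy.ne' (Real.Gamma_pos_of_pos hy).ne', add_comm]) hz hn
  simp only [Function.comp, Real.Gamma_one, Real.log_one, zero_add] at h2
  calc _ ≤ Real.exp (Real.log (Real.Gamma z.re)) := Real.exp_le_exp.2 h2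
    _ = _ := Real.exp_log (Real.Gamma_pos_of_pos hz)

lemma differentiableAt_GammaSeq {z : ℂ} (hz : 0 < z.re) {n : ℕ} (hn : n ≠ 0) :
    HasDerivAt (fun z => Complex.GammaSeq z n)
      (Complex.GammaSeq z n * (Real.log n - ∑ j ∈ range (n+1), 1 / (z + j))) z := by
  have hn' : (n:ℂ) ≠ 0 := by exact_mod_cast hn
  have hp : ∀ j ∈ range (n+1), z + (j:ℂ) ≠ 0 := fun j _ h => by
    have := congrArg Complex.re h
    simp at this; have : (0:ℝ) ≤ j := by positivity
    linarith
  have h0 : ∏ j ∈ range (n+1), (z + (j:ℂ)) ≠ 0 := Finset.prod_ne_zero_iff.2 hp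
  have h1 : HasDerivAt (fun z : ℂ => (n:ℂ) ^ z * (n.factorial : ℂ)) ((n:ℂ)^z * Complex.log n * (n.factorial : ℂ)) z := by
    have := ((hasDerivAt_id z).const_cpow (c := (n:ℂ)) (Or.inl hn')).mul_const (n.factorial : ℂ)
    simpa using this
  have h2 : HasDerivAt (fun z : ℂ => ∏ j ∈ range (n+1), (z + (j:ℂ)))
      ((∏ j ∈ range (n+1), (z + (j:ℂ))) * ∑ j ∈ range (n+1), 1 / (z + j)) z := by
    have hd : DifferentiableAt ℂ (fun z : ℂ => ∏ j ∈ range (n+1), (z + (j:ℂ))) z := by fun_prop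
    have h3 := logDeriv_prod (s := range (n+1)) (f := fun (j:ℕ) (z:ℂ) => z + (j:ℂ)) (x := z) hp (fun j _ => by fun_prop)
    have h4 : deriv (fun z : ℂ => ∏ j ∈ range (n+1), (z + (j:ℂ))) z = (∏ j ∈ range (n+1), (z + (j:ℂ))) * ∑ j ∈ range (n+1), 1 / (z + j) := by
      have h5 : logDeriv (fun z : ℂ => ∏ j ∈ range (n+1), (z + (j:ℂ))) z = ∑ j ∈ range (n+1), 1 / (z + j) := by
        rw [h3]; refine Finset.sum_congr rfl fun j _ => ?_
        simp [logDeriv_apply]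
      rw [← h5, logDeriv_apply]; field_simp
    rw [← h4]; exact hd.hasDerivAt
  have h3 := h1.div h2 h0
  refine (h3.congr_deriv ?_)
  unfold Complex.GammaSeq
  rw [Complex.natCast_log]
  field_simp

lemma digamma_tendsto {z : ℂ} (hz : 0 < z.re) :
    Tendsto (fun n : ℕ => (Real.log n : ℂ) - ∑ j ∈ range (n+1), 1 / (z + j)) atTop
      (𝓝 (Complex.digamma z)) := by
  have hR : 0 < z.re / 2 := by positivity
  have hre : ∀ w ∈ closedBall z (z.re/2), z.re / 2 ≤ w.re ∧ w.re ≤ 2 * z.re := fun w hw => by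
    have h1 := Complex.abs_re_le_norm (w - z)
    rw [mem_closedBall, dist_eq_norm] at hw
    have := abs_le.1 (h1.trans hw)
    simp at this
    constructor <;> linarith [this.1, this.2]
  have hGc : ContinuousOn Real.Gamma (Set.Icc (z.re/2) (2 * z.re)) := fun x hx =>
    (Real.differentiableAt_Gamma (fun m => by
      have : (0:ℝ) ≤ m := by positivity
      linarith [hx.1])).continuousAt.continuousWithinAt
  obtain ⟨B, hB⟩ := (isCompact_Icc.image_of_continuousOn hGc).bddAbove
  have hne : ∀ w ∈ closedBall z (z.re/2), ∀ m : ℕ, w ≠ -m := fun w hw m h => by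
    have := (hre w hw).1
    rw [h] at this; simp at this
    have : (0:ℝ) ≤ m := by positivity
    linarith
  have key := deriv_tendsto_of_bounded (f := fun n z => Complex.GammaSeq z (n+1)) (g := Complex.Gamma)
    (c := z) (R := z.re/2) (B := B) hR
    (fun n => by
      refine DifferentiableOn.diffContOnCl (fun w hw => ?_)
      rw [closure_ball _ hR.ne'] at hw
      exact (differentiableAt_GammaSeq (by linarith [(hre w hw).1]) n.succ_ne_zero).differentiableAt.differentiableWithinAt)
    (by
      refine DifferentiableOn.diffContOnCl (fun w hw => ?_)
      rw [closure_ball _ hR.ne'] at hw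
      exact (Complex.differentiableAt_Gamma w (hne w hw)).differentiableWithinAt)
    (Eventually.of_forall fun n w hw => by
      have h := hre w (sphere_subset_closedBall hw)
      exact (norm_GammaSeq_le (by linarith [h.1]) n.succ_ne_zero).trans
        (hB ⟨w.re, ⟨h.1, h.2⟩, rfl⟩))
    (fun w _ => (Complex.GammaSeq_tendsto_Gamma w).comp (tendsto_add_atTop_nat 1))
  have h2 := (Complex.GammaSeq_tendsto_Gamma z).comp (tendsto_add_atTop_nat 1)
  have hG : Complex.Gamma z ≠ 0 := Complex.Gamma_ne_zero_of_re_pos hz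
  have h3 := key.div h2 hG
  rw [Complex.digamma_def, logDeriv_apply]
  rw [← tendsto_add_atTop_iff_nat 1]
  refine h3.congr' ?_
  have h4 : ∀ᶠ n in atTop, Complex.GammaSeq z (n+1) ≠ 0 := h2.eventually_ne hG
  filter_upwards [h4] with n hn
  have := (differentiableAt_GammaSeq hz n.succ_ne_zero).deriv
  simp only [Function.comp, Nat.succ_eq_add_one] at this ⊢
  simp only [Pi.div_apply, Function.comp_apply]
  rw [this]
  field_simp

lemma norm_inv_sub_log_le {w : ℂ} (hw : 0 < w.re) :
    ‖1 / w - (Complex.log (w + 1) - Complex.log w)‖ ≤ 1 / 2 * (1 / ‖w‖ ^ 2) := by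
  have hw0 : w ≠ 0 := fun h => by simp [h] at hw
  have hre : ∀ t : ℝ, 0 ≤ t → 0 < (w + t).re := fun t ht => by simp; linarith
  have hne : ∀ t : ℝ, 0 ≤ t → w + t ≠ 0 := fun t ht h => by have := hre t ht; simp [h] at this
  have hn : ∀ t : ℝ, 0 ≤ t → ‖w‖ ≤ ‖w + t‖ := fun t ht => by
    rw [← sq_le_sq₀ (norm_nonneg _) (norm_nonneg _), ← Complex.normSq_eq_norm_sq, ← Complex.normSq_eq_norm_sq,
      Complex.normSq_apply, Complex.normSq_apply]
    simp; nlinarith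
  have hd : ∀ t ∈ Set.uIcc (0:ℝ) 1, HasDerivAt (fun t : ℝ => t / w - Complex.log (w + t)) (1 / w - 1 / (w + t)) t := by
    intro t ht
    rw [Set.uIcc_of_le zero_le_one] at ht
    have h1 : HasDerivAt (fun t : ℝ => w + (t:ℂ)) 1 t := by
      simpa using (Complex.ofRealCLM.hasDerivAt (x := t)).const_add w
    have h2 : HasDerivAt (fun t : ℝ => (t:ℂ) / w) (1 / w) t := by
      simpa using (Complex.ofRealCLM.hasDerivAt (x := t)).div_const w
    exact h2.sub (h1.clog_real (Or.inl (hre t ht.1)))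
  have hcont : ContinuousOn (fun t : ℝ => 1 / w - 1 / (w + t)) (Set.uIcc 0 1) := by
    rw [Set.uIcc_of_le zero_le_one]
    refine continuousOn_const.sub (continuousOn_const.div (by fun_prop) fun t ht => hne t ht.1)
  have hi := intervalIntegral.integral_eq_sub_of_hasDerivAt hd hcont.intervalIntegrable
  have e1 : 1 / w - (Complex.log (w + 1) - Complex.log w) = ∫ t in (0:ℝ)..1, (1 / w - 1 / (w + t)) := by
    rw [hi]; simp; ring
  rw [e1]
  calc _ ≤ ∫ t in (0:ℝ)..1, t * (1 / ‖w‖^2) := by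
        refine intervalIntegral.norm_integral_le_of_norm_le zero_le_one ?_ (by apply Continuous.intervalIntegrable; fun_prop)
        refine Eventually.of_forall fun t ht => ?_
        have e2 : 1 / w - 1 / (w + t) = t / (w * (w + t)) := by
          have := hne t ht.1.le
          field_simp; ring
        have hwp : 0 < ‖w‖ := norm_pos_iff.2 hw0
        rw [e2, norm_div, norm_mul, Complex.norm_real, Real.norm_of_nonneg ht.1.le, mul_one_div, sq]
        have := hn t ht.1.le
        have := ht.1.le
        gcongr
    _ = _ := by
        rw [intervalIntegral.integral_mul_const, integral_id]; norm_num

lemma sum_inv_sq_le {a : ℝ} (ha : 0 < a) (n : ℕ) :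
    ∑ j ∈ range (n+1), 1 / (a + j)^2 ≤ 1 / a ^ 2 + 1 / a - 1 / (a + n) := by
  induction n with
  | zero => simp
  | succ n ih =>
    rw [Finset.sum_range_succ]
    have h0 : 0 < a + n := by positivity
    have : 1 / (a + (n+1:ℕ)) ^ 2 ≤ 1 / (a + n) - 1 / (a + (n+1:ℕ)) := by
      push_cast
      rw [div_sub_div _ _ h0.ne' (by positivity), div_le_div_iff₀ (by positivity) (by positivity)]
      nlinarith
    linarith

lemma tendsto_log_shift (z : ℂ) :
    Tendsto (fun n : ℕ => (Real.log n : ℂ) - Complex.log (z + (n+1:ℕ))) atTop (𝓝 0) := by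
  have h1 : Tendsto (fun n : ℕ => 1 + (z + 1) / (n:ℂ)) atTop (𝓝 1) := by
    simpa using (tendsto_const_div_atTop_nhds_zero_nat (z + 1)).const_add (1:ℂ)
  have h2 : Tendsto (fun n : ℕ => -Complex.log (1 + (z + 1) / (n:ℂ))) atTop (𝓝 (-Complex.log 1)) :=
    ((continuousAt_clog (Or.inl (by simp))).tendsto.comp h1).neg
  rw [Complex.log_one, neg_zero] at h2
  refine h2.congr' ?_
  filter_upwards [h1.eventually_ne one_ne_zero, eventually_gt_atTop 0] with n hn hn0
  have hn1 : (n:ℂ) ≠ 0 := by exact_mod_cast hn0.ne'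
  have : z + ((n+1:ℕ):ℂ) = ((n:ℝ):ℂ) * (1 + (z+1)/n) := by
    push_cast; field_simp; ring
  rw [this, Complex.log_ofReal_mul (by exact_mod_cast hn0) hn]
  ring

/-- `|ψ(z) - log z| ≤ 1/|z| + 1/|z|²` in the right half plane -/
lemma norm_digamma_sub_log_le {z : ℂ} (hz : 0 < z.re) :
    ‖Complex.digamma z - Complex.log z‖ ≤ 1 / ‖z‖ + 1 / ‖z‖ ^ 2 := by
  have hz0 : z ≠ 0 := fun h => by simp [h] at hz
  have hzp : 0 < ‖z‖ := norm_pos_iff.2 hz0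
  have h1 := ((digamma_tendsto hz).sub (tendsto_log_shift z)).sub_const (Complex.log z)
  rw [sub_zero] at h1
  refine le_of_tendsto h1.norm (Eventually.of_forall fun n => ?_)
  have e1 : ∀ n : ℕ, (Real.log n : ℂ) - ∑ j ∈ range (n+1), 1 / (z + j) - ((Real.log n : ℂ) - Complex.log (z + (n+1:ℕ))) - Complex.log z
      = - ∑ j ∈ range (n+1), (1 / (z + j) - (Complex.log (z + j + 1) - Complex.log (z + j))) := by
    intro n
    rw [Finset.sum_sub_distrib]
    have : ∑ j ∈ range (n+1), (Complex.log (z + j + 1) - Complex.log (z + j)) = Complex.log (z + (n+1:ℕ)) - Complex.log z := by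
      have := Finset.sum_range_sub (fun j : ℕ => Complex.log (z + j)) (n+1)
      simp only [Nat.cast_zero, add_zero] at this
      rw [← this]
      refine Finset.sum_congr rfl fun j _ => ?_
      push_cast; rw [add_assoc]
    rw [this]; ring
  rw [e1, norm_neg]
  calc _ ≤ ∑ j ∈ range (n+1), ‖1 / (z + j) - (Complex.log (z + j + 1) - Complex.log (z + j))‖ := norm_sum_le _ _
    _ ≤ ∑ j ∈ range (n+1), 1 / (‖z‖ + j)^2 := by
        refine Finset.sum_le_sum fun j _ => ?_
        have hj : (0:ℝ) ≤ j := by positivity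
        have hr : 0 < (z + j).re := by simp; linarith
        refine (norm_inv_sub_log_le hr).trans ?_
        have : (‖z‖ + j)^2 ≤ 2 * ‖z + j‖^2 := by
          have e := Complex.sq_norm z
          rw [Complex.sq_norm, Complex.normSq_apply]
          rw [Complex.normSq_apply] at e
          simp
          nlinarith [sq_nonneg (‖z‖ - j)]
        have h2 : 0 < ‖z‖ + j := by positivity
        rw [div_mul_div_comm, div_le_div_iff₀ (by
          have : 0 < ‖z + j‖ := norm_pos_iff.2 (fun h => by simp [h] at hr)
          positivity) (by positivity)]
        nlinarith
    _ ≤ _ := (sum_inv_sq_le hzp n)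
    _ ≤ _ := by
        have : 0 ≤ 1 / (‖z‖ + n) := by positivity
        linarith

lemma log_le_half_sub_inv {a : ℝ} (ha : 1 ≤ a) : Real.log a ≤ (a - 1 / a) / 2 := by
  have h := Real.self_le_sinh_iff.2 (Real.log_nonneg ha)
  rwa [Real.sinh_eq, Real.exp_neg, Real.exp_log (by linarith), ← one_div] at h

lemma digamma_real_le {x : ℝ} (hx : 0 < x) :
    (Complex.digamma x).re ≤ Real.log x - 1 / (2 * x) := by
  have h1 := (digamma_tendsto (z := (x:ℂ)) (by simpa using hx)).sub (tendsto_log_shift x)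
  rw [sub_zero] at h1
  have h2 := (Complex.continuous_re.tendsto _).comp h1
  have h3 : Tendsto (fun n : ℕ => Real.log x - 1 / (2 * x) + 1 / (2 * (x + (n + 1 : ℕ)))) atTop (𝓝 (Real.log x - 1 / (2 * x) + 0)) := by
    refine Tendsto.const_add _ ?_
    refine Tendsto.div_atTop tendsto_const_nhds ?_
    refine Tendsto.const_mul_atTop two_pos (tendsto_atTop_add_const_left _ _ ?_)
    exact tendsto_natCast_atTop_atTop.comp (tendsto_add_atTop_nat 1)
  rw [add_zero] at h3
  refine le_of_tendsto_of_tendsto' h2 h3 fun n => ?_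
  have e : ((Real.log n : ℂ) - ∑ j ∈ range (n+1), 1 / ((x:ℂ) + j) - ((Real.log n : ℂ) - Complex.log ((x:ℂ) + (n+1:ℕ))))
      = ((Real.log (x + (n+1:ℕ)) - ∑ j ∈ range (n+1), 1 / (x + j) : ℝ) : ℂ) := by
    push_cast
    rw [Complex.ofReal_log (by positivity)]
    push_cast; ring
  simp only [Function.comp]
  rw [e, Complex.ofReal_re]
  clear e h1 h2 h3
  induction n with
  | zero =>
    simp
    have := log_le_half_sub_inv (a := (x + 1)/x) (by rw [le_div_iff₀ hx]; linarith)
    rw [Real.log_div (by positivity) hx.ne'] at this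
    have e : ((x + 1)/x - 1/((x+1)/x))/2 = (x⁻¹ - x⁻¹ * 2⁻¹) + (x+1)⁻¹ * 2⁻¹ := by
      field_simp; ring
    linarith
  | succ n ih =>
    rw [Finset.sum_range_succ]
    have hy : 0 < x + (n+1:ℕ) := by positivity
    set y := x + ((n+1:ℕ):ℝ) with hyd
    have e0 : x + ((n+1+1:ℕ):ℝ) = y + 1 := by rw [hyd]; push_cast; ring
    rw [e0]
    have := log_le_half_sub_inv (a := (y + 1)/y) (by rw [le_div_iff₀ hy]; linarith)
    rw [Real.log_div (by positivity) hy.ne'] at this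
    have e : ((y + 1)/y - 1/((y+1)/y))/2 = 1 / (2 * y) + 1 / (2 * (y + 1)) := by
      field_simp; ring
    have e3 : 1 / y = 2 * (1 / (2 * y)) := by field_simp
    linarith

end PB

namespace PB
open Filter Topology Metric
open scoped ComplexConjugate

noncomputable def Xi (s : ℂ) : ℂ := s * (s - 1) * completedRiemannZeta₀ s + 1

lemma Xi_diff : Differentiable ℂ Xi := by
  unfold Xi
  have := differentiable_completedZeta₀
  fun_prop

lemma Xi_one_sub (s : ℂ) : Xi (1 - s) = Xi s := by
  unfold Xi; rw [completedRiemannZeta₀_one_sub]; ring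

lemma Xi_zero : Xi 0 = 1 := by simp [Xi]
lemma Xi_one : Xi 1 = 1 := by simp [Xi]

lemma riemannZeta₁_eq {s : ℂ} (hs : s ≠ 1) : riemannZeta₁ s = (s - 1) * riemannZeta s := by
  rw [riemannZeta_eq_inv_sub_mul hs]
  have := sub_ne_zero_of_ne hs
  field_simp

lemma Xi_eq {s : ℂ} (hs : -2 < s.re) :
    Xi s = 2 * riemannZeta₁ s * (π:ℂ) ^ (-s/2) * Complex.Gamma (s / 2 + 1) := by
  by_cases h0 : s = 0
  · subst h0
    rw [Xi_zero, riemannZeta₁_eq (by norm_num), riemannZeta_zero]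
    norm_num
  by_cases h1 : s = 1
  · subst h1
    have h := Complex.Gammaℝ_one
    rw [Complex.Gammaℝ_def] at h
    rw [Xi_one, riemannZeta₁_one, Complex.Gamma_add_one _ (by norm_num)]
    linear_combination -h
  · have hG : Complex.Gammaℝ s ≠ 0 := by
      rw [Ne, Complex.Gammaℝ_eq_zero_iff]
      rintro ⟨n, hn⟩
      rcases n with _ | n
      · simp at hn; exact h0 hn
      · rw [hn] at hs; simp at hs
        have : (0:ℝ) ≤ n := by positivity
        linarith
    have hs1 := sub_ne_zero_of_ne h1
    have h1s : 1 - s ≠ 0 := fun h => hs1 (by linear_combination -h)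
    have e1 : Xi s = s * (s - 1) * completedRiemannZeta s := by
      unfold Xi; rw [completedRiemannZeta_eq]; field_simp; ring
    rw [e1, riemannZeta₁_eq h1, riemannZeta_def_of_ne_zero h0, Complex.Gamma_add_one _ (by simpa using h0)]
    rw [Complex.Gammaℝ_def] at hG ⊢
    have hG2 := right_ne_zero_of_mul hG
    have hG1 := left_ne_zero_of_mul hG
    field_simp

lemma pi_cpow_ne (s : ℂ) : (π:ℂ) ^ s ≠ 0 := by
  rw [Ne, Complex.cpow_eq_zero_iff]
  simp [Real.pi_ne_zero]

lemma half_re {s : ℂ} (hs : -2 < s.re) : 0 < (s / 2 + 1).re := by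
  simp; linarith

lemma Xi_eq_zero_iff {s : ℂ} (hs : -2 < s.re) : Xi s = 0 ↔ riemannZeta₁ s = 0 := by
  rw [Xi_eq hs]
  have h1 := Complex.Gamma_ne_zero_of_re_pos (half_re hs)
  have h2 := pi_cpow_ne (-s/2)
  simp [h1, h2]

lemma Xi_ne_zero_of_one_le {s : ℂ} (hs : 1 ≤ s.re) : Xi s ≠ 0 := by
  rw [Ne, Xi_eq_zero_iff (by linarith)]
  by_cases h1 : s = 1
  · subst h1; simp
  · rw [riemannZeta₁_eq h1]
    exact mul_ne_zero (sub_ne_zero_of_ne h1) (riemannZeta_ne_zero_of_one_le_re hs)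

lemma Xi_zero_re {ρ : ℂ} (h : Xi ρ = 0) : 0 < ρ.re ∧ ρ.re < 1 := by
  constructor
  · by_contra hc
    exact Xi_ne_zero_of_one_le (s := 1 - ρ) (by simp; linarith) (by rw [Xi_one_sub, h])
  · by_contra hc
    exact Xi_ne_zero_of_one_le (by linarith) h

lemma Xi_zero_zeta {ρ : ℂ} (h : Xi ρ = 0) : riemannZeta ρ = 0 := by
  have h1 := Xi_zero_re h
  have hne : ρ ≠ 1 := fun h => by simp [h] at h1
  rw [Xi_eq_zero_iff (by linarith), riemannZeta₁_eq hne] at h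
  exact (mul_eq_zero.1 h).resolve_left (sub_ne_zero_of_ne hne)

lemma riemannZeta₁_conj (s : ℂ) : riemannZeta₁ (conj s) = conj (riemannZeta₁ s) := by
  by_cases h1 : s = 1
  · subst h1; simp
  · have h2 : conj s ≠ 1 := fun h => h1 (by simpa using congrArg conj h)
    rw [riemannZeta₁_eq h1, riemannZeta₁_eq h2, riemannZeta_conj]; simp

lemma Xi_conj (s : ℂ) : Xi (conj s) = conj (Xi s) := by
  have key : ∀ s : ℂ, -2 < s.re → Xi (conj s) = conj (Xi s) := by
    intro s hs
    rw [Xi_eq hs, Xi_eq (by simpa using hs), riemannZeta₁_conj]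
    have e1 : conj s / 2 + 1 = conj (s / 2 + 1) := by simp [Complex.conj_ofNat]
    rw [e1, Complex.Gamma_conj]
    have e2 : (π:ℂ) ^ (-conj s / 2) = conj ((π:ℂ) ^ (-s/2)) := by
      have h := Complex.cpow_conj (π:ℂ) (-s/2) (by rw [Complex.arg_ofReal_of_nonneg Real.pi_pos.le]; exact Real.pi_pos.ne)
      rw [Complex.conj_ofReal] at h
      rw [← h]; simp [Complex.conj_ofNat]
    rw [e2]; simp [Complex.conj_ofNat]
  by_cases hs : -2 < s.re
  · exact key s hs
  · have := key (1 - s) (by simp; linarith)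
    simp only [map_sub, map_one, Xi_one_sub] at this
    exact this

/-- `-(d/ds) log((s-1)ζ(s))` -/
noncomputable def gg (s : ℂ) : ℂ := - logDeriv riemannZeta₁ s

lemma gg_one : gg 1 = -(Real.eulerMascheroniConstant : ℂ) := by
  simp [gg, logDeriv_apply]

lemma logDeriv_Xi {s : ℂ} (hs : -2 < s.re) (h : Xi s ≠ 0) :
    logDeriv Xi s = - gg s - Real.log π / 2 + Complex.digamma (s/2 + 1) / 2 := by
  have hz : riemannZeta₁ s ≠ 0 := by rwa [Ne, ← Xi_eq_zero_iff hs]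
  have hG := Complex.Gamma_ne_zero_of_re_pos (half_re hs)
  have hGd : DifferentiableAt ℂ Complex.Gamma (s/2+1) := Complex.differentiableAt_Gamma _ (fun m h => by
    have := half_re hs; rw [h] at this; simp at this
    have : (0:ℝ) ≤ m := by positivity
    linarith)
  have hev : Xi =ᶠ[𝓝 s] fun s => (2 * riemannZeta₁ s) * ((π:ℂ) ^ (-s/2) * Complex.Gamma (s / 2 + 1)) := by
    have : ∀ᶠ z in 𝓝 s, -2 < z.re := (isOpen_lt continuous_const Complex.continuous_re).mem_nhds hs
    filter_upwards [this] with z hz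
    rw [Xi_eq hz]; ring
  have hd0 := (hasDerivAt_id s).neg.div_const 2
  have hp : HasDerivAt (fun s : ℂ => (π:ℂ) ^ (-s/2)) ((π:ℂ) ^ (-s/2) * Complex.log π * (-1/2)) s :=
    hd0.const_cpow (c := (π:ℂ)) (Or.inl (by exact_mod_cast Real.pi_ne_zero))
  have hg : HasDerivAt (fun s : ℂ => Complex.Gamma (s/2+1)) (deriv Complex.Gamma (s/2+1) * (1/2)) s := by
    have h1 : HasDerivAt (fun s : ℂ => s/2+1) (1/2) s := ((hasDerivAt_id s).div_const 2).add_const 1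
    exact hGd.hasDerivAt.comp s h1
  have e : logDeriv Xi s = logDeriv (fun s => (2 * riemannZeta₁ s) * ((π:ℂ) ^ (-s/2) * Complex.Gamma (s / 2 + 1))) s := by
    rw [logDeriv_apply, logDeriv_apply, hev.deriv_eq, hev.self_of_nhds]
  have e1 := logDeriv_mul (f := fun s => 2 * riemannZeta₁ s) (g := fun s => ((π:ℂ) ^ (-s/2) * Complex.Gamma (s / 2 + 1))) s
    (by simpa using hz) (mul_ne_zero (pi_cpow_ne _) hG) (by fun_prop) (hp.mul hg).differentiableAt
  have e2 := logDeriv_mul (f := fun s : ℂ => (π:ℂ) ^ (-s/2)) (g := fun s => Complex.Gamma (s / 2 + 1)) s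
    (pi_cpow_ne _) hG hp.differentiableAt hg.differentiableAt
  rw [e, e1, logDeriv_const_mul _ _ two_ne_zero, e2, logDeriv_apply (fun s : ℂ => (π:ℂ) ^ (-s/2)),
    logDeriv_apply (fun s : ℂ => Complex.Gamma (s/2+1)), hp.deriv, hg.deriv, Complex.digamma_def, logDeriv_apply Complex.Gamma, gg,
    Complex.ofReal_log Real.pi_pos.le]
  have := pi_cpow_ne (-s/2)
  field_simp
  ring

open ArithmeticFunction in
lemma gg_eq {s : ℂ} (hs : 1 < s.re) :
    gg s = LSeries (fun n => (vonMangoldt n : ℂ)) s - 1 / (s - 1) := by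
  have hne : s ≠ 1 := fun h => by simp [h] at hs
  have h1 := sub_ne_zero_of_ne hne
  rw [LSeries_vonMangoldt_eq_deriv_riemannZeta_div hs, gg, logDeriv_apply,
    deriv_riemannZeta_eq_neg_inv_sub_sq_mul_add hne, riemannZeta_eq_inv_sub_mul hne]
  have hz : riemannZeta₁ s ≠ 0 := by
    rw [Ne, ← Xi_eq_zero_iff (by linarith)]
    exact Xi_ne_zero_of_one_le hs.le
  field_simp
  ring

lemma logDeriv_Xi_one_sub (s : ℂ) : logDeriv Xi (1 - s) = - logDeriv Xi s := by
  have h : Xi = fun s => Xi (1 - s) := by funext s; rw [Xi_one_sub]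
  have hd : deriv Xi s = - deriv Xi (1 - s) := by
    conv_lhs => rw [h]
    rw [deriv_comp_const_sub]
  rw [logDeriv_apply, logDeriv_apply, Xi_one_sub, hd]; ring

lemma logDeriv_Xi_conj (s : ℂ) : logDeriv Xi (conj s) = conj (logDeriv Xi s) := by
  have h : Xi = conj ∘ Xi ∘ conj := by funext s; simp [Xi_conj]
  have hd : deriv Xi (conj s) = conj (deriv Xi s) := by
    conv_lhs => rw [h]
    rw [deriv_conj_conj]; simp
  rw [logDeriv_apply, logDeriv_apply, Xi_conj, hd]; simp

/-- value at 0 -/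
lemma gg_zero : gg 0 = 1 - Real.log (2 * π) := by
  have h0 := logDeriv_Xi (s := 0) (by simp) (by rw [Xi_zero]; norm_num)
  have h1 := logDeriv_Xi (s := 1) (by norm_num) (by rw [Xi_one]; norm_num)
  have h2 := logDeriv_Xi_one_sub 0
  rw [sub_zero] at h2
  have h3 := Complex.digamma_apply_add_one (1/2) (fun m h => by
    have := congrArg Complex.re h; simp at this
    have h4 : (0:ℝ) ≤ m := by positivity
    linarith)
  rw [Complex.digamma_one_half] at h3
  rw [h3, gg_one] at h1
  simp only [zero_div, zero_add, Complex.digamma_one] at h0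
  rw [h0] at h2
  rw [Real.log_mul two_ne_zero Real.pi_ne_zero]
  push_cast [Complex.ofReal_log]
  rw [Complex.ofReal_log zero_le_two]
  rw [h1] at h2
  push_cast
  norm_num at h2
  linear_combination -h2

end PB

namespace PB
open Filter Topology Metric
open scoped ComplexConjugate

lemma strip_bound : ∃ C : ℝ, 0 ≤ C ∧ ∀ s : ℂ, 1/2 ≤ s.re → s.re ≤ 2 →
    ‖completedRiemannZeta₀ s‖ ≤ C := by
  set P := HurwitzZeta.hurwitzEvenFEPair 0 with hP
  have hM := P.isStrongFEPair_toStrongFEPair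
  have hc : ∀ s : ℂ, MellinConvergent P.f_modif s := fun s => (hM.hasMellin s).1
  have hi : ∀ a : ℝ, MeasureTheory.IntegrableOn (fun t : ℝ => t ^ (a - 1) * ‖P.f_modif t‖) (Set.Ioi 0) := by
    intro a
    have h := (hc (a:ℂ)).norm
    refine MeasureTheory.IntegrableOn.congr_fun h ?_ measurableSet_Ioi
    intro t ht
    simp only [norm_smul]
    rw [Complex.norm_cpow_eq_rpow_re_of_pos ht]; simp
  set C : ℝ := ∫ t in Set.Ioi (0:ℝ), (t ^ ((1/4:ℝ) - 1) * ‖P.f_modif t‖ + t ^ ((1:ℝ) - 1) * ‖P.f_modif t‖) with hC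
  have hC0 : 0 ≤ C := by
    apply MeasureTheory.setIntegral_nonneg measurableSet_Ioi
    intro t ht
    have : (0:ℝ) < t := ht
    positivity
  refine ⟨C, hC0, fun s h1 h2 => ?_⟩
  have e : completedRiemannZeta₀ s = mellin P.f_modif (s/2) / 2 := rfl
  have hb : ‖mellin P.f_modif (s/2)‖ ≤ C := by
    unfold mellin
    refine MeasureTheory.norm_integral_le_of_norm_le ((hi (1/4)).add (hi 1)) ?_
    refine (MeasureTheory.ae_restrict_iff' measurableSet_Ioi).2 (Filter.Eventually.of_forall fun t ht => ?_)
    have ht' : (0:ℝ) < t := ht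
    rw [norm_smul, Complex.norm_cpow_eq_rpow_re_of_pos ht]
    show _ ≤ t ^ ((1/4:ℝ) - 1) * ‖P.f_modif t‖ + t ^ ((1:ℝ) - 1) * ‖P.f_modif t‖
    rw [← add_mul]
    gcongr
    have hr : (s/2 - 1).re = s.re/2 - 1 := by simp
    rw [hr]
    rcases le_total t 1 with h | h
    · have := Real.rpow_le_rpow_of_exponent_ge ht' h (show (1/4:ℝ) - 1 ≤ s.re/2 - 1 by linarith)
      have h3 : 0 ≤ t ^ ((1:ℝ)-1) := by positivity
      exact le_add_of_le_of_nonneg this h3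
    · have := Real.rpow_le_rpow_of_exponent_le h (show s.re/2 - 1 ≤ (1:ℝ)-1 by linarith)
      have h3 : 0 ≤ t ^ ((1/4:ℝ)-1) := by positivity
      exact le_add_of_nonneg_of_le h3 this
  rw [e, norm_div]
  simp
  have := norm_nonneg (mellin P.f_modif (s/2))
  linarith

lemma zeta_bound : ∃ C : ℝ, 0 ≤ C ∧ ∀ s : ℂ, 2 ≤ s.re → ‖riemannZeta s‖ ≤ C := by
  refine ⟨∑' n : ℕ, 1 / ((n:ℝ)^2), tsum_nonneg fun n => by positivity, fun s hs => ?_⟩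
  rw [zeta_eq_tsum_one_div_nat_cpow (by linarith)]
  refine tsum_of_norm_bounded (Real.summable_one_div_nat_pow.2 (by norm_num)).hasSum fun n => ?_
  rcases Nat.eq_zero_or_pos n with h | h
  · subst h
    have : s ≠ 0 := by rintro rfl; simp at hs; linarith
    simp [this]
  · rw [norm_div, Complex.norm_natCast_cpow_of_pos h]
    simp only [norm_one]
    have h1 : (1:ℝ) ≤ n := by exact_mod_cast h
    rw [← Real.rpow_natCast (n:ℝ) 2]
    apply one_div_le_one_div_of_le (by positivity)
    exact Real.rpow_le_rpow_of_exponent_le h1 (by simpa using hs)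

lemma norm_Gamma_le {z : ℂ} (hz : 0 < z.re) : ‖Complex.Gamma z‖ ≤ Real.Gamma z.re := by
  rw [Complex.Gamma_eq_integral hz, Real.Gamma_eq_integral hz]
  unfold Complex.GammaIntegral
  refine MeasureTheory.norm_integral_le_of_norm_le (Real.GammaIntegral_convergent hz) ?_
  refine (MeasureTheory.ae_restrict_iff' measurableSet_Ioi).2 (Filter.Eventually.of_forall fun t ht => ?_)
  rw [norm_mul, Complex.norm_cpow_eq_rpow_re_of_pos ht]
  simp [Complex.norm_exp]

lemma Gamma_growth {σ R : ℝ} (hσ : 2 ≤ σ) (hR : σ + 2 ≤ R) : Real.Gamma (σ/2+1) ≤ Real.exp (R * √R) := by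
  set n := ⌈σ/2⌉₊ with hn
  have h1 : σ/2 ≤ n := Nat.le_ceil _
  have h2 : (n:ℝ) < σ/2 + 1 := Nat.ceil_lt_add_one (by linarith)
  have h3 : Real.Gamma (σ/2+1) ≤ Real.Gamma (n+1) :=
    Real.Gamma_strictMonoOn_Ici.monotoneOn (by simp; linarith) (by simp; linarith) (by linarith)
  rw [Real.Gamma_nat_eq_factorial] at h3
  have h4 : ((n.factorial : ℕ):ℝ) ≤ (n:ℝ)^n := by exact_mod_cast Nat.factorial_le_pow n
  have hn1 : (1:ℝ) ≤ n := by linarith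
  have hRpos : 0 < R := by linarith
  have h5 : (n:ℝ)^n = Real.exp (n * Real.log n) := by
    rw [← Real.rpow_natCast, Real.rpow_def_of_pos (by linarith), mul_comm]
  refine h3.trans (h4.trans ?_)
  rw [h5]
  apply Real.exp_le_exp.2
  have h6 : Real.log n ≤ 2 * √R := by
    have : Real.log n ≤ Real.log R := Real.log_le_log (by linarith) (by linarith)
    have h7 : Real.log R = 2 * Real.log (√R) := by rw [Real.log_sqrt hRpos.le]; ring
    have h8 := Real.log_le_sub_one_of_pos (Real.sqrt_pos.2 hRpos)
    linarith
  have h9 : 0 ≤ √R := Real.sqrt_nonneg R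
  calc (n:ℝ) * Real.log n ≤ (R/2) * (2*√R) := by
        apply mul_le_mul (by linarith) h6 (Real.log_nonneg hn1) (by linarith)
    _ = _ := by ring

lemma Xi_growth_half : ∃ C : ℝ, 0 ≤ C ∧ ∀ s : ℂ, 1/2 ≤ s.re →
    ‖Xi s‖ ≤ Real.exp (C * (‖s‖+2) * √(‖s‖+2)) := by
  obtain ⟨C1, hC1, h1⟩ := strip_bound
  obtain ⟨C2, hC2, h2⟩ := zeta_bound
  refine ⟨C1 + 2*C2 + 4, by positivity, fun s hs => ?_⟩
  set R := ‖s‖ + 2 with hR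
  have hR2 : 2 ≤ R := by have := norm_nonneg s; linarith
  have hsq : 1 ≤ √R := by rw [Real.one_le_sqrt]; linarith
  have hs1 : ‖s - 1‖ ≤ R := by
    calc ‖s - 1‖ ≤ ‖s‖ + ‖(1:ℂ)‖ := norm_sub_le _ _
      _ ≤ R := by simp; linarith
  have hs0 : ‖s‖ ≤ R := by linarith
  have hlin : ∀ a : ℝ, 0 ≤ a → a ≤ Real.exp a := fun a ha => by linarith [Real.add_one_le_exp a]
  have hRR : R ≤ R * √R := by nlinarith
  rcases le_total s.re 2 with h | h
  · have e1 : ‖Xi s‖ ≤ R * R * C1 + 1 := by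
      unfold Xi
      refine (norm_add_le _ _).trans ?_
      rw [norm_mul, norm_mul, norm_one]
      have := h1 s hs h
      gcongr
    have e2 : R * R * C1 + 1 ≤ Real.exp (R) * Real.exp R * Real.exp (C1) := by
      have a1 := Real.add_one_le_exp R
      have a2 := Real.add_one_le_exp C1
      have : R * R * C1 + 1 ≤ (R+1) * (R+1) * (C1+1) := by nlinarith [mul_nonneg hC1 (by linarith : 0 ≤ R)]
      refine this.trans ?_
      have : 0 ≤ R := by linarith
      gcongr
    refine (e1.trans e2).trans ?_
    rw [← Real.exp_add, ← Real.exp_add]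
    apply Real.exp_le_exp.2
    have : C1 ≤ C1 * (R*√R) := by nlinarith
    have : 0 ≤ 2 * C2 * (R*√R) := by positivity
    nlinarith
  · have e1 : ‖Xi s‖ ≤ 2 * (R * C2) * 1 * Real.exp (R * √R) := by
      rw [Xi_eq (by linarith)]
      rw [norm_mul, norm_mul, norm_mul, riemannZeta₁_eq (by rintro rfl; simp at h), norm_mul]
      have e3 : ‖(π:ℂ) ^ (-s/2)‖ ≤ 1 := by
        rw [Complex.norm_cpow_eq_rpow_re_of_pos Real.pi_pos]
        apply Real.rpow_le_one_of_one_le_of_nonpos (by linarith [Real.pi_gt_three])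
        simp; linarith
      have e4 : ‖Complex.Gamma (s/2+1)‖ ≤ Real.exp (R * √R) := by
        refine (norm_Gamma_le (half_re (by linarith))).trans ?_
        have : (s/2+1).re = s.re/2+1 := by simp
        rw [this]
        refine Gamma_growth h ?_
        have := Complex.re_le_norm s
        linarith
      have e5 := h2 s h
      simp only [Complex.norm_ofNat]
      gcongr
    refine e1.trans ?_
    have e2 : 2 * (R * C2) * 1 ≤ Real.exp R * Real.exp (2*C2) := by
      have a1 := hlin R (by linarith)
      have a2 := hlin (2*C2) (by linarith)
      calc 2 * (R * C2) * 1 = R * (2*C2) := by ring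
        _ ≤ _ := by gcongr
    refine (mul_le_mul_of_nonneg_right e2 (Real.exp_pos _).le).trans ?_
    rw [← Real.exp_add, ← Real.exp_add]
    apply Real.exp_le_exp.2
    have : 2*C2 ≤ 2*C2 * (R*√R) := by nlinarith
    have : 0 ≤ C1 * (R*√R) := by positivity
    nlinarith

lemma Xi_growth : ∃ C : ℝ, 0 < C ∧ ∀ R : ℝ, 4 ≤ R → ∀ s : ℂ, ‖s‖ ≤ R →
    ‖Xi s‖ ≤ Real.exp (C * R * √R) := by
  obtain ⟨C, hC, h⟩ := Xi_growth_half
  refine ⟨4*C+1, by linarith, fun R hR s hs => ?_⟩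
  have key : ∀ w : ℂ, ‖w‖ ≤ R + 1 → 1/2 ≤ w.re → ‖Xi w‖ ≤ Real.exp ((4*C+1) * R * √R) := by
    intro w hw hwr
    refine (h w hwr).trans (Real.exp_le_exp.2 ?_)
    have h1 : ‖w‖ + 2 ≤ 2 * R := by linarith
    have h2 : √(‖w‖+2) ≤ 2 * √R := by
      rw [show (2:ℝ) * √R = √(4*R) by
        rw [Real.sqrt_mul (by norm_num), show (4:ℝ) = 2^2 by norm_num, Real.sqrt_sq (by norm_num)]]
      apply Real.sqrt_le_sqrt; linarith
    have h3 : 0 ≤ √R := Real.sqrt_nonneg _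
    calc C * (‖w‖+2) * √(‖w‖+2) ≤ C * (2*R) * (2*√R) := by gcongr
      _ ≤ _ := by nlinarith [mul_nonneg (by linarith : 0 ≤ R) h3]
  rcases le_total (1/2) s.re with h1 | h1
  · exact key s (by linarith) h1
  · rw [← Xi_one_sub]
    refine key (1 - s) ?_ (by simp; linarith)
    refine (norm_sub_le _ _).trans ?_
    simp; linarith
end PB

namespace PB
open Filter Topology Metric
open scoped ComplexConjugate

lemma factor_one {f : ℂ → ℂ} (hf : Differentiable ℂ f) {a : ℂ} (ha : analyticOrderAt f a ≠ ⊤) :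
    ∃ g : ℂ → ℂ, Differentiable ℂ g ∧ g a ≠ 0 ∧ ∀ s, f s = (s - a) ^ (analyticOrderNatAt f a) * g s := by
  obtain ⟨g, hg, hga, he⟩ := ((hf.analyticAt a).analyticOrderAt_ne_top).1 ha
  set n := analyticOrderNatAt f a
  have hval : ∀ s, s ≠ a → f s = (s - a) ^ n * (f s / (s-a)^n) := by
    intro s hs
    have : (s - a)^n ≠ 0 := pow_ne_zero _ (sub_ne_zero_of_ne hs)
    field_simp
  refine ⟨fun s => if s = a then g a else f s / (s - a)^n, ?_, by simpa using hga, ?_⟩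
  · intro s
    by_cases hs : s = a
    · subst hs
      refine hg.differentiableAt.congr_of_eventuallyEq ?_
      filter_upwards [he] with z hz
      by_cases h : z = s
      · simp [h]
      · have : (z - s)^n ≠ 0 := pow_ne_zero _ (sub_ne_zero_of_ne h)
        simp only [h, if_false]
        rw [hz, smul_eq_mul]; field_simp
    · have h1 : DifferentiableAt ℂ (fun s => f s / (s - a)^n) s := by
        have : (s - a)^n ≠ 0 := pow_ne_zero _ (sub_ne_zero_of_ne hs)
        have h2 := hf s
        fun_prop (disch := assumption)
      refine h1.congr_of_eventuallyEq ?_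
      filter_upwards [isOpen_ne.mem_nhds hs] with z hz
      have : z ≠ a := hz
      simp [this]
  · intro s
    by_cases hs : s = a
    · subst hs
      have := he.self_of_nhds
      simpa using this
    · simp only [hs, if_false]; exact hval s hs

lemma factor_finset {f : ℂ → ℂ} (hf : Differentiable ℂ f) (hord : ∀ a, analyticOrderAt f a ≠ ⊤)
    (S : Finset ℂ) :
    ∃ g : ℂ → ℂ, Differentiable ℂ g ∧ (∀ a ∈ S, g a ≠ 0) ∧
      ∀ s, f s = (∏ a ∈ S, (s - a) ^ (analyticOrderNatAt f a)) * g s := by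
  induction S using Finset.induction_on with
  | empty => exact ⟨f, hf, by simp, by simp⟩
  | insert a S haS ih =>
    obtain ⟨g, hg, hgne, he⟩ := ih
    have hP : Differentiable ℂ (fun s : ℂ => ∏ b ∈ S, (s - b) ^ (analyticOrderNatAt f b)) := by fun_prop
    have ho : analyticOrderAt f a = analyticOrderAt g a := by
      have e : f = (fun s : ℂ => ∏ b ∈ S, (s - b) ^ (analyticOrderNatAt f b)) * g := by
        funext s; exact he s
      conv_lhs => rw [e]
      rw [analyticOrderAt_mul (hP.analyticAt a) (hg.analyticAt a)]
      have : analyticOrderAt (fun s : ℂ => ∏ b ∈ S, (s - b) ^ (analyticOrderNatAt f b)) a = 0 := by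
        rw [(hP.analyticAt a).analyticOrderAt_eq_zero]
        rw [Finset.prod_ne_zero_iff]
        intro b hb
        apply pow_ne_zero
        apply sub_ne_zero_of_ne
        rintro rfl; exact haS hb
      rw [this, zero_add]
    obtain ⟨h, hh, hha, hhe⟩ := factor_one hg (a := a) (by rw [← ho]; exact hord a)
    refine ⟨h, hh, ?_, ?_⟩
    · intro b hb
      rcases Finset.mem_insert.1 hb with rfl | hb
      · exact hha
      · intro h0
        apply hgne b hb
        rw [hhe b, h0, mul_zero]
    · intro s
      rw [Finset.prod_insert haS, he s, hhe s]
      have : analyticOrderNatAt f a = analyticOrderNatAt g a := by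
        unfold analyticOrderNatAt; rw [ho]
      rw [this]; ring

/-- Multiplicity of a zero. -/
noncomputable def mu (ρ : ℂ) : ℕ := analyticOrderNatAt Xi ρ

lemma Xi_order (a : ℂ) : analyticOrderAt Xi a ≠ ⊤ := by
  have hA : AnalyticOnNhd ℂ Xi Set.univ := fun z _ => Xi_diff.analyticAt z
  refine hA.analyticOrderAt_ne_top_of_isPreconnected isPreconnected_univ (Set.mem_univ 0) (Set.mem_univ a) ?_
  have : analyticOrderAt Xi 0 = 0 := by
    rw [(Xi_diff.analyticAt 0).analyticOrderAt_eq_zero, Xi_zero]; norm_num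
  rw [this]; simp

lemma Xi_zeros_finite {K : Set ℂ} (hK : IsCompact K) : (K ∩ {ρ | Xi ρ = 0}).Finite := by
  refine (IsCompact.inter_riemannZetaZeros_finite hK).subset ?_
  rintro ρ ⟨h1, h2⟩
  exact ⟨h1, Xi_zero_zeta h2⟩

lemma mu_pos {ρ : ℂ} (h : Xi ρ = 0) : 1 ≤ mu ρ := by
  have h1 : analyticOrderAt Xi ρ ≠ 0 := by
    rw [(Xi_diff.analyticAt ρ).analyticOrderAt_ne_zero]; exact h
  have h2 : ((mu ρ : ℕ) : ℕ∞) = analyticOrderAt Xi ρ := Nat.cast_analyticOrderNatAt (Xi_order ρ)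
  by_contra hc
  have : mu ρ = 0 := by omega
  rw [this] at h2
  exact h1 (by rw [← h2]; simp)

lemma mu_one_sub (ρ : ℂ) : mu (1 - ρ) = mu ρ := by
  have h := analyticOrderAt_comp_of_deriv_ne_zero (f := Xi) (g := fun s => 1 - s) (z₀ := ρ)
    (by fun_prop) (by simp)
  have e : Xi ∘ (fun s => 1 - s) = Xi := by funext s; simp [Xi_one_sub]
  rw [e] at h
  unfold mu analyticOrderNatAt; rw [h]

lemma mu_conj (ρ : ℂ) : mu (conj ρ) = mu ρ := by
  have h := (Xi_diff.analyticAt (conj ρ)).analyticOrderNatAt_eq_iff (Xi_order (conj ρ)) (n := mu ρ)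
  refine h.2 ?_
  obtain ⟨g, hg, hga, he⟩ := factor_one Xi_diff (Xi_order ρ)
  refine ⟨conj ∘ g ∘ conj, ?_, ?_, ?_⟩
  · have : Differentiable ℂ (conj ∘ g ∘ conj) := by
      intro s
      have := (hg (conj s)).conj_conj
      simpa using this
    exact this.analyticAt _
  · simpa using hga
  · refine Eventually.of_forall fun z => ?_
    have h1 := he (conj z)
    rw [Xi_conj] at h1
    have h2 := congrArg conj h1
    simp only [Complex.conj_conj, map_mul, map_pow, map_sub] at h2
    simpa [mu, smul_eq_mul] using h2

noncomputable def ZZ (R : ℝ) : Finset ℂ :=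
  (Xi_zeros_finite (isCompact_closedBall (1/2 : ℂ) R)).toFinset

lemma mem_ZZ {R : ℝ} {ρ : ℂ} : ρ ∈ ZZ R ↔ ‖ρ - 1/2‖ ≤ R ∧ Xi ρ = 0 := by
  simp [ZZ, dist_eq_norm]

lemma logDeriv_bound {g : ℂ → ℂ} (hg : Differentiable ℂ g) {c : ℂ} {r M : ℝ} (hr : 0 < r) (hM : 0 < M)
    (hne : ∀ z ∈ ball c r, g z ≠ 0) (hb : ∀ z ∈ ball c r, ‖g z‖ ≤ ‖g c‖ * Real.exp M)
    {s : ℂ} (hs : ‖s - c‖ ≤ r/8) :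
    ‖logDeriv g s - logDeriv g c‖ ≤ 64 * M / r^2 * ‖s - c‖ := by
  have hgd : Differentiable ℂ (deriv g) := hg.deriv
  have hl : DifferentiableOn ℂ (logDeriv g) (ball c r) := by
    intro z hz
    apply DifferentiableAt.differentiableWithinAt
    exact (hgd z).div (hg z) (hne z hz)
  obtain ⟨F, hF0, hF⟩ := hl.isExactOn_ball.with_val_at c 0
  have hcm : c ∈ ball c r := mem_ball_self hr
  -- g = g c * exp F
  have hexp : ∀ z ∈ ball c r, g z = g c * Complex.exp (F z) := by
    have hd : ∀ z ∈ ball c r, HasDerivAt (fun z => g z * Complex.exp (-F z)) 0 z := by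
      intro z hz
      have h1 := (hg z).hasDerivAt.mul ((hF z hz).neg.cexp)
      have h2 : deriv g z * Complex.exp ((-F) z) + g z * (Complex.exp ((-F) z) * -logDeriv g z) = 0 := by
        have := hne z hz
        rw [logDeriv_apply]; field_simp; ring
      rw [h2] at h1
      exact h1
    intro z hz
    have hc := (convex_ball c r).is_const_of_fderivWithin_eq_zero (𝕜 := ℂ)
      (f := fun z => g z * Complex.exp (-F z))
      (fun z hz => (hd z hz).differentiableAt.differentiableWithinAt)
      (fun z hz => by
        rw [fderivWithin_of_isOpen isOpen_ball hz]
        have := (hd z hz).hasFDerivAt.fderiv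
        rw [this]; ext; simp) hz hcm
    simp only [hF0, neg_zero, Complex.exp_zero, mul_one] at hc
    rw [← hc, mul_assoc, ← Complex.exp_add]; simp
  have hre : ∀ z ∈ ball c r, (F z).re ≤ M := by
    intro z hz
    have h1 := hb z hz
    rw [hexp z hz, norm_mul, Complex.norm_exp] at h1
    have hp : 0 < ‖g c‖ := norm_pos_iff.2 (hne c hcm)
    exact Real.exp_le_exp.1 (le_of_mul_le_mul_left h1 hp)
  have hFd : DifferentiableOn ℂ F (ball c r) := fun z hz => (hF z hz).differentiableAt.differentiableWithinAt
  have hshift : ∀ w ∈ ball (0:ℂ) r, c + w ∈ ball c r := by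
    intro w hw
    simpa [dist_eq_norm] using hw
  have hFb : ∀ z, ‖z - c‖ ≤ r/2 → ‖F z‖ ≤ 2 * M := by
    intro z hz
    have h1 := Complex.borelCaratheodory_zero (f := fun w => F (c + w)) (R := r) (z := z - c) hM ?_ ?_ hr ?_ ?_
    · simp only [add_sub_cancel] at h1
      refine h1.trans ?_
      rw [div_le_iff₀ (by linarith)]
      nlinarith
    · refine hFd.comp (by fun_prop) (fun w hw => hshift w hw)
    · intro w hw; exact hre _ (hshift w hw)
    · rw [mem_ball_zero_iff]; linarith
    · simpa using hF0
  have hsub : ∀ z, ‖z - c‖ < r → z ∈ ball c r := fun z hz => by simpa [dist_eq_norm] using hz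
  have hlb : ∀ z, ‖z - c‖ ≤ r/4 → ‖logDeriv g z‖ ≤ 8 * M / r := by
    intro z hz
    rw [← (hF z (hsub z (by linarith))).deriv]
    have h1 := Complex.norm_deriv_le_of_forall_mem_sphere_norm_le (c := z) (R := r/4) (C := 2*M) (f := F) (by linarith) ?_ ?_
    · refine h1.trans (le_of_eq ?_); field_simp; ring
    · apply DifferentiableOn.diffContOnCl
      refine hFd.mono ?_
      refine closure_ball_subset_closedBall.trans fun w hw => ?_
      rw [mem_closedBall, dist_eq_norm] at hw
      apply hsub
      calc ‖w - c‖ ≤ ‖w - z‖ + ‖z - c‖ := norm_sub_le_norm_sub_add_norm_sub _ _ _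
        _ < r := by linarith
    · intro w hw
      rw [mem_sphere, dist_eq_norm] at hw
      apply hFb
      calc ‖w - c‖ ≤ ‖w - z‖ + ‖z - c‖ := norm_sub_le_norm_sub_add_norm_sub _ _ _
        _ ≤ r/2 := by linarith
  have hdb : ∀ z, ‖z - c‖ ≤ r/8 → ‖deriv (logDeriv g) z‖ ≤ 64 * M / r^2 := by
    intro z hz
    have h1 := Complex.norm_deriv_le_of_forall_mem_sphere_norm_le (c := z) (R := r/8) (C := 8*M/r) (f := logDeriv g) (by linarith) ?_ ?_
    · refine h1.trans (le_of_eq ?_); field_simp; ring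
    · apply DifferentiableOn.diffContOnCl
      refine hl.mono ?_
      refine closure_ball_subset_closedBall.trans fun w hw => ?_
      rw [mem_closedBall, dist_eq_norm] at hw
      apply hsub
      calc ‖w - c‖ ≤ ‖w - z‖ + ‖z - c‖ := norm_sub_le_norm_sub_add_norm_sub _ _ _
        _ < r := by linarith
    · intro w hw
      rw [mem_sphere, dist_eq_norm] at hw
      apply hlb
      calc ‖w - c‖ ≤ ‖w - z‖ + ‖z - c‖ := norm_sub_le_norm_sub_add_norm_sub _ _ _
        _ ≤ r/4 := by linarith
  refine Convex.norm_image_sub_le_of_norm_deriv_le (s := closedBall c (r/8)) ?_ ?_ (convex_closedBall _ _) ?_ ?_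
  · intro z hz
    rw [mem_closedBall, dist_eq_norm] at hz
    exact (hl z (hsub z (by linarith))).differentiableAt (isOpen_ball.mem_nhds (hsub z (by linarith)))
  · intro z hz
    rw [mem_closedBall, dist_eq_norm] at hz
    exact hdb z hz
  · exact mem_closedBall_self (by linarith)
  · rw [mem_closedBall, dist_eq_norm]; exact hs

lemma ZZ_re {R : ℝ} {ρ : ℂ} (h : ρ ∈ ZZ R) : 0 < ρ.re ∧ ρ.re < 1 := Xi_zero_re (mem_ZZ.1 h).2

lemma Xi_ne_two : Xi 2 ≠ 0 := Xi_ne_zero_of_one_le (by simp)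

lemma logDeriv_factor {S : Finset ℂ} {g : ℂ → ℂ} (hg : Differentiable ℂ g)
    (he : ∀ s, Xi s = (∏ a ∈ S, (s - a) ^ (mu a)) * g s) {s : ℂ} (hs : Xi s ≠ 0) :
    logDeriv Xi s = ∑ a ∈ S, (mu a : ℂ) / (s - a) + logDeriv g s := by
  have h0 := hs
  rw [he s] at h0
  have h1 := left_ne_zero_of_mul h0
  have h2 := right_ne_zero_of_mul h0
  have e : Xi = fun s => (∏ a ∈ S, (s - a) ^ (mu a)) * g s := funext he
  conv_lhs => rw [e]
  rw [logDeriv_mul (f := fun s => ∏ a ∈ S, (s - a) ^ (mu a)) s h1 h2 (by fun_prop) (hg s)]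
  congr 1
  rw [Finset.prod_ne_zero_iff] at h1
  rw [logDeriv_prod (f := fun a s => (s - a) ^ (mu a)) h1 (by intro i _; fun_prop)]
  refine Finset.sum_congr rfl fun a ha => ?_
  rw [logDeriv_fun_pow (f := fun s => s - a) (by fun_prop)]
  rw [logDeriv_apply]; simp [deriv_sub_const, mul_div_assoc, div_eq_mul_inv]

lemma hadamard_diff : ∃ C : ℝ, 0 < C ∧ ∀ s : ℂ, Xi s ≠ 0 → ∀ R : ℝ, 8 * ‖s - 2‖ + 10 ≤ R →
    ‖(logDeriv Xi s - logDeriv Xi 2) - (∑ ρ ∈ ZZ R, (mu ρ : ℂ) / (s - ρ) - ∑ ρ ∈ ZZ R, (mu ρ : ℂ) / (2 - ρ))‖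
      ≤ C * ‖s - 2‖ / √R := by
  obtain ⟨C, hC, hgrow⟩ := Xi_growth
  set B := max 0 (-Real.log ‖Xi 2‖) with hB
  have hB0 : 0 ≤ B := le_max_left _ _
  refine ⟨256 * (27 * C + B), by positivity, fun s hs R hR => ?_⟩
  have hsn := norm_nonneg (s - 2)
  have hR10 : 10 ≤ R := by linarith
  obtain ⟨g, hg, hgne, he⟩ := factor_finset Xi_diff Xi_order (ZZ R)
  have hnz : ∀ z : ℂ, ‖z - 1/2‖ ≤ R → g z ≠ 0 := by
    intro z hz h0
    by_cases hX : Xi z = 0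
    · exact hgne z (mem_ZZ.2 ⟨hz, hX⟩) h0
    · apply hX; rw [he z, h0, mul_zero]
  have e1 := logDeriv_factor hg he hs
  have e2 := logDeriv_factor hg he Xi_ne_two
  rw [e1, e2]
  have hsq : 1 ≤ √R := by rw [Real.one_le_sqrt]; linarith
  have hsqR : √R * √R = R := Real.mul_self_sqrt (by linarith)
  set M := (27 * C + B) * (R * √R) with hM
  have hMpos : 0 < M := by
    have : 0 < R := by linarith
    positivity
  -- bound of g on big sphere
  have hXi2 : 0 < ‖Xi 2‖ := norm_pos_iff.2 Xi_ne_two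
  have hB2 : 1 ≤ ‖Xi 2‖ * Real.exp B := by
    have h1 : Real.exp (-Real.log ‖Xi 2‖) ≤ Real.exp B := Real.exp_le_exp.2 (le_max_right _ _)
    rw [Real.exp_neg, Real.exp_log hXi2] at h1
    calc (1:ℝ) = ‖Xi 2‖ * ‖Xi 2‖⁻¹ := by field_simp
      _ ≤ _ := by gcongr
  have hsph : ∀ z : ℂ, ‖z - 2‖ = 2 * (R + 2) → ‖g z‖ ≤ ‖g 2‖ * Real.exp M := by
    intro z hz
    have hz1 : ‖Xi z‖ ≤ Real.exp (C * (4*R) * √(4*R)) := by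
      apply hgrow _ (by linarith)
      calc ‖z‖ = ‖(z - 2) + 2‖ := by ring_nf
        _ ≤ ‖z - 2‖ + ‖(2:ℂ)‖ := norm_add_le _ _
        _ ≤ _ := by rw [hz]; simp; linarith
    have hz2 : Real.exp (C * (4*R) * √(4*R)) ≤ ‖Xi 2‖ * Real.exp M := by
      have h4 : √(4*R) = 2 * √R := by
        rw [Real.sqrt_mul (by norm_num), show (4:ℝ) = 2^2 by norm_num, Real.sqrt_sq (by norm_num)]
      calc Real.exp (C * (4*R) * √(4*R)) = 1 * Real.exp (8 * C * (R * √R)) := by rw [h4]; ring_nf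
        _ ≤ (‖Xi 2‖ * Real.exp B) * Real.exp (8 * C * (R * √R)) := by gcongr
        _ = ‖Xi 2‖ * Real.exp (B + 8 * C * (R * √R)) := by rw [Real.exp_add]; ring
        _ ≤ _ := by
          gcongr
          rw [hM]
          have : 1 ≤ R * √R := by nlinarith
          nlinarith [mul_nonneg hC.le (by linarith : 0 ≤ R * √R)]
    have hprod : ∏ a ∈ ZZ R, ‖2 - a‖ ^ (mu a) ≤ ∏ a ∈ ZZ R, ‖z - a‖ ^ (mu a) := by
      apply Finset.prod_le_prod (fun _ _ => by positivity)
      intro a ha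
      gcongr
      have h1 := (mem_ZZ.1 ha).1
      have h2 : ‖2 - a‖ ≤ R + 3/2 := by
        calc ‖2 - a‖ = ‖(3/2 : ℂ) - (a - 1/2)‖ := by ring_nf
          _ ≤ ‖(3/2 : ℂ)‖ + ‖a - 1/2‖ := norm_sub_le _ _
          _ ≤ _ := by
            have : ‖(3/2 : ℂ)‖ = 3/2 := by norm_num
            linarith
      have h3 : ‖z - 2‖ ≤ ‖z - a‖ + ‖2 - a‖ := by
        calc ‖z - 2‖ = ‖(z - a) - (2 - a)‖ := by ring_nf
          _ ≤ _ := norm_sub_le _ _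
      rw [hz] at h3
      linarith
    have hp2 : 0 < ∏ a ∈ ZZ R, ‖2 - a‖ ^ (mu a) := by
      apply Finset.prod_pos
      intro a ha
      apply pow_pos
      rw [norm_pos_iff]
      intro h
      have h1 := (ZZ_re ha).2
      have : a = 2 := by linear_combination -h
      rw [this] at h1; norm_num at h1
    have hpz := hp2.trans_le hprod
    have f1 : ‖Xi z‖ = (∏ a ∈ ZZ R, ‖z - a‖ ^ (mu a)) * ‖g z‖ := by
      rw [he z, norm_mul, norm_prod]; simp [mu]
    have f2 : ‖Xi 2‖ = (∏ a ∈ ZZ R, ‖2 - a‖ ^ (mu a)) * ‖g 2‖ := by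
      rw [he 2, norm_mul, norm_prod]; simp [mu]
    have f3 := hz1.trans hz2
    rw [f1, f2] at f3
    have f4 : (∏ a ∈ ZZ R, ‖z - a‖ ^ (mu a)) * ‖g z‖ ≤ (∏ a ∈ ZZ R, ‖z - a‖ ^ (mu a)) * (‖g 2‖ * Real.exp M) := by
      refine f3.trans ?_
      rw [mul_assoc]
      gcongr
    exact le_of_mul_le_mul_left f4 hpz
  have hball : ∀ z ∈ ball (2:ℂ) (2 * (R+2)), ‖g z‖ ≤ ‖g 2‖ * Real.exp M := by
    intro z hz
    refine Complex.norm_le_of_forall_mem_frontier_norm_le (U := ball (2:ℂ) (2*(R+2))) isBounded_ball hg.diffContOnCl ?_ (subset_closure hz)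
    intro w hw
    rw [frontier_ball _ (by linarith)] at hw
    apply hsph
    simpa [dist_eq_norm] using hw
  have hfin := logDeriv_bound hg (c := 2) (r := R - 2) (M := M) (by linarith) hMpos ?_ ?_ (s := s) (by linarith)
  · have e3 : (∑ a ∈ ZZ R, (mu a : ℂ) / (s - a) + logDeriv g s - (∑ a ∈ ZZ R, (mu a : ℂ) / (2 - a) + logDeriv g 2) -
      (∑ ρ ∈ ZZ R, (mu ρ : ℂ) / (s - ρ) - ∑ ρ ∈ ZZ R, (mu ρ : ℂ) / (2 - ρ))) = logDeriv g s - logDeriv g 2 := by ring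
    rw [e3]
    refine hfin.trans ?_
    have h5 : 64 * M / (R-2)^2 ≤ 256 * (27 * C + B) / √R := by
      rw [div_le_div_iff₀ (by nlinarith) (by linarith), hM]
      have h6 : R^2 ≤ 4 * (R-2)^2 := by nlinarith
      have h7 : 0 < 27 * C + B := by positivity
      calc 64 * ((27 * C + B) * (R * √R)) * √R = 64 * (27*C+B) * R^2 := by
            rw [show 64 * ((27 * C + B) * (R * √R)) * √R = 64 * (27*C+B) * R * (√R*√R) by ring, hsqR]; ring
        _ ≤ 64 * (27*C+B) * (4 * (R-2)^2) := by gcongr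
        _ = _ := by ring
    calc 64 * M / (R-2)^2 * ‖s-2‖ ≤ 256 * (27 * C + B) / √R * ‖s - 2‖ := by gcongr
      _ = _ := by ring
  · intro z hz
    apply hnz
    rw [mem_ball, dist_eq_norm] at hz
    calc ‖z - 1/2‖ = ‖(z - 2) + (3/2:ℂ)‖ := by ring_nf
      _ ≤ ‖z - 2‖ + ‖(3/2:ℂ)‖ := norm_add_le _ _
      _ ≤ R := by
        have : ‖(3/2 : ℂ)‖ = 3/2 := by norm_num
        linarith
  · intro z hz
    apply hball
    exact ball_subset_ball (by linarith) hz

lemma hadamard_diff_tendsto {s : ℂ} (hs : Xi s ≠ 0) :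
    Tendsto (fun R : ℝ => ∑ ρ ∈ ZZ R, (mu ρ : ℂ) / (s - ρ) - ∑ ρ ∈ ZZ R, (mu ρ : ℂ) / (2 - ρ)) atTop
      (𝓝 (logDeriv Xi s - logDeriv Xi 2)) := by
  obtain ⟨C, hC, h⟩ := hadamard_diff
  rw [tendsto_iff_norm_sub_tendsto_zero]
  have hlim : Tendsto (fun R : ℝ => C * ‖s - 2‖ / √R) atTop (𝓝 0) :=
    Tendsto.div_atTop tendsto_const_nhds Real.tendsto_sqrt_atTop
  refine squeeze_zero' (Eventually.of_forall fun _ => norm_nonneg _) ?_ hlim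
  filter_upwards [eventually_ge_atTop (8 * ‖s - 2‖ + 10)] with R hR
  rw [norm_sub_rev]
  exact h s hs R hR

lemma ZZ_sum_symm (R : ℝ) (f : ℂ → ℂ) : ∑ ρ ∈ ZZ R, f ρ = ∑ ρ ∈ ZZ R, f (1 - ρ) := by
  have hm : ∀ ρ ∈ ZZ R, 1 - ρ ∈ ZZ R := by
    intro ρ h
    rw [mem_ZZ] at h ⊢
    refine ⟨?_, by rw [Xi_one_sub]; exact h.2⟩
    rw [show (1:ℂ) - ρ - 1/2 = -(ρ - 1/2) by ring, norm_neg]; exact h.1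
  refine Finset.sum_bij' (fun ρ _ => 1 - ρ) (fun ρ _ => 1 - ρ) hm hm ?_ ?_ ?_ <;> simp

theorem hadamard {s : ℂ} (hs : Xi s ≠ 0) :
    Tendsto (fun R : ℝ => ∑ ρ ∈ ZZ R, (mu ρ : ℂ) / (s - ρ)) atTop (𝓝 (logDeriv Xi s)) := by
  have hm1 : Xi (-1) ≠ 0 := by
    have := Xi_one_sub 2
    norm_num at this
    rw [this]; exact Xi_ne_two
  have h1 := hadamard_diff_tendsto hm1
  have e : ∀ R : ℝ, ∑ ρ ∈ ZZ R, (mu ρ : ℂ) / (-1 - ρ) = - ∑ ρ ∈ ZZ R, (mu ρ : ℂ) / (2 - ρ) := by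
    intro R
    rw [ZZ_sum_symm, ← Finset.sum_neg_distrib]
    refine Finset.sum_congr rfl fun ρ _ => ?_
    rw [mu_one_sub, show (-1 : ℂ) - (1 - ρ) = -(2 - ρ) by ring, div_neg]
  have e2 : logDeriv Xi (-1) = - logDeriv Xi 2 := by
    have := logDeriv_Xi_one_sub 2
    norm_num at this
    exact this
  simp only [e, e2] at h1
  have h2 : Tendsto (fun R : ℝ => ∑ ρ ∈ ZZ R, (mu ρ : ℂ) / (2 - ρ)) atTop (𝓝 (logDeriv Xi 2)) := by
    have := h1.const_mul (-1/2)
    refine (this.congr fun R => ?_).trans (le_of_eq ?_)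
    · ring
    · congr 1; ring
  have := (hadamard_diff_tendsto hs).add h2
  simpa using this
end PB

namespace PB
open Filter Topology Metric
open scoped ComplexConjugate

lemma re_one_div_pos {s ρ : ℂ} (hs : 1 ≤ s.re) (hρ : Xi ρ = 0) : 0 < (1 / (s - ρ)).re := by
  have h := (Xi_zero_re hρ).2
  rw [one_div, Complex.inv_re]
  have h1 : 0 < (s - ρ).re := by simp; linarith
  have : s - ρ ≠ 0 := fun h0 => by rw [h0] at h1; simp at h1
  exact div_pos h1 (Complex.normSq_pos.2 this)

lemma exists_subset_ZZ (S : Finset ℂ) (hS : ∀ ρ ∈ S, Xi ρ = 0) : ∃ R0 : ℝ, ∀ R ≥ R0, S ⊆ ZZ R := by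
  refine ⟨∑ ρ ∈ S, ‖ρ - 1/2‖, fun R hR ρ hρ => mem_ZZ.2 ⟨?_, hS ρ hρ⟩⟩
  exact (Finset.single_le_sum (f := fun ρ : ℂ => ‖ρ - 1/2‖) (fun _ _ => norm_nonneg _) hρ).trans hR

lemma sum_re_le {s : ℂ} (hs : 1 ≤ s.re) (S : Finset ℂ) (hS : ∀ ρ ∈ S, Xi ρ = 0) :
    ∑ ρ ∈ S, (mu ρ : ℝ) * (1 / (s - ρ)).re ≤ (logDeriv Xi s).re := by
  have h := (Complex.continuous_re.tendsto _).comp (hadamard (Xi_ne_zero_of_one_le hs))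
  refine ge_of_tendsto h ?_
  obtain ⟨R0, hR0⟩ := exists_subset_ZZ S hS
  filter_upwards [eventually_ge_atTop R0] with R hR
  have e : (Complex.re ∘ fun R => ∑ ρ ∈ ZZ R, (mu ρ : ℂ) / (s - ρ)) R = ∑ ρ ∈ ZZ R, (mu ρ : ℝ) * (1 / (s - ρ)).re := by
    simp only [Function.comp, Complex.re_sum]
    refine Finset.sum_congr rfl fun ρ _ => ?_
    rw [div_eq_mul_one_div, ← Complex.ofReal_natCast, Complex.re_ofReal_mul]
  rw [e]
  refine Finset.sum_le_sum_of_subset_of_nonneg (hR0 R hR) fun ρ hρ _ => ?_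
  have := re_one_div_pos hs (mem_ZZ.1 hρ).2
  positivity

lemma logDeriv_Xi_re_nonneg {s : ℂ} (hs : 1 ≤ s.re) : 0 ≤ (logDeriv Xi s).re := by
  simpa using sum_re_le hs ∅ (by simp)

lemma logDeriv_diff_le {s s2 : ℂ} (hs : Xi s ≠ 0) (hs2 : s2.re = 2) (him : s2.im = s.im)
    (hle : s.re ≤ 2) {Q : ℝ} (hQ0 : 0 ≤ Q) (hQ : ∀ ρ, Xi ρ = 0 → ‖s2 - ρ‖ ≤ Q * ‖s - ρ‖) :
    ‖logDeriv Xi s - logDeriv Xi s2‖ ≤ (2 - s.re) * Q * (logDeriv Xi s2).re := by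
  have hX2 : Xi s2 ≠ 0 := Xi_ne_zero_of_one_le (by linarith)
  have h1 := (hadamard hs).sub (hadamard hX2)
  have h1n := h1.norm
  refine le_of_tendsto h1n (Eventually.of_forall fun R => ?_)
  rw [← Finset.sum_sub_distrib]
  refine (norm_sum_le _ _).trans ?_
  have h2 := sum_re_le (s := s2) (by linarith) (ZZ R) (fun ρ h => (mem_ZZ.1 h).2)
  refine le_trans ?_ (mul_le_mul_of_nonneg_left h2 (by nlinarith))
  rw [Finset.mul_sum]
  refine Finset.sum_le_sum fun ρ hρ => ?_
  have hρ0 := (mem_ZZ.1 hρ).2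
  have hsρ : s - ρ ≠ 0 := fun h => hs (by rw [sub_eq_zero.1 h]; exact hρ0)
  have hs2ρ : s2 - ρ ≠ 0 := fun h => hX2 (by rw [sub_eq_zero.1 h]; exact hρ0)
  have e : (mu ρ : ℂ) / (s - ρ) - mu ρ / (s2 - ρ) = mu ρ * ((s2 - s) / ((s - ρ) * (s2 - ρ))) := by
    field_simp; ring
  have e2 : s2 - s = ((2 - s.re : ℝ) : ℂ) := by
    apply Complex.ext <;> simp [hs2, him]
  rw [e, norm_mul, norm_div, norm_mul, e2, Complex.norm_real, Real.norm_of_nonneg (by linarith)]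
  have e3 : (1 / (s2 - ρ)).re = (2 - ρ.re) / ‖s2 - ρ‖^2 := by
    rw [one_div, Complex.inv_re, Complex.normSq_eq_norm_sq]; simp [hs2]
  have hn1 : 0 < ‖s - ρ‖ := norm_pos_iff.2 hsρ
  have hn2 : 0 < ‖s2 - ρ‖ := norm_pos_iff.2 hs2ρ
  have hr := Xi_zero_re hρ0
  rw [e3]
  have key : (2 - s.re) / (‖s - ρ‖ * ‖s2 - ρ‖) ≤ (2 - s.re) * Q * ((2 - ρ.re) / ‖s2 - ρ‖^2) := by
    have hq := hQ ρ hρ0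
    have k1 : 1 / (‖s - ρ‖ * ‖s2 - ρ‖) ≤ Q / ‖s2 - ρ‖^2 := by
      rw [div_le_div_iff₀ (by positivity) (by positivity)]
      nlinarith
    have k2 : Q / ‖s2 - ρ‖^2 ≤ Q * ((2 - ρ.re) / ‖s2 - ρ‖^2) := by
      rw [div_eq_mul_one_div]
      gcongr
      linarith
    calc _ = (2 - s.re) * (1 / (‖s - ρ‖ * ‖s2 - ρ‖)) := by ring
      _ ≤ (2 - s.re) * (Q * ((2 - ρ.re) / ‖s2 - ρ‖^2)) := by
        have : 0 ≤ 2 - s.re := by linarith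
        gcongr
        exact k1.trans k2
      _ = _ := by ring
  have hm : ‖(mu ρ : ℂ)‖ = (mu ρ : ℝ) := by simp
  rw [hm]
  calc _ ≤ (mu ρ : ℝ) * ((2 - s.re) * Q * ((2 - ρ.re) / ‖s2 - ρ‖^2)) := by gcongr
    _ = _ := by ring

open ArithmeticFunction in
lemma LSeries_norm_le {s : ℂ} {σ : ℝ} (hσ : 1 < σ) (hs : σ ≤ s.re) :
    ‖LSeries (fun n => (vonMangoldt n : ℂ)) s‖ ≤ (LSeries (fun n => (vonMangoldt n : ℂ)) (σ:ℂ)).re := by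
  have hsum := LSeriesSummable_vonMangoldt (s := (σ:ℂ)) (by simpa using hσ)
  have e : (LSeries (fun n => (vonMangoldt n : ℂ)) (σ:ℂ)).re
      = ∑' n, (LSeries.term (fun n => (vonMangoldt n : ℂ)) (σ:ℂ) n).re := by
    unfold LSeries
    exact Complex.re_tsum hsum
  have hr : ∀ n : ℕ, ‖LSeries.term (fun n => (vonMangoldt n : ℂ)) (σ:ℂ) n‖
      = (LSeries.term (fun n => (vonMangoldt n : ℂ)) (σ:ℂ) n).re := by
    intro n
    rcases Nat.eq_zero_or_pos n with h | h
    · simp [h]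
    · rw [LSeries.term_of_ne_zero h.ne', show (n:ℂ) = ((n:ℝ):ℂ) by simp, ← Complex.ofReal_cpow (by positivity),
        ← Complex.ofReal_div, Complex.norm_real, Complex.ofReal_re, Real.norm_of_nonneg]
      have := vonMangoldt_nonneg (n := n)
      positivity
  rw [e]
  unfold LSeries
  refine tsum_of_norm_bounded (a := ∑' n, (LSeries.term (fun n => (vonMangoldt n : ℂ)) (σ:ℂ) n).re) ?_ ?_ (g := fun n => (LSeries.term (fun n => (vonMangoldt n : ℂ)) (σ:ℂ) n).re)
  · have : Summable fun n => (LSeries.term (fun n => (vonMangoldt n : ℂ)) (σ:ℂ) n).re :=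
      (hsum.norm).congr hr
    exact this.hasSum
  · intro n
    rw [← hr]
    refine LSeries.norm_term_le_of_re_le_re _ ?_ n
    simpa using hs

lemma LSeries_real_nonneg {σ : ℝ} (hσ : 1 < σ) :
    0 ≤ (LSeries (fun n => (ArithmeticFunction.vonMangoldt n : ℂ)) (σ:ℂ)).re :=
  (norm_nonneg _).trans (LSeries_norm_le hσ (s := (σ:ℂ)) (by simp))

lemma logDeriv_Xi_re_eq {s : ℂ} (hs : 1 < s.re) : (logDeriv Xi s).re =
    (1 / (s - 1)).re - (LSeries (fun n => (ArithmeticFunction.vonMangoldt n : ℂ)) s).re - Real.log π / 2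
      + (Complex.digamma (s/2 + 1)).re / 2 := by
  rw [logDeriv_Xi (by linarith) (Xi_ne_zero_of_one_le hs.le), gg_eq hs]
  have : (Complex.digamma (s/2+1) / 2).re = (Complex.digamma (s/2+1)).re/2 := by
    simp
  have h2 : ((Real.log π : ℂ) / 2).re = Real.log π / 2 := by
    rw [show ((Real.log π : ℂ) / 2) = ((Real.log π / 2 : ℝ) : ℂ) by push_cast; rfl, Complex.ofReal_re]
  simp only [Complex.add_re, Complex.sub_re, Complex.neg_re, this, h2]
  ring

lemma digamma_real_add_one_le {x : ℝ} (hx : 0 < x) : (Complex.digamma ((x:ℂ)+1)).re ≤ Real.log x + 1/(2*x) := by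
  rw [Complex.digamma_apply_add_one _ (fun m h => by
    have h1 := congrArg Complex.re h
    simp at h1
    have : (0:ℝ) ≤ m := by positivity
    linarith)]
  have h := digamma_real_le hx
  have e : ((x:ℂ)⁻¹).re = 1/x := by rw [← Complex.ofReal_inv, Complex.ofReal_re, one_div]
  simp only [Complex.add_re, one_div, e] at *
  have : x⁻¹ - (2*x)⁻¹ = (2*x)⁻¹ := by field_simp; norm_num
  linarith

lemma X_real_le {x : ℝ} (hx : 1 < x) :
    (logDeriv Xi (x:ℂ)).re ≤ 1/(x-1) + Real.log (x/(2*π))/2 + 1/(2*x) := by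
  rw [logDeriv_Xi_re_eq (by simpa using hx)]
  have h1 := LSeries_real_nonneg hx
  have h2 := digamma_real_add_one_le (x := x/2) (by linarith)
  have e1 : (1 / ((x:ℂ) - 1)).re = 1/(x-1) := by
    rw [← Complex.ofReal_one, ← Complex.ofReal_sub, ← Complex.ofReal_div, Complex.ofReal_re]
  have e2 : (x:ℂ)/2 = ((x/2:ℝ):ℂ) := by push_cast; rfl
  have e3 : Real.log (x/(2*π)) = Real.log (x/2) - Real.log π := by
    rw [← Real.log_div (by positivity) Real.pi_ne_zero]; congr 1; field_simp
  rw [e1, e2, e3]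
  have e4 : 1/(2*(x/2)) = 2*(1/(2*x)) := by field_simp
  rw [e4] at h2
  linarith

lemma exp_le_inv {x : ℝ} (hx : x < 1) : Real.exp x ≤ 1/(1-x) := by
  have h := Real.one_sub_le_exp_neg x
  have hp := Real.exp_pos x
  rw [le_div_iff₀ (by linarith)]
  calc Real.exp x * (1-x) ≤ Real.exp x * Real.exp (-x) := by gcongr
    _ = 1 := by rw [← Real.exp_add]; simp

lemma LSeries_two_le : (LSeries (fun n => (ArithmeticFunction.vonMangoldt n : ℂ)) 2).re ≤ 7/10 := by
  have h := logDeriv_Xi_re_nonneg (s := 2) (by simp)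
  rw [logDeriv_Xi_re_eq (by simp)] at h
  have h1 : (Complex.digamma ((1:ℝ):ℂ)).re ≤ Real.log 1 - 1/(2*1) := digamma_real_le one_pos
  have h2 : Complex.digamma ((2:ℂ)/2+1) = Complex.digamma ((1:ℝ):ℂ) + 1 := by
    have := Complex.digamma_apply_add_one 1 (fun m h => by
      have h1 := congrArg Complex.re h
      simp at h1
      have : (0:ℝ) ≤ m := by positivity
      linarith)
    simp at this ⊢
    rw [← this]
  rw [h2] at h
  have h3 : (1 / ((2:ℂ) - 1)).re = 1 := by norm_num
  rw [h3] at h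
  simp only [Complex.add_re, Complex.one_re] at h
  have h4 : 1.1 ≤ Real.log π := by
    rw [Real.le_log_iff_exp_le Real.pi_pos]
    have h5 : Real.exp 1.1 = Real.exp 1 * Real.exp 0.1 := by rw [← Real.exp_add]; norm_num
    have h6 := Real.exp_one_lt_d9
    have h7 : Real.exp 0.1 ≤ 1/(1-0.1) := by
      exact exp_le_inv (by norm_num)
    have := Real.pi_gt_d4
    have hp := Real.exp_pos 1
    rw [h5]
    calc Real.exp 1 * Real.exp 0.1 ≤ 2.7182818286 * (1/(1-0.1)) := by gcongr
      _ ≤ 3.1415 := by norm_num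
      _ ≤ π := by linarith
  rw [Real.log_one] at h1
  linarith

def RHT : Prop := ∀ ρ : ℂ, Xi ρ = 0 → 0 < ρ.im → ρ.im ≤ 3*(10:ℝ)^12 + 1 + π/3 → ρ.re = 1/2

noncomputable def ZT (T : ℝ) : Finset ℂ :=
  ((Xi_zeros_finite (K := Set.Icc 0 1 ×ℂ Set.Icc 0 T)
    (isCompact_Icc.reProdIm isCompact_Icc)).toFinset).filter (fun ρ => 0 < ρ.im)

lemma mem_ZT {T : ℝ} {ρ : ℂ} : ρ ∈ ZT T ↔ Xi ρ = 0 ∧ 0 < ρ.im ∧ ρ.im ≤ T := by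
  simp only [ZT, Finset.mem_filter, Set.Finite.mem_toFinset, Set.mem_inter_iff, Complex.mem_reProdIm,
    Set.mem_Icc, Set.mem_ofPred_eq]
  constructor
  · rintro ⟨⟨⟨_, h1⟩, h2⟩, h3⟩; exact ⟨h2, h3, h1.2⟩
  · rintro ⟨h1, h2, h3⟩
    have := Xi_zero_re h1
    exact ⟨⟨⟨⟨this.1.le, this.2.le⟩, h2.le, h3⟩, h1⟩, h2⟩

lemma Xi_conj_zero {ρ : ℂ} (h : Xi ρ = 0) : Xi (conj ρ) = 0 := by rw [Xi_conj, h]; simp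

lemma no_real_zero {ρ : ℂ} (h : Xi ρ = 0) : ρ.im ≠ 0 := by
  intro him
  have h1 := sum_re_le (s := 3) (by norm_num) {ρ} (by simpa using h)
  have h2 := X_real_le (x := 3) (by norm_num)
  have hr := Xi_zero_re h
  have hm : (1:ℝ) ≤ mu ρ := by exact_mod_cast mu_pos h
  have e : (1 / (3 - ρ)).re = 1/(3 - ρ.re) := by
    have : (3:ℂ) - ρ = ((3 - ρ.re : ℝ):ℂ) := by apply Complex.ext <;> simp [him]
    rw [this, ← Complex.ofReal_one, ← Complex.ofReal_div, Complex.ofReal_re]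
  rw [Finset.sum_singleton, e] at h1
  have h3 : 1/3 ≤ 1/(3 - ρ.re) := one_div_le_one_div_of_le (by linarith) (by linarith)
  have h4 : Real.log (3/(2*π)) < -(2/3) := by
    rw [Real.log_lt_iff_lt_exp (by positivity)]
    have hp := Real.pi_gt_d4
    have a1 : (3:ℝ)/(2*π) < 3/6.283 := by
      apply div_lt_div_of_pos_left <;> linarith
    refine a1.trans ?_
    have a2 : (3/6.283 : ℝ)^3 < Real.exp (-(2/3)) ^ 3 := by
      rw [← Real.exp_nat_mul]
      have : Real.exp ((3:ℕ) * -(2/3)) = (Real.exp 1 * Real.exp 1)⁻¹ := by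
        rw [← Real.exp_add, ← Real.exp_neg]; congr 1; norm_num
      rw [this]
      have h6 := Real.exp_one_lt_d9
      have h7 := Real.exp_pos 1
      have : (2.7182818286 * 2.7182818286 : ℝ)⁻¹ ≤ (Real.exp 1 * Real.exp 1)⁻¹ := by gcongr
      refine lt_of_lt_of_le ?_ this
      norm_num
    exact lt_of_pow_lt_pow_left₀ 3 (Real.exp_pos _).le a2
  have e5 : ((3:ℝ):ℂ) = 3 := by norm_num
  rw [e5] at h2
  have h6 : 0 < 1/(3 - ρ.re) := by linarith [h3]
  norm_num at h2
  nlinarith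

/-- pair kernel bound -/
lemma pair_sum_le {T : ℝ} (hT : ∀ ρ ∈ ZT T, ρ.re = 1/2) {b τ : ℝ} (hb : 1/2 ≤ b) :
    ∑ ρ ∈ ZT T, (mu ρ : ℝ) * (b / (b^2 + (τ - ρ.im)^2) + b / (b^2 + (τ + ρ.im)^2))
      ≤ (logDeriv Xi ((1/2 + b : ℝ) + τ * Complex.I)).re := by
  set s : ℂ := ((1/2 + b : ℝ) : ℂ) + τ * Complex.I with hs
  have hsre : s.re = 1/2 + b := by simp [hs]
  have hsim : s.im = τ := by simp [hs]
  have hinj : Set.InjOn (fun ρ : ℂ => conj ρ) (ZT T) := fun a _ b _ h => (starRingEnd ℂ).injective h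
  set S := ZT T ∪ (ZT T).image (fun ρ => conj ρ) with hS
  have hdis : Disjoint (ZT T) ((ZT T).image (fun ρ => conj ρ)) := by
    rw [Finset.disjoint_left]
    intro a ha hb
    obtain ⟨c, hc, rfl⟩ := Finset.mem_image.1 hb
    have h1 := (mem_ZT.1 ha).2.1
    have h2 := (mem_ZT.1 hc).2.1
    simp at h1; linarith
  have h := sum_re_le (s := s) (by rw [hsre]; linarith) S (by
    intro ρ hρ
    rcases Finset.mem_union.1 hρ with h | h
    · exact (mem_ZT.1 h).1
    · obtain ⟨c, hc, rfl⟩ := Finset.mem_image.1 h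
      exact Xi_conj_zero (mem_ZT.1 hc).1)
  rw [hS, Finset.sum_union hdis, Finset.sum_image hinj, ← Finset.sum_add_distrib] at h
  refine le_trans (le_of_eq ?_) h
  refine Finset.sum_congr rfl fun ρ hρ => ?_
  rw [mu_conj, ← mul_add]
  have hre := hT ρ hρ
  congr 1
  rw [one_div, one_div, Complex.inv_re, Complex.inv_re, Complex.normSq_apply, Complex.normSq_apply]
  simp only [Complex.sub_re, Complex.sub_im, Complex.conj_re, Complex.conj_im, hsre, hsim, hre]
  congr 1 <;> · congr 1 <;> ring

lemma ZT_half {T : ℝ} (hRH : RHT) (hT : T ≤ 3*(10:ℝ)^12 + 1 + π/3) : ∀ ρ ∈ ZT T, ρ.re = 1/2 := by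
  intro ρ hρ
  have := mem_ZT.1 hρ
  exact hRH ρ this.1 this.2.1 (this.2.2.trans hT)

lemma im_sq_ge {ρ : ℂ} (hRH : RHT) (h : Xi ρ = 0) : 18 ≤ ρ.im^2 := by
  have key : ∀ ρ : ℂ, Xi ρ = 0 → 0 < ρ.im → 18 ≤ ρ.im^2 := by
    intro ρ h him
    by_contra hc
    push Not at hc
    have hle : ρ.im ≤ 5 := by nlinarith
    have h1 := pair_sum_le (T := 5) (ZT_half hRH (by linarith [Real.pi_pos])) (b := 4) (τ := 0) (by norm_num)
    have h2 := X_real_le (x := 9/2) (by norm_num)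
    have e5 : (((1/2 + 4 : ℝ) : ℂ) + (0:ℝ) * Complex.I) = ((9/2:ℝ):ℂ) := by push_cast; ring
    rw [e5] at h1
    have hm : (1:ℝ) ≤ mu ρ := by exact_mod_cast mu_pos h
    have h3 := Finset.single_le_sum (f := fun ρ : ℂ => (mu ρ : ℝ) * ((4:ℝ) / (4^2 + (0 - ρ.im)^2) + 4 / (4^2 + (0 + ρ.im)^2)))
      (fun _ _ => by positivity) (mem_ZT.2 ⟨h, him, hle⟩)
    have h4 : (4:ℝ)/34 ≤ (4:ℝ) / (4^2 + (0 - ρ.im)^2) := by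
      apply div_le_div_of_nonneg_left <;> nlinarith
    have h5 : (4:ℝ)/34 ≤ (4:ℝ) / (4^2 + (0 + ρ.im)^2) := by
      apply div_le_div_of_nonneg_left <;> nlinarith
    have h6 : Real.log (9/2/(2*π)) < -(1/3) := by
      rw [Real.log_lt_iff_lt_exp (by positivity)]
      have hp := Real.pi_gt_d4
      have a1 : (9:ℝ)/2/(2*π) < 4.5/6.283 := by
        rw [show (9:ℝ)/2 = 4.5 by norm_num]
        apply div_lt_div_of_pos_left <;> linarith
      refine a1.trans ?_
      have a2 : (4.5/6.283 : ℝ)^3 < Real.exp (-(1/3)) ^ 3 := by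
        rw [← Real.exp_nat_mul]
        have : Real.exp ((3:ℕ) * -(1/3)) = (Real.exp 1)⁻¹ := by
          rw [← Real.exp_neg]; congr 1; norm_num
        rw [this]
        have h6 := Real.exp_one_lt_d9
        have h7 := Real.exp_pos 1
        have : (2.7182818286 : ℝ)⁻¹ ≤ (Real.exp 1)⁻¹ := by gcongr
        refine lt_of_lt_of_le ?_ this
        norm_num
      exact lt_of_pow_lt_pow_left₀ 3 (Real.exp_pos _).le a2
    norm_num at h2
    norm_num at h6
    have h7 : (1:ℝ) * (4/34+4/34) ≤ (mu ρ : ℝ) * ((4:ℝ) / (4^2 + (0 - ρ.im)^2) + 4 / (4^2 + (0 + ρ.im)^2)) := by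
      gcongr
    norm_num at h1 h3 h7
    linarith
  rcases lt_trichotomy ρ.im 0 with h0 | h0 | h0
  · have := key (conj ρ) (Xi_conj_zero h) (by simpa using h0)
    simpa using this
  · exact absurd h0 (no_real_zero h)
  · exact key ρ h h0
end PB

namespace PB
open Filter Topology Metric
open scoped ComplexConjugate

/-- entire function (e^z-1)/z -/
noncomputable def DD (z : ℂ) : ℂ := dslope Complex.exp 0 z

lemma DD_diff : Differentiable ℂ DD := by
  have h : DifferentiableOn ℂ (dslope Complex.exp 0) Set.univ :=
    (Complex.differentiableOn_dslope Filter.univ_mem).2 Complex.differentiable_exp.differentiableOn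
  exact fun z => (h z (Set.mem_univ z)).differentiableAt Filter.univ_mem

lemma DD_zero : DD 0 = 1 := by simp [DD, dslope_same]

lemma DD_of_ne {z : ℂ} (h : z ≠ 0) : DD z = (Complex.exp z - 1) / z := by
  rw [DD, dslope_of_ne _ h, slope_def_field]; simp

noncomputable def BB (z : ℂ) : ℂ := (DD z)⁻¹

lemma BB_zero : BB 0 = 1 := by simp [BB, DD_zero]

lemma BB_of_ne {z : ℂ} (h : z ≠ 0) : BB z = z / (Complex.exp z - 1) := by
  rw [BB, DD_of_ne h, inv_div]

lemma DD_ne_zero {z : ℂ} (h : z.re ≠ 0 ∨ |z.im| < 2*π) : DD z ≠ 0 := by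
  by_cases h0 : z = 0
  · rw [h0, DD_zero]; norm_num
  rw [DD_of_ne h0, Ne, div_eq_zero_iff]
  push Not
  refine ⟨fun he => ?_, h0⟩
  have h1 : Complex.exp z = 1 := by linear_combination he
  rw [Complex.exp_eq_one_iff] at h1
  obtain ⟨n, hn⟩ := h1
  have hre : z.re = 0 := by rw [hn]; simp
  have him : z.im = n * (2*π) := by rw [hn]; simp
  rcases h with h | h
  · exact h hre
  · rw [him, abs_mul, abs_of_pos (by positivity : 0 < 2*π)] at h
    have h2 : |(n:ℝ)| < 1 := by
      have := Real.pi_pos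
      by_contra hc
      push Not at hc
      nlinarith
    have h3 : |n| < 1 := by exact_mod_cast h2
    have h4 : n = 0 := Int.abs_lt_one_iff.1 h3
    apply h0; rw [hn, h4]; simp

lemma BB_diffAt {z : ℂ} (h : z.re ≠ 0 ∨ |z.im| < 2*π) : DifferentiableAt ℂ BB z :=
  (DD_diff z).inv (DD_ne_zero h)

/-- real version -/
noncomputable def bb (x : ℝ) : ℝ := if x = 0 then 1 else x / (Real.exp x - 1)

lemma BB_ofReal (x : ℝ) : BB (x:ℂ) = (bb x : ℂ) := by
  unfold bb
  by_cases h : x = 0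
  · simp [h, BB_zero]
  · rw [BB_of_ne (by exact_mod_cast h), if_neg h]; push_cast; rfl

lemma exp_sub_one_ne {x : ℝ} (h : x ≠ 0) : Real.exp x - 1 ≠ 0 := by
  rw [sub_ne_zero]; intro h1; rw [Real.exp_eq_one_iff] at h1; exact h h1

lemma bb_inv_slope {x : ℝ} (h : x ≠ 0) : bb x = (slope Real.exp 0 x)⁻¹ := by
  rw [bb, if_neg h, slope_def_field]; simp

lemma slope_exp_pos {x : ℝ} (h : x ≠ 0) : 0 < slope Real.exp 0 x := by
  rw [slope_def_field]
  simp only [Real.exp_zero, sub_zero]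
  rcases lt_or_gt_of_ne h with h | h
  · apply div_pos_of_neg_of_neg _ h
    have := Real.exp_lt_one_iff.2 h; linarith
  · apply div_pos _ h
    have := Real.one_lt_exp_iff.2 h; linarith

lemma bb_anti : Antitone bb := by
  have key : ∀ x, x < 0 → 1 ≤ bb x := by
    intro x hx
    rw [bb, if_neg hx.ne]
    have h1 := Real.add_one_le_exp x
    have h2 := Real.exp_lt_one_iff.2 hx
    rw [le_div_iff_of_neg (by linarith)]; linarith
  have key2 : ∀ x, 0 < x → bb x ≤ 1 := by
    intro x hx
    rw [bb, if_neg hx.ne']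
    have h1 := Real.add_one_le_exp x
    rw [div_le_one (by linarith)]; linarith
  intro a b hab
  by_cases ha : a = 0
  · rcases eq_or_lt_of_le hab with h | h
    · rw [h]
    · have : bb a = 1 := by simp [bb, ha]
      rw [this]; exact key2 b (by linarith)
  by_cases hb : b = 0
  · rcases eq_or_lt_of_le hab with h | h
    · rw [h]
    · have : bb b = 1 := by simp [bb, hb]
      rw [this]; exact key a (by linarith)
  rw [bb_inv_slope ha, bb_inv_slope hb]
  apply inv_anti₀ (slope_exp_pos ha)
  have := convexOn_exp.secant_mono (a := 0) (x := a) (y := b) (Set.mem_univ _) (Set.mem_univ _) (Set.mem_univ _) ha hb hab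
  rw [slope_def_field, slope_def_field]
  exact this

lemma bb_neg (x : ℝ) : bb (-x) = bb x + x := by
  unfold bb
  by_cases h : x = 0
  · simp [h]
  · rw [if_neg h, if_neg (by simpa using h), Real.exp_neg]
    have h1 := exp_sub_one_ne h
    have h2 := (Real.exp_pos x).ne'
    have h3 : (Real.exp x)⁻¹ - 1 ≠ 0 := by
      rw [← Real.exp_neg]; exact exp_sub_one_ne (by simpa using h)
    have h4 : 1 - Real.exp x ≠ 0 := fun h => h1 (by linarith)
    field_simp
    ring

lemma bb_le_of_le {a b : ℝ} (h : a ≤ b) : bb b ≤ bb a ∧ bb a + a ≤ bb b + b := by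
  refine ⟨bb_anti h, ?_⟩
  rw [← bb_neg, ← bb_neg]; exact bb_anti (by linarith)

noncomputable def GG (j : ℝ) (z : ℂ) : ℂ := BB z + j * z

noncomputable def kk (l j : ℝ) (z : ℂ) : ℂ := (GG j l - GG j (z - 2*π*Complex.I)) / (2*π*Complex.I)

noncomputable def HH (l j x : ℝ) : ℝ := ((bb x + j * x) - (bb l + j * l)) / (2*π)

lemma HH_sign {l j : ℝ} (hj : j = 0 ∨ j = 1) {x : ℝ} :
    (l ≤ x → 0 ≤ (2*j-1) * HH l j x) ∧ (x ≤ l → (2*j-1) * HH l j x ≤ 0) ∧ |HH l j x| ≤ |x - l| / (2*π) := by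
  have hp : 0 < 2*π := by positivity
  unfold HH
  rw [abs_div, abs_of_pos hp, ← mul_div_assoc]
  refine ⟨fun h => ?_, fun h => ?_, ?_⟩
  · apply div_nonneg _ hp.le
    have := bb_le_of_le h
    rcases hj with rfl | rfl <;> linarith
  · apply div_nonpos_of_nonpos_of_nonneg _ hp.le
    have := bb_le_of_le h
    rcases hj with rfl | rfl <;> linarith
  · apply div_le_div_of_nonneg_right _ hp.le
    rcases le_total l x with h | h
    · have := bb_le_of_le h
      rw [abs_of_nonneg (sub_nonneg.2 h), abs_le]
      rcases hj with rfl | rfl <;> constructor <;> linarith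
    · have := bb_le_of_le h
      rw [abs_of_nonpos (sub_nonpos.2 h), abs_le]
      rcases hj with rfl | rfl <;> constructor <;> linarith

lemma BB_sub_period {z : ℂ} (hz2 : z ≠ 2*π*Complex.I) :
    BB (z - 2*π*Complex.I) = (z - 2*π*Complex.I) / (Complex.exp z - 1) := by
  rw [BB_of_ne (sub_ne_zero_of_ne hz2), Complex.exp_sub, Complex.exp_two_pi_mul_I, div_one]

lemma two_pi_I_ne : (2*π*Complex.I : ℂ) ≠ 0 := by
  simp [Real.pi_ne_zero]

/-- on the line of height 2π, k = i h -/
lemma kk_top (l j x : ℝ) : kk l j ((x:ℂ) + (2*π:ℝ) * Complex.I) = Complex.I * (HH l j x : ℂ) := by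
  unfold kk HH GG
  have e : (x:ℂ) + (2*π:ℝ) * Complex.I - 2*π*Complex.I = x := by push_cast; ring
  rw [e, BB_ofReal, BB_ofReal]
  have := two_pi_I_ne
  have hp : (π:ℂ) ≠ 0 := by exact_mod_cast Real.pi_ne_zero
  push_cast
  field_simp
  rw [Complex.I_sq]; ring

/-- on the real line, Im k = h (x ≠ 0) -/
lemma kk_bot (l j : ℝ) {x : ℝ} (hx : x ≠ 0) : kk l j (x:ℂ) = ((1/(Real.exp x - 1) + j : ℝ) : ℂ) + Complex.I * (HH l j x : ℂ) := by
  unfold kk HH GG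
  rw [BB_sub_period (fun h => by
    have := congrArg Complex.re h; simp at this; exact hx this), BB_ofReal]
  have := two_pi_I_ne
  have hp : (π:ℂ) ≠ 0 := by exact_mod_cast Real.pi_ne_zero
  have he : Complex.exp x - 1 ≠ 0 := by
    rw [← Complex.ofReal_exp, ← Complex.ofReal_one, ← Complex.ofReal_sub]
    exact_mod_cast exp_sub_one_ne hx
  have hbx : bb x = x / (Real.exp x - 1) := by rw [bb, if_neg hx]
  rw [hbx]
  push_cast
  field_simp
  ring_nf
  rw [Complex.I_sq]
  ring

lemma norm_exp_sub_one_ge (w : ℂ) : |Real.exp w.re - 1| ≤ ‖Complex.exp w - 1‖ := by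
  have := abs_norm_sub_norm_le (Complex.exp w) 1
  rwa [Complex.norm_exp, norm_one] at this

lemma norm_BB_le {w : ℂ} (h : 1 ≤ |w.re|) : ‖BB w‖ ≤ 2 * ‖w‖ := by
  have hw : w ≠ 0 := by rintro rfl; simp at h; linarith
  rw [BB_of_ne hw, norm_div]
  have h1 := norm_exp_sub_one_ge w
  have h2 : (1:ℝ)/2 ≤ |Real.exp w.re - 1| := by
    rcases le_total 0 w.re with h0 | h0
    · rw [abs_of_nonneg h0] at h
      have := Real.add_one_le_exp w.re
      rw [abs_of_nonneg] <;> linarith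
    · rw [abs_of_nonpos h0] at h
      have h3 : Real.exp w.re ≤ Real.exp (-1) := Real.exp_le_exp.2 (by linarith)
      have h4 : Real.exp (-1) ≤ 1/2 := by
        have := exp_le_inv (x := -1) (by norm_num); linarith
      rw [abs_of_nonpos] <;> linarith
  have h5 : (1:ℝ)/2 ≤ ‖Complex.exp w - 1‖ := h2.trans h1
  rw [div_le_iff₀ (by linarith)]
  nlinarith [norm_nonneg w]

lemma norm_kk_le {l j : ℝ} (hj : j = 0 ∨ j = 1) {z : ℂ} (h : 1 ≤ |z.re|) :
    ‖kk l j z‖ ≤ |bb l + j * l| + 3 * ‖z‖ + 20 := by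
  unfold kk
  have hp := Real.pi_gt_three
  have hp4 := Real.pi_lt_d2
  have e : ‖(2*π*Complex.I : ℂ)‖ = 2*π := by simp [abs_of_pos Real.pi_pos]
  rw [norm_div, e, div_le_iff₀ (by positivity)]
  have h1 : ‖GG j (l:ℂ)‖ = |bb l + j*l| := by
    rw [GG, BB_ofReal, ← Complex.ofReal_mul, ← Complex.ofReal_add, Complex.norm_real, Real.norm_eq_abs]
  have h2 : ‖z - 2*π*Complex.I‖ ≤ ‖z‖ + 2*π := by
    refine (norm_sub_le _ _).trans ?_; rw [e]
  have h3 : ‖GG j (z - 2*π*Complex.I)‖ ≤ 3 * ‖z - 2*π*Complex.I‖ := by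
    unfold GG
    refine (norm_add_le _ _).trans ?_
    have := norm_BB_le (w := z - 2*π*Complex.I) (by simpa using h)
    rw [norm_mul]
    have hjn : ‖(j:ℂ)‖ ≤ 1 := by rcases hj with rfl | rfl <;> simp
    have := mul_le_mul_of_nonneg_right hjn (norm_nonneg (z - 2*π*Complex.I))
    linarith
  have h4 : ‖GG j ↑l - GG j (z - 2 * ↑π * Complex.I)‖ ≤ |bb l + j*l| + 3 * (‖z‖ + 2*π) := by
    refine (norm_sub_le _ _).trans ?_
    rw [h1]; linarith
  refine h4.trans ?_
  nlinarith [abs_nonneg (bb l + j*l), norm_nonneg z]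

lemma kk_diffAt {l j : ℝ} {z : ℂ} (h : z.re ≠ 0 ∨ (0 < z.im ∧ z.im < 4*π)) : DifferentiableAt ℂ (kk l j) z := by
  unfold kk GG
  have h1 : DifferentiableAt ℂ BB (z - 2*π*Complex.I) := by
    apply BB_diffAt
    rcases h with h | h
    · left; simpa using h
    · right; simp; rw [abs_lt]; constructor <;> linarith
  have h2 : DifferentiableAt ℂ (fun z : ℂ => BB (z - 2*π*Complex.I)) z := by
    exact DifferentiableAt.comp z (g := BB) h1 (by fun_prop)
  fun_prop

noncomputable def FF (l j u : ℝ) : ℝ :=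
  (1/π) * (∫ θ in (0:ℝ)..(2*π), kk l j ((l:ℂ) + (θ:ℂ) * Complex.I) * Complex.exp ((θ * u : ℝ) * Complex.I)).re
end PB

namespace PB
open Filter Topology Metric
open scoped ComplexConjugate

noncomputable def JJ (l j u x : ℝ) : ℝ :=
  (∫ θ in (0:ℝ)..(2*π), kk l j ((x:ℂ) + (θ:ℂ) * Complex.I) * Complex.exp (((x - l : ℝ) + θ * Complex.I) * u)).re

lemma FF_eq_JJ (l j u : ℝ) : FF l j u = JJ l j u l / π := by
  unfold FF JJ
  rw [one_div, inv_mul_eq_div]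
  congr 3
  ext θ
  congr 2
  push_cast; simp; ring

lemma HH_cont (l j : ℝ) {x : ℝ} (hx : x ≠ 0) : ContinuousAt (HH l j) x := by
  have h : ContinuousAt bb x := by
    have h1 : ContinuousAt (fun y : ℝ => y / (Real.exp y - 1)) x := by
      have := exp_sub_one_ne hx
      fun_prop (disch := assumption)
    refine h1.congr ?_
    filter_upwards [isOpen_ne.mem_nhds hx] with y hy
    rw [bb, if_neg hy]
  unfold HH
  fun_prop

lemma JJ_diff (l j u : ℝ) {a b : ℝ} (hab : a ≤ b) (h : 0 < a ∨ b < 0) :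
    JJ l j u a - JJ l j u b = (1 - Real.cos (2*π*u)) * ∫ x in a..b, HH l j x * Real.exp ((x - l) * u) := by
  have hne : ∀ x ∈ Set.uIcc a b, x ≠ 0 := by
    intro x hx
    rw [Set.uIcc_of_le hab] at hx
    rcases h with h | h
    · exact (lt_of_lt_of_le h hx.1).ne'
    · exact (lt_of_le_of_lt hx.2 h).ne
  set f : ℂ → ℂ := fun z => kk l j z * Complex.exp ((z - l) * u) with hf
  have key := Complex.integral_boundary_rect_eq_zero_of_differentiableOn f (a:ℂ) ((b:ℂ) + (2*π:ℝ) * Complex.I) (by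
    intro z hz
    apply DifferentiableAt.differentiableWithinAt
    have hz1 := hz.1
    simp at hz1
    have := kk_diffAt (l := l) (j := j) (z := z) (Or.inl (hne _ hz1))
    apply DifferentiableAt.mul this
    fun_prop)
  simp only [Complex.ofReal_re, Complex.ofReal_im, Complex.add_re, Complex.add_im, Complex.mul_re, Complex.mul_im, Complex.I_re, Complex.I_im, mul_zero, mul_one, sub_zero, add_zero, zero_add, zero_mul, smul_eq_mul] at key
  set Ia := ∫ y in (0:ℝ)..(2*π), f ((a:ℂ) + y * Complex.I) with hIa
  set Ib := ∫ y in (0:ℝ)..(2*π), f ((b:ℂ) + y * Complex.I) with hIb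
  have hJ : ∀ x : ℝ, JJ l j u x = (∫ y in (0:ℝ)..(2*π), f ((x:ℂ) + y * Complex.I)).re := by
    intro x
    unfold JJ
    congr 2
    ext θ
    simp only [hf]
    congr 2
    push_cast; ring
  have hHc : ContinuousOn (fun x : ℝ => HH l j x * Real.exp ((x - l) * u)) (Set.uIcc a b) := by
    intro x hx
    apply ContinuousAt.continuousWithinAt
    have := HH_cont l j (hne x hx)
    fun_prop
  have hRc : ContinuousOn (fun x : ℝ => (1/(Real.exp x - 1) + j) * Real.exp ((x - l) * u)) (Set.uIcc a b) := by
    intro x hx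
    apply ContinuousAt.continuousWithinAt
    have := exp_sub_one_ne (hne x hx)
    fun_prop (disch := assumption)
  set H := ∫ x in a..b, HH l j x * Real.exp ((x - l) * u) with hH
  have hbot : (∫ x in a..b, f ((x:ℂ) + (0:ℝ) * Complex.I)) =
      ((∫ x in a..b, (1/(Real.exp x - 1) + j) * Real.exp ((x - l) * u) : ℝ) : ℂ) + Complex.I * (H : ℂ) := by
    rw [hH, ← intervalIntegral.integral_ofReal, ← intervalIntegral.integral_ofReal, ← intervalIntegral.integral_const_mul,
      ← intervalIntegral.integral_add]
    · apply intervalIntegral.integral_congr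
      intro x hx
      simp only [hf]
      have e : (x:ℂ) + (0:ℝ) * Complex.I = x := by simp
      rw [e, kk_bot l j (hne x hx), ← Complex.ofReal_sub, ← Complex.ofReal_mul, ← Complex.ofReal_exp]
      push_cast; ring
    · exact ((Complex.continuous_ofReal.comp_continuousOn hRc)).intervalIntegrable
    · exact (continuousOn_const.mul (Complex.continuous_ofReal.comp_continuousOn hHc)).intervalIntegrable
  have htop : (∫ x in a..b, f ((x:ℂ) + (2*π:ℝ) * Complex.I)) = Complex.I * (H:ℂ) * Complex.exp ((2*π*u:ℝ) * Complex.I) := by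
    rw [hH, ← intervalIntegral.integral_ofReal, ← intervalIntegral.integral_const_mul, ← intervalIntegral.integral_mul_const]
    apply intervalIntegral.integral_congr
    intro x hx
    simp only [hf]
    rw [kk_top]
    have e : ((x:ℂ) + (2*π:ℝ) * Complex.I - l) * u = (((x - l) * u : ℝ) : ℂ) + (2*π*u:ℝ) * Complex.I := by push_cast; ring
    rw [e, Complex.exp_add, ← Complex.ofReal_exp]
    push_cast; ring
  have k2 := congrArg Complex.im key
  have e0 : (∫ x in a..b, f ((x:ℂ) + ((0:ℝ):ℂ) * Complex.I)) = ∫ x in a..b, f (x:ℂ) := by simp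
  simp only [Complex.ofReal_zero, zero_mul, add_zero] at hbot
  simp only [Complex.ofReal_zero, zero_mul, add_zero] at k2
  rw [hbot, htop] at k2
  rw [hJ, hJ]
  rw [Complex.exp_ofReal_mul_I] at k2
  simp [-Complex.ofReal_mul, -Complex.ofReal_cos, -Complex.ofReal_sin] at k2
  linarith

/-- decay of J at infinity -/
lemma norm_JJ_le {l j : ℝ} (hj : j = 0 ∨ j = 1) (u : ℝ) {x : ℝ} (hx : 1 ≤ |x|) :
    |JJ l j u x| ≤ (|bb l + j * l| + 3 * (|x| + 7) + 20) * Real.exp ((x - l) * u) * 7 := by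
  unfold JJ
  refine (Complex.abs_re_le_norm _).trans ?_
  have hp := Real.pi_gt_three
  have hp4 := Real.pi_lt_d2
  have h := intervalIntegral.norm_integral_le_of_norm_le_const (a := 0) (b := 2*π)
    (f := fun θ : ℝ => kk l j ((x:ℂ) + (θ:ℂ) * Complex.I) * Complex.exp (((x - l : ℝ) + θ * Complex.I) * u))
    (C := (|bb l + j * l| + 3 * (|x| + 7) + 20) * Real.exp ((x - l) * u)) (by
    intro θ hθ
    rw [Set.uIoc_of_le (by positivity)] at hθ
    rw [norm_mul, Complex.norm_exp]
    have e : (((x - l : ℝ) + θ * Complex.I) * (u:ℂ)).re = (x - l) * u := by simp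
    rw [e]
    gcongr
    refine (norm_kk_le hj (by simpa using hx)).trans ?_
    have : ‖(x:ℂ) + θ * Complex.I‖ ≤ |x| + 7 := by
      refine (norm_add_le _ _).trans ?_
      rw [norm_mul, Complex.norm_I, mul_one, Complex.norm_real, Complex.norm_real, Real.norm_eq_abs, Real.norm_eq_abs,
        abs_of_pos hθ.1]
      linarith [hθ.2]
    linarith)
  refine h.trans ?_
  rw [sub_zero, abs_of_pos (by positivity : 0 < 2*π)]
  exact mul_le_mul_of_nonneg_left (by linarith) (by positivity)

lemma JJ_tendsto_top {l j : ℝ} (hj : j = 0 ∨ j = 1) {u : ℝ} (hu : u < 0) : Tendsto (JJ l j u) atTop (𝓝 0) := by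
  rw [tendsto_zero_iff_abs_tendsto_zero]
  have h1 : Tendsto (fun x : ℝ => (|bb l + j * l| + 3 * (x + 7) + 20) * Real.exp ((x - l) * u) * 7) atTop (𝓝 0) := by
    have h2 := tendsto_rpow_mul_exp_neg_mul_atTop_nhds_zero 1 (-u) (by linarith)
    have h3 := tendsto_rpow_mul_exp_neg_mul_atTop_nhds_zero 0 (-u) (by linarith)
    have h4 := (h2.const_mul (21 * Real.exp (-l*u))).add (h3.const_mul ((|bb l + j * l| + 41) * 7 * Real.exp (-l*u)))
    simp only [mul_zero, add_zero, Real.rpow_one, Real.rpow_zero, one_mul] at h4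
    refine h4.congr fun x => ?_
    have : Real.exp ((x - l) * u) = Real.exp (-l*u) * Real.exp (-(-u) * x) := by rw [← Real.exp_add]; ring_nf
    rw [this]; ring
  refine squeeze_zero' (Eventually.of_forall fun x => abs_nonneg _) ?_ h1
  filter_upwards [eventually_ge_atTop 1] with x hx
  have := norm_JJ_le (l := l) hj u (x := x) (by rw [abs_of_nonneg] <;> linarith)
  rwa [abs_of_nonneg (by linarith : 0 ≤ x)] at this

lemma JJ_tendsto_bot {l j : ℝ} (hj : j = 0 ∨ j = 1) {u : ℝ} (hu : 0 < u) : Tendsto (fun x => JJ l j u (-x)) atTop (𝓝 0) := by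
  rw [tendsto_zero_iff_abs_tendsto_zero]
  have h1 : Tendsto (fun x : ℝ => (|bb l + j * l| + 3 * (x + 7) + 20) * Real.exp ((-x - l) * u) * 7) atTop (𝓝 0) := by
    have h2 := tendsto_rpow_mul_exp_neg_mul_atTop_nhds_zero 1 (u) (by linarith)
    have h3 := tendsto_rpow_mul_exp_neg_mul_atTop_nhds_zero 0 (u) (by linarith)
    have h4 := (h2.const_mul (21 * Real.exp (-l*u))).add (h3.const_mul ((|bb l + j * l| + 41) * 7 * Real.exp (-l*u)))
    simp only [mul_zero, add_zero, Real.rpow_one, Real.rpow_zero, one_mul] at h4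
    refine h4.congr fun x => ?_
    have : Real.exp ((-x - l) * u) = Real.exp (-l*u) * Real.exp (-u * x) := by rw [← Real.exp_add]; ring_nf
    rw [this]; ring
  refine squeeze_zero' (Eventually.of_forall fun x => abs_nonneg _) ?_ h1
  filter_upwards [eventually_ge_atTop 1] with x hx
  have := norm_JJ_le (l := l) hj u (x := -x) (by rw [abs_neg, abs_of_nonneg] <;> linarith)
  rwa [abs_neg, abs_of_nonneg (by linarith : 0 ≤ x)] at this

lemma one_sub_cos_bd (v : ℝ) : 0 ≤ 1 - Real.cos v ∧ 1 - Real.cos v ≤ 2 :=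
  ⟨by linarith [Real.cos_le_one v], by linarith [Real.neg_one_le_cos v]⟩

lemma JJ_right {l j u : ℝ} (hj : j = 0 ∨ j = 1) (hu : u < 0) {b : ℝ} (hl : 0 < l) (hb : l ≤ b) :
    0 ≤ (2*j-1) * (JJ l j u l - JJ l j u b) ∧ |JJ l j u l - JJ l j u b| ≤ 1/(π*u^2) := by
  rw [JJ_diff l j u hb (Or.inl hl)]
  obtain ⟨hc0, hc2⟩ := one_sub_cos_bd (2*π*u)
  have hpos := Real.pi_pos
  have hcont : ContinuousOn (fun x : ℝ => HH l j x * Real.exp ((x - l) * u)) (Set.uIcc l b) := by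
    intro x hx
    rw [Set.uIcc_of_le hb] at hx
    apply ContinuousAt.continuousWithinAt
    have := HH_cont l j (lt_of_lt_of_le hl hx.1).ne'
    fun_prop
  constructor
  · rw [mul_left_comm, ← intervalIntegral.integral_const_mul]
    apply mul_nonneg hc0
    apply intervalIntegral.integral_nonneg hb
    intro x hx
    rw [← mul_assoc]
    exact mul_nonneg ((HH_sign hj).1 hx.1) (Real.exp_pos _).le
  · have hW : ∀ x ∈ Set.uIcc l b, HasDerivAt (fun x => Real.exp ((x - l) * u) * ((x - l)/u - 1/u^2)) ((x - l) * Real.exp ((x - l) * u)) x := by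
      intro x _
      have h1 : HasDerivAt (fun x : ℝ => (x - l) * u) (1 * u) x := ((hasDerivAt_id x).sub_const l).mul_const u
      have h2 : HasDerivAt (fun x : ℝ => (x - l)/u - 1/u^2) (1/u) x := (((hasDerivAt_id x).sub_const l).div_const u).sub_const _
      have hu0 := hu.ne
      exact (h1.exp.mul h2).congr_deriv (by field_simp; ring)
    have hI := intervalIntegral.integral_eq_sub_of_hasDerivAt hW (by apply Continuous.intervalIntegrable; fun_prop)
    have hle : |∫ x in l..b, HH l j x * Real.exp ((x - l) * u)| ≤ ∫ x in l..b, (1/(2*π)) * ((x - l) * Real.exp ((x - l) * u)) := by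
      rw [← Real.norm_eq_abs]
      apply intervalIntegral.norm_integral_le_of_norm_le hb
      · apply Eventually.of_forall
        intro x hx
        rw [Real.norm_eq_abs, abs_mul, abs_of_pos (Real.exp_pos _)]
        have := (HH_sign hj (l := l) (x := x)).2.2
        rw [abs_of_nonneg (by linarith [hx.1] : 0 ≤ x - l)] at this
        calc |HH l j x| * Real.exp ((x - l) * u) ≤ ((x-l)/(2*π)) * Real.exp ((x - l) * u) := by gcongr
          _ = _ := by ring
      · apply Continuous.intervalIntegrable; fun_prop
    rw [intervalIntegral.integral_const_mul, hI] at hle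
    rw [abs_mul, abs_of_nonneg hc0]
    have h3 : Real.exp ((b - l) * u) * ((b - l)/u - 1/u^2) ≤ 0 := by
      apply mul_nonpos_of_nonneg_of_nonpos (Real.exp_pos _).le
      have : (b-l)/u ≤ 0 := div_nonpos_of_nonneg_of_nonpos (by linarith) hu.le
      have : 0 ≤ 1/u^2 := by positivity
      linarith
    calc (1 - Real.cos (2*π*u)) * |∫ x in l..b, HH l j x * Real.exp ((x - l) * u)| ≤ 2 * ((1/(2*π)) * (0 + 1/u^2)) := by
          apply mul_le_mul hc2 _ (abs_nonneg _) (by norm_num)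
          refine hle.trans ?_
          apply mul_le_mul_of_nonneg_left _ (by positivity)
          simp only [sub_self, zero_mul, Real.exp_zero, zero_div, zero_sub, one_mul, sub_neg_eq_add]
          linarith
      _ = _ := by field_simp; ring

noncomputable def WW (l u x : ℝ) : ℝ := Real.exp ((x - l) * u) * ((l - x)/u + 1/u^2)

lemma JJ_left {l j u : ℝ} (hj : j = 0 ∨ j = 1) (hu : 0 < u) {a b : ℝ} (hab : a ≤ b) (hbl : b ≤ l) (h : 0 < a ∨ b < 0) :
    0 ≤ (2*j-1) * (JJ l j u b - JJ l j u a) ∧ (2*j-1) * (JJ l j u b - JJ l j u a) ≤ 1/π * (WW l u b - WW l u a) := by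
  have h0 := JJ_diff l j u hab h
  have h1 : JJ l j u b - JJ l j u a = (1 - Real.cos (2*π*u)) * -∫ x in a..b, HH l j x * Real.exp ((x - l) * u) := by linarith
  rw [h1]
  obtain ⟨hc0, hc2⟩ := one_sub_cos_bd (2*π*u)
  have hpos := Real.pi_pos
  have hne : ∀ x ∈ Set.uIcc a b, x ≠ 0 := by
    intro x hx
    rw [Set.uIcc_of_le hab] at hx
    rcases h with h | h
    · exact (lt_of_lt_of_le h hx.1).ne'
    · exact (lt_of_le_of_lt hx.2 h).ne
  have hcont : ContinuousOn (fun x : ℝ => (-(2*j-1) * HH l j x) * Real.exp ((x - l) * u)) (Set.uIcc a b) := by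
    intro x hx
    apply ContinuousAt.continuousWithinAt
    have := HH_cont l j (hne x hx)
    fun_prop
  have e : (2*j-1) * ((1 - Real.cos (2*π*u)) * -∫ x in a..b, HH l j x * Real.exp ((x - l) * u)) =
     (1 - Real.cos (2*π*u)) * ∫ x in a..b, (-(2*j-1) * HH l j x) * Real.exp ((x - l) * u) := by
    simp only [mul_assoc]
    rw [intervalIntegral.integral_const_mul]; ring
  rw [e]
  have hnn : 0 ≤ ∫ x in a..b, (-(2*j-1) * HH l j x) * Real.exp ((x - l) * u) := by
    apply intervalIntegral.integral_nonneg hab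
    intro x hx
    have := (HH_sign hj (l := l) (x := x)).2.1 (by linarith [hx.2])
    exact mul_nonneg (by linarith) (Real.exp_pos _).le
  refine ⟨mul_nonneg hc0 hnn, ?_⟩
  have hW : ∀ x ∈ Set.uIcc a b, HasDerivAt (WW l u) ((l - x) * Real.exp ((x - l) * u)) x := by
    intro x _
    have h1 : HasDerivAt (fun x : ℝ => (x - l) * u) (1 * u) x := ((hasDerivAt_id x).sub_const l).mul_const u
    have h2 : HasDerivAt (fun x : ℝ => (l - x)/u + 1/u^2) (-1/u) x := (((hasDerivAt_id x).const_sub l).div_const u).add_const _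
    have := h1.exp.mul h2
    exact this.congr_deriv (by field_simp; ring)
  have hI := intervalIntegral.integral_eq_sub_of_hasDerivAt hW (by apply Continuous.intervalIntegrable; fun_prop)
  have hle : ∫ x in a..b, (-(2*j-1) * HH l j x) * Real.exp ((x - l) * u) ≤ ∫ x in a..b, (1/(2*π)) * ((l - x) * Real.exp ((x - l) * u)) := by
    apply intervalIntegral.integral_mono_on hab hcont.intervalIntegrable (by apply Continuous.intervalIntegrable; fun_prop)
    intro x hx
    have h2 := (HH_sign hj (l := l) (x := x)).2.2
    rw [abs_of_nonpos (by linarith [hx.2] : x - l ≤ 0)] at h2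
    have h3 := abs_le.1 h2
    have : -(2*j-1) * HH l j x ≤ (l-x)/(2*π) := by
      have e2 : -(x-l) = l - x := by ring
      rw [e2] at h3
      rcases hj with rfl | rfl <;> linarith
    calc _ ≤ ((l-x)/(2*π)) * Real.exp ((x - l) * u) := by gcongr
          _ = _ := by ring
  rw [intervalIntegral.integral_const_mul, hI] at hle
  calc _ ≤ 2 * ((1/(2*π)) * (WW l u b - WW l u a)) := by
        apply mul_le_mul hc2 hle hnn (by norm_num)
    _ = _ := by field_simp
end PB

namespace PB
open Filter Topology Metric
open scoped ComplexConjugate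

lemma kk_near {l j : ℝ} {z : ℂ} (hz : z ≠ 0) (him : |z.im| < 2*π) :
    kk l j z = ((GG j l - BB z - j * (z - 2*π*Complex.I)) / (2*π*Complex.I) + dslope BB 0 z) + 1/z := by
  have h2 : z ≠ 2*π*Complex.I := by
    rintro rfl
    simp [abs_of_pos Real.pi_pos] at him
  unfold kk
  rw [GG, GG, BB_sub_period h2, dslope_of_ne _ hz, slope_def_field, BB_zero, BB_of_ne hz]
  have := two_pi_I_ne
  have h3 : Complex.exp z - 1 ≠ 0 := by
    have := DD_ne_zero (z := z) (Or.inr him)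
    rw [DD_of_ne hz] at this
    intro h; rw [h] at this; simp at this
  have hI := Complex.I_ne_zero
  have hp : (π:ℂ) ≠ 0 := by exact_mod_cast Real.pi_ne_zero
  rw [sub_zero]
  field_simp
  ring

lemma JJ_jump {l j u : ℝ} : Tendsto (fun a => JJ l j u a - JJ l j u (-a)) (𝓝[>] 0) (𝓝 (π * Real.exp (-l*u))) := by
  have hpi := Real.pi_pos
  set q : ℂ → ℂ := fun z => kk l j z * Complex.exp ((z - l) * u) - Complex.exp (-l*u) / z with hq
  set Q : ℂ → ℂ := fun z => ((GG j l - BB z - j * (z - 2*π*Complex.I)) / (2*π*Complex.I) + dslope BB 0 z) * Complex.exp ((z-l)*u)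
    + Complex.exp (-l*u) * dslope (fun z => Complex.exp (z * u)) 0 z with hQ
  have hB0 : DifferentiableAt ℂ BB 0 := BB_diffAt (Or.inr (by simp [hpi]))
  have hQc : ContinuousAt Q 0 := by
    have h1 : ContinuousAt (dslope BB 0) 0 := continuousAt_dslope_same.2 hB0
    have h2 : ContinuousAt (dslope (fun z => Complex.exp (z * u)) 0) 0 := continuousAt_dslope_same.2 (by fun_prop)
    have h3 : ContinuousAt BB 0 := hB0.continuousAt
    fun_prop
  have hqQ : ∀ᶠ z in 𝓝[≠] (0:ℂ), Q z = q z := by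
    have ho : {z : ℂ | |z.im| < 2*π} ∈ 𝓝 (0:ℂ) := by
      apply IsOpen.mem_nhds (isOpen_lt (by fun_prop) continuous_const)
      simp [hpi]
    filter_upwards [nhdsWithin_le_nhds ho, self_mem_nhdsWithin] with z hz1 hz2
    have hz2 : z ≠ 0 := hz2
    simp only [hq, hQ]
    have ed : dslope (fun z => Complex.exp (z * u)) 0 z = (Complex.exp (z*u) - 1)/z := by
      rw [dslope_of_ne _ hz2, slope_def_field]; simp
    rw [kk_near hz2 hz1, ed]
    have e : Complex.exp ((z - l)*u) = Complex.exp (-l*u) * Complex.exp (z*u) := by rw [← Complex.exp_add]; ring_nf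
    rw [e]; field_simp; ring
  set q' := Function.update q 0 (Q 0) with hq'
  have hc0 : ContinuousAt q' 0 := by
    rw [continuousAt_update_same]
    exact (hQc.tendsto.mono_left nhdsWithin_le_nhds).congr' hqQ
  have hcont : ∀ z : ℂ, 0 ≤ z.im → z.im ≤ 2*π → ContinuousAt q' z := by
    intro z h0 h1
    by_cases hz : z = 0
    · rw [hz]; exact hc0
    have hk : DifferentiableAt ℂ (kk l j) z := by
      apply kk_diffAt
      by_cases hr : z.re = 0
      · right
        refine ⟨lt_of_le_of_ne h0 fun h => hz (Complex.ext hr h.symm), by linarith⟩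
      · exact Or.inl hr
    have hqz : ContinuousAt q z := by
      have := hk.continuousAt
      simp only [hq]
      fun_prop (disch := assumption)
    rw [hq', continuousAt_update_of_ne hz]
    exact hqz
  have hcp : ∀ x : ℝ, ContinuousOn (fun θ : ℝ => q' ((x:ℂ) + θ * Complex.I)) (Set.Icc 0 (2*π)) := by
    intro x θ hθ
    apply ContinuousAt.continuousWithinAt
    apply ContinuousAt.comp (g := q')
    · apply hcont <;> simp [hθ.1, hθ.2]
    · fun_prop
  set K : Set ℂ := (Set.Icc (-1:ℝ) 1) ×ℂ (Set.Icc 0 (2*π)) with hK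
  have hKc : IsCompact K := isCompact_Icc.reProdIm isCompact_Icc
  obtain ⟨C, hC⟩ := hKc.exists_bound_of_continuousOn (f := q') (fun z hz => (hcont z hz.2.1 hz.2.2).continuousWithinAt)
  have hP : ContinuousAt (fun x : ℝ => ∫ θ in (0:ℝ)..(2*π), q' ((x:ℂ) + θ * Complex.I)) 0 := by
    apply intervalIntegral.continuousAt_of_dominated_interval (bound := fun _ => C)
    · apply Eventually.of_forall
      intro x
      rw [Set.uIoc_of_le (by positivity)]
      exact ((hcp x).mono Set.Ioc_subset_Icc_self).aestronglyMeasurable measurableSet_Ioc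
    · filter_upwards [Icc_mem_nhds (by norm_num : (-1:ℝ) < 0) (by norm_num : (0:ℝ) < 1)] with x hx
      apply Eventually.of_forall
      intro θ hθ
      rw [Set.uIoc_of_le (by positivity)] at hθ
      apply hC
      refine ⟨?_, ?_⟩
      · simpa using hx
      · simpa using ⟨hθ.1.le, hθ.2⟩
    · exact intervalIntegrable_const
    · apply Eventually.of_forall
      intro θ hθ
      rw [Set.uIoc_of_le (by positivity)] at hθ
      apply ContinuousAt.comp (g := q')
      · apply hcont <;> simp [hθ.1.le, hθ.2]
      · fun_prop
  set P : ℝ → ℂ := fun x : ℝ => ∫ θ in (0:ℝ)..(2*π), q' ((x:ℂ) + θ * Complex.I) with hPdef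
  have hJ : ∀ x : ℝ, x ≠ 0 → JJ l j u x = (P x).re + Real.exp (-l*u) * Real.arctan (2*π/x) := by
    intro x hx
    have hne : ∀ θ : ℝ, (x:ℂ) + θ * Complex.I ≠ 0 := by
      intro θ h
      have := congrArg Complex.re h; simp at this; exact hx this
    have hintg : Continuous (fun θ : ℝ => Complex.exp (-l*u) / ((x:ℂ) + θ * Complex.I)) := by
      apply Continuous.div continuous_const (by fun_prop) hne
    have h1 : (∫ θ in (0:ℝ)..(2*π), kk l j ((x:ℂ) + (θ:ℂ) * Complex.I) * Complex.exp (((x - l : ℝ) + θ * Complex.I) * u))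
       = P x + ∫ θ in (0:ℝ)..(2*π), Complex.exp (-l*u) / ((x:ℂ) + θ * Complex.I) := by
      rw [hPdef, ← intervalIntegral.integral_add]
      · apply intervalIntegral.integral_congr
        intro θ _
        simp only [hq', Function.update_of_ne (hne θ), hq]
        have e : ((x - l : ℝ):ℂ) + θ * Complex.I = x + θ * Complex.I - l := by push_cast; ring
        rw [e]; ring
      · apply ContinuousOn.intervalIntegrable
        rw [Set.uIcc_of_le (by positivity)]
        exact hcp x
      · exact hintg.intervalIntegrable _ _
    unfold JJ
    rw [h1, Complex.add_re]
    congr 1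
    have h2 : (∫ θ in (0:ℝ)..(2*π), Complex.exp (-l*u) / ((x:ℂ) + θ * Complex.I)).re = ∫ θ in (0:ℝ)..(2*π), Real.exp (-l*u) * (x/(x^2+θ^2)) := by
      have := Complex.reCLM.intervalIntegral_comp_comm (hintg.intervalIntegrable 0 (2*π) (μ := MeasureTheory.volume))
      simp only [Complex.reCLM_apply] at this
      rw [← this]
      apply intervalIntegral.integral_congr
      intro θ _
      simp only
      have e : Complex.exp (-l*u) = ((Real.exp (-l*u) : ℝ) : ℂ) := by push_cast; rfl
      rw [e, div_eq_mul_inv, Complex.re_ofReal_mul, Complex.inv_re, Complex.normSq_apply]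
      simp
      ring_nf
    rw [h2, intervalIntegral.integral_const_mul]
    congr 1
    have hd : ∀ θ ∈ Set.uIcc (0:ℝ) (2*π), HasDerivAt (fun θ => Real.arctan (θ/x)) (x/(x^2+θ^2)) θ := by
      intro θ _
      refine ((hasDerivAt_id θ).div_const x).arctan.congr_deriv ?_
      have : x^2+θ^2 ≠ 0 := by positivity
      simp only [id]
      field_simp
    rw [intervalIntegral.integral_eq_sub_of_hasDerivAt hd]
    · simp
    · apply Continuous.intervalIntegrable
      apply Continuous.div continuous_const (by fun_prop)
      intro θ; positivity
  have hlim : Tendsto (fun a : ℝ => (P a).re - (P (-a)).re + 2 * (Real.exp (-l*u) * Real.arctan (2*π/a))) (𝓝[>] 0)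
      (𝓝 ((P 0).re - (P 0).re + 2 * (Real.exp (-l*u) * (π/2)))) := by
    have t1 : Tendsto P (𝓝[>] 0) (𝓝 (P 0)) := hP.tendsto.mono_left nhdsWithin_le_nhds
    have t2 : Tendsto (fun a => P (-a)) (𝓝[>] 0) (𝓝 (P 0)) := by
      have : Tendsto (fun a : ℝ => -a) (𝓝[>] 0) (𝓝 0) := by
        have := (continuous_neg (G := ℝ)).tendsto 0
        rw [neg_zero] at this
        exact this.mono_left nhdsWithin_le_nhds
      exact hP.tendsto.comp this
    have t3 : Tendsto (fun a : ℝ => Real.arctan (2*π/a)) (𝓝[>] 0) (𝓝 (π/2)) := by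
      have h4 : Tendsto (fun a : ℝ => 2*π/a) (𝓝[>] 0) atTop := by
        simp only [div_eq_mul_inv]
        exact tendsto_inv_nhdsGT_zero.const_mul_atTop (by positivity)
      exact (Real.tendsto_arctan_atTop.mono_right nhdsWithin_le_nhds).comp h4
    have c1 := (Complex.continuous_re.tendsto _).comp t1
    have c2 := (Complex.continuous_re.tendsto _).comp t2
    exact (c1.sub c2).add ((t3.const_mul _).const_mul _)
  have e : (P 0).re - (P 0).re + 2 * (Real.exp (-l*u) * (π/2)) = π * Real.exp (-l*u) := by ring
  rw [e] at hlim
  refine hlim.congr' ?_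
  filter_upwards [self_mem_nhdsWithin] with a ha
  have ha : 0 < a := ha
  rw [hJ a ha.ne', hJ (-a) (by linarith), div_neg, Real.arctan_neg]
  ring

lemma WW_cont (l u : ℝ) : Continuous (WW l u) := by unfold WW; fun_prop

lemma FF_pos {l j u : ℝ} (hj : j = 0 ∨ j = 1) (hl : 0 < l) (hu : 0 < u) :
    0 ≤ (2*j-1) * (FF l j u - Real.exp (-l*u)) ∧ (2*j-1) * (FF l j u - Real.exp (-l*u)) ≤ 1/(π^2*u^2) := by
  have hpi := Real.pi_pos
  -- step 1: for fixed V ≥ 1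
  have step : ∀ V : ℝ, 0 < V → 0 ≤ (2*j-1) * (JJ l j u l - JJ l j u (-V) - π * Real.exp (-l*u)) ∧
      (2*j-1) * (JJ l j u l - JJ l j u (-V) - π * Real.exp (-l*u)) ≤ 1/π * (WW l u l) := by
    intro V hV
    have hW0 : 0 ≤ WW l u (-V) := by
      unfold WW
      have : 0 ≤ (l - -V)/u := div_nonneg (by linarith) hu.le
      positivity
    have t := (tendsto_const_nhds (x := JJ l j u l - JJ l j u (-V)) (f := 𝓝[>] (0:ℝ))).sub (JJ_jump (l := l) (j := j) (u := u))
    have t2 := t.const_mul (2*j-1)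
    have tW : Tendsto (fun a => 1/π * (WW l u l - WW l u a + (WW l u (-a) - WW l u (-V)))) (𝓝[>] 0) (𝓝 (1/π * (WW l u l - WW l u 0 + (WW l u (-0) - WW l u (-V))))) := by
      have hc : Continuous (fun a => 1/π * (WW l u l - WW l u a + (WW l u (-a) - WW l u (-V)))) := by
        have := WW_cont l u
        fun_prop
      exact (hc.tendsto 0).mono_left nhdsWithin_le_nhds
    have hev : ∀ᶠ a in 𝓝[>] (0:ℝ), 0 < a ∧ a < l ∧ a < V := by
      filter_upwards [self_mem_nhdsWithin, nhdsWithin_le_nhds (Iio_mem_nhds hl), nhdsWithin_le_nhds (Iio_mem_nhds hV)] with a h1 h2 h3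
      exact ⟨h1, h2, h3⟩
    constructor
    · refine ge_of_tendsto t2 ?_
      filter_upwards [hev] with a ⟨h0, h1, h2⟩
      have p1 := JJ_left (l := l) hj hu h1.le le_rfl (Or.inl h0)
      have p2 := JJ_left (l := l) hj hu (a := -V) (b := -a) (by linarith) (by linarith) (Or.inr (by linarith))
      linarith [p1.1, p2.1]
    · have h := le_of_tendsto_of_tendsto t2 tW (by
        filter_upwards [hev] with a ⟨h0, h1, h2⟩
        have p1 := JJ_left (l := l) hj hu h1.le le_rfl (Or.inl h0)
        have p2 := JJ_left (l := l) hj hu (a := -V) (b := -a) (by linarith) (by linarith) (Or.inr (by linarith))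
        linarith [p1.2, p2.2])
      refine h.trans ?_
      rw [neg_zero]
      apply mul_le_mul_of_nonneg_left _ (by positivity)
      linarith
  have t3 : Tendsto (fun V => (2*j-1) * (JJ l j u l - JJ l j u (-V) - π * Real.exp (-l*u))) atTop (𝓝 ((2*j-1) * (JJ l j u l - 0 - π * Real.exp (-l*u)))) :=
    ((tendsto_const_nhds.sub (JJ_tendsto_bot hj hu)).sub_const _).const_mul _
  have a1 := ge_of_tendsto t3 (by filter_upwards [eventually_gt_atTop 0] with V hV using (step V hV).1)
  have a2 := le_of_tendsto t3 (by filter_upwards [eventually_gt_atTop 0] with V hV using (step V hV).2)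
  have e : (2*j-1) * (FF l j u - Real.exp (-l*u)) = ((2*j-1) * (JJ l j u l - 0 - π * Real.exp (-l*u)))/π := by
    rw [FF_eq_JJ]; field_simp; ring
  rw [e]
  refine ⟨div_nonneg a1 hpi.le, ?_⟩
  rw [div_le_iff₀ hpi]
  refine a2.trans (le_of_eq ?_)
  unfold WW
  simp
  field_simp

lemma FF_neg {l j u : ℝ} (hj : j = 0 ∨ j = 1) (hl : 0 < l) (hu : u < 0) :
    0 ≤ (2*j-1) * FF l j u ∧ |FF l j u| ≤ 1/(π^2*u^2) := by
  have hpi := Real.pi_pos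
  have t0 : Tendsto (fun V => JJ l j u l - JJ l j u V) atTop (𝓝 (JJ l j u l)) := by
    have := (tendsto_const_nhds (x := JJ l j u l)).sub (JJ_tendsto_top (l := l) hj hu)
    rwa [sub_zero] at this
  have a1 := ge_of_tendsto (t0.const_mul (2*j-1)) (by filter_upwards [eventually_ge_atTop l] with V hV using (JJ_right hj hu hl hV).1)
  have a2 := le_of_tendsto t0.abs (by filter_upwards [eventually_ge_atTop l] with V hV using (JJ_right hj hu hl hV).2)
  rw [FF_eq_JJ, ← mul_div_assoc, abs_div, abs_of_pos hpi]
  refine ⟨div_nonneg a1 hpi.le, ?_⟩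
  rw [div_le_iff₀ hpi]
  refine a2.trans (le_of_eq ?_)
  field_simp
end PB

namespace PB
open Filter Topology Metric MeasureTheory
open scoped ComplexConjugate FourierTransform

noncomputable def Kf (l j t : ℝ) : ℂ := kk l j ((l:ℂ) + ((2*π*min t 1 : ℝ) : ℂ) * Complex.I)

lemma Kf_cont {l j : ℝ} (hl : 0 < l) : Continuous (Kf l j) := by
  rw [continuous_iff_continuousAt]
  intro t
  unfold Kf
  apply ContinuousAt.comp (g := kk l j)
  · exact (kk_diffAt (Or.inl (by simp [hl.ne']))).continuousAt
  · fun_prop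

lemma Kf_one {l j t : ℝ} (ht : 1 ≤ t) : Kf l j t = 0 := by
  unfold Kf
  rw [min_eq_right ht, mul_one, kk_top]
  simp [HH]

lemma Kf_zero {l j : ℝ} (hl : 0 < l) : Kf l j 0 = ((1/(Real.exp l - 1) + j : ℝ) : ℂ) := by
  unfold Kf
  rw [min_eq_left (by norm_num)]
  simp only [mul_zero, Complex.ofReal_zero, zero_mul, add_zero]
  rw [kk_bot l j hl.ne']
  simp [HH]

lemma FF_eq_Kf (l j u : ℝ) : FF l j u = 2 * (∫ t in (0:ℝ)..1, Kf l j t * Complex.exp ((2*π*t*u:ℝ) * Complex.I)).re := by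
  unfold FF
  have h2 := intervalIntegral.smul_integral_comp_mul_left (a := 0) (b := 1) (fun θ : ℝ => kk l j ((l:ℂ) + (θ:ℂ) * Complex.I) * Complex.exp ((θ * u : ℝ) * Complex.I)) (2*π)
  rw [mul_zero, mul_one] at h2
  rw [← h2]
  have e : (∫ t in (0:ℝ)..1, Kf l j t * Complex.exp ((2*π*t*u:ℝ) * Complex.I)) = ∫ (x : ℝ) in (0:ℝ)..1, kk l j (↑l + ↑(2 * π * x) * Complex.I) * Complex.exp (↑(2 * π * x * u) * Complex.I) := by
    apply intervalIntegral.integral_congr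
    intro t ht
    rw [Set.uIcc_of_le zero_le_one] at ht
    simp only [Kf, min_eq_left ht.2]
  rw [e, Complex.smul_re, smul_eq_mul, ← mul_assoc]
  have := Real.pi_ne_zero
  congr 1
  field_simp

lemma FF_cont {l j : ℝ} (hl : 0 < l) : Continuous (FF l j) := by
  have : Continuous (fun u : ℝ => 2 * (∫ t in (0:ℝ)..1, Kf l j t * Complex.exp ((2*π*t*u:ℝ) * Complex.I)).re) := by
    apply continuous_const.mul
    apply Complex.continuous_re.comp
    apply intervalIntegral.continuous_parametric_intervalIntegral_of_continuous
    have := Kf_cont (j := j) hl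
    fun_prop
    fun_prop
  exact this.congr fun u => (FF_eq_Kf l j u).symm

lemma FF_bdd {l j : ℝ} (hl : 0 < l) : ∃ C, 0 ≤ C ∧ ∀ u, |FF l j u| ≤ C := by
  obtain ⟨C, hC⟩ := (isCompact_Icc (a := (0:ℝ)) (b := 1)).exists_bound_of_continuousOn (Kf_cont (j := j) hl).continuousOn
  have hC0 : 0 ≤ C := (norm_nonneg _).trans (hC 0 (by simp))
  refine ⟨2 * C, by positivity, fun u => ?_⟩
  rw [FF_eq_Kf, abs_mul, abs_two]
  have h := intervalIntegral.norm_integral_le_of_norm_le_const (a := 0) (b := 1) (C := C)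
    (f := fun t : ℝ => Kf l j t * Complex.exp ((2*π*t*u:ℝ) * Complex.I)) (by
      intro t ht
      rw [Set.uIoc_of_le zero_le_one] at ht
      rw [norm_mul, Complex.norm_exp_ofReal_mul_I, mul_one]
      exact hC t ⟨ht.1.le, ht.2⟩)
  have h2 := Complex.abs_re_le_norm (∫ t in (0:ℝ)..1, Kf l j t * Complex.exp ((2*π*t*u:ℝ) * Complex.I))
  simp only [sub_zero, abs_one, mul_one] at h
  linarith

noncomputable def EE (l u : ℝ) : ℝ := if 0 ≤ u then Real.exp (-l*u) else 0

lemma FF_EE_bd {l j u : ℝ} (hj : j = 0 ∨ j = 1) (hl : 0 < l) (hu : u ≠ 0) :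
    |FF l j u - EE l u| ≤ 1/(π^2*u^2) := by
  unfold EE
  rcases lt_or_gt_of_ne hu with h | h
  · rw [if_neg (by linarith), sub_zero]; exact (FF_neg hj hl h).2
  · rw [if_pos h.le]
    have := FF_pos hj hl h
    rw [abs_le]
    rcases hj with rfl | rfl <;> constructor <;> linarith [this.1, this.2]

lemma FF_sign {l j : ℝ} (hj : j = 0 ∨ j = 1) (hl : 0 < l) (u : ℝ) :
    0 ≤ (2*j-1) * (FF l j u - EE l u) := by
  rcases lt_trichotomy u 0 with h | h | h
  · rw [EE, if_neg (by linarith), sub_zero]; exact (FF_neg hj hl h).1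
  · rw [EE, if_pos h.ge, h]
    have hc : Continuous (fun u => (2*j-1) * (FF l j u - Real.exp (-l*u))) := by
      have := FF_cont (j := j) hl
      fun_prop
    have t : Tendsto (fun u => (2*j-1) * (FF l j u - Real.exp (-l*u))) (𝓝[>] 0) _ := (hc.tendsto 0).mono_left nhdsWithin_le_nhds
    refine ge_of_tendsto t ?_
    filter_upwards [self_mem_nhdsWithin] with v hv
    exact (FF_pos hj hl hv).1
  · rw [EE, if_pos h.le]; exact (FF_pos hj hl h).1

lemma EE_meas (l : ℝ) : Measurable (EE l) := by
  unfold EE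
  exact Measurable.ite measurableSet_Ici (by fun_prop) measurable_const

lemma EE_bd {l : ℝ} (hl : 0 < l) (u : ℝ) : |EE l u| ≤ 1 := by
  unfold EE
  split_ifs with h
  · rw [abs_of_pos (Real.exp_pos _)]
    apply Real.exp_le_one_iff.2
    nlinarith
  · simp

lemma EE_int {l : ℝ} (hl : 0 < l) : Integrable (EE l) ∧ ∫ u, EE l u = 1/l := by
  have e : EE l = Set.indicator (Set.Ici 0) (fun u => Real.exp (-l*u)) := by
    ext u; simp [EE, Set.indicator]
  have h : IntegrableOn (fun u => Real.exp (-l*u)) (Set.Ici 0) := by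
    rw [integrableOn_Ici_iff_integrableOn_Ioi]
    exact integrableOn_exp_mul_Ioi (by linarith) 0
  rw [e]
  refine ⟨h.integrable_indicator measurableSet_Ici, ?_⟩
  rw [integral_indicator measurableSet_Ici, integral_Ici_eq_integral_Ioi, integral_exp_mul_Ioi (by linarith)]
  simp

lemma G_int {l j : ℝ} (hj : j = 0 ∨ j = 1) (hl : 0 < l) : Integrable (fun u => FF l j u - EE l u) := by
  obtain ⟨C, hC0, hC⟩ := FF_bdd (j := j) hl
  have hb : Integrable (fun u : ℝ => (2 * (C + 1) + 2) * (1 + u^2)⁻¹) := integrable_inv_one_add_sq.const_mul _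
  refine hb.mono' (((FF_cont hl).measurable.sub (EE_meas l)).aestronglyMeasurable) (Eventually.of_forall fun u => ?_)
  rw [Real.norm_eq_abs, ← div_eq_mul_inv, le_div_iff₀ (by positivity)]
  rcases le_total (u^2) 1 with h | h
  · have h1 : |FF l j u - EE l u| ≤ C + 1 := (abs_sub _ _).trans (add_le_add (hC u) (EE_bd hl u))
    nlinarith [abs_nonneg (FF l j u - EE l u)]
  · have hu : u ≠ 0 := by rintro rfl; norm_num at h
    have h1 := FF_EE_bd hj hl hu
    have h2 : 1/(π^2*u^2) ≤ 1/u^2 := by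
      apply one_div_le_one_div_of_le (by positivity)
      have : 1 ≤ π^2 := by nlinarith [Real.pi_gt_three]
      nlinarith
    have h3 : |FF l j u - EE l u| * (1+u^2) ≤ 1/u^2 * (1 + u^2) := by
      apply mul_le_mul_of_nonneg_right (h1.trans h2) (by positivity)
    have h4 : 1/u^2 * (1+u^2) ≤ 2 := by
      rw [one_div, inv_mul_le_iff₀ (by positivity)]; linarith
    linarith

lemma FF_integral {l j : ℝ} (hj : j = 0 ∨ j = 1) (hl : 0 < l) : Integrable (FF l j) ∧ ∫ u, FF l j u = 1/(Real.exp l - 1) + j := by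
  have hFi : Integrable (FF l j) := by
    have := (G_int hj hl).add (EE_int hl).1
    refine this.congr (Eventually.of_forall fun u => ?_)
    simp
  refine ⟨hFi, ?_⟩
  set φ : ℝ → ℂ := fun t => if t ≤ 0 then Kf l j (-t) else conj (Kf l j t) with hφ
  have hKc := Kf_cont (j := j) hl
  have hφc : Continuous φ := by
    apply Continuous.if_le (by fun_prop) (Complex.continuous_conj.comp hKc) continuous_id continuous_const
    intro t ht
    have ht : t = 0 := ht
    simp only [Function.comp]
    rw [ht, neg_zero, Kf_zero hl, Complex.conj_ofReal]
  have hsupp : ∀ t, t ∉ Set.Icc (-1:ℝ) 1 → φ t = 0 := by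
    intro t ht
    simp only [hφ]
    rw [Set.mem_Icc, not_and_or] at ht
    push Not at ht
    rcases ht with h | h
    · rw [if_pos (by linarith), Kf_one (by linarith)]
    · rw [if_neg (by linarith), Kf_one (by linarith), map_zero]
  have hφi : Integrable φ := hφc.integrable_of_hasCompactSupport (HasCompactSupport.intro isCompact_Icc hsupp)
  have hF : 𝓕 φ = fun u => ((FF l j u : ℝ) : ℂ) := by
    ext u
    rw [Real.fourier_real_eq_integral_exp_smul]
    have e1 : (∫ v : ℝ, Complex.exp (↑(-2 * π * v * u) * Complex.I) • φ v) = ∫ v in (-1:ℝ)..1, Complex.exp (↑(-2 * π * v * u) * Complex.I) • φ v := by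
      rw [intervalIntegral.integral_of_le (by norm_num), ← integral_Icc_eq_integral_Ioc]
      symm
      apply setIntegral_eq_integral_of_forall_compl_eq_zero
      intro t ht
      rw [hsupp t ht, smul_zero]
    have hci : ∀ a b : ℝ, IntervalIntegrable (fun v : ℝ => Complex.exp (↑(-2 * π * v * u) * Complex.I) • φ v) volume a b := by
      intro a b
      apply Continuous.intervalIntegrable
      fun_prop
    rw [e1, ← intervalIntegral.integral_add_adjacent_intervals (hci (-1) 0) (hci 0 1)]
    set A := ∫ t in (0:ℝ)..1, Kf l j t * Complex.exp ((2*π*t*u:ℝ) * Complex.I) with hA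
    have e2 : (∫ v in (-1:ℝ)..0, Complex.exp (↑(-2 * π * v * u) * Complex.I) • φ v) = A := by
      have := intervalIntegral.integral_comp_neg (a := 0) (b := 1) (fun v : ℝ => Complex.exp (↑(-2 * π * v * u) * Complex.I) • φ v)
      rw [neg_zero] at this
      rw [← this, hA]
      apply intervalIntegral.integral_congr
      intro t ht
      rw [Set.uIcc_of_le zero_le_one] at ht
      simp only [hφ]
      rw [if_pos (by linarith [ht.1]), neg_neg, smul_eq_mul, mul_comm]
      congr 3
      push_cast; ring
    have e3 : (∫ v in (0:ℝ)..1, Complex.exp (↑(-2 * π * v * u) * Complex.I) • φ v) = conj A := by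
      rw [hA, intervalIntegral.integral_of_le zero_le_one, intervalIntegral.integral_of_le zero_le_one, ← integral_conj, ← intervalIntegral.integral_of_le zero_le_one, ← intervalIntegral.integral_of_le zero_le_one]
      apply intervalIntegral.integral_congr
      intro t ht
      rw [Set.uIcc_of_le zero_le_one] at ht
      have hφt : φ t = conj (Kf l j t) := by
        simp only [hφ]
        split_ifs with h
        · have : t = 0 := le_antisymm h ht.1
          rw [this, neg_zero, Kf_zero hl, Complex.conj_ofReal]
        · rfl
      simp only
      rw [hφt, smul_eq_mul, map_mul, ← Complex.exp_conj, mul_comm]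
      congr 2
      rw [map_mul, Complex.conj_ofReal, Complex.conj_I]
      push_cast; ring
    rw [e2, e3, Complex.add_conj, FF_eq_Kf]
  have hinv := hφc.fourierInv_fourier_eq hφi (by rw [hF]; exact hFi.ofReal)
  have h0 := congrFun hinv 0
  rw [hF, Real.fourierInv_eq'] at h0
  simp only [inner_zero_right, mul_zero, Complex.ofReal_zero, zero_mul, Complex.exp_zero, one_smul] at h0
  rw [integral_complex_ofReal] at h0
  simp only [hφ, le_refl, if_true, neg_zero, Kf_zero hl] at h0
  exact_mod_cast h0

lemma G_integral {l j : ℝ} (hj : j = 0 ∨ j = 1) (hl : 0 < l) : ∫ u, (FF l j u - EE l u) = 1/(Real.exp l - 1) + j - 1/l := by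
  rw [integral_sub (FF_integral hj hl).1 (EE_int hl).1, (FF_integral hj hl).2, (EE_int hl).2]
end PB

namespace PB
open Filter Topology Metric MeasureTheory
open scoped ComplexConjugate

noncomputable def kt (l j T τ : ℝ) : ℂ := kk l j ((l:ℂ) + ((2*π/T*τ : ℝ) : ℂ) * Complex.I)

lemma kt_cont {l j T : ℝ} (hl : 0 < l) : Continuous (kt l j T) := by
  rw [continuous_iff_continuousAt]
  intro t
  unfold kt
  apply ContinuousAt.comp (g := kk l j)
  · exact (kk_diffAt (Or.inl (by simp [hl.ne']))).continuousAt
  · fun_prop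

lemma FF_T {l j T : ℝ} (hT : 0 < T) (w : ℝ) :
    FF l j (T/(2*π) * w) = (2/T) * (∫ τ in (0:ℝ)..T, kt l j T τ * Complex.exp ((τ * w : ℝ) * Complex.I)).re := by
  unfold FF
  have hp := Real.pi_ne_zero
  have h2 := intervalIntegral.smul_integral_comp_mul_left (a := 0) (b := T) (fun θ : ℝ => kk l j ((l:ℂ) + (θ:ℂ) * Complex.I) * Complex.exp ((θ * (T/(2*π)*w) : ℝ) * Complex.I)) (2*π/T)
  rw [mul_zero, div_mul_cancel₀ _ hT.ne'] at h2
  rw [← h2, Complex.smul_re, smul_eq_mul, ← mul_assoc]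
  congr 1
  · field_simp
  · congr 2
    ext τ
    unfold kt
    congr 4
    field_simp

lemma term_eq {δ τ : ℝ} (n : ℕ) : LSeries.term (fun n => (ArithmeticFunction.vonMangoldt n : ℂ)) ((1 + δ : ℝ) + τ * Complex.I) n
    = ((ArithmeticFunction.vonMangoldt n / (n:ℝ)^(1+δ) : ℝ) : ℂ) * Complex.exp ((-(τ * Real.log n) : ℝ) * Complex.I) := by
  by_cases hn : n = 0
  · subst hn; simp
  · rw [LSeries.term_of_ne_zero hn]
    have hn' : (0:ℝ) < n := by positivity
    have hnc : (n:ℂ) ≠ 0 := by exact_mod_cast hn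
    rw [Complex.cpow_add _ _ hnc]
    have e1 : (n:ℂ)^((1+δ:ℝ):ℂ) = (((n:ℝ)^(1+δ) : ℝ) : ℂ) := by
      rw [Complex.ofReal_cpow hn'.le]; simp
    have e2 : (n:ℂ)^(τ * Complex.I) = Complex.exp ((τ * Real.log n : ℝ) * Complex.I) := by
      rw [Complex.cpow_def_of_ne_zero hnc, ← Complex.natCast_log]
      congr 1; push_cast; ring
    rw [e1, e2, Complex.ofReal_neg, neg_mul, Complex.exp_neg]
    push_cast
    field_simp

lemma vM_summable {δ : ℝ} (hδ : 0 < δ) : Summable (fun n : ℕ => ArithmeticFunction.vonMangoldt n / (n:ℝ)^(1+δ)) := by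
  have h := ArithmeticFunction.LSeriesSummable_vonMangoldt (s := ((1+δ:ℝ):ℂ) + (0:ℝ) * Complex.I) (by simp; linarith)
  have h2 := Complex.hasSum_re h.hasSum
  refine h2.summable.congr fun n => ?_
  rw [term_eq]; simp

lemma kt_bdd {l j T : ℝ} (hl : 0 < l) : ∃ C, 0 ≤ C ∧ ∀ τ ∈ Set.Icc 0 T, ‖kt l j T τ‖ ≤ C := by
  obtain ⟨C, hC⟩ := (isCompact_Icc (a := (0:ℝ)) (b := T)).exists_bound_of_continuousOn (kt_cont (j := j) hl).continuousOn
  exact ⟨max C 0, le_max_right _ _, fun τ hτ => (hC τ hτ).trans (le_max_left _ _)⟩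

lemma sum_formula {l j T δ L : ℝ} (hT : 0 < T) (hl : 0 < l) (hδ : 0 < δ) :
    HasSum (fun n : ℕ => ArithmeticFunction.vonMangoldt n / (n:ℝ)^(1+δ) * FF l j (T/(2*π) * (L - Real.log n)))
      ((2/T) * (∫ τ in (0:ℝ)..T, kt l j T τ * Complex.exp ((τ * L : ℝ) * Complex.I) *
        LSeries (fun n => (ArithmeticFunction.vonMangoldt n : ℂ)) ((1 + δ : ℝ) + τ * Complex.I)).re) := by
  obtain ⟨C, hC0, hC⟩ := kt_bdd (j := j) (T := T) hl
  have hk := kt_cont (j := j) (T := T) hl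
  have hs := intervalIntegral.hasSum_integral_of_dominated_convergence (μ := volume) (a := 0) (b := T)
    (F := fun n τ => kt l j T τ * Complex.exp ((τ * L : ℝ) * Complex.I) * LSeries.term (fun n => (ArithmeticFunction.vonMangoldt n : ℂ)) ((1 + δ : ℝ) + τ * Complex.I) n)
    (f := fun τ => kt l j T τ * Complex.exp ((τ * L : ℝ) * Complex.I) *
        LSeries (fun n => (ArithmeticFunction.vonMangoldt n : ℂ)) ((1 + δ : ℝ) + τ * Complex.I))
    (fun n _ => C * (ArithmeticFunction.vonMangoldt n / (n:ℝ)^(1+δ)))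
    (by
      intro n
      apply Continuous.aestronglyMeasurable
      simp only [term_eq]
      fun_prop)
    (by
      intro n
      refine Eventually.of_forall fun τ hτ => ?_
      rw [Set.uIoc_of_le hT.le] at hτ
      rw [term_eq, norm_mul, norm_mul, norm_mul, Complex.norm_exp_ofReal_mul_I, Complex.norm_exp_ofReal_mul_I, mul_one, mul_one, Complex.norm_real, Real.norm_eq_abs,
        abs_of_nonneg (div_nonneg ArithmeticFunction.vonMangoldt_nonneg (by positivity))]
      apply mul_le_mul_of_nonneg_right (hC τ ⟨hτ.1.le, hτ.2⟩) (div_nonneg ArithmeticFunction.vonMangoldt_nonneg (by positivity)))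
    (Eventually.of_forall fun τ _ => (vM_summable hδ).mul_left C)
    intervalIntegrable_const
    (by
      refine Eventually.of_forall fun τ _ => ?_
      apply HasSum.mul_left
      exact (ArithmeticFunction.LSeriesSummable_vonMangoldt (s := ((1+δ:ℝ):ℂ) + τ * Complex.I) (by simp; linarith)).hasSum)
  have h2 := (Complex.hasSum_re hs).mul_left (2/T)
  refine h2.congr_fun fun n => ?_
  rw [FF_T hT, ← mul_assoc, mul_comm (_ / _) (2/T), mul_assoc]
  congr 1
  rw [← Complex.re_ofReal_mul, ← intervalIntegral.integral_const_mul]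
  congr 2
  ext τ
  rw [term_eq]
  have e : ((τ * (L - Real.log n) : ℝ) : ℂ) * Complex.I = ((τ * L : ℝ) : ℂ) * Complex.I + ((-(τ * Real.log n) : ℝ):ℂ) * Complex.I := by push_cast; ring
  rw [e, Complex.exp_add]
  ring

lemma int_formula {l j T δ L : ℝ} (hT : 0 < T) (hl : 0 < l) (hδ : 0 < δ) :
    ∫ v in Set.Ioi (0:ℝ), Real.exp (-δ*v) * FF l j (T/(2*π) * (L - v)) =
      (2/T) * (∫ τ in (0:ℝ)..T, kt l j T τ * Complex.exp ((τ * L : ℝ) * Complex.I) * (1/(((1 + δ : ℝ) + τ * Complex.I) - 1))).re := by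
  have hk := kt_cont (j := j) (T := T) hl
  set f : ℝ → ℝ → ℂ := fun v τ => kt l j T τ * Complex.exp ((τ * L : ℝ) * Complex.I) * Complex.exp ((-(δ:ℂ) - τ * Complex.I) * v) with hf
  have hfc : Continuous (Function.uncurry f) := by
    simp only [hf, Function.uncurry_def]
    fun_prop
  have hintg : Integrable (Function.uncurry f) ((volume.restrict (Set.Ioi 0)).prod (volume.restrict (Set.Ioc 0 T))) := by
    have h1 : Integrable (fun v : ℝ => Real.exp (-δ*v)) (volume.restrict (Set.Ioi 0)) := integrableOn_exp_mul_Ioi (by linarith) 0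
    have h2 : Integrable (fun τ : ℝ => ‖kt l j T τ‖) (volume.restrict (Set.Ioc 0 T)) :=
      (hk.norm.integrableOn_Icc (a := 0) (b := T)).mono_set Set.Ioc_subset_Icc_self
    refine (h1.mul_prod h2).mono' hfc.aestronglyMeasurable (Eventually.of_forall fun p => ?_)
    simp only [hf, Function.uncurry_def]
    rw [norm_mul, norm_mul, Complex.norm_exp_ofReal_mul_I, Complex.norm_exp, mul_one, mul_comm]
    apply le_of_eq
    congr 2
    simp
  have hswap := integral_integral_swap hintg
  have e1 : ∀ v : ℝ, (∫ τ in Set.Ioc 0 T, f v τ) = ((Real.exp (-δ*v) : ℝ) : ℂ) * ∫ τ in (0:ℝ)..T, kt l j T τ * Complex.exp ((τ * (L - v) : ℝ) * Complex.I) := by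
    intro v
    rw [← intervalIntegral.integral_of_le hT.le, ← intervalIntegral.integral_const_mul]
    congr 1
    ext τ
    simp only [hf]
    have e : (-(δ:ℂ) - τ * Complex.I) * v = ((-δ*v:ℝ):ℂ) + ((-(τ*v):ℝ):ℂ) * Complex.I := by push_cast; ring
    have e' : ((τ * (L - v) : ℝ):ℂ) * Complex.I = ((τ * L : ℝ) : ℂ) * Complex.I + ((-(τ*v):ℝ):ℂ) * Complex.I := by push_cast; ring
    rw [e, e', Complex.exp_add, Complex.exp_add, Complex.ofReal_exp]
    ring
  have e2 : ∀ τ : ℝ, (∫ v in Set.Ioi (0:ℝ), f v τ) = kt l j T τ * Complex.exp ((τ * L : ℝ) * Complex.I) * (1/(((1 + δ : ℝ) + τ * Complex.I) - 1)) := by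
    intro τ
    simp only [hf]
    rw [integral_const_mul, integral_exp_mul_complex_Ioi (by simp; exact hδ)]
    congr 1
    have hne : (δ:ℂ) + τ * Complex.I ≠ 0 := by
      intro h; have := congrArg Complex.re h; simp at this; linarith
    have hne2 : -(δ:ℂ) - τ * Complex.I ≠ 0 := by
      intro h; apply hne; linear_combination -h
    have e3 : ((1 + δ : ℝ):ℂ) + τ * Complex.I - 1 = δ + τ * Complex.I := by push_cast; ring
    rw [e3]
    simp
    rw [div_eq_iff hne2]; field_simp; ring
  simp only [e1, e2] at hswap
  rw [intervalIntegral.integral_of_le hT.le, ← hswap]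
  have hI : Integrable (fun v : ℝ => ((Real.exp (-δ*v) : ℝ) : ℂ) * ∫ τ in (0:ℝ)..T, kt l j T τ * Complex.exp ((τ * (L - v) : ℝ) * Complex.I)) (volume.restrict (Set.Ioi 0)) := by
    have := hintg.integral_prod_left
    simpa only [Function.uncurry_def, e1] using this
  rw [← RCLike.re_eq_complex_re, ← integral_re hI, ← integral_const_mul]
  congr 1
  ext v
  rw [FF_T hT, RCLike.re_eq_complex_re, Complex.re_ofReal_mul]
  ring
end PB

namespace PB
open Filter Topology Metric MeasureTheory
open scoped ComplexConjugate

lemma riemannZeta₁_ne {s : ℂ} (hs : 1 ≤ s.re) : riemannZeta₁ s ≠ 0 := fun h =>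
  Xi_ne_zero_of_one_le hs ((Xi_eq_zero_iff (by linarith)).2 h)

lemma gg_diffAt {s : ℂ} (hs : riemannZeta₁ s ≠ 0) : DifferentiableAt ℂ gg s := by
  have hd : Differentiable ℂ riemannZeta₁ := by
    exact differentiable_riemannZeta₁
  have h2 : AnalyticAt ℂ riemannZeta₁ s := hd.analyticAt s
  show DifferentiableAt ℂ (fun s => -logDeriv riemannZeta₁ s) s
  unfold logDeriv
  exact (h2.deriv.differentiableAt.div h2.differentiableAt hs).neg

lemma gg_cont_strip : Continuous (fun p : ℝ × ℝ => gg (((1 + max p.1 0 : ℝ) : ℂ) + (p.2 : ℂ) * Complex.I)) := by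
  rw [continuous_iff_continuousAt]
  intro p
  apply ContinuousAt.comp (g := gg) 
  · apply (gg_diffAt (riemannZeta₁_ne _)).continuousAt
    simp
  · fun_prop

noncomputable def Dd (l j T L δ : ℝ) : ℝ :=
  (2/T) * (∫ τ in (0:ℝ)..T, kt l j T τ * Complex.exp ((τ * L : ℝ) * Complex.I) *
    gg (((1 + max δ 0 : ℝ) : ℂ) + (τ : ℂ) * Complex.I)).re

lemma Dd_cont {l j T L : ℝ} (hl : 0 < l) : Continuous (Dd l j T L) := by
  unfold Dd
  apply Continuous.mul continuous_const
  apply Complex.continuous_re.comp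
  apply intervalIntegral.continuous_parametric_intervalIntegral_of_continuous'
  have := gg_cont_strip
  have h2 := kt_cont (j := j) (T := T) hl
  fun_prop

lemma Dd_eq {l j T L δ : ℝ} (hT : 0 < T) (hl : 0 < l) (hδ : 0 < δ) :
    HasSum (fun n : ℕ => ArithmeticFunction.vonMangoldt n/(n:ℝ)^(1+δ) * FF l j (T/(2*π)*(L - Real.log n)))
     (Dd l j T L δ + ∫ v in Set.Ioi (0:ℝ), Real.exp (-δ*v) * FF l j (T/(2*π)*(L-v))) := by
  convert sum_formula (L := L) (j := j) hT hl hδ using 1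
  rw [int_formula hT hl hδ]
  unfold Dd
  rw [← mul_add, ← Complex.add_re, ← intervalIntegral.integral_add]
  · congr 2
    apply intervalIntegral.integral_congr
    intro τ _
    simp only
    rw [max_eq_left hδ.le, gg_eq (by simp; exact hδ)]
    ring
  · apply Continuous.intervalIntegrable
    have := gg_cont_strip.comp (Continuous.prodMk_right δ)
    simp only [Function.comp_def] at this
    have h2 := kt_cont (j := j) (T := T) hl
    fun_prop
  · apply Continuous.intervalIntegrable
    have h2 := kt_cont (j := j) (T := T) hl
    have h3 : ∀ τ : ℝ, (((1 + δ : ℝ) : ℂ) + (τ : ℂ) * Complex.I) - 1 ≠ 0 := by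
      intro τ h
      have := congrArg Complex.re h
      simp at this
      linarith
    fun_prop (disch := intro τ; exact h3 τ)

lemma EE_scale {l T L v : ℝ} (hT : 0 < T) :
    EE l (T/(2*π)*(L-v)) = if v ≤ L then Real.exp (-(l*T/(2*π))*(L-v)) else 0 := by
  unfold EE
  have h : (0 ≤ T/(2*π)*(L-v)) ↔ v ≤ L := by
    rw [mul_nonneg_iff_of_pos_left (by positivity), sub_nonneg]
  simp only [h]
  congr 2; ring

lemma E1_delta {l j T x δ : ℝ} (hj : j = 0 ∨ j = 1) (hT : 0 < T) (hl : 0 < l) (hδ : 0 < δ) (hx : 1 ≤ x) :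
    (2*j-1) * ∑ n ∈ Finset.Icc 1 ⌊x⌋₊, ArithmeticFunction.vonMangoldt n/(n:ℝ)^(1+δ) * Real.exp (-(l*T/(2*π))*(Real.log x-Real.log n))
     ≤ (2*j-1) * (Dd l j T (Real.log x) δ + ∫ v in (0:ℝ)..Real.log x, Real.exp (-δ*v) * Real.exp (-(l*T/(2*π))*(Real.log x-v)))
       + (2*π/T) * ((2*j-1) * (1/(Real.exp l - 1)+j-1/l)) := by
  have hL : 0 ≤ Real.log x := Real.log_nonneg hx
  set L := Real.log x with hLdef
  have h1 := (Dd_eq (j := j) (L := L) hT hl hδ).mul_left (2*j-1)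
  have h2 : HasSum (fun n : ℕ => (2*j-1) * (ArithmeticFunction.vonMangoldt n/(n:ℝ)^(1+δ) * EE l (T/(2*π)*(L - Real.log n))))
     ((2*j-1) * ∑ n ∈ Finset.Icc 1 ⌊x⌋₊, ArithmeticFunction.vonMangoldt n/(n:ℝ)^(1+δ) * Real.exp (-(l*T/(2*π))*(Real.log x-Real.log n))) := by
    apply HasSum.mul_left
    have : ∑ n ∈ Finset.Icc 1 ⌊x⌋₊, ArithmeticFunction.vonMangoldt n/(n:ℝ)^(1+δ) * Real.exp (-(l*T/(2*π))*(Real.log x-Real.log n))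
      = ∑ n ∈ Finset.Icc 1 ⌊x⌋₊, ArithmeticFunction.vonMangoldt n/(n:ℝ)^(1+δ) * EE l (T/(2*π)*(L - Real.log n)) := by
      apply Finset.sum_congr rfl
      intro n hn
      rw [Finset.mem_Icc] at hn
      have : (n:ℝ) ≤ x := (Nat.le_floor_iff (by linarith)).1 hn.2
      rw [EE_scale hT, if_pos (Real.log_le_log (by exact_mod_cast hn.1) this)]
    rw [this]
    apply hasSum_sum_of_ne_finset_zero
    intro n hn
    rcases Nat.eq_zero_or_pos n with h | h
    · simp [h]
    · rw [EE_scale hT, if_neg, mul_zero]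
      intro hle
      apply hn
      rw [Finset.mem_Icc]
      refine ⟨h, Nat.le_floor ?_⟩
      exact (Real.log_le_log_iff (by exact_mod_cast h) (by linarith)).1 hle
  have h3 := hasSum_le (fun n => ?_) h2 h1
  swap
  · have a := FF_sign hj hl (T/(2*π)*(L - Real.log n))
    have b : 0 ≤ ArithmeticFunction.vonMangoldt n/(n:ℝ)^(1+δ) := div_nonneg ArithmeticFunction.vonMangoldt_nonneg (by positivity)
    nlinarith [mul_nonneg b a]
  refine h3.trans ?_
  rw [mul_add, mul_add, add_assoc]
  gcongr
  have hG : Integrable (fun v : ℝ => FF l j (T/(2*π)*(L-v)) - EE l (T/(2*π)*(L-v))) := by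
    have := ((G_int hj hl).comp_mul_left' (R := T/(2*π)) (by positivity)).comp_sub_left L
    exact this
  have hGv : ∫ v : ℝ, (FF l j (T/(2*π)*(L-v)) - EE l (T/(2*π)*(L-v))) = (2*π/T) * (1/(Real.exp l - 1)+j-1/l) := by
    rw [integral_sub_left_eq_self (fun v => FF l j (T/(2*π)*v) - EE l (T/(2*π)*v)) volume L,
      Measure.integral_comp_mul_left (fun v => FF l j v - EE l v) (T/(2*π)), G_integral hj hl, smul_eq_mul, abs_of_pos (by positivity)]
    congr 1
    field_simp
  have hEm : Measurable (fun v : ℝ => EE l (T/(2*π)*(L-v))) := (EE_meas l).comp (by fun_prop)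
  have hEi : IntegrableOn (fun v : ℝ => Real.exp (-δ*v) * EE l (T/(2*π)*(L-v))) (Set.Ioi 0) := by
    have h0 : IntegrableOn (fun v => Real.exp (-δ*v)) (Set.Ioi 0) := integrableOn_exp_mul_Ioi (by linarith) 0
    refine Integrable.mono' h0 ((Measurable.mul (by fun_prop) hEm).aestronglyMeasurable) (Eventually.of_forall fun v => ?_)
    rw [norm_mul, Real.norm_eq_abs, Real.norm_eq_abs, abs_of_pos (Real.exp_pos _)]
    exact mul_le_of_le_one_right (Real.exp_pos _).le (EE_bd hl _)
  have hGi : IntegrableOn (fun v : ℝ => Real.exp (-δ*v) * (FF l j (T/(2*π)*(L-v)) - EE l (T/(2*π)*(L-v)))) (Set.Ioi 0) := by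
    refine Integrable.mono' hG.norm.integrableOn ?_ ?_
    · exact (Measurable.mul (by fun_prop) (((FF_cont hl).measurable.comp (by fun_prop)).sub hEm)).aestronglyMeasurable
    · filter_upwards [ae_restrict_mem measurableSet_Ioi] with v hv
      rw [norm_mul]
      apply mul_le_of_le_one_left (norm_nonneg _)
      rw [Real.norm_eq_abs, abs_of_pos (Real.exp_pos _)]
      apply Real.exp_le_one_iff.2
      have : (0:ℝ) < v := hv
      nlinarith
  have e1 : ∫ v in Set.Ioi (0:ℝ), Real.exp (-δ*v) * FF l j (T/(2*π)*(L-v)) =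
      (∫ v in Set.Ioi (0:ℝ), Real.exp (-δ*v) * EE l (T/(2*π)*(L-v))) +
      ∫ v in Set.Ioi (0:ℝ), Real.exp (-δ*v) * (FF l j (T/(2*π)*(L-v)) - EE l (T/(2*π)*(L-v))) := by
    rw [← integral_add hEi hGi]
    congr 1; ext v; ring
  have e2 : ∫ v in Set.Ioi (0:ℝ), Real.exp (-δ*v) * EE l (T/(2*π)*(L-v)) = ∫ v in (0:ℝ)..L, Real.exp (-δ*v) * Real.exp (-(l*T/(2*π))*(L-v)) := by
    rw [intervalIntegral.integral_of_le hL]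
    have hsub : Set.Ioc 0 L ⊆ Set.Ioi (0:ℝ) := fun v hv => hv.1
    rw [setIntegral_eq_of_subset_of_forall_sdiff_eq_zero (f := fun v => Real.exp (-δ*v) * EE l (T/(2*π)*(L-v))) measurableSet_Ioi hsub]
    · apply setIntegral_congr_fun measurableSet_Ioc
      intro v hv
      simp only
      rw [EE_scale hT, if_pos hv.2]
    · intro v hv
      rw [EE_scale hT, if_neg, mul_zero]
      intro h
      exact hv.2 ⟨hv.1, h⟩
  rw [e1, e2, mul_add]
  apply add_le_add le_rfl
  calc (2*j-1) * ∫ v in Set.Ioi (0:ℝ), Real.exp (-δ*v) * (FF l j (T/(2*π)*(L-v)) - EE l (T/(2*π)*(L-v)))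
      = ∫ v in Set.Ioi (0:ℝ), (2*j-1) * (Real.exp (-δ*v) * (FF l j (T/(2*π)*(L-v)) - EE l (T/(2*π)*(L-v)))) := by
        rw [integral_const_mul]
    _ ≤ ∫ v in Set.Ioi (0:ℝ), (2*j-1) * ((FF l j (T/(2*π)*(L-v)) - EE l (T/(2*π)*(L-v)))) := by
        apply setIntegral_mono_on (hGi.const_mul _) (hG.integrableOn.const_mul _) measurableSet_Ioi
        intro v hv
        have a := FF_sign hj hl (T/(2*π)*(L - v))
        have b : Real.exp (-δ*v) ≤ 1 := by
          apply Real.exp_le_one_iff.2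
          have : (0:ℝ) < v := hv
          nlinarith
        nlinarith
    _ ≤ ∫ v : ℝ, (2*j-1) * ((FF l j (T/(2*π)*(L-v)) - EE l (T/(2*π)*(L-v)))) := by
        apply setIntegral_le_integral (hG.const_mul _)
        exact Eventually.of_forall fun v => FF_sign hj hl _
    _ = _ := by rw [integral_const_mul, hGv]; ring

theorem E1 {l j T x : ℝ} (hj : j = 0 ∨ j = 1) (hT : 0 < T) (hl : 0 < l) (hx : 1 ≤ x) :
    (2*j-1) * ∑ n ∈ Finset.Icc 1 ⌊x⌋₊, ArithmeticFunction.vonMangoldt n/(n:ℝ) * Real.exp (-(l*T/(2*π))*(Real.log x-Real.log n))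
     ≤ (2*j-1) * (Dd l j T (Real.log x) 0 + (1 - Real.exp (-(l*T/(2*π))*Real.log x))/(l*T/(2*π)))
       + (2*π/T) * ((2*j-1) * (1/(Real.exp l - 1)+j-1/l)) := by
  have hε : 0 < l*T/(2*π) := by positivity
  set ε := l*T/(2*π) with hεd
  set L := Real.log x with hLd
  have e0 : ∫ v in (0:ℝ)..L, Real.exp (-(0:ℝ)*v) * Real.exp (-ε*(L-v)) = (1 - Real.exp (-ε*L))/ε := by
    have : ∀ v ∈ Set.uIcc 0 L, HasDerivAt (fun v => Real.exp (-ε*(L-v))/ε) (Real.exp (-(0:ℝ)*v) * Real.exp (-ε*(L-v))) v := by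
      intro v _
      have h1 : HasDerivAt (fun v => -ε*(L-v)) ε v := (((hasDerivAt_id v).const_sub L).const_mul (-ε)).congr_deriv (by ring)
      exact ((h1.exp).div_const ε).congr_deriv (by simp; field_simp)
    rw [intervalIntegral.integral_eq_sub_of_hasDerivAt this (by apply Continuous.intervalIntegrable; fun_prop)]
    simp
    field_simp
  rw [← e0]
  have c1 : Continuous (fun δ : ℝ => (2*j-1) * ∑ n ∈ Finset.Icc 1 ⌊x⌋₊, ArithmeticFunction.vonMangoldt n/(n:ℝ)^(1+δ) * Real.exp (-ε*(L-Real.log n))) := by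
    apply Continuous.mul continuous_const
    apply continuous_finsetSum
    intro n hn
    have : (0:ℝ) < n := by exact_mod_cast (Finset.mem_Icc.1 hn).1
    apply Continuous.mul _ continuous_const
    apply Continuous.div continuous_const
    · apply Continuous.rpow continuous_const (by fun_prop)
      intro y; exact Or.inl this.ne'
    · intro y; positivity
  have c2 : Continuous (fun δ : ℝ => (2*j-1) * (Dd l j T L δ + ∫ v in (0:ℝ)..L, Real.exp (-δ*v) * Real.exp (-ε*(L-v)))
       + (2*π/T) * ((2*j-1) * (1/(Real.exp l - 1)+j-1/l))) := by
    have := Dd_cont (j := j) (T := T) (L := L) hl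
    have h3 : Continuous (fun δ : ℝ => ∫ v in (0:ℝ)..L, Real.exp (-δ*v) * Real.exp (-ε*(L-v))) := by
      apply intervalIntegral.continuous_parametric_intervalIntegral_of_continuous'
      fun_prop
    fun_prop
  have t1 := (c1.tendsto 0).mono_left (nhdsWithin_le_nhds (s := Set.Ioi 0))
  have t2 := (c2.tendsto 0).mono_left (nhdsWithin_le_nhds (s := Set.Ioi 0))
  have := le_of_tendsto_of_tendsto t1 t2 (by
    filter_upwards [self_mem_nhdsWithin] with δ hδ
    exact E1_delta hj hT hl hδ hx)
  simpa using this

end PB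

namespace PB
open Filter Topology Metric MeasureTheory
open scoped ComplexConjugate

/-- boundary integral over a rectangle -/
noncomputable def RI (a b c d : ℝ) (f : ℂ → ℂ) : ℂ :=
  (∫ x in a..b, f (x + c * Complex.I)) - (∫ x in a..b, f (x + d * Complex.I))
   + Complex.I * (∫ y in c..d, f (b + y * Complex.I)) - Complex.I * ∫ y in c..d, f (a + y * Complex.I)

lemma RI_zero {a b c d : ℝ} (hab : a ≤ b) (hcd : c ≤ d) {f : ℂ → ℂ}
    (hf : ∀ s : ℂ, a ≤ s.re → s.re ≤ b → c ≤ s.im → s.im ≤ d → DifferentiableAt ℂ f s) :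
    RI a b c d f = 0 := by
  have := Complex.integral_boundary_rect_eq_zero_of_differentiableOn f (a + c * Complex.I) (b + d * Complex.I) (by
    intro s hs
    rw [Complex.mem_reProdIm] at hs
    simp [Set.uIcc_of_le, hab, hcd] at hs
    exact (hf s hs.1.1 hs.1.2 hs.2.1 hs.2.2).differentiableWithinAt)
  simpa [RI] using this

lemma log_int_h {a b y : ℝ} (hy : y ≠ 0) :
    ∫ x in a..b, 1 / ((x:ℂ) + y * Complex.I) = Complex.log (b + y * Complex.I) - Complex.log (a + y * Complex.I) := by
  have hne : ∀ x : ℝ, (x:ℂ) + y * Complex.I ≠ 0 := fun x h => hy (by simpa using congrArg Complex.im h)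
  apply intervalIntegral.integral_eq_sub_of_hasDerivAt (f := fun x : ℝ => Complex.log (x + y * Complex.I))
  · intro x _
    have h1 : HasDerivAt (fun x : ℝ => (x:ℂ) + y * Complex.I) 1 x := (Complex.ofRealCLM.hasDerivAt).add_const _
    exact (h1.clog_real (by right; simpa using hy))
  · apply Continuous.intervalIntegrable
    fun_prop (disch := intro x; exact hne x)

lemma log_int_v {c d x : ℝ} (hx : 0 < x) :
    Complex.I * ∫ y in c..d, 1 / ((x:ℂ) + y * Complex.I) = Complex.log (x + d * Complex.I) - Complex.log (x + c * Complex.I) := by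
  have hne : ∀ y : ℝ, (x:ℂ) + y * Complex.I ≠ 0 := fun y h => hx.ne' (by simpa using congrArg Complex.re h)
  rw [← intervalIntegral.integral_const_mul]
  apply intervalIntegral.integral_eq_sub_of_hasDerivAt (f := fun y : ℝ => Complex.log (x + y * Complex.I))
  · intro y _
    have h1 : HasDerivAt (fun y : ℝ => (x:ℂ) + y * Complex.I) Complex.I y := by
      have := ((Complex.ofRealCLM.hasDerivAt (x := y)).mul_const Complex.I).const_add (x:ℂ)
      simpa using this
    exact ((h1.clog_real (by left; simpa using hx))).congr_deriv (by ring)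
  · apply Continuous.intervalIntegrable
    fun_prop (disch := intro x; exact hne x)

lemma log_neg_up {z : ℂ} (h : 0 < z.im) : Complex.log (-z) = Complex.log z - π * Complex.I := by
  simp only [Complex.log, norm_neg, Complex.arg_neg_eq_arg_sub_pi_of_im_pos h]
  push_cast; ring

lemma log_neg_dn {z : ℂ} (h : z.im < 0) : Complex.log (-z) = Complex.log z + π * Complex.I := by
  simp only [Complex.log, norm_neg, Complex.arg_neg_eq_arg_add_pi_of_im_neg h]
  push_cast; ring

lemma RI_inv {a b c d : ℝ} {ρ : ℂ} (h1 : a < ρ.re) (h2 : ρ.re < b) (h3 : c < ρ.im) (h4 : ρ.im < d) :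
    RI a b c d (fun s => 1/(s - ρ)) = 2 * π * Complex.I := by
  have e : ∀ x y : ℝ, (x:ℂ) + y * Complex.I - ρ = ((x - ρ.re : ℝ):ℂ) + ((y - ρ.im : ℝ) : ℂ) * Complex.I := by
    intro x y; apply Complex.ext <;> simp
  unfold RI
  simp only [e]
  rw [intervalIntegral.integral_comp_sub_right (fun x : ℝ => 1 / ((x:ℂ) + ((c - ρ.im : ℝ):ℂ) * Complex.I)) ρ.re,
    intervalIntegral.integral_comp_sub_right (fun x : ℝ => 1 / ((x:ℂ) + ((d - ρ.im : ℝ):ℂ) * Complex.I)) ρ.re,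
    intervalIntegral.integral_comp_sub_right (fun y : ℝ => 1 / (((b - ρ.re : ℝ):ℂ) + (y:ℂ) * Complex.I)) ρ.im,
    intervalIntegral.integral_comp_sub_right (fun y : ℝ => 1 / (((a - ρ.re : ℝ):ℂ) + (y:ℂ) * Complex.I)) ρ.im,
    log_int_h (by linarith), log_int_h (by linarith), log_int_v (by linarith)]
  have e3 : ∀ y : ℝ, 1 / (((a - ρ.re : ℝ):ℂ) + (y:ℂ) * Complex.I) = -(1 / (((-(a - ρ.re) : ℝ):ℂ) + ((-y : ℝ):ℂ) * Complex.I)) := by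
    intro y
    rw [show (((-(a - ρ.re) : ℝ):ℂ) + ((-y : ℝ):ℂ) * Complex.I) = -(((a - ρ.re : ℝ):ℂ) + (y:ℂ) * Complex.I) by push_cast; ring]
    rw [one_div, one_div, inv_neg, neg_neg]
  have e4 : Complex.I * ∫ y in (c - ρ.im)..(d - ρ.im), 1 / (((a - ρ.re : ℝ):ℂ) + (y:ℂ) * Complex.I) =
      Complex.log (-(((a - ρ.re : ℝ):ℂ) + ((d - ρ.im : ℝ) : ℂ) * Complex.I)) - Complex.log (-(((a - ρ.re : ℝ):ℂ) + ((c - ρ.im : ℝ) : ℂ) * Complex.I)) := by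
    simp only [e3]
    rw [intervalIntegral.integral_neg, intervalIntegral.integral_comp_neg (fun y : ℝ => 1 / (((-(a - ρ.re) : ℝ):ℂ) + (y:ℂ) * Complex.I)), mul_neg, log_int_v (by linarith)]
    push_cast
    rw [neg_sub]
    congr 1 <;> congr 1 <;> ring
  rw [e4, log_neg_up (by simp; exact h4), log_neg_dn (by simp; exact h3)]
  ring

lemma RI_add_sum {a b c d : ℝ} {S : Finset ℂ} {C : ℂ → ℂ} {f g : ℂ → ℂ} (hab : a ≤ b) (hcd : c ≤ d)
    (hS : ∀ ρ ∈ S, a < ρ.re ∧ ρ.re < b ∧ c < ρ.im ∧ ρ.im < d)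
    (hg : ∀ s : ℂ, a ≤ s.re → s.re ≤ b → c ≤ s.im → s.im ≤ d → DifferentiableAt ℂ g s)
    (hf : ∀ s : ℂ, a ≤ s.re → s.re ≤ b → c ≤ s.im → s.im ≤ d → s ∉ S → f s = g s + ∑ ρ ∈ S, C ρ * (1/(s-ρ))) :
    RI a b c d f = 2 * π * Complex.I * ∑ ρ ∈ S, C ρ := by
  have hg0 := RI_zero hab hcd hg
  have hcont : ∀ {u v : ℝ} (p : ℝ → ℂ), u ≤ v → Continuous p → (∀ t ∈ Set.Icc u v, (a ≤ (p t).re ∧ (p t).re ≤ b ∧ c ≤ (p t).im ∧ (p t).im ≤ d) ∧ p t ∉ S) →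
     ∫ t in u..v, f (p t) = (∫ t in u..v, g (p t)) + ∑ ρ ∈ S, C ρ * ∫ t in u..v, 1/(p t - ρ) := by
    intro u v p huv hp hm
    have i1 : IntervalIntegrable (fun t => g (p t)) volume u v := by
      apply ContinuousOn.intervalIntegrable
      rw [Set.uIcc_of_le huv]
      intro t ht
      obtain ⟨⟨q1, q2, q3, q4⟩, -⟩ := hm t ht
      exact (ContinuousAt.comp (hg _ q1 q2 q3 q4).continuousAt hp.continuousAt).continuousWithinAt
    have i2 : ∀ ρ ∈ S, IntervalIntegrable (fun t => C ρ * (1/(p t - ρ))) volume u v := by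
      intro ρ hρ
      apply ContinuousOn.intervalIntegrable
      rw [Set.uIcc_of_le huv]
      apply ContinuousOn.mul continuousOn_const
      apply ContinuousOn.div continuousOn_const (by fun_prop)
      intro t ht h
      rw [sub_eq_zero] at h
      exact (hm t ht).2 (h ▸ hρ)
    rw [intervalIntegral.integral_congr (g := fun t => g (p t) + ∑ ρ ∈ S, C ρ * (1/(p t - ρ)))]
    · rw [intervalIntegral.integral_add i1, intervalIntegral.integral_finsetSum i2]
      · simp only [intervalIntegral.integral_const_mul]
      · have := IntervalIntegrable.sum S i2
        have e : (fun t => ∑ ρ ∈ S, C ρ * (1/(p t - ρ))) = ∑ ρ ∈ S, fun t => C ρ * (1/(p t - ρ)) := by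
          ext t; simp
        rw [e]
        exact this
    · intro t ht
      rw [Set.uIcc_of_le huv] at ht
      obtain ⟨⟨q1, q2, q3, q4⟩, q5⟩ := hm t ht
      exact hf _ q1 q2 q3 q4 q5
  have key : RI a b c d f = RI a b c d g + ∑ ρ ∈ S, C ρ * RI a b c d (fun s => 1/(s-ρ)) := by
    unfold RI
    rw [hcont (fun t : ℝ => (t:ℂ) + c * Complex.I) hab (by fun_prop), hcont (fun t : ℝ => (t:ℂ) + d * Complex.I) hab (by fun_prop),
      hcont (fun t : ℝ => (b:ℂ) + t * Complex.I) hcd (by fun_prop), hcont (fun t : ℝ => (a:ℂ) + t * Complex.I) hcd (by fun_prop)]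
    · simp only [mul_add, mul_sub, Finset.sum_add_distrib, Finset.sum_sub_distrib, Finset.mul_sum]
      have : ∀ ρ (z : ℂ), C ρ * (Complex.I * z) = Complex.I * (C ρ * z) := fun ρ z => by ring
      simp only [this]
      ring
    · intro t ht
      refine ⟨by simp; exact ⟨hab, ht.1, ht.2⟩, fun h => ?_⟩
      have := (hS _ h).1
      simp at this
    · intro t ht
      refine ⟨by simp; exact ⟨hab, ht.1, ht.2⟩, fun h => ?_⟩
      have := (hS _ h).2.1
      simp at this
    · intro t ht
      refine ⟨by simp; exact ⟨ht.1, ht.2, hcd⟩, fun h => ?_⟩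
      have := (hS _ h).2.2.2
      simp at this
    · intro t ht
      refine ⟨by simp; exact ⟨ht.1, ht.2, hcd⟩, fun h => ?_⟩
      have := (hS _ h).2.2.1
      simp at this
  rw [key, hg0, zero_add, Finset.mul_sum]
  apply Finset.sum_congr rfl
  intro ρ hρ
  obtain ⟨q1, q2, q3, q4⟩ := hS ρ hρ
  rw [RI_inv q1 q2 q3 q4]; ring

end PB

namespace PB
open Filter Topology Metric MeasureTheory
open scoped ComplexConjugate

open Classical in
noncomputable def Wq (l j : ℝ) (z : ℂ) : ℂ :=
  if z = 2*π*Complex.I then (2*π*Complex.I) * kk l j (2*π*Complex.I)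
  else (z * (GG j l - j * (z - 2*π*Complex.I)) - (z - 2*π*Complex.I) * BB z) / (2*π*Complex.I)

lemma Wq_eq {l j : ℝ} {z : ℂ} (hz : z ≠ 0) : Wq l j z = z * kk l j z := by
  unfold Wq
  split_ifs with h
  · rw [h]
  · unfold kk
    rw [show GG j (z - 2*π*Complex.I) = BB (z - 2*π*Complex.I) + j * (z - 2*π*Complex.I) from rfl, BB_sub_period h, BB_of_ne hz]
    ring

lemma Wq_diffAt {l j : ℝ} {z : ℂ} (h : z.re ≠ 0 ∨ (-(2*π) < z.im ∧ z.im < 4*π)) : DifferentiableAt ℂ (Wq l j) z := by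
  by_cases h0 : z.re ≠ 0 ∨ (0 < z.im ∧ z.im < 4*π)
  · have hz : z ≠ 0 := by rintro rfl; simp at h0
    have : Wq l j =ᶠ[𝓝 z] fun z => z * kk l j z := by
      filter_upwards [isOpen_ne.mem_nhds hz] with w hw using Wq_eq hw
    exact (differentiableAt_id.mul (kk_diffAt h0)).congr_of_eventuallyEq this
  · push Not at h0
    have h1 : z.im ≤ 0 := by
      by_contra hc
      push Not at hc
      rcases h with h | h
      · exact h h0.1
      · linarith [h0.2 hc]
    have h2 : z ≠ 2*π*Complex.I := by
      rintro rfl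
      simp at h1
      linarith [Real.pi_pos]
    have h3 : |z.im| < 2*π := by
      rw [abs_lt]
      rcases h with h | h
      · exact absurd h0.1 h
      · exact ⟨h.1, by linarith [Real.pi_pos]⟩
    have : Wq l j =ᶠ[𝓝 z] fun z => (z * (GG j l - j * (z - 2*π*Complex.I)) - (z - 2*π*Complex.I) * BB z) / (2*π*Complex.I) := by
      filter_upwards [isOpen_ne.mem_nhds h2] with w hw
      unfold Wq; rw [if_neg hw]
    have hb := BB_diffAt (Or.inr h3)
    exact DifferentiableAt.congr_of_eventuallyEq (by fun_prop) this

lemma digamma_diffAt {z : ℂ} (hz : 0 < z.re) : DifferentiableAt ℂ Complex.digamma z := by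
  have hU : IsOpen {z : ℂ | 0 < z.re} := isOpen_lt continuous_const Complex.continuous_re
  have hne : ∀ w : ℂ, 0 < w.re → ∀ m : ℕ, w ≠ -m := by
    rintro w hw m rfl
    simp at hw
    have : (0:ℝ) ≤ m := by positivity
    linarith
  have h1 : DifferentiableOn ℂ Complex.Gamma {z : ℂ | 0 < z.re} := fun w hw =>
    (Complex.differentiableAt_Gamma w (hne w hw)).differentiableWithinAt
  have h2 : AnalyticAt ℂ Complex.Gamma z := h1.analyticAt (hU.mem_nhds hz)
  exact h2.deriv.differentiableAt.div h2.differentiableAt (Complex.Gamma_ne_zero_of_re_pos hz)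

/-- weighted kernel times `x^(s-1)` times `s - s0` -/
noncomputable def PP (l j T L : ℝ) (s : ℂ) : ℂ :=
  Wq l j ((2*π/T : ℝ) * (s - (1 - l*T/(2*π) : ℝ))) / (2*π/T : ℝ) * Complex.exp ((s-1)*L)

noncomputable def Kz (l j T : ℝ) (s : ℂ) : ℂ := kk l j ((2*π/T : ℝ) * (s - (1 - l*T/(2*π) : ℝ)))

lemma PP_eq {l j T L : ℝ} {s : ℂ} (hT : 0 < T) (hs : s ≠ (1 - l*T/(2*π) : ℝ)) :
    PP l j T L s = Kz l j T s * Complex.exp ((s-1)*L) * (s - (1 - l*T/(2*π) : ℝ)) := by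
  have hκ : ((2*π/T : ℝ):ℂ) ≠ 0 := by
    rw [Ne, Complex.ofReal_eq_zero]; positivity
  unfold PP Kz
  rw [Wq_eq (mul_ne_zero hκ (sub_ne_zero_of_ne hs))]
  field_simp

lemma PP_diffAt {l j T L : ℝ} {s : ℂ} (hT : 0 < T) (h1 : -T < s.im) (h2 : s.im < 2*T) :
    DifferentiableAt ℂ (PP l j T L) s := by
  have hp := Real.pi_pos
  have : DifferentiableAt ℂ (fun s : ℂ => Wq l j ((2*π/T : ℝ) * (s - (1 - l*T/(2*π) : ℝ)))) s := by
    apply DifferentiableAt.comp (g := Wq l j)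
    · apply Wq_diffAt
      right
      have e : (((2*π/T : ℝ):ℂ) * (s - ((1 - l*T/(2*π) : ℝ):ℂ))).im = 2*π/T*s.im := by
        rw [Complex.im_ofReal_mul, Complex.sub_im, Complex.ofReal_im, sub_zero]
      rw [e]
      constructor
      · rw [div_mul_eq_mul_div, lt_div_iff₀ hT]; nlinarith
      · rw [div_mul_eq_mul_div, div_lt_iff₀ hT]; nlinarith
    · fun_prop
  unfold PP
  fun_prop

lemma gg_sub_zeros {T : ℝ} : ∃ H : ℂ → ℂ, ∃ U : Set ℂ, IsOpen U ∧ DifferentiableOn ℂ H U ∧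
    (∀ s : ℂ, -2 < s.re → (Xi s = 0 → s ∈ ZT T) → s ∈ U) ∧
    ∀ s : ℂ, -2 < s.re → Xi s ≠ 0 → gg s = H s - ∑ ρ ∈ ZT T, (mu ρ : ℂ) / (s - ρ) := by
  obtain ⟨g, hg, hg0, he⟩ := factor_finset Xi_diff Xi_order (ZT T)
  refine ⟨fun s => -logDeriv g s - Real.log π / 2 + Complex.digamma (s/2+1)/2,
    {s | -2 < s.re ∧ g s ≠ 0}, ?_, ?_, ?_, ?_⟩
  · exact (isOpen_lt continuous_const Complex.continuous_re).inter (isOpen_ne.preimage hg.continuous)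
  · intro s hs
    apply DifferentiableAt.differentiableWithinAt
    have a := hg.analyticAt s
    have h1 : DifferentiableAt ℂ (logDeriv g) s := a.deriv.differentiableAt.div a.differentiableAt hs.2
    have h2 : DifferentiableAt ℂ (fun s : ℂ => Complex.digamma (s/2+1)) s := by
      apply DifferentiableAt.comp (g := Complex.digamma)
      · exact digamma_diffAt (half_re hs.1)
      · fun_prop
    fun_prop
  · intro s h1 h2
    refine ⟨h1, ?_⟩
    by_cases h : Xi s = 0
    · exact hg0 s (h2 h)
    · rw [he s] at h
      exact right_ne_zero_of_mul h
  · intro s h1 h2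
    have h3 := logDeriv_Xi h1 h2
    rw [logDeriv_factor hg he h2] at h3
    linear_combination h3

lemma Xi_real_ne (x : ℝ) : Xi (x:ℂ) ≠ 0 := fun h => no_real_zero h (by simp)

lemma contour {l j T L : ℝ} (hT : 0 < T) (hε0 : 0 ≤ l*T/(2*π)) (hε : l*T/(2*π) ≤ 1) (htop : ∀ ρ ∈ ZT T, ρ.im < T) :
    RI (-1) 1 0 T (fun s => PP l j T L s * dslope gg (1 - l*T/(2*π) : ℝ) s)
     = - (2*π*Complex.I * ∑ ρ ∈ ZT T, (mu ρ : ℂ) * (Kz l j T ρ * Complex.exp ((ρ-1)*L))) := by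
  set s0 : ℂ := ((1 - l*T/(2*π) : ℝ) : ℂ) with hs0
  have hs0re : s0.re = 1 - l*T/(2*π) := Complex.ofReal_re _
  have hXi0 : Xi s0 ≠ 0 := Xi_real_ne _
  have hmem : ∀ ρ ∈ ZT T, s0 ≠ ρ := fun ρ hρ h => hXi0 (h ▸ (mem_ZT.1 hρ).1)
  obtain ⟨H, U, hU, hH, hUm, hgg⟩ := gg_sub_zeros (T := T)
  have hs0U : s0 ∈ U := hUm s0 (by rw [hs0re]; linarith) (fun h => absurd h hXi0)
  have hdH : DifferentiableOn ℂ (dslope H s0) U := (Complex.differentiableOn_dslope (hU.mem_nhds hs0U)).2 hH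
  set V : Set ℂ := {s | -T < s.im ∧ s.im < 2*T} with hV
  have hVo : IsOpen V := (isOpen_lt continuous_const Complex.continuous_im).inter (isOpen_lt Complex.continuous_im continuous_const)
  have hdP : ∀ ρ ∈ ZT T, DifferentiableOn ℂ (dslope (PP l j T L) ρ) V := by
    intro ρ hρ
    have h1 := (mem_ZT.1 hρ).2.1
    have h2 := htop ρ hρ
    apply (Complex.differentiableOn_dslope (hVo.mem_nhds ⟨by linarith, by linarith⟩)).2
    intro s hs
    exact (PP_diffAt hT hs.1 hs.2).differentiableWithinAt
  have hrect : ∀ s : ℂ, -1 ≤ s.re → s.re ≤ 1 → 0 ≤ s.im → s.im ≤ T → Xi s = 0 → s ∈ ZT T := by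
    intro s _ _ h3 h4 h0
    exact mem_ZT.2 ⟨h0, lt_of_le_of_ne h3 (no_real_zero h0).symm, h4⟩
  -- the difference quotient
  have hds : ∀ s : ℂ, -2 < s.re → Xi s ≠ 0 → dslope gg s0 s = dslope H s0 s + ∑ ρ ∈ ZT T, (mu ρ : ℂ) / ((s - ρ) * (s0 - ρ)) := by
    have off : ∀ s : ℂ, -2 < s.re → Xi s ≠ 0 → s ≠ s0 → dslope gg s0 s = dslope H s0 s + ∑ ρ ∈ ZT T, (mu ρ : ℂ) / ((s - ρ) * (s0 - ρ)) := by
      intro s h1 h2 h3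
      rw [dslope_of_ne _ h3, dslope_of_ne _ h3, slope_def_field, slope_def_field, hgg s h1 h2, hgg s0 (by rw [hs0re]; linarith) hXi0]
      have h4 : s - s0 ≠ 0 := sub_ne_zero_of_ne h3
      have : ∑ ρ ∈ ZT T, (mu ρ : ℂ) / ((s - ρ) * (s0 - ρ)) = (∑ ρ ∈ ZT T, (mu ρ : ℂ) / (s0 - ρ) - ∑ ρ ∈ ZT T, (mu ρ : ℂ) / (s - ρ)) / (s - s0) := by
        rw [← Finset.sum_sub_distrib, Finset.sum_div]
        apply Finset.sum_congr rfl
        intro ρ hρ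
        have h5 : s0 - ρ ≠ 0 := sub_ne_zero_of_ne (hmem ρ hρ)
        have h6 : s - ρ ≠ 0 := fun h => h2 (by rw [sub_eq_zero.1 h]; exact (mem_ZT.1 hρ).1)
        field_simp
        ring
      rw [this]
      field_simp
      ring
    intro s h1 h2
    by_cases h3 : s = s0
    · rw [h3]
      rw [h3] at h1 h2
      have c1 : ContinuousAt (dslope gg s0) s0 := by
        rw [continuousAt_dslope_same]
        exact gg_diffAt (fun h => h2 ((Xi_eq_zero_iff h1).2 h))
      have c2 : ContinuousAt (fun w => dslope H s0 w + ∑ ρ ∈ ZT T, (mu ρ : ℂ) / ((w - ρ) * (s0 - ρ))) s0 := by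
        apply ContinuousAt.add
        · exact (hdH.differentiableAt (hU.mem_nhds hs0U)).continuousAt
        · apply tendsto_finsetSum
          intro ρ hρ
          apply ContinuousAt.div continuousAt_const (by fun_prop)
          exact mul_ne_zero (sub_ne_zero_of_ne (hmem ρ hρ)) (sub_ne_zero_of_ne (hmem ρ hρ))
      have ev : dslope gg s0 =ᶠ[𝓝[≠] s0] (fun w => dslope H s0 w + ∑ ρ ∈ ZT T, (mu ρ : ℂ) / ((w - ρ) * (s0 - ρ))) := by
        have e1 : ∀ᶠ w in 𝓝 s0, -2 < w.re := (isOpen_lt continuous_const Complex.continuous_re).mem_nhds h1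
        have e2 : ∀ᶠ w in 𝓝 s0, Xi w ≠ 0 := Xi_diff.continuous.continuousAt.eventually_ne h2
        filter_upwards [nhdsWithin_le_nhds e1, nhdsWithin_le_nhds e2, self_mem_nhdsWithin] with w a b c
        exact off w a b c
      exact ((c1.eventuallyEq_nhds_iff_eventuallyEq_nhdsNE c2).1 ev).eq_of_nhds
    · exact off s h1 h2 h3
  have main := RI_add_sum (a := -1) (b := 1) (c := 0) (d := T) (S := ZT T)
    (C := fun ρ => (mu ρ : ℂ) / (s0 - ρ) * PP l j T L ρ)
    (f := fun s => PP l j T L s * dslope gg s0 s)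
    (g := fun s => PP l j T L s * dslope H s0 s + ∑ ρ ∈ ZT T, (mu ρ : ℂ) / (s0 - ρ) * dslope (PP l j T L) ρ s)
    (by norm_num) hT.le ?_ ?_ ?_
  · rw [main, ← mul_neg, ← Finset.sum_neg_distrib]
    congr 1
    apply Finset.sum_congr rfl
    intro ρ hρ
    rw [PP_eq hT (hmem ρ hρ).symm]
    have h5 : s0 - ρ ≠ 0 := sub_ne_zero_of_ne (hmem ρ hρ)
    rw [← hs0]
    field_simp
    ring
  · intro ρ hρ
    have h := Xi_zero_re (mem_ZT.1 hρ).1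
    exact ⟨by linarith [h.1], h.2, (mem_ZT.1 hρ).2.1, htop ρ hρ⟩
  · intro s h1 h2 h3 h4
    have hsU : s ∈ U := hUm s (by linarith) (hrect s h1 h2 h3 h4)
    have hsV : s ∈ V := ⟨by linarith, by linarith⟩
    have d1 := PP_diffAt (l := l) (j := j) (L := L) hT hsV.1 hsV.2
    have d2 := hdH.differentiableAt (hU.mem_nhds hsU)
    apply DifferentiableAt.add (d1.mul d2)
    apply DifferentiableAt.fun_sum
    intro ρ hρ
    exact ((hdP ρ hρ).differentiableAt (hVo.mem_nhds hsV)).const_mul _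
  · intro s h1 h2 h3 h4 h5
    have hX : Xi s ≠ 0 := fun h => h5 (hrect s h1 h2 h3 h4 h)
    rw [hds s (by linarith) hX, mul_add, add_assoc, ← Finset.sum_add_distrib, Finset.mul_sum]
    congr 1
    apply Finset.sum_congr rfl
    intro ρ hρ
    have h6 : s ≠ ρ := fun h => h5 (h ▸ hρ)
    have h7 : s - ρ ≠ 0 := sub_ne_zero_of_ne h6
    have h8 : s0 - ρ ≠ 0 := sub_ne_zero_of_ne (hmem ρ hρ)
    rw [dslope_of_ne _ h6, slope_def_field]
    field_simp
    ring

end PB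

namespace PB
open Filter Topology Metric MeasureTheory
open scoped ComplexConjugate

lemma one_sub_cos_ge {θ : ℝ} (h : |θ| ≤ 7/2) : θ^2/13 ≤ 1 - Real.cos θ := by
  wlog h0 : 0 ≤ θ with H
  · have := H (θ := -θ) (by rwa [abs_neg]) (by linarith)
    simpa using this
  rw [abs_of_nonneg h0] at h
  have hp := Real.pi_gt_d4
  have hp2 := Real.pi_lt_d4
  rcases le_total θ π with h1 | h1
  · have := Real.cos_le_one_sub_mul_cos_sq (x := θ) (by rwa [abs_of_nonneg h0])
    have h2 : (1:ℝ)/13 ≤ 2/π^2 := by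
      rw [div_le_div_iff₀ (by norm_num) (by positivity)]; nlinarith
    nlinarith [sq_nonneg θ]
  · have : Real.cos θ ≤ 0 := Real.cos_nonpos_of_pi_div_two_le_of_le (by linarith) (by linarith)
    nlinarith

lemma norm_BB_box {z : ℂ} (h1 : |z.re| ≤ 1/2) (h2 : |z.im| ≤ 7/2) : ‖BB z‖ ≤ 4 := by
  by_cases hz : z = 0
  · rw [hz, BB_zero]; norm_num
  have hz0 : 0 < ‖z‖ := norm_pos_iff.2 hz
  have e : ‖Complex.exp z - 1‖^2 = (Real.exp z.re - 1)^2 + 2 * Real.exp z.re * (1 - Real.cos z.im) := by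
    rw [← Complex.normSq_eq_norm_sq, Complex.normSq_apply]
    simp [Complex.exp_re, Complex.exp_im]
    linear_combination (Real.exp z.re)^2 * (Real.sin_sq_add_cos_sq z.im)
  have hc := one_sub_cos_ge h2
  obtain ⟨q1, q2⟩ := abs_le.1 h1
  have ha : Real.exp z.re ≥ 1/2 := by linarith [Real.add_one_le_exp z.re]
  have hb : z.re^2/13 ≤ (Real.exp z.re - 1)^2 := by
    rcases le_total 0 z.re with h | h
    · have := Real.add_one_le_exp z.re
      nlinarith
    · have h3 := exp_le_inv (x := z.re) (by linarith)
      have h4 : 1/(1-z.re) ≤ 1 + z.re/2 := by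
        rw [div_le_iff₀ (by linarith)]; nlinarith
      nlinarith
  have key : ‖z‖^2/13 ≤ ‖Complex.exp z - 1‖^2 := by
    rw [e, ← Complex.normSq_eq_norm_sq, Complex.normSq_apply]
    nlinarith [sq_nonneg z.im]
  have hne : 0 < ‖Complex.exp z - 1‖ := by
    have : 0 < ‖Complex.exp z - 1‖^2 := lt_of_lt_of_le (by positivity) key
    exact lt_of_le_of_ne (norm_nonneg _) (fun h => by rw [← h] at this; norm_num at this)
  rw [BB_of_ne hz, norm_div, div_le_iff₀ hne]
  nlinarith

lemma BB_lip {a θ : ℝ} (ha : |a| ≤ 1/100) (hθ : |θ| ≤ π) :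
    ‖BB ((a:ℂ) + θ * Complex.I) - BB (θ * Complex.I)‖ ≤ 14 * |a| := by
  have hp2 := Real.pi_lt_d4
  set s : Set ℂ := Set.Icc (-1/100) (1/100) ×ℂ Set.Icc (-π) π with hs
  have hconv : Convex ℝ s := ((convex_Icc _ _).linear_preimage Complex.reLm).inter ((convex_Icc _ _).linear_preimage Complex.imLm)
  have hd : ∀ z ∈ s, DifferentiableAt ℂ BB z := by
    intro z hz
    apply BB_diffAt; right
    rw [abs_lt]
    exact ⟨by linarith [hz.2.1, Real.pi_pos], by linarith [hz.2.2, Real.pi_pos]⟩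
  have hb : ∀ z ∈ s, ‖deriv BB z‖ ≤ 14 := by
    intro z hz
    rw [hs, Complex.mem_reProdIm, Set.mem_Icc, Set.mem_Icc] at hz
    obtain ⟨⟨hz1, hz2⟩, hz3, hz4⟩ := hz
    have hin : ∀ w ∈ closedBall z (1/3), |w.re| ≤ 1/2 ∧ |w.im| ≤ 7/2 := by
      intro w hw
      rw [mem_closedBall, dist_eq_norm] at hw
      have r1 := (Complex.abs_re_le_norm (w - z)).trans hw
      have r2 := (Complex.abs_im_le_norm (w - z)).trans hw
      rw [Complex.sub_re, abs_le] at r1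
      rw [Complex.sub_im, abs_le] at r2
      constructor <;> rw [abs_le] <;> constructor <;> linarith [r1.1, r1.2, r2.1, r2.2]
    have := Complex.norm_deriv_le_of_forall_mem_sphere_norm_le (f := BB) (c := z) (R := 1/3) (C := 4) (by norm_num) ?_ ?_
    · linarith
    · apply DifferentiableOn.diffContOnCl
      rw [closure_ball _ (by norm_num)]
      intro w hw
      apply DifferentiableAt.differentiableWithinAt
      apply BB_diffAt; right
      have := (hin w hw).2
      linarith [Real.pi_gt_d4]
    · intro w hw
      have := hin w (sphere_subset_closedBall hw)
      exact norm_BB_box this.1 this.2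
  rw [abs_le] at ha hθ
  have := hconv.norm_image_sub_le_of_norm_deriv_le hd hb (x := (θ:ℂ) * Complex.I) (y := (a:ℂ) + θ * Complex.I) ?_ ?_
  · refine this.trans (le_of_eq ?_)
    congr 1
    simp
  · refine ⟨?_, ?_⟩ <;> simp
    · norm_num
    · exact ⟨hθ.1, hθ.2⟩
  · refine ⟨?_, ?_⟩ <;> simp
    · constructor <;> linarith [ha.1, ha.2]
    · exact ⟨hθ.1, hθ.2⟩

lemma norm_GG_le {l j : ℝ} (hj : j = 0 ∨ j = 1) (hl : |l| ≤ 1/100) : ‖GG j l‖ ≤ 5 := by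
  unfold GG
  have h1 : ‖BB (l:ℂ)‖ ≤ 4 := norm_BB_box (by simp; linarith) (by simp; norm_num)
  have h2 : ‖(j:ℂ) * l‖ ≤ 1 := by
    rw [norm_mul, Complex.norm_real, Complex.norm_real, Real.norm_eq_abs, Real.norm_eq_abs]
    rcases hj with h | h <;> rw [h] <;> simp
    linarith
  exact (norm_add_le _ _).trans (by linarith)

lemma norm_Wq_le {l j : ℝ} (hj : j = 0 ∨ j = 1) (hl : |l| ≤ 1/100) {z : ℂ} (h1 : |z.re| ≤ 1/100) (h2 : 0 ≤ z.im) (h3 : z.im ≤ 2*π) :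
    ‖Wq l j z‖ ≤ 17 := by
  have hp := Real.pi_gt_d4
  have hp2 := Real.pi_lt_d4
  have hG := norm_GG_le hj hl
  have hj1 : ‖(j:ℂ)‖ ≤ 1 := by rcases hj with h | h <;> simp [h]
  have hn : ‖(2*π*Complex.I : ℂ)‖ = 2*π := by simp [abs_of_pos Real.pi_pos]
  rcases le_total z.im π with h | h
  · have hne : z ≠ 2*π*Complex.I := by
      rintro rfl; simp at h; linarith
    have b1 : ‖BB z‖ ≤ 4 := norm_BB_box (by linarith) (by rw [abs_of_nonneg h2]; linarith)
    have b2 : ‖z‖ ≤ 3.2 := (Complex.norm_le_abs_re_add_abs_im z).trans (by rw [abs_of_nonneg h2]; linarith)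
    have b3 : ‖z - 2*π*Complex.I‖ ≤ 6.3 := by
      refine (Complex.norm_le_abs_re_add_abs_im _).trans ?_
      simp
      rw [abs_of_nonpos (by linarith : z.im - 2*π ≤ 0)]
      linarith
    unfold Wq
    rw [if_neg hne, norm_div, hn, div_le_iff₀ (by positivity)]
    have c1 : ‖z * (GG j l - j * (z - 2*π*Complex.I))‖ ≤ 3.2 * (5 + 1 * 6.3) := by
      rw [norm_mul]
      gcongr
      refine (norm_sub_le _ _).trans ?_
      rw [norm_mul]
      gcongr
    have c2 : ‖(z - 2*π*Complex.I) * BB z‖ ≤ 6.3 * 4 := by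
      rw [norm_mul]; gcongr
    refine (norm_sub_le _ _).trans ?_
    linarith
  · have hz : z ≠ 0 := by rintro rfl; simp at h; linarith
    rw [Wq_eq hz]
    have b2 : ‖z‖ ≤ 6.3 := (Complex.norm_le_abs_re_add_abs_im z).trans (by rw [abs_of_nonneg h2]; linarith)
    have b3 : ‖z - 2*π*Complex.I‖ ≤ 3.2 := by
      refine (Complex.norm_le_abs_re_add_abs_im _).trans ?_
      simp
      rw [abs_of_nonpos (by linarith : z.im - 2*π ≤ 0)]
      linarith
    have b1 : ‖BB (z - 2*π*Complex.I)‖ ≤ 4 := norm_BB_box (by simp; linarith) (by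
      simp
      rw [abs_of_nonpos (by linarith : z.im - 2*π ≤ 0)]
      linarith)
    have c1 : ‖GG j (z - 2*π*Complex.I)‖ ≤ 4 + 1 * 3.2 := by
      unfold GG
      refine (norm_add_le _ _).trans ?_
      rw [norm_mul]
      gcongr
    unfold kk
    rw [norm_mul, norm_div, hn, ← mul_div_assoc, div_le_iff₀ (by positivity)]
    have c3 : ‖z‖ * ‖GG j l - GG j (z - 2*π*Complex.I)‖ ≤ 6.3 * (5 + (4 + 1 * 3.2)) := by
      gcongr
      exact (norm_sub_le _ _).trans (by linarith)
    linarith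

end PB

namespace PB
open Filter Topology Metric MeasureTheory
open scoped ComplexConjugate

lemma log_big : Real.log (31 * 10^11) ≤ 29 := by
  rw [Real.log_le_iff_le_exp (by norm_num)]
  have h := Real.exp_one_gt_d9
  have e : Real.exp 29 = (Real.exp 1)^29 := by rw [← Real.exp_nat_mul]; norm_num
  rw [e]
  calc (31 * 10^11 : ℝ) ≤ (2.7182818283:ℝ)^29 := by norm_num
    _ ≤ _ := by gcongr

lemma log_pi_le : Real.log π ≤ 7/5 := by
  have h1 : Real.log π ≤ Real.log (2^2) := Real.log_le_log Real.pi_pos (by linarith [Real.pi_lt_d4])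
  rw [Real.log_pow] at h1
  push_cast at h1
  linarith [Real.log_two_lt_d9]

lemma one_le_log_pi : 1 ≤ Real.log π := by
  rw [Real.le_log_iff_exp_le Real.pi_pos]
  linarith [Real.exp_one_lt_d9, Real.pi_gt_d4]

lemma digamma_norm_le {z : ℂ} (h1 : 1/2 ≤ z.re) (h2 : ‖z‖ ≤ 31 * 10^11) : ‖Complex.digamma z‖ ≤ 39 := by
  have hz : 1/2 ≤ ‖z‖ := h1.trans ((le_abs_self _).trans (Complex.abs_re_le_norm z))
  have hd := norm_digamma_sub_log_le (z := z) (by linarith)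
  have a1 : 1/‖z‖ ≤ 2 := by rw [div_le_iff₀ (by linarith)]; linarith
  have a2 : 1/‖z‖^2 ≤ 4 := by rw [div_le_iff₀ (by positivity)]; nlinarith
  have hl : ‖Complex.log z‖ ≤ 29 + 3.15 := by
    refine (Complex.norm_le_abs_re_add_abs_im _).trans ?_
    rw [Complex.log_re, Complex.log_im]
    have b1 : |Real.log ‖z‖| ≤ 29 := by
      rw [abs_le]
      constructor
      · have : Real.log (1/2) ≤ Real.log ‖z‖ := Real.log_le_log (by norm_num) hz
        rw [one_div, Real.log_inv] at this
        linarith [Real.log_two_lt_d9]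
      · exact (Real.log_le_log (by linarith) h2).trans log_big
    have b2 := Complex.abs_arg_le_pi z
    linarith [Real.pi_lt_d4]
  have := norm_add_le (Complex.digamma z - Complex.log z) (Complex.log z)
  rw [sub_add_cancel] at this
  linarith

lemma LSeries_two_norm {s : ℂ} (hs : 2 ≤ s.re) : ‖LSeries (fun n => (ArithmeticFunction.vonMangoldt n : ℂ)) s‖ ≤ 7/10 := by
  have := LSeries_norm_le (σ := 2) (by norm_num) hs
  have h2 := LSeries_two_le
  push_cast at this
  linarith

lemma gg_two {s : ℂ} (hs : s.re = 2) : ‖gg s‖ ≤ 1.7 := by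
  rw [gg_eq (by linarith)]
  have h1 := LSeries_two_norm hs.ge
  have h2 : ‖1/(s-1)‖ ≤ 1 := by
    rw [norm_div, norm_one]
    have : 1 ≤ ‖s-1‖ := by
      have := Complex.re_le_norm (s-1)
      rw [Complex.sub_re, hs, Complex.one_re] at this
      linarith
    rw [div_le_one (by linarith)]; exact this
  have := norm_sub_le (LSeries (fun n => (ArithmeticFunction.vonMangoldt n : ℂ)) s) (1/(s-1))
  linarith

lemma half_norm {s : ℂ} (h1 : |s.re| ≤ 2) (h2 : |s.im| ≤ 30001 * 10^8) : ‖s/2+1‖ ≤ 31 * 10^11 := by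
  refine (norm_add_le _ _).trans ?_
  rw [norm_div]
  have := Complex.norm_le_abs_re_add_abs_im s
  simp
  linarith

lemma half_re_ge {s : ℂ} (h1 : -1 ≤ s.re) : 1/2 ≤ (s/2+1).re := by
  have : (s/2+1).re = s.re/2+1 := by simp
  rw [this]; linarith

lemma log_pi_norm : ‖((Real.log π : ℝ) : ℂ)/2‖ ≤ 0.7 := by
  rw [norm_div, Complex.norm_real, Real.norm_eq_abs, abs_of_nonneg (by linarith [one_le_log_pi])]
  simp
  linarith [log_pi_le]

lemma gg_strip {s : ℂ} (h1 : -1 ≤ s.re) (h1b : s.re ≤ 2) (h2 : |s.im| ≤ 30001 * 10^8) (hX : Xi s ≠ 0) :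
    ‖gg s‖ ≤ ‖logDeriv Xi s‖ + 20.2 := by
  have hd := digamma_norm_le (half_re_ge h1) (half_norm (by rw [abs_le]; constructor <;> linarith) h2)
  have e := logDeriv_Xi (by linarith) hX
  have : gg s = -logDeriv Xi s - Real.log π/2 + Complex.digamma (s/2+1)/2 := by linear_combination e
  rw [this]
  have h3 : ‖Complex.digamma (s/2+1)/2‖ ≤ 19.5 := by
    rw [norm_div]; simp; linarith
  have h4 := log_pi_norm
  have h5 := norm_add_le (-logDeriv Xi s - Real.log π/2) (Complex.digamma (s/2+1)/2)
  have h6 := norm_sub_le (-logDeriv Xi s) ((Real.log π:ℂ)/2)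
  rw [norm_neg] at h6
  linarith

lemma Xi_two_norm {s : ℂ} (hs : s.re = 2) (h2 : |s.im| ≤ 30001 * 10^8) : ‖logDeriv Xi s‖ ≤ 22 := by
  have hd := digamma_norm_le (half_re_ge (by linarith)) (half_norm (by rw [hs]; norm_num) h2)
  rw [logDeriv_Xi (by linarith) (Xi_ne_zero_of_one_le (by linarith))]
  have h3 : ‖Complex.digamma (s/2+1)/2‖ ≤ 19.5 := by
    rw [norm_div]; simp; linarith
  have h4 := log_pi_norm
  have h5 := norm_add_le (-gg s - Real.log π/2) (Complex.digamma (s/2+1)/2)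
  have h6 := norm_sub_le (-gg s) ((Real.log π:ℂ)/2)
  rw [norm_neg] at h6
  have := gg_two hs
  linarith

lemma gg_left {t : ℝ} (h2 : |t| ≤ 30001 * 10^8) : ‖gg (-1 + t * Complex.I)‖ ≤ 43 := by
  have hX : Xi (-1 + t * Complex.I) ≠ 0 := fun h => by
    have := (Xi_zero_re h).1
    simp at this
    linarith
  have h1 := gg_strip (s := -1 + t * Complex.I) (by simp) (by simp; norm_num) (by simpa using h2) hX
  have h3 := logDeriv_Xi_one_sub (-1 + t * Complex.I)
  have h4 := Xi_two_norm (s := 1 - (-1 + t * Complex.I)) (by simp; norm_num) (by simpa using h2)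
  rw [h3, norm_neg] at h4
  linarith

lemma gg_real_norm (hRH : RHT) {σ : ℝ} (h1 : -1 ≤ σ) (h2 : σ ≤ 1) : ‖gg σ‖ ≤ 30 := by
  have hX := Xi_real_ne σ
  have a := gg_strip (s := σ) (by simpa using h1) (by simp; linarith) (by simp) hX
  have hx2 := X_real_le (x := 2) (by norm_num)
  have hl : Real.log (2/(2*π)) ≤ 0 := by
    apply Real.log_nonpos (by positivity)
    rw [div_le_one (by positivity)]
    linarith [Real.pi_gt_d4]
  have hx3 : (logDeriv Xi ((2:ℝ):ℂ)).re ≤ 5/4 := by linarith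
  have hx0 : 0 ≤ (logDeriv Xi ((2:ℝ):ℂ)).re := logDeriv_Xi_re_nonneg (by simp)
  have hx4 : ‖logDeriv Xi ((2:ℝ):ℂ)‖ = (logDeriv Xi ((2:ℝ):ℂ)).re := by
    have := logDeriv_Xi_conj ((2:ℝ):ℂ)
    rw [Complex.conj_ofReal] at this
    have h3 := Complex.conj_eq_iff_re.1 this.symm
    conv_lhs => rw [← h3]
    rw [Complex.norm_real, Real.norm_eq_abs, abs_of_nonneg hx0]
  have b := logDeriv_diff_le (s := σ) (s2 := ((2:ℝ):ℂ)) hX (by simp) (by simp) (by simp; linarith) (Q := 2) (by norm_num) (by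
    intro ρ hρ
    have h18 := im_sq_ge hRH hρ
    have h3 : 3 ≤ ‖(σ:ℂ) - ρ‖ := by
      have := Complex.abs_im_le_norm ((σ:ℂ) - ρ)
      simp at this
      have h4 : 3 ≤ |ρ.im| := by
        by_contra hc
        push Not at hc
        have := sq_abs ρ.im
        nlinarith [abs_nonneg ρ.im]
      linarith
    have h4 : ((2:ℝ):ℂ) - ρ = ((σ:ℂ) - ρ) + ((2 - σ : ℝ):ℂ) := by push_cast; ring
    rw [h4]
    refine (norm_add_le _ _).trans ?_
    rw [Complex.norm_real, Real.norm_eq_abs, abs_of_nonneg (by linarith)]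
    linarith)
  rw [Complex.ofReal_re] at b
  have c := norm_add_le (logDeriv Xi σ - logDeriv Xi ((2:ℝ):ℂ)) (logDeriv Xi ((2:ℝ):ℂ))
  rw [sub_add_cancel] at c
  nlinarith

lemma gg_conj (s : ℂ) : gg (conj s) = conj (gg s) := by
  have h : riemannZeta₁ = conj ∘ riemannZeta₁ ∘ conj := by funext s; simp [riemannZeta₁_conj]
  have hd : deriv riemannZeta₁ (conj s) = conj (deriv riemannZeta₁ s) := by
    conv_lhs => rw [h]
    rw [deriv_conj_conj]; simp
  unfold gg
  rw [logDeriv_apply, logDeriv_apply, riemannZeta₁_conj, hd]; simp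

lemma gg_real (σ : ℝ) : gg σ = ((gg σ).re : ℂ) := by
  have := gg_conj σ
  rw [Complex.conj_ofReal] at this
  exact (Complex.conj_eq_iff_re.1 this.symm).symm

lemma X_two_le {τ : ℝ} (h1 : 1000 ≤ τ) (h2 : τ ≤ 30001 * 10^8) : (logDeriv Xi ((2:ℝ) + τ * Complex.I)).re ≤ 14.3 := by
  rw [logDeriv_Xi_re_eq (by simp)]
  set s : ℂ := ((2:ℝ):ℂ) + τ * Complex.I with hs
  have hre : s.re = 2 := by simp [hs]
  have him : s.im = τ := by simp [hs]
  have a1 : (1/(s-1)).re ≤ 0.01 := by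
    rw [one_div, Complex.inv_re, Complex.normSq_apply]
    simp only [Complex.sub_re, Complex.sub_im, hre, him, Complex.one_re, Complex.one_im]
    rw [div_le_iff₀ (by nlinarith)]
    nlinarith
  have a2 := LSeries_two_norm hre.ge
  have a3 := (abs_le.1 (Complex.abs_re_le_norm (LSeries (fun n => (ArithmeticFunction.vonMangoldt n : ℂ)) s))).1
  have hz : 500 ≤ ‖s/2+1‖ := by
    have := Complex.abs_im_le_norm (s/2+1)
    have e : (s/2+1).im = τ/2 := by simp [him]
    rw [e, abs_of_nonneg (by linarith)] at this
    linarith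
  have hz2 : ‖s/2+1‖ ≤ 15001 * 10^8 := by
    refine (Complex.norm_le_abs_re_add_abs_im _).trans ?_
    have e : (s/2+1).im = τ/2 := by simp [him]
    have e2 : (s/2+1).re = 2 := by simp [hre]; norm_num
    rw [e, e2, abs_of_nonneg (by linarith : (0:ℝ) ≤ τ/2), abs_of_nonneg (by norm_num : (0:ℝ) ≤ 2)]
    linarith
  have hd := norm_digamma_sub_log_le (z := s/2+1) (by have : (s/2+1).re = 2 := by simp [hre]; norm_num
                                                      rw [this]; norm_num)
  have b1 : 1/‖s/2+1‖ ≤ 0.002 := by rw [div_le_iff₀ (by linarith)]; linarith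
  have b2 : 1/‖s/2+1‖^2 ≤ 0.002 := by rw [div_le_iff₀ (by positivity)]; nlinarith
  have b3 := (Complex.re_le_norm (Complex.digamma (s/2+1) - Complex.log (s/2+1)))
  rw [Complex.sub_re, Complex.log_re] at b3
  have b4 : Real.log ‖s/2+1‖ ≤ 28.1 := by
    refine (Real.log_le_log (by linarith) hz2).trans ?_
    rw [Real.log_le_iff_le_exp (by norm_num)]
    have h := Real.exp_one_gt_d9
    have e : Real.exp 28.1 = (Real.exp 1)^28 * Real.exp 0.1 := by rw [← Real.exp_nat_mul, ← Real.exp_add]; norm_num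
    have h3 : (1.1:ℝ) ≤ Real.exp 0.1 := by linarith [Real.add_one_le_exp (0.1:ℝ)]
    rw [e]
    calc (15001 * 10^8 : ℝ) ≤ (2.7182818283:ℝ)^28 * 1.1 := by norm_num
      _ ≤ _ := by gcongr
  have := one_le_log_pi
  linarith

lemma exists_T (hRH : RHT) : ∃ T : ℝ, 3*10^12 + π/3 + 1/2 ≤ T ∧ T ≤ 3*10^12 + π/3 + 1 ∧ ∀ ρ, Xi ρ = 0 → 1/92 ≤ |ρ.im - T| := by
  by_contra hc
  push Not at hc
  have hp := Real.pi_gt_d4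
  have hp2 := Real.pi_lt_d4
  set a : ℝ := 3*10^12 + π/3 + 1/2 with ha
  have h : ∀ i : Fin 23, ∃ ρ : ℂ, Xi ρ = 0 ∧ |ρ.im - (a + (2*(i:ℝ)+1)/92)| < 1/92 := by
    intro i
    have hi : (i:ℝ) ≤ 22 := by
      have := i.2
      exact_mod_cast (by omega : (i:ℕ) ≤ 22)
    have hi0 : (0:ℝ) ≤ i := by positivity
    exact hc _ (by linarith) (by linarith)
  choose r hr0 hr using h
  have hinj : Function.Injective r := by
    intro i k hik
    by_contra hne
    have h1 := abs_lt.1 (hr i)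
    have h2 := abs_lt.1 (hr k)
    rw [hik] at h1
    have hlt : (i:ℕ) < k ∨ (k:ℕ) < i := by
      rcases lt_trichotomy (i:ℕ) k with h | h | h
      · exact Or.inl h
      · exact absurd (Fin.ext h) hne
      · exact Or.inr h
    rcases hlt with h | h
    · have : (i:ℝ) + 1 ≤ k := by exact_mod_cast h
      linarith
    · have : (k:ℝ) + 1 ≤ i := by exact_mod_cast h
      linarith
  have hsum := sum_re_le (s := ((2:ℝ):ℂ) + (a + 1/4 : ℝ) * Complex.I) (by simp) (Finset.univ.image r) (by
    intro ρ hρ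
    rw [Finset.mem_image] at hρ
    obtain ⟨i, -, rfl⟩ := hρ
    exact hr0 i)
  rw [Finset.sum_image (fun i _ k _ h => hinj h)] at hsum
  have hX := X_two_le (τ := a + 1/4) (by linarith) (by linarith)
  have hlow : ∀ i : Fin 23, (0.64:ℝ) ≤ (mu (r i) : ℝ) * (1 / (((2:ℝ):ℂ) + (a + 1/4 : ℝ) * Complex.I - r i)).re := by
    intro i
    have hi : (i:ℝ) ≤ 22 := by
      have := i.2
      exact_mod_cast (by omega : (i:ℕ) ≤ 22)
    have hi0 : (0:ℝ) ≤ i := by positivity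
    have h1 := abs_lt.1 (hr i)
    have hhalf := hRH (r i) (hr0 i) (by linarith) (by linarith)
    have hm : (1:ℝ) ≤ mu (r i) := by exact_mod_cast mu_pos (hr0 i)
    have hre : (0.64:ℝ) ≤ (1 / (((2:ℝ):ℂ) + (a + 1/4 : ℝ) * Complex.I - r i)).re := by
      rw [one_div, Complex.inv_re, Complex.normSq_apply]
      simp only [Complex.sub_re, Complex.add_re, Complex.ofReal_re, Complex.mul_re, Complex.I_re, mul_zero, Complex.ofReal_im, Complex.I_im, mul_one, sub_self, add_zero, hhalf,
        Complex.sub_im, Complex.add_im, Complex.mul_im, zero_add]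
      have q : (a + 1/4 - (r i).im) * (a + 1/4 - (r i).im) ≤ 1/16 := by
        have q1 : -(1/4) ≤ a + 1/4 - (r i).im := by linarith
        have q2 : a + 1/4 - (r i).im ≤ 1/4 := by linarith
        nlinarith
      rw [le_div_iff₀ (by nlinarith [mul_self_nonneg (a + 1/4 - (r i).im)])]
      nlinarith
    nlinarith
  have h3 : (23:ℝ) * 0.64 ≤ ∑ i : Fin 23, (mu (r i) : ℝ) * (1 / (((2:ℝ):ℂ) + (a + 1/4 : ℝ) * Complex.I - r i)).re := by
    have := Finset.sum_le_sum (s := Finset.univ) (fun i _ => hlow i)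
    rw [Finset.sum_const] at this
    simpa using this
  linarith

lemma gg_top {T σ : ℝ} (h1 : -1 ≤ σ) (h2 : σ ≤ 1) (hT : 1000 ≤ T) (hT2 : T ≤ 30001 * 10^8) (hd : ∀ ρ, Xi ρ = 0 → 1/92 ≤ |ρ.im - T|) :
    ‖gg (σ + T * Complex.I)‖ ≤ 1380 * (2-σ)^2 := by
  set s : ℂ := (σ:ℂ) + T * Complex.I with hs
  have hre : s.re = σ := by simp [hs]
  have him : s.im = T := by simp [hs]
  have hX : Xi s ≠ 0 := fun h => by
    have := hd s h
    rw [him] at this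
    norm_num at this
  have a := gg_strip (s := s) (by linarith) (by linarith) (by rw [him, abs_of_nonneg (by linarith)]; exact hT2) hX
  have b := Xi_two_norm (s := ((2:ℝ):ℂ) + T * Complex.I) (by simp) (by simpa [abs_of_nonneg (by linarith : 0 ≤ T)] using hT2)
  have c := X_two_le hT hT2
  have c0 : 0 ≤ (logDeriv Xi ((2:ℝ) + T * Complex.I)).re := logDeriv_Xi_re_nonneg (by simp)
  have d := logDeriv_diff_le (s := s) (s2 := ((2:ℝ):ℂ) + T * Complex.I) hX (by simp) (by simp [him]) (by linarith) (Q := 1 + 92*(2-σ)) (by nlinarith) (by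
    intro ρ hρ
    have h3 : 1/92 ≤ ‖s - ρ‖ := by
      refine (hd ρ hρ).trans ?_
      rw [← him, abs_sub_comm, ← Complex.sub_im]
      exact Complex.abs_im_le_norm _
    have h4 : ((2:ℝ):ℂ) + T * Complex.I - ρ = (s - ρ) + ((2 - σ : ℝ):ℂ) := by rw [hs]; push_cast; ring
    rw [h4]
    refine (norm_add_le _ _).trans ?_
    rw [Complex.norm_real, Real.norm_eq_abs, abs_of_nonneg (by linarith)]
    nlinarith)
  have e := norm_add_le (logDeriv Xi s - logDeriv Xi ((2:ℝ) + T * Complex.I)) (logDeriv Xi ((2:ℝ) + T * Complex.I))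
  rw [sub_add_cancel] at e
  rw [hre] at d
  have f : (2-σ) * (1 + 92*(2-σ)) * (logDeriv Xi ((2:ℝ) + T * Complex.I)).re ≤ (2-σ) * (1 + 92*(2-σ)) * 14.3 :=
    mul_le_mul_of_nonneg_left c (by nlinarith)
  nlinarith

end PB

namespace PB
open Filter Topology Metric MeasureTheory
open scoped ComplexConjugate

lemma int_lin_exp {a : ℝ} (ha : 0 < a) : ∫ σ in (-1:ℝ)..1, (1-σ) * Real.exp (-a*(1-σ)) ≤ 1/a^2 := by
  have hd : ∀ σ : ℝ, HasDerivAt (fun σ => Real.exp (-a*(1-σ)) * ((1-σ)/a + 1/a^2)) ((1-σ) * Real.exp (-a*(1-σ))) σ := by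
    intro σ
    have h1 : HasDerivAt (fun σ : ℝ => 1 - σ) (-1) σ := by
      simpa using (hasDerivAt_id σ).const_sub 1
    have h2 := (h1.const_mul (-a)).exp
    have h3 := (h1.div_const a).add_const (1/a^2)
    refine (h2.mul h3).congr_deriv ?_
    field_simp
    ring
  rw [intervalIntegral.integral_eq_sub_of_hasDerivAt (fun σ _ => hd σ) (by
    apply Continuous.intervalIntegrable; fun_prop)]
  have : 0 ≤ Real.exp (-a*(1-(-1))) * ((1-(-1))/a + 1/a^2) := by positivity
  simp only [sub_self, mul_zero, Real.exp_zero, one_mul, zero_div, zero_add]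
  linarith

lemma Phi_eq {l j T L : ℝ} {s : ℂ} (hT : 0 < T) (hs : s ≠ (1 - l*T/(2*π) : ℝ)) :
    PP l j T L s * dslope gg (1 - l*T/(2*π) : ℝ) s = Kz l j T s * Complex.exp ((s-1)*L) * (gg s - gg (1 - l*T/(2*π) : ℝ)) := by
  rw [PP_eq hT hs, dslope_of_ne _ hs, slope_def_field]
  have := sub_ne_zero_of_ne hs
  generalize ((1 - l*T/(2*π) : ℝ) : ℂ) = c at *
  field_simp

lemma Kz_real_arg {l T σ : ℝ} (hT : 0 < T) : 2*π/T * (σ - (1 - l*T/(2*π))) - l = 2*π/T*(σ-1) := by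
  have := Real.pi_ne_zero
  field_simp
  ring

lemma HH_bd {l j T σ : ℝ} (hj : j = 0 ∨ j = 1) (hT : 0 < T) (hσ : σ ≤ 1) :
    |HH l j (2*π/T * (σ - (1 - l*T/(2*π))))| ≤ (1-σ)/T := by
  refine (HH_sign hj).2.2.trans ?_
  rw [Kz_real_arg hT, abs_mul, abs_of_pos (by positivity : 0 < 2*π/T), abs_of_nonpos (by linarith)]
  have := Real.pi_ne_zero
  apply le_of_eq
  field_simp
  ring

lemma abs_im_integral_le {f : ℝ → ℂ} {g : ℝ → ℝ} {a b : ℝ} (hab : a ≤ b) (h : ∀ᵐ t, t ∈ Set.Ioc a b → |(f t).im| ≤ g t)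
    (hg : IntervalIntegrable g volume a b) (hg0 : 0 ≤ ∫ t in a..b, g t) : |(∫ t in a..b, f t).im| ≤ ∫ t in a..b, g t := by
  by_cases hf : IntervalIntegrable f volume a b
  · have := Complex.imCLM.intervalIntegral_comp_comm hf
    simp only [Complex.imCLM_apply] at this
    rw [← this, ← Real.norm_eq_abs]
    exact intervalIntegral.norm_integral_le_of_norm_le hab (by simpa [Real.norm_eq_abs] using h) hg
  · rw [intervalIntegral.integral_undef hf]; simpa using hg0

lemma Phi_bottom (hRH : RHT) {l j T L : ℝ} (hj : j = 0 ∨ j = 1) (hT : 0 < T) (hε0 : 0 ≤ l*T/(2*π)) (hε : l*T/(2*π) ≤ 1) (hL : 0 < L) :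
    |(∫ x in (-1:ℝ)..1, PP l j T L (x + (0:ℝ) * Complex.I) * dslope gg (1 - l*T/(2*π) : ℝ) (x + (0:ℝ) * Complex.I)).im| ≤ 60/T * (1/L^2) := by
  have hb := int_lin_exp hL
  have hc : Continuous fun σ : ℝ => 60/T * ((1-σ) * Real.exp (-L*(1-σ))) := by fun_prop
  have hi : ∫ σ in (-1:ℝ)..1, 60/T * ((1-σ) * Real.exp (-L*(1-σ))) = 60/T * ∫ σ in (-1:ℝ)..1, (1-σ) * Real.exp (-L*(1-σ)) := by
    rw [intervalIntegral.integral_const_mul]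
  refine (abs_im_integral_le (g := fun σ => 60/T * ((1-σ) * Real.exp (-L*(1-σ)))) (by norm_num) ?_ (hc.intervalIntegrable _ _) ?_).trans ?_
  · have hne : ∀ᵐ σ : ℝ, σ ≠ 1 - l*T/(2*π) := by
      simp [ae_iff, measure_singleton]
    filter_upwards [hne] with σ hσ hm
    have hx : ((σ:ℂ) + (0:ℝ) * Complex.I) = (σ:ℂ) := by simp
    rw [hx, Phi_eq hT (by exact_mod_cast hσ), gg_real σ, gg_real (1 - l*T/(2*π))]
    have hK : (Kz l j T σ).im = HH l j (2*π/T * (σ - (1 - l*T/(2*π)))) := by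
      unfold Kz
      rw [← Complex.ofReal_sub, ← Complex.ofReal_mul, kk_bot _ _ (mul_ne_zero (by positivity) (sub_ne_zero_of_ne hσ))]
      simp only [Complex.add_im, Complex.ofReal_im, Complex.mul_im, Complex.I_re, Complex.I_im, Complex.ofReal_re]
      ring
    have he : Complex.exp (((σ:ℂ)-1)*L) = ((Real.exp (-L*(1-σ)) : ℝ) : ℂ) := by
      push_cast; congr 1; ring
    rw [he, ← Complex.ofReal_sub, Complex.im_mul_ofReal, Complex.im_mul_ofReal, hK, abs_mul, abs_mul, Real.abs_exp]
    have h1 := HH_bd (l := l) hj hT hm.2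
    have h2 : |(gg σ).re - (gg (1 - l*T/(2*π) : ℝ)).re| ≤ 60 := by
      have a := (Complex.abs_re_le_norm _).trans (gg_real_norm hRH hm.1.le hm.2)
      have b := (Complex.abs_re_le_norm _).trans (gg_real_norm hRH (σ := 1 - l*T/(2*π)) (by linarith) (by linarith))
      have := abs_sub (gg σ).re (gg (1 - l*T/(2*π) : ℝ)).re
      linarith
    have h3 : 0 ≤ (1-σ)/T := div_nonneg (by linarith [hm.2]) hT.le
    calc _ ≤ (1-σ)/T * Real.exp (-L*(1-σ)) * 60 := by gcongr
      _ = _ := by ring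
  · apply intervalIntegral.integral_nonneg (by norm_num)
    intro σ hσ
    have : 0 ≤ 1 - σ := by linarith [hσ.2]
    positivity
  · rw [hi]
    exact mul_le_mul_of_nonneg_left hb (by positivity)

lemma Phi_top (hRH : RHT) {l j T L : ℝ} (hj : j = 0 ∨ j = 1) (hT : 1000 ≤ T) (hT2 : T ≤ 30001 * 10^8) (hd : ∀ ρ, Xi ρ = 0 → 1/92 ≤ |ρ.im - T|)
    (hε0 : 0 ≤ l*T/(2*π)) (hε : l*T/(2*π) ≤ 1) (hL : 2 < L) :
    ‖∫ x in (-1:ℝ)..1, PP l j T L (x + T * Complex.I) * dslope gg (1 - l*T/(2*π) : ℝ) (x + T * Complex.I)‖ ≤ 1410/T * (1/(L-2)^2) := by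
  have hT0 : 0 < T := by linarith
  have hb := int_lin_exp (a := L-2) (by linarith)
  have hc : Continuous fun σ : ℝ => 1410/T * ((1-σ) * Real.exp (-(L-2)*(1-σ))) := by fun_prop
  have hi : ∫ σ in (-1:ℝ)..1, 1410/T * ((1-σ) * Real.exp (-(L-2)*(1-σ))) = 1410/T * ∫ σ in (-1:ℝ)..1, (1-σ) * Real.exp (-(L-2)*(1-σ)) := by
    rw [intervalIntegral.integral_const_mul]
  refine (intervalIntegral.norm_integral_le_of_norm_le (g := fun σ => 1410/T * ((1-σ) * Real.exp (-(L-2)*(1-σ)))) (by norm_num) ?_ (hc.intervalIntegrable _ _)).trans ?_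
  · refine Filter.Eventually.of_forall fun σ hm => ?_
    have hne : (σ:ℂ) + T * Complex.I ≠ (1 - l*T/(2*π) : ℝ) := fun h => by
      have := congrArg Complex.im h
      rw [Complex.ofReal_im] at this
      simp at this; linarith
    rw [Phi_eq hT0 hne]
    have hK : Kz l j T (σ + T * Complex.I) = Complex.I * HH l j (2*π/T * (σ - (1 - l*T/(2*π)))) := by
      unfold Kz
      rw [← kk_top]
      congr 1
      have : (T:ℂ) ≠ 0 := by exact_mod_cast hT0.ne'
      push_cast
      field_simp
      ring
    have he : ‖Complex.exp (((σ:ℂ) + T * Complex.I - 1)*L)‖ = Real.exp (-L*(1-σ)) := by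
      rw [Complex.norm_exp]; congr 1; simp; ring
    rw [hK, norm_mul, norm_mul, norm_mul, he, Complex.norm_I, one_mul, Complex.norm_real, Real.norm_eq_abs]
    have h1 := HH_bd (l := l) hj hT0 hm.2
    have h3 : 0 ≤ (1-σ)/T := div_nonneg (by linarith [hm.2]) hT0.le
    have h2 : ‖gg (σ + T * Complex.I) - gg (1 - l*T/(2*π) : ℝ)‖ ≤ 1410 * Real.exp (2*(1-σ)) := by
      have a := gg_top hm.1.le hm.2 hT hT2 hd
      have b := gg_real_norm hRH (σ := 1 - l*T/(2*π)) (by linarith) (by linarith)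
      have c := norm_sub_le (gg (σ + T * Complex.I)) (gg (1 - l*T/(2*π) : ℝ))
      have d := Real.add_one_le_exp (1-σ)
      have e : Real.exp (2*(1-σ)) = Real.exp (1-σ)^2 := by rw [← Real.exp_nat_mul]; norm_num
      have hm2 := hm.2
      have f : (2-σ)^2 ≤ Real.exp (1-σ)^2 := by
        apply pow_le_pow_left₀ (by linarith); linarith
      have f1 : 1 ≤ (2-σ)^2 := by nlinarith
      rw [e]
      linarith
    calc _ ≤ (1-σ)/T * Real.exp (-L*(1-σ)) * (1410 * Real.exp (2*(1-σ))) := by gcongr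
      _ = 1410/T * ((1-σ) * (Real.exp (-L*(1-σ)) * Real.exp (2*(1-σ)))) := by ring
      _ = _ := by rw [← Real.exp_add]; congr 4; ring
  · rw [hi]
    exact mul_le_mul_of_nonneg_left hb (by positivity)

lemma Phi_left (hRH : RHT) {l j T L : ℝ} (hj : j = 0 ∨ j = 1) (hT : 1000000 ≤ T) (hT2 : T ≤ 30001 * 10^8)
    (hl : |l| ≤ 1/100) (hε0 : 0 ≤ l*T/(2*π)) (hε : l*T/(2*π) ≤ 1) :
    ‖∫ t in (0:ℝ)..T, PP l j T L ((-1:ℝ) + t * Complex.I) * dslope gg (1 - l*T/(2*π) : ℝ) ((-1:ℝ) + t * Complex.I)‖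
      ≤ 17 * (T/(2*π)) * Real.exp (-2*L) * (73*1.4143) * 29 := by
  have hT0 : 0 < T := by linarith
  have hp := Real.pi_pos
  have hp2 := Real.pi_lt_d4
  set C : ℝ := 17 * (T/(2*π)) * Real.exp (-2*L) * (73*1.4143) with hC
  have hC0 : 0 ≤ C := by positivity
  have hintg : ∫ t in (0:ℝ)..T, C * (1 / (t + 1)) = C * Real.log (T+1) := by
    rw [intervalIntegral.integral_const_mul]
    congr 1
    rw [intervalIntegral.integral_comp_add_right (fun t => 1/t) 1, integral_one_div_of_pos (by norm_num) (by linarith)]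
    simp
  have hii : IntervalIntegrable (fun t : ℝ => C * (1/(t+1))) volume 0 T := by
    apply ContinuousOn.intervalIntegrable
    intro t ht
    rw [Set.uIcc_of_le hT0.le] at ht
    have : t + 1 ≠ 0 := by linarith [ht.1]
    exact ContinuousAt.continuousWithinAt (by fun_prop (disch := assumption))
  refine (intervalIntegral.norm_integral_le_of_norm_le (g := fun t => C * (1/(t+1))) hT0.le ?_ hii).trans ?_
  · refine Filter.Eventually.of_forall fun t hm => ?_
    have ht0 := hm.1
    set s : ℂ := ((-1:ℝ):ℂ) + t * Complex.I with hs
    have hsre : s.re = -1 := by simp [hs]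
    have hsim : s.im = t := by simp [hs]
    have hne : s ≠ (1 - l*T/(2*π) : ℝ) := fun h => by
      have := congrArg Complex.im h
      rw [hsim, Complex.ofReal_im] at this
      linarith
    have hκ : 2*π/T ≤ 1/200 := by rw [div_le_iff₀ hT0]; linarith
    have hκ0 : 0 < 2*π/T := by positivity
    have hPP : ‖PP l j T L s‖ ≤ 17 * (T/(2*π)) * Real.exp (-2*L) := by
      unfold PP
      have hw := norm_Wq_le hj hl (z := (2*π/T : ℝ) * (s - (1 - l*T/(2*π) : ℝ))) (by
        rw [Complex.re_ofReal_mul, Complex.sub_re, Complex.ofReal_re, hsre, abs_mul, abs_of_pos hκ0, abs_of_nonpos (by linarith)]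
        nlinarith) (by
        rw [Complex.im_ofReal_mul, Complex.sub_im, Complex.ofReal_im, hsim]
        have : 0 ≤ t - 0 := by linarith
        positivity) (by
        rw [Complex.im_ofReal_mul, Complex.sub_im, Complex.ofReal_im, hsim, sub_zero, div_mul_eq_mul_div, div_le_iff₀ hT0]
        nlinarith [hm.2])
      have he : ‖Complex.exp ((s - 1)*L)‖ = Real.exp (-2*L) := by
        rw [Complex.norm_exp]; congr 1
        rw [Complex.re_mul_ofReal, Complex.sub_re, hsre]; norm_num
      rw [norm_mul, norm_div, he, Complex.norm_real, Real.norm_eq_abs, abs_of_pos hκ0, div_eq_mul_inv, inv_div]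
      gcongr
    have hds : ‖dslope gg (1 - l*T/(2*π) : ℝ) s‖ ≤ 73*1.4143*(1/(t+1)) := by
      rw [dslope_of_ne _ hne, slope_def_field, norm_div]
      have a : ‖gg s‖ ≤ 43 := by
        have := gg_left (t := t) (by rw [abs_of_pos ht0]; linarith [hm.2])
        rw [hs]; simpa using this
      have b := gg_real_norm hRH (σ := 1 - l*T/(2*π)) (by linarith) (by linarith)
      have c := norm_sub_le (gg s) (gg (1 - l*T/(2*π) : ℝ))
      have d : t + 1 ≤ 1.4143 * ‖s - (1 - l*T/(2*π) : ℝ)‖ := by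
        have e : ‖s - (1 - l*T/(2*π) : ℝ)‖^2 = (-1 - (1 - l*T/(2*π)))^2 + t^2 := by
          rw [Complex.sq_norm, Complex.normSq_apply, Complex.sub_re, Complex.sub_im, hsre, hsim, Complex.ofReal_re, Complex.ofReal_im]
          ring
        apply abs_le_of_sq_le_sq' _ (by positivity) |>.2
        rw [mul_pow, e]
        nlinarith [sq_nonneg (t-1)]
      have hpos : 0 < ‖s - (1 - l*T/(2*π) : ℝ)‖ := norm_pos_iff.2 (sub_ne_zero_of_ne hne)
      rw [div_le_iff₀ hpos]
      have : 73 * 1.4143 * (1/(t+1)) * ‖s - (1 - l*T/(2*π) : ℝ)‖ = 73 * (1.4143 * ‖s - (1 - l*T/(2*π) : ℝ)‖/(t+1)) := by ring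
      rw [this]
      have : 1 ≤ 1.4143 * ‖s - (1 - l*T/(2*π) : ℝ)‖/(t+1) := by rw [le_div_iff₀ (by linarith)]; linarith
      linarith
    rw [norm_mul]
    calc _ ≤ 17 * (T/(2*π)) * Real.exp (-2*L) * (73*1.4143*(1/(t+1))) := by gcongr
      _ = _ := by rw [hC]; ring
  · rw [hintg]
    apply mul_le_mul_of_nonneg_left _ hC0
    refine le_trans (Real.log_le_log (by linarith) ?_) log_big
    linarith

lemma Phi_right {l j T L : ℝ} (hT : 0 < T) (hl : 0 < l) :
    (2/T) * (∫ t in (0:ℝ)..T, PP l j T L ((1:ℝ) + t * Complex.I) * dslope gg (1 - l*T/(2*π) : ℝ) ((1:ℝ) + t * Complex.I)).re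
     = Dd l j T L 0 - (gg (1 - l*T/(2*π) : ℝ)).re * FF l j (T/(2*π) * L) := by
  have hp := Real.pi_pos
  set s0 : ℝ := 1 - l*T/(2*π) with hs0
  have hs01 : s0 < 1 := by
    have : 0 < l*T/(2*π) := by positivity
    rw [hs0]; linarith
  have hgc : Continuous fun τ : ℝ => gg (((1 + max 0 0 : ℝ) : ℂ) + (τ : ℂ) * Complex.I) := by
    rw [continuous_iff_continuousAt]
    intro τ
    apply ContinuousAt.comp (g := gg)
    · exact (gg_diffAt (riemannZeta₁_ne (by simp))).continuousAt
    · fun_prop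
  have hkc := kt_cont (j := j) (T := T) hl
  have e1 : ∀ t : ℝ, PP l j T L ((1:ℝ) + t * Complex.I) * dslope gg s0 ((1:ℝ) + t * Complex.I)
     = kt l j T t * Complex.exp ((t * L : ℝ) * Complex.I) * gg (((1 + max 0 0 : ℝ) : ℂ) + (t : ℂ) * Complex.I)
       - (kt l j T t * Complex.exp ((t * L : ℝ) * Complex.I)) * ((gg s0).re : ℂ) := by
    intro t
    have hne : ((1:ℝ):ℂ) + t * Complex.I ≠ s0 := fun h => by
      have := congrArg Complex.re h
      simp at this; linarith
    rw [hs0, Phi_eq hT hne, ← gg_real]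
    have hK : Kz l j T ((1:ℝ) + t * Complex.I) = kt l j T t := by
      unfold Kz kt
      congr 1
      have : (T:ℂ) ≠ 0 := by exact_mod_cast hT.ne'
      have : (π:ℂ) ≠ 0 := by exact_mod_cast hp.ne'
      push_cast
      field_simp
      ring
    rw [hK]
    have e2 : (((1:ℝ):ℂ) + t * Complex.I - 1) * L = (t * L : ℝ) * Complex.I := by push_cast; ring
    rw [e2]
    simp only [max_self, add_zero]
    ring
  simp only [e1]
  rw [intervalIntegral.integral_sub, intervalIntegral.integral_mul_const, Complex.sub_re, Complex.re_mul_ofReal, FF_T hT]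
  · unfold Dd
    ring
  · apply Continuous.intervalIntegrable; fun_prop
  · apply Continuous.intervalIntegrable; fun_prop

/-- explicit-formula estimate -/
lemma E2 (hRH : RHT) {l j T L : ℝ} (hj : j = 0 ∨ j = 1) (hT : 1000000 ≤ T) (hT2 : T ≤ 30001 * 10^8)
    (hTh : T ≤ 3*(10:ℝ)^12+1+π/3) (hd : ∀ ρ, Xi ρ = 0 → 1/92 ≤ |ρ.im - T|)
    (hl : 0 < l) (hl1 : l ≤ 1/100) (hε : l*T/(2*π) ≤ 1) (hL : 2 < L) :
    |Dd l j T L 0 - (gg (1 - l*T/(2*π) : ℝ)).re * Real.exp (-(l*T/(2*π))*L)|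
      ≤ (4*π/T) * (∑ ρ ∈ ZT T, (mu ρ : ℝ) * ‖Kz l j T ρ‖) * Real.exp (-L/2) + 3060/T^2 * (1/(L-2)^2) + 16210 * Real.exp (-2*L) := by
  have hT0 : 0 < T := by linarith
  have hp := Real.pi_pos
  have hp1 := Real.pi_gt_d4
  have hε0 : 0 ≤ l*T/(2*π) := by positivity
  have hb := Phi_bottom hRH (l := l) (L := L) hj hT0 hε0 hε (by linarith)
  have ht := Phi_top hRH (l := l) hj (by linarith) hT2 hd hε0 hε hL
  have hle := Phi_left hRH (l := l) (L := L) hj hT hT2 (by rw [abs_of_pos hl]; exact hl1) hε0 hε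
  have hr := Phi_right (j := j) (L := L) hT0 hl
  have hc := contour (l := l) (j := j) (L := L) hT0 hε0 hε (fun ρ hρ => by
    obtain ⟨h1, h2, h3⟩ := mem_ZT.1 hρ
    refine lt_of_le_of_ne h3 fun h => ?_
    have := hd ρ h1
    rw [h] at this; norm_num at this)
  unfold RI at hc
  set B := ∫ x in (-1:ℝ)..1, PP l j T L (x + (0:ℝ) * Complex.I) * dslope gg (1 - l*T/(2*π) : ℝ) (x + (0:ℝ) * Complex.I)
  set Tp := ∫ x in (-1:ℝ)..1, PP l j T L (x + T * Complex.I) * dslope gg (1 - l*T/(2*π) : ℝ) (x + T * Complex.I)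
  set R := ∫ t in (0:ℝ)..T, PP l j T L ((1:ℝ) + t * Complex.I) * dslope gg (1 - l*T/(2*π) : ℝ) ((1:ℝ) + t * Complex.I)
  set Lf := ∫ t in (0:ℝ)..T, PP l j T L ((-1:ℝ) + t * Complex.I) * dslope gg (1 - l*T/(2*π) : ℝ) ((-1:ℝ) + t * Complex.I)
  set Z := ∑ ρ ∈ ZT T, (mu ρ : ℂ) * (Kz l j T ρ * Complex.exp ((ρ-1)*L)) with hZ
  set S := ∑ ρ ∈ ZT T, (mu ρ : ℝ) * ‖Kz l j T ρ‖ with hS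
  have hZn : ‖Z‖ ≤ S * Real.exp (-L/2) := by
    rw [hZ, hS, Finset.sum_mul]
    refine norm_sum_le_of_le _ fun ρ hρ => ?_
    have hre := ZT_half hRH hTh ρ hρ
    rw [norm_mul, norm_mul, Complex.norm_natCast, Complex.norm_exp, Complex.re_mul_ofReal, Complex.sub_re, hre, Complex.one_re]
    have : ((1/2:ℝ) - 1) * L = -L/2 := by ring
    rw [this, mul_assoc]
  have him := congrArg Complex.im hc
  have hI : B.im - Tp.im + R.re - Lf.re = -(2*π*Z.re) := by
    simpa using him
  have hF := FF_EE_bd (u := T/(2*π)*L) hj hl (by positivity)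
  rw [EE, if_pos (by positivity)] at hF
  have hexp : -l * (T/(2*π)*L) = -(l*T/(2*π))*L := by ring
  rw [hexp] at hF
  have hg := (Complex.abs_re_le_norm _).trans (gg_real_norm hRH (σ := 1 - l*T/(2*π)) (by linarith) (by linarith))
  set g := (gg (1 - l*T/(2*π) : ℝ)).re
  set F := FF l j (T/(2*π)*L)
  set E := Real.exp (-(l*T/(2*π))*L)
  have hL2 : 1/L^2 ≤ 1/(L-2)^2 := by
    apply one_div_le_one_div_of_le
    · have : 0 < L - 2 := by linarith
      positivity
    · nlinarith
  have hF2 : 1/(π^2*(T/(2*π)*L)^2) = 4/T^2 * (1/L^2) := by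
    field_simp
    ring
  have hZ1 := (Complex.abs_re_le_norm Z).trans hZn
  have ht1 := (Complex.abs_im_le_norm Tp).trans ht
  have hl1' := (Complex.abs_re_le_norm Lf).trans hle
  have hR : R.re = Lf.re - 2*π*Z.re - B.im + Tp.im := by linarith
  have hdec : Dd l j T L 0 - g*E = (2/T)*Lf.re - (2/T)*(2*π*Z.re) - (2/T)*B.im + (2/T)*Tp.im + g*(F-E) := by
    have : Dd l j T L 0 = (2/T)*R.re + g*F := by linarith
    rw [this, hR]; ring
  rw [hdec]
  have h2T : 0 < 2/T := by positivity
  have q1 : |(2/T)*Lf.re| ≤ 16210 * Real.exp (-2*L) := by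
    rw [abs_mul, abs_of_pos h2T]
    have := mul_le_mul_of_nonneg_left hl1' h2T.le
    refine this.trans ?_
    have e : 2/T*(17 * (T/(2*π)) * Real.exp (-2*L) * (73*1.4143) * 29) = (17*73*1.4143*29/π)*Real.exp (-2*L) := by
      field_simp
    rw [e]
    apply mul_le_mul_of_nonneg_right _ (Real.exp_pos _).le
    rw [div_le_iff₀ hp]
    nlinarith
  have q2 : |(2/T)*(2*π*Z.re)| ≤ (4*π/T) * S * Real.exp (-L/2) := by
    rw [abs_mul, abs_of_pos h2T, abs_mul, abs_of_pos (by positivity : 0 < 2*π)]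
    have := mul_le_mul_of_nonneg_left hZ1 (by positivity : 0 ≤ 4*π/T)
    calc _ = 4*π/T*|Z.re| := by ring
      _ ≤ _ := this
      _ = _ := by ring
  have q3 : |(2/T)*B.im| ≤ 120/T^2 * (1/(L-2)^2) := by
    rw [abs_mul, abs_of_pos h2T]
    refine (mul_le_mul_of_nonneg_left hb h2T.le).trans ?_
    have e : 2/T*(60/T*(1/L^2)) = 120/T^2*(1/L^2) := by field_simp; norm_num
    rw [e]
    exact mul_le_mul_of_nonneg_left hL2 (by positivity)
  have q4 : |(2/T)*Tp.im| ≤ 2820/T^2 * (1/(L-2)^2) := by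
    rw [abs_mul, abs_of_pos h2T]
    refine (mul_le_mul_of_nonneg_left ht1 h2T.le).trans (le_of_eq ?_)
    rw [← mul_assoc]; congr 1
    field_simp; norm_num
  have q5 : |g*(F-E)| ≤ 120/T^2 * (1/(L-2)^2) := by
    rw [abs_mul]
    rw [hF2] at hF
    have : |g| * |F-E| ≤ 30 * (4/T^2*(1/L^2)) := mul_le_mul hg hF (abs_nonneg _) (by norm_num)
    refine this.trans ?_
    have e : 30 * (4/T^2*(1/L^2)) = 120/T^2*(1/L^2) := by ring
    rw [e]
    exact mul_le_mul_of_nonneg_left hL2 (by positivity)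
  have e : 3060/T^2 * (1/(L-2)^2) = 120/T^2 * (1/(L-2)^2) + 2820/T^2 * (1/(L-2)^2) + 120/T^2 * (1/(L-2)^2) := by ring
  rw [e]
  rw [abs_le] at q1 q2 q3 q4 q5 ⊢
  constructor <;> linarith [q1.1, q1.2, q2.1, q2.2, q3.1, q3.2, q4.1, q4.2, q5.1, q5.2]

end PB

namespace PB
open Filter Topology Metric MeasureTheory
open scoped ComplexConjugate

noncomputable def cc (t : ℝ) : ℝ := π*t*Real.cos (π*t)/Real.sin (π*t)

lemma cc_lim {t : ℝ} (h0 : 0 < t) (h1 : t ≤ 1/2) :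
    Tendsto (fun n : ℕ => 2*t^2 * (1/(1-t^2) + ∑ j ∈ Finset.range n, 1/(((j:ℝ)+2)^2 - t^2))) atTop (𝓝 (1 - cc t)) := by
  have hmem : (t:ℂ) ∈ Complex.integerComplement := by
    rintro ⟨n, hn⟩
    have hn' : (n:ℝ) = t := by exact_mod_cast hn
    have h2 : (0:ℝ) < n := by rw [hn']; exact h0
    have h3 : (n:ℝ) < 1 := by rw [hn']; linarith
    have h2' : 0 < n := by exact_mod_cast h2
    have h3' : n < 1 := by exact_mod_cast h3
    omega
  have h := tendsto_logDeriv_euler_cot_sub hmem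
  have h2 := ((Complex.continuous_re.tendsto _).comp ((tendsto_add_atTop_iff_nat 1).2 h)).const_mul (-t)
  have hs : Real.sin (π*t) ≠ 0 := by
    apply ne_of_gt
    apply Real.sin_pos_of_pos_of_lt_pi
    · positivity
    · nlinarith [Real.pi_pos]
  have e : -t * (π * Complex.cot (π * t) - 1/t : ℂ).re = 1 - cc t := by
    have : (π * Complex.cot (π * t) - 1/t : ℂ) = ((π * (Real.cos (π*t)/Real.sin (π*t)) - 1/t : ℝ) : ℂ) := by
      rw [Complex.cot]; push_cast; ring
    rw [this, Complex.ofReal_re, cc]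
    field_simp
    ring
  rw [e] at h2
  refine h2.congr fun n => ?_
  have e2 : ∀ j : ℕ, cotTerm (t:ℂ) j = ((-(2*t) * (1/(((j:ℝ)+1)^2 - t^2)) : ℝ) : ℂ) := by
    intro j
    rw [cotTerm_identity hmem]
    have : ((j:ℝ)+1)^2 - t^2 ≠ 0 := by
      have : (0:ℝ) ≤ j := by positivity
      nlinarith
    have h3 : ((j:ℂ)+1)^2 - (t:ℂ)^2 ≠ 0 := by exact_mod_cast this
    have e4 : ((t:ℂ) + (j+1)) * (t - (j+1)) = -(((j:ℂ)+1)^2 - (t:ℂ)^2) := by ring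
    rw [e4]
    push_cast
    field_simp
  simp only [Function.comp, e2]
  rw [← Complex.ofReal_sum, Complex.ofReal_re, Finset.sum_range_succ', ← Finset.mul_sum]
  have e5 : ∀ j : ℕ, ((j+1:ℕ):ℝ)+1 = (j:ℝ)+2 := by intro j; push_cast; ring
  simp only [e5]
  push_cast
  rw [zero_add, one_pow]
  ring

lemma cc_le {t : ℝ} (h0 : 0 < t) (h1 : t ≤ 1/2) : cc t ≤ 1 - 3.28*t^2 - 2*t^4 := by
  have hl := cc_lim h0 h1
  have hz := ((hasSum_zeta_two.tendsto_sum_nat.comp (tendsto_add_atTop_nat 2)).add_const (1/(1-t^2) - 1)).const_mul (2*t^2)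
  have ht : 0 < 1 - t^2 := by nlinarith
  have := le_of_tendsto_of_tendsto' hz hl (fun n => by
    apply mul_le_mul_of_nonneg_left _ (by positivity)
    simp only [Function.comp]
    rw [Finset.sum_range_succ', Finset.sum_range_succ']
    have e : ∀ j : ℕ, ((j+1+1:ℕ):ℝ) = (j:ℝ)+2 := by intro j; push_cast; ring
    simp only [e]
    have : ∑ k ∈ Finset.range n, 1/((k:ℝ)+2)^2 ≤ ∑ j ∈ Finset.range n, 1/(((j:ℝ)+2)^2 - t^2) := by
      apply Finset.sum_le_sum
      intro i _
      have : (0:ℝ) ≤ i := by positivity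
      apply one_div_le_one_div_of_le
      · nlinarith
      · nlinarith
    norm_num at this ⊢
    linarith)
  have h2 : 1 + t^2 ≤ 1/(1-t^2) := by rw [le_div_iff₀ ht]; nlinarith [sq_nonneg (t^2)]
  have h3 : 1.64 ≤ π^2/6 := by nlinarith [Real.pi_gt_d4]
  have h4 : 2*t^2*(1.64 + (1+t^2-1)) ≤ 2*t^2*(π^2/6+(1/(1-t^2)-1)) := by
    apply mul_le_mul_of_nonneg_left _ (by positivity)
    linarith
  nlinarith

lemma cc_ge {t : ℝ} (h0 : 0 < t) (h1 : t ≤ 1/2) : 1 - cc t ≤ 10/3*t^2 + 8/3*t^4 := by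
  have hl := cc_lim h0 h1
  have ht : 0 < 1 - t^2 := by nlinarith
  have hs : ∀ n : ℕ, ∑ j ∈ Finset.range n, 1/(((j:ℝ)+2)^2 - t^2) ≤ 2/3 - 1/((n:ℝ)+3/2) := by
    intro n
    induction n with
    | zero => norm_num
    | succ k ih =>
      rw [Finset.sum_range_succ]
      have hk : (0:ℝ) ≤ k := by positivity
      have a : 1/(((k:ℝ)+2)^2 - t^2) ≤ 1/(((k:ℝ)+3/2)*((k:ℝ)+5/2)) := by
        apply one_div_le_one_div_of_le (by positivity)
        nlinarith
      have b : 1/(((k:ℝ)+3/2)*((k:ℝ)+5/2)) = 1/((k:ℝ)+3/2) - 1/((k:ℝ)+5/2) := by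
        field_simp; ring
      push_cast
      have c : (k:ℝ)+1+3/2 = k + 5/2 := by ring
      rw [c]
      linarith
  have := le_of_tendsto' (a := 1 - cc t) (b := 2*t^2*(1/(1-t^2) + 2/3)) hl (fun n => by
    apply mul_le_mul_of_nonneg_left _ (by positivity)
    have := hs n
    have : 0 ≤ 1/((n:ℝ)+3/2) := by positivity
    linarith [hs n])
  have h2 : 1/(1-t^2) ≤ 1 + 4/3*t^2 := by rw [div_le_iff₀ ht]; nlinarith [sq_nonneg t, mul_nonneg (sq_nonneg t) (by nlinarith : 0 ≤ 1/4 - t^2)]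
  have h4 : 2*t^2*(1/(1-t^2) + 2/3) ≤ 2*t^2*(1 + 4/3*t^2 + 2/3) := by
    apply mul_le_mul_of_nonneg_left _ (by positivity)
    linarith
  nlinarith

lemma cc_nonneg {t : ℝ} (h0 : 0 < t) (h1 : t ≤ 1/2) : 0 ≤ cc t ∧ cc t ≤ 1 := by
  constructor
  · have hp := Real.pi_pos
    have : 0 ≤ Real.cos (π*t) := Real.cos_nonneg_of_mem_Icc ⟨by nlinarith, by nlinarith⟩
    have : 0 ≤ Real.sin (π*t) := Real.sin_nonneg_of_nonneg_of_le_pi (by positivity) (by nlinarith)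
    unfold cc
    positivity
  · have := cc_le h0 h1
    nlinarith [sq_nonneg t, sq_nonneg (t^2)]

lemma BB_imag {t : ℝ} (h0 : t ≠ 0) (hs : Real.sin (π*t) ≠ 0) : BB ((2*π*t:ℝ) * Complex.I) = (cc t : ℂ) - (π*t:ℝ) * Complex.I := by
  have hp := Real.pi_ne_zero
  rw [BB_of_ne (mul_ne_zero (by exact_mod_cast mul_ne_zero (mul_ne_zero two_ne_zero hp) h0) Complex.I_ne_zero)]
  have e : Complex.exp ((2*π*t:ℝ)*Complex.I) - 1 = 2 * Complex.I * Real.sin (π*t) * (Real.cos (π*t) + Real.sin (π*t) * Complex.I) := by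
    have h1 : ((2*π*t:ℝ):ℂ)*Complex.I = ((π*t:ℝ):ℂ)*Complex.I + ((π*t:ℝ):ℂ)*Complex.I := by push_cast; ring
    rw [h1, Complex.exp_add, Complex.exp_mul_I, ← Complex.ofReal_cos, ← Complex.ofReal_sin]
    have h2 : ((Real.sin (π*t):ℝ):ℂ)^2 + ((Real.cos (π*t):ℝ):ℂ)^2 = 1 := by exact_mod_cast Real.sin_sq_add_cos_sq (π*t)
    linear_combination h2 - (Real.sin (π*t):ℂ)^2 * Complex.I_sq
  have hI := Complex.I_sq
  have hs' : ((Real.sin (π*t):ℝ):ℂ) ≠ 0 := by exact_mod_cast hs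
  have hu : ((Real.cos (π*t):ℝ):ℂ) + (Real.sin (π*t):ℝ) * Complex.I ≠ 0 := by
    rw [Complex.ofReal_cos, Complex.ofReal_sin, ← Complex.exp_mul_I]; exact Complex.exp_ne_zero _
  rw [e, div_eq_iff (mul_ne_zero (mul_ne_zero (mul_ne_zero two_ne_zero Complex.I_ne_zero) hs') hu)]
  have h2 : ((Real.sin (π*t):ℝ):ℂ)^2 + ((Real.cos (π*t):ℝ):ℂ)^2 = 1 := by exact_mod_cast Real.sin_sq_add_cos_sq (π*t)
  have hc : (cc t : ℂ) * ((Real.sin (π*t):ℝ):ℂ) = ((π*t:ℝ):ℂ) * ((Real.cos (π*t):ℝ):ℂ) := by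
    unfold cc; push_cast at hs' ⊢; field_simp
  push_cast at *
  linear_combination (-2)*(π:ℂ)*t*Complex.I*h2 - 2*Complex.I*(Complex.cos (π*t) + Complex.sin (π*t) * Complex.I)*hc + 2*(π:ℂ)*t*(Complex.sin (π*t))^2*Complex.I*Complex.I_sq 

end PB

namespace PB
open Filter Topology Metric MeasureTheory
open scoped ComplexConjugate

lemma w_small {t : ℝ} (h0 : 0 < t) (h1 : t ≤ 1/2) :
    (t + (1-t)*cc t)^2 + (π*t*(1-t))^2 ≤ (1 + 0.2*t - 1.199*t^3)^2 := by
  have hc := cc_le h0 h1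
  have hc0 := (cc_nonneg h0 h1).1
  have hp : π^2 ≤ 98697/10000 := by nlinarith [Real.pi_lt_d4, Real.pi_pos]
  have a : (t + (1-t)*cc t)^2 ≤ (t + (1-t)*(1 - 3.28*t^2 - 2*t^4))^2 := by
    apply pow_le_pow_left₀
    · have : 0 ≤ 1 - t := by linarith
      positivity
    · have := mul_le_mul_of_nonneg_left hc (by linarith : 0 ≤ 1 - t)
      linarith
  have b : (π*t*(1-t))^2 ≤ 98697/10000*(t*(1-t))^2 := by
    have : (π*t*(1-t))^2 = π^2*(t*(1-t))^2 := by ring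
    rw [this]
    exact mul_le_mul_of_nonneg_right hp (sq_nonneg _)
  obtain ⟨u, hu⟩ : ∃ u, u = 1/2 - t := ⟨_, rfl⟩
  have hu0 : 0 ≤ u := by linarith
  have key : (1 + 0.2*t - 1.199*t^3)^2 - (t + (1-t)*(1 - 3.28*t^2 - 2*t^4))^2 - 98697/10000*(t*(1-t))^2 
    = t * (1024/5*t^0*u^9 + 628848/625*t^1*u^8 + 1285296/625*t^2*u^7 + 291404/125*t^3*u^6 + 1188728/625*t^4*u^5 + 95793201/62500*t^5*u^4 + 17354401/15625*t^6*u^3 + 15779403/31250*t^7*u^2 + 1764201/15625*t^8*u^1 + 488001/62500*t^9*u^0) := by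
    rw [hu]; ring
  have : 0 ≤ t * (1024/5*t^0*u^9 + 628848/625*t^1*u^8 + 1285296/625*t^2*u^7 + 291404/125*t^3*u^6 + 1188728/625*t^4*u^5 + 95793201/62500*t^5*u^4 + 17354401/15625*t^6*u^3 + 15779403/31250*t^7*u^2 + 1764201/15625*t^8*u^1 + 488001/62500*t^9*u^0) := by positivity
  linarith

lemma w_big {v : ℝ} (h0 : 0 < v) (h1 : v ≤ 1/2) :
    ((1-v)*(1 - cc v))^2 + (π*(1-v)*v)^2 ≤ (1 + 0.2*(1-v) - 1.199*(1-v)^3)^2 := by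
  have hc := cc_ge h0 h1
  have hc0 := (cc_nonneg h0 h1).2
  have hp : π^2 ≤ 98697/10000 := by nlinarith [Real.pi_lt_d4, Real.pi_pos]
  have a : ((1-v)*(1 - cc v))^2 ≤ ((1-v)*(10/3*v^2 + 8/3*v^4))^2 := by
    apply pow_le_pow_left₀
    · exact mul_nonneg (by linarith) (by linarith)
    · exact mul_le_mul_of_nonneg_left hc (by linarith : 0 ≤ 1 - v)
  have b : (π*(1-v)*v)^2 ≤ 98697/10000*(v*(1-v))^2 := by
    have : (π*(1-v)*v)^2 = π^2*(v*(1-v))^2 := by ring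
    rw [this]
    exact mul_le_mul_of_nonneg_right hp (sq_nonneg _)
  obtain ⟨u, hu⟩ : ∃ u, u = 1/2 - v := ⟨_, rfl⟩
  have hu0 : 0 ≤ u := by linarith
  have key : (1 + 0.2*(1-v) - 1.199*(1-v)^3)^2 - ((1-v)*(10/3*v^2 + 8/3*v^4))^2 - 98697/10000*(v*(1-v))^2 
    = 16/15625*v^0*u^10 + 54512/15625*v^1*u^9 + 7140748/15625*v^2*u^8 + 45773032/15625*v^3*u^7 + 1126345787/140625*v^4*u^6 + 1705313119/140625*v^5*u^5 + 2068311467/187500*v^6*u^4 + 857957071/140625*v^7*u^3 + 559407913/281250*v^8*u^2 + 17333012/46875*v^9*u^1 + 2296401/62500*v^10*u^0 := by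
    rw [hu]; ring
  have : 0 ≤ 16/15625*v^0*u^10 + 54512/15625*v^1*u^9 + 7140748/15625*v^2*u^8 + 45773032/15625*v^3*u^7 + 1126345787/140625*v^4*u^6 + 1705313119/140625*v^5*u^5 + 2068311467/187500*v^6*u^4 + 857957071/140625*v^7*u^3 + 559407913/281250*v^8*u^2 + 17333012/46875*v^9*u^1 + 2296401/62500*v^10*u^0 := by positivity
  linarith

lemma w_nonneg {t : ℝ} (h0 : 0 < t) (h1 : t ≤ 1) : 0 ≤ 1 + 0.2*t - 1.199*t^3 := by
  have : t^3 ≤ t := by nlinarith [mul_pos h0 h0]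
  nlinarith

lemma norm_of_parts {a b j w : ℝ} (hj : j = 0 ∨ j = 1) (hw : 0 ≤ w) (h : a^2 + b^2 ≤ w^2) :
    ‖(a:ℂ) + (b:ℂ) * (2*j-1) * Complex.I‖ ≤ w := by
  apply abs_le_of_sq_le_sq' _ hw |>.2
  refine le_trans (le_of_eq ?_) h
  rw [Complex.sq_norm, Complex.normSq_apply]
  rcases hj with h | h <;> rw [h] <;> simp <;> ring

lemma norm_two_pi_I : ‖(2*π*Complex.I : ℂ)‖ = 2*π := by
  simp [abs_of_pos Real.pi_pos]

lemma BB_l {l : ℝ} (hl : 0 < l) (hl1 : l ≤ 1/10^11) : ‖BB l - 1‖ ≤ 14/10^11 := by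
  have := BB_lip (a := l) (θ := 0) (by rw [abs_of_pos hl]; linarith) (by simp [Real.pi_pos.le])
  simp only [Complex.ofReal_zero, zero_mul, add_zero, BB_zero, abs_of_pos hl] at this
  linarith

lemma norm_mul_le' {a b : ℂ} {A B : ℝ} (h1 : ‖a‖ ≤ A) (h2 : ‖b‖ ≤ B) : ‖a*b‖ ≤ A*B := by
  rw [norm_mul]
  exact mul_le_mul h1 h2 (norm_nonneg _) ((norm_nonneg _).trans h1)

lemma Wq_small {l j a t : ℝ} (hj : j = 0 ∨ j = 1) (hl : 0 < l) (hl1 : l ≤ 1/10^11) (ha : |a| ≤ 1/10^11) (h0 : 0 < t) (h1 : t ≤ 1/2) :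
    ‖Wq l j ((a:ℂ) + (2*π*t:ℝ) * Complex.I)‖ ≤ 1 + 1/10^8 + 0.2*t - 1.199*t^3 := by
  have hp := Real.pi_pos
  have hp2 := Real.pi_lt_d4
  have hp1 := Real.pi_gt_d4
  have hj1 : ‖(j:ℂ)‖ ≤ 1 := by rcases hj with h | h <;> simp [h]
  set z0 : ℂ := (2*π*t:ℝ) * Complex.I with hz0
  set z : ℂ := (a:ℂ) + z0 with hz
  have hzne : z ≠ 2*π*Complex.I := fun h => by
    have := congrArg Complex.im h
    simp [hz, hz0] at this
    have h3 : t = 1 := by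
      have hp' := hp.ne'
      field_simp at this
      linarith
    linarith
  have hsin : Real.sin (π*t) ≠ 0 := by
    apply ne_of_gt
    exact Real.sin_pos_of_pos_of_lt_pi (by positivity) (by nlinarith)
  have hB0 : BB z0 = (cc t : ℂ) - (π*t:ℝ) * Complex.I := BB_imag h0.ne' hsin
  have hlip : ‖BB z - BB z0‖ ≤ 14/10^11 := by
    have := BB_lip (a := a) (θ := 2*π*t) (by linarith) (by rw [abs_of_pos (by positivity)]; nlinarith)
    linarith
  have hBl := BB_l hl hl1
  have hB0n : ‖BB z0‖ ≤ 4 := by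
    apply norm_BB_box
    · simp [hz0]
    · simp only [hz0, Complex.im_ofReal_mul, Complex.I_im, mul_one]
      rw [abs_of_pos (by positivity)]; nlinarith
  have hz0n : ‖z0‖ ≤ 3.5 := by
    rw [hz0, norm_mul, Complex.norm_I, mul_one, Complex.norm_real, Real.norm_eq_abs, abs_of_pos (by positivity)]
    nlinarith
  have han : ‖(a:ℂ)‖ ≤ 1/10^11 := by rw [Complex.norm_real]; exact ha
  have hln : ‖(l:ℂ)‖ ≤ 1/10^11 := by rw [Complex.norm_real, Real.norm_eq_abs, abs_of_pos hl]; exact hl1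
  have hzn : ‖z‖ ≤ 4 := by
    refine (norm_add_le _ _).trans ?_
    linarith
  have hzp : ‖z - 2*π*Complex.I‖ ≤ 11 := by
    refine (norm_sub_le _ _).trans ?_
    rw [norm_two_pi_I]; linarith
  set W0 : ℂ := ((t + (1-t)*cc t : ℝ):ℂ) + ((π*t*(1-t):ℝ):ℂ) * (2*j-1) * Complex.I with hW0
  have hW0n : ‖W0‖ ≤ 1 + 0.2*t - 1.199*t^3 := norm_of_parts hj (w_nonneg h0 (by linarith)) (w_small h0 h1)
  have hdiff : Wq l j z - W0 = (z*(BB l - 1) + z*(j*l) + a - j*(a*(z + z0 - 2*π*Complex.I)) - (z - 2*π*Complex.I)*(BB z - BB z0) - a*BB z0)/(2*π*Complex.I) := by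
    rw [Wq, if_neg hzne, eq_div_iff two_pi_I_ne, sub_mul, div_mul_cancel₀ _ two_pi_I_ne, hW0, hB0, GG]
    have hza : z = a + z0 := hz
    rw [hza, hz0]
    push_cast
    ring_nf
  have hnum : ‖z*(BB l - 1) + z*(j*l) + a - j*(a*(z + z0 - 2*π*Complex.I)) - (z - 2*π*Complex.I)*(BB z - BB z0) - a*BB z0‖ ≤ 300/10^11 := by
    have q1 := norm_mul_le' hzn hBl
    have q2 := norm_mul_le' hzn (norm_mul_le' hj1 hln)
    have q3 : ‖z + z0 - 2*π*Complex.I‖ ≤ 15 := by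
      refine (norm_sub_le _ _).trans ?_
      have := norm_add_le z z0
      rw [norm_two_pi_I]; linarith
    have q4 := norm_mul_le' hj1 (norm_mul_le' han q3)
    have q5 := norm_mul_le' hzp hlip
    have q6 := norm_mul_le' han hB0n
    have r1 := norm_add_le (z*(BB l - 1)) (z*(j*l))
    have r2 := norm_add_le (z*(BB l - 1) + z*(j*l)) a
    have r3 := norm_sub_le (z*(BB l - 1) + z*(j*l) + a) (j*(a*(z + z0 - 2*π*Complex.I)))
    have r4 := norm_sub_le (z*(BB l - 1) + z*(j*l) + a - j*(a*(z + z0 - 2*π*Complex.I))) ((z - 2*π*Complex.I)*(BB z - BB z0))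
    have r5 := norm_sub_le (z*(BB l - 1) + z*(j*l) + a - j*(a*(z + z0 - 2*π*Complex.I)) - (z - 2*π*Complex.I)*(BB z - BB z0)) (a*BB z0)
    linarith
  have hd : ‖Wq l j z - W0‖ ≤ 1/10^8 := by
    rw [hdiff, norm_div, norm_two_pi_I, div_le_iff₀ (by positivity)]
    linarith
  have := norm_add_le (Wq l j z - W0) W0
  rw [sub_add_cancel] at this
  linarith

lemma Wq_big {l j a v : ℝ} (hj : j = 0 ∨ j = 1) (hl : 0 < l) (hl1 : l ≤ 1/10^11) (ha : |a| ≤ 1/10^11) (h0 : 0 < v) (h1 : v ≤ 1/2) :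
    ‖Wq l j ((a:ℂ) + (2*π*(1-v):ℝ) * Complex.I)‖ ≤ 1 + 1/10^8 + 0.2*(1-v) - 1.199*(1-v)^3 := by
  have hp := Real.pi_pos
  have hp2 := Real.pi_lt_d4
  have hp1 := Real.pi_gt_d4
  have hj1 : ‖(j:ℂ)‖ ≤ 1 := by rcases hj with h | h <;> simp [h]
  set z0 : ℂ := (2*π*(1-v):ℝ) * Complex.I with hz0
  set z : ℂ := (a:ℂ) + z0 with hz
  set y0 : ℂ := (2*π*(-v):ℝ) * Complex.I with hy0
  have hzy : z - 2*π*Complex.I = a + y0 := by rw [hz, hz0, hy0]; push_cast; ring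
  have hzne : z ≠ 0 := fun h => by
    have := congrArg Complex.im h
    simp [hz, hz0] at this
    linarith
  have hsin : Real.sin (π*v) ≠ 0 := by
    apply ne_of_gt
    exact Real.sin_pos_of_pos_of_lt_pi (by positivity) (by nlinarith)
  have hB0 : BB y0 = (cc v : ℂ) + (π*v:ℝ) * Complex.I := by
    have := BB_imag (t := -v) (by linarith) (by rw [mul_neg, Real.sin_neg]; exact neg_ne_zero.2 hsin)
    rw [hy0, this, cc, cc, mul_neg, Real.sin_neg, Real.cos_neg]
    push_cast
    rw [neg_mul, neg_div_neg_eq]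
    ring
  have hlip : ‖BB (a + y0) - BB y0‖ ≤ 14/10^11 := by
    have := BB_lip (a := a) (θ := 2*π*(-v)) (by linarith) (by rw [abs_of_neg (by nlinarith)]; nlinarith)
    linarith
  have hBl := BB_l hl hl1
  have hB0n : ‖BB y0‖ ≤ 4 := by
    apply norm_BB_box
    · simp [hy0]
    · simp only [hy0, Complex.im_ofReal_mul, Complex.I_im, mul_one]
      rw [abs_of_neg (by nlinarith)]; nlinarith
  have hy0n : ‖y0‖ ≤ 4 := by
    rw [hy0, norm_mul, Complex.norm_I, mul_one, Complex.norm_real, Real.norm_eq_abs, abs_of_neg (by nlinarith)]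
    nlinarith
  have hz0n : ‖z0‖ ≤ 6.5 := by
    rw [hz0, norm_mul, Complex.norm_I, mul_one, Complex.norm_real, Real.norm_eq_abs, abs_of_pos (by nlinarith)]
    nlinarith
  have han : ‖(a:ℂ)‖ ≤ 1/10^11 := by rw [Complex.norm_real]; exact ha
  have hln : ‖(l:ℂ)‖ ≤ 1/10^11 := by rw [Complex.norm_real, Real.norm_eq_abs, abs_of_pos hl]; exact hl1
  have hzn : ‖z‖ ≤ 7 := by
    refine (norm_add_le _ _).trans ?_
    linarith
  set W0 : ℂ := (((1-v)*(1 - cc v) : ℝ):ℂ) + ((π*(1-v)*v:ℝ):ℂ) * (2*j-1) * Complex.I with hW0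
  have hW0n : ‖W0‖ ≤ 1 + 0.2*(1-v) - 1.199*(1-v)^3 := norm_of_parts hj (w_nonneg (by linarith) (by linarith)) (w_big h0 h1)
  have hdiff : Wq l j z - W0 = (z*(BB l - 1) + z*(j*l) - z*(BB (a+y0) - BB y0) - z*(j*a) + a*(1 - BB y0 - j*y0))/(2*π*Complex.I) := by
    rw [Wq_eq hzne, kk, hzy, eq_div_iff two_pi_I_ne, sub_mul, mul_div_assoc', div_mul_cancel₀ _ two_pi_I_ne, hW0, hB0, GG, GG]
    have hza : z = a + z0 := hz
    rw [hza, hz0, hy0]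
    push_cast
    ring_nf
  have hnum : ‖z*(BB l - 1) + z*(j*l) - z*(BB (a+y0) - BB y0) - z*(j*a) + a*(1 - BB y0 - j*y0)‖ ≤ 300/10^11 := by
    have q1 := norm_mul_le' hzn hBl
    have q2 := norm_mul_le' hzn (norm_mul_le' hj1 hln)
    have q3 := norm_mul_le' hzn hlip
    have q4 := norm_mul_le' hzn (norm_mul_le' hj1 han)
    have q5 : ‖1 - BB y0 - j*y0‖ ≤ 9 := by
      have a1 := norm_mul_le' hj1 hy0n
      have a2 := norm_sub_le (1:ℂ) (BB y0)
      have a3 := norm_sub_le (1 - BB y0) (j*y0)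
      rw [norm_one] at a2
      linarith
    have q6 := norm_mul_le' han q5
    have r1 := norm_add_le (z*(BB l - 1)) (z*(j*l))
    have r2 := norm_sub_le (z*(BB l - 1) + z*(j*l)) (z*(BB (a+y0) - BB y0))
    have r3 := norm_sub_le (z*(BB l - 1) + z*(j*l) - z*(BB (a+y0) - BB y0)) (z*(j*a))
    have r4 := norm_add_le (z*(BB l - 1) + z*(j*l) - z*(BB (a+y0) - BB y0) - z*(j*a)) (a*(1 - BB y0 - j*y0))
    linarith
  have hd : ‖Wq l j z - W0‖ ≤ 1/10^8 := by
    rw [hdiff, norm_div, norm_two_pi_I, div_le_iff₀ (by positivity)]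
    linarith
  have := norm_add_le (Wq l j z - W0) W0
  rw [sub_add_cancel] at this
  linarith

lemma Kz_bound {l j T : ℝ} (hj : j = 0 ∨ j = 1) (hT : 10^12 ≤ T) (hl : 0 < l) (hl1 : l*T/(2*π) ≤ 1)
    {ρ : ℂ} (hre : ρ.re = 1/2) (h0 : 0 < ρ.im) (h1 : ρ.im < T) :
    2*π/T * ‖Kz l j T ρ‖ ≤ (1 + 1/10^8)/ρ.im + 0.2/T - 1.199*ρ.im^2/T^3 := by
  have hp := Real.pi_pos
  have hp2 := Real.pi_lt_d4
  have hT0 : 0 < T := by linarith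
  set z : ℂ := (2*π/T : ℝ) * (ρ - (1 - l*T/(2*π) : ℝ)) with hz
  set a : ℝ := 2*π/T * (1/2 - (1 - l*T/(2*π))) with ha
  set t : ℝ := ρ.im/T with ht
  have ht0 : 0 < t := by positivity
  have ht1 : t < 1 := by rw [ht, div_lt_one hT0]; exact h1
  have hze : z = (a:ℂ) + (2*π*t:ℝ) * Complex.I := by
    apply Complex.ext
    · rw [hz, Complex.re_ofReal_mul, Complex.sub_re, Complex.ofReal_re, hre, Complex.add_re, Complex.ofReal_re, Complex.re_ofReal_mul, Complex.I_re, mul_zero, add_zero]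
    · rw [hz, Complex.im_ofReal_mul, Complex.sub_im, Complex.ofReal_im]; simp [ht]; ring
  have hε0 : 0 ≤ l*T/(2*π) := by positivity
  have hκ : 2*π/T ≤ 1/10^11 := by rw [div_le_iff₀ hT0]; linarith
  have hκ0 : 0 < 2*π/T := by positivity
  have hla : l ≤ 1/10^11 := by
    have : l = (l*T/(2*π)) * (2*π/T) := by field_simp
    rw [this]; nlinarith
  have haa : |a| ≤ 1/10^11 := by
    rw [ha, abs_mul, abs_of_pos hκ0]
    have : |1/2 - (1 - l*T/(2*π))| ≤ 1 := by rw [abs_le]; constructor <;> linarith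
    nlinarith [abs_nonneg (1/2 - (1 - l*T/(2*π)))]
  have hW : ‖Wq l j z‖ ≤ 1 + 1/10^8 + 0.2*t - 1.199*t^3 := by
    rw [hze]
    rcases le_or_gt t (1/2) with h | h
    · exact Wq_small hj hl hla haa ht0 h
    · have := Wq_big hj hl hla haa (v := 1-t) (by linarith) (by linarith)
      rwa [sub_sub_cancel] at this
  have hzn : 2*π*t ≤ ‖z‖ := by
    have := Complex.abs_im_le_norm z
    have e : z.im = 2*π*t := by rw [hze]; simp
    rw [e, abs_of_pos (by positivity)] at this
    exact this
  have hzne : z ≠ 0 := fun h => by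
    rw [h, norm_zero] at hzn
    have : 0 < 2*π*t := by positivity
    linarith
  have hK : Kz l j T ρ = kk l j z := rfl
  rw [Wq_eq hzne, norm_mul] at hW
  rw [hK]
  have h3 : 2*π*t*‖kk l j z‖ ≤ 1 + 1/10^8 + 0.2*t - 1.199*t^3 :=
    (mul_le_mul_of_nonneg_right hzn (norm_nonneg _)).trans hW
  have e1 : 2*π/T*‖kk l j z‖ = 2*π*t*‖kk l j z‖/ρ.im := by rw [ht]; field_simp
  have e2 : (1 + 1/10^8)/ρ.im + 0.2/T - 1.199*ρ.im^2/T^3 = (1 + 1/10^8 + 0.2*t - 1.199*t^3)/ρ.im := by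
    rw [ht]; field_simp
  rw [e1, e2]
  exact div_le_div_of_nonneg_right h3 h0.le

lemma Kz_bound' {l j T : ℝ} (hj : j = 0 ∨ j = 1) (hT : 10^12 ≤ T) (hl : 0 < l) (hl1 : l*T/(2*π) ≤ 1)
    {ρ : ℂ} (hre : ρ.re = 1/2) (h0 : 0 < ρ.im) (h1 : ρ.im < T) :
    2*π/T * ‖Kz l j T ρ‖ ≤ 1.00001 * (1/ρ.im + 0.2/T - 1.199*ρ.im^2/T^3) := by
  refine (Kz_bound hj hT hl hl1 hre h0 h1).trans ?_
  have hT0 : 0 < T := by linarith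
  set t : ℝ := ρ.im/T with ht
  have ht0 : 0 < t := by positivity
  have ht1 : t < 1 := by rw [ht, div_lt_one hT0]; exact h1
  have e2 : (1 + 1/10^8)/ρ.im + 0.2/T - 1.199*ρ.im^2/T^3 = (1 + 1/10^8 + 0.2*t - 1.199*t^3)/ρ.im := by
    rw [ht]; field_simp
  have e3 : 1.00001 * (1/ρ.im + 0.2/T - 1.199*ρ.im^2/T^3) = (1.00001*(1 + 0.2*t - 1.199*t^3))/ρ.im := by
    rw [ht]; field_simp
  rw [e2, e3]
  apply div_le_div_of_nonneg_right _ h0.le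
  have : 0 ≤ (1-t)*(0.999+1.199*t+1.199*t^2) := mul_nonneg (by linarith) (by positivity)
  nlinarith

end PB

namespace PB
open Filter Topology Metric MeasureTheory
open scoped ComplexConjugate

lemma arctan_le_self {x : ℝ} (hx : 0 ≤ x) : Real.arctan x ≤ x := by
  have := Real.le_tan (Real.arctan_nonneg.2 hx) (Real.arctan_lt_pi_div_two x)
  rwa [Real.tan_arctan] at this

lemma arctan_ge {x : ℝ} (hx : 0 ≤ x) : x - x^3/3 ≤ Real.arctan x := by
  have hd : ∀ y : ℝ, HasDerivAt (fun y : ℝ => Real.arctan y - (y - y^3/3)) (1/(1+y^2) - (1 - y^2)) y := by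
    intro y
    refine ((Real.hasDerivAt_arctan y).sub ((hasDerivAt_id y).sub (((hasDerivAt_id y).pow 3).div_const 3))).congr_deriv ?_
    simp
  have hm : MonotoneOn (fun y : ℝ => Real.arctan y - (y - y^3/3)) (Set.Ici 0) := by
    apply monotoneOn_of_deriv_nonneg (convex_Ici 0)
    · intro y _; exact (hd y).continuousAt.continuousWithinAt
    · intro y _; exact (hd y).differentiableAt.differentiableWithinAt
    · intro y _
      rw [(hd y).deriv, sub_nonneg, le_div_iff₀ (by positivity)]
      nlinarith [sq_nonneg (y^2)]
  have := hm Set.self_mem_Ici (Set.mem_Ici.2 hx) hx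
  simp at this
  linarith

noncomputable def Pp (β : ℝ) : ℝ := (1/4)*(Real.log (β/(2*π)))^2 + 2*Real.log (1 - 1/(2*β)) - 3/(4*β)

lemma Pp_deriv {β : ℝ} (hβ : 4 ≤ β) :
    HasDerivAt Pp ((1/2)*Real.log (β/(2*π))/β + 1/(β*(β-1/2)) + 3/(4*β^2)) β := by
  have hp := Real.pi_pos
  have h0 : β ≠ 0 := by linarith
  have h1 : HasDerivAt (fun β : ℝ => Real.log (β/(2*π))) (1/β) β := by
    have := ((hasDerivAt_id β).div_const (2*π)).log (by simp [h0])
    refine this.congr_deriv ?_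
    simp; field_simp
  have h2 : HasDerivAt (fun β : ℝ => 1 - 1/(2*β)) (1/(2*β^2)) β := by
    have := (((hasDerivAt_id β).const_mul 2).inv (by simp [h0])).const_sub 1
    refine (this.congr_deriv ?_).congr_of_eventuallyEq ?_
    · simp; field_simp
    · filter_upwards with y; simp
  have h2' := h2.log (by
    have : 1/(2*β) < 1 := by rw [div_lt_one (by linarith)]; linarith
    linarith)
  have h3 : HasDerivAt (fun β : ℝ => 3/(4*β)) (-(3/(4*β^2))) β := by
    have := (((hasDerivAt_id β).const_mul 4).inv (by simp [h0])).const_mul 3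
    refine (this.congr_deriv ?_).congr_of_eventuallyEq ?_
    · simp; field_simp
    · filter_upwards with y; simp; ring
  have := (((h1.pow 2).const_mul (1/4)).add (h2'.const_mul 2)).sub h3
  refine this.congr_deriv ?_
  have h4 : 2*β - 1 ≠ 0 := by linarith
  have h5 : β - 1/2 ≠ 0 := by linarith
  have e1 : 2*(1/(2*β^2)/(1-1/(2*β))) = 1/(β*(β-1/2)) := by
    field_simp
  rw [e1]
  simp
  ring

lemma X_div_le {β : ℝ} (hβ : 4 ≤ β) : (logDeriv Xi ((1/2+β:ℝ):ℂ)).re ≤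
    β*((1/2)*Real.log (β/(2*π))/β + 1/(β*(β-1/2)) + 3/(4*β^2)) := by
  have hp := Real.pi_pos
  have h0 : 0 < β := by linarith
  refine (X_real_le (by linarith)).trans ?_
  have h1 : Real.log ((1/2+β)/(2*π)) ≤ Real.log (β/(2*π)) + 1/(2*β) := by
    have e : (1/2+β)/(2*π) = (β/(2*π))*(1+1/(2*β)) := by field_simp; ring
    rw [e, Real.log_mul (by positivity) (by positivity)]
    have := Real.log_le_sub_one_of_pos (x := 1+1/(2*β)) (by positivity)
    linarith
  have h5 : 0 < β - 1/2 := by linarith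
  have e2 : β*((1/2)*Real.log (β/(2*π))/β + 1/(β*(β-1/2)) + 3/(4*β^2)) = (1/2)*Real.log (β/(2*π)) + 1/(β-1/2) + 3/(4*β) := by
    field_simp
  rw [e2]
  have h6 : 1/(2*(1/2+β)) ≤ 1/(2*β) := one_div_le_one_div_of_le (by positivity) (by linarith)
  have e3 : 3/(4*β) = (1/(2*β))/2 + 1/(2*β) := by field_simp; norm_num
  have e4 : 1/2 + β - 1 = β - 1/2 := by ring
  rw [e3, e4]
  linarith

lemma pair_zero {T : ℝ} (hT : ∀ ρ ∈ ZT T, ρ.re = 1/2) {β : ℝ} (hb : 1/2 ≤ β) :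
    ∑ ρ ∈ ZT T, (mu ρ:ℝ) * (2*β/(β^2+ρ.im^2)) ≤ (logDeriv Xi ((1/2+β:ℝ):ℂ)).re := by
  have := pair_sum_le (τ := 0) hT hb
  rw [Complex.ofReal_zero, zero_mul, add_zero] at this
  refine le_trans (le_of_eq ?_) this
  apply Finset.sum_congr rfl
  intro ρ _
  rw [zero_sub, zero_add, neg_sq]; ring

lemma part1 (hRH : RHT) {T : ℝ} (hT : T ≤ 3*(10:ℝ)^12+1+π/3) {β0 : ℝ} (hβ : 4 ≤ β0) :
    2 * ∑ ρ ∈ ZT T, (mu ρ:ℝ) * (Real.arctan (β0/ρ.im)/ρ.im) ≤ (1/4)*(Real.log (β0/(2*π)))^2 + 0.9 := by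
  have hp := Real.pi_pos
  have hp1 := Real.pi_gt_d4
  have hp2 := Real.pi_lt_d4
  have hh := ZT_half hRH hT
  have hder : ∀ β : ℝ, 4 ≤ β → HasDerivAt (fun β : ℝ => 2 * ∑ ρ ∈ ZT T, (mu ρ:ℝ) * (Real.arctan (β/ρ.im)/ρ.im) - Pp β)
      ((∑ ρ ∈ ZT T, (mu ρ:ℝ) * (2/(β^2+ρ.im^2))) - ((1/2)*Real.log (β/(2*π))/β + 1/(β*(β-1/2)) + 3/(4*β^2))) β := by
    intro β hβ
    refine HasDerivAt.sub ?_ (Pp_deriv hβ)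
    have : HasDerivAt (fun β : ℝ => ∑ ρ ∈ ZT T, (mu ρ:ℝ) * (Real.arctan (β/ρ.im)/ρ.im)) (∑ ρ ∈ ZT T, (mu ρ:ℝ) * (1/(β^2+ρ.im^2))) β := by
      apply HasDerivAt.fun_sum
      intro ρ hρ
      have h0 := (mem_ZT.1 hρ).2.1
      have := ((((hasDerivAt_id β).div_const ρ.im).arctan).div_const ρ.im).const_mul (mu ρ:ℝ)
      refine this.congr_deriv ?_
      simp only [id]
      have : β^2+ρ.im^2 ≠ 0 := by positivity
      have : 1+(β/ρ.im)^2 ≠ 0 := by positivity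
      congr 1
      field_simp
      ring
    refine (this.const_mul 2).congr_deriv ?_
    rw [Finset.mul_sum]
    apply Finset.sum_congr rfl
    intro ρ _
    ring
  have hanti : AntitoneOn (fun β : ℝ => 2 * ∑ ρ ∈ ZT T, (mu ρ:ℝ) * (Real.arctan (β/ρ.im)/ρ.im) - Pp β) (Set.Ici 4) := by
    apply antitoneOn_of_deriv_nonpos (convex_Ici 4)
    · intro β hβ; exact (hder β hβ).continuousAt.continuousWithinAt
    · intro β hβ; rw [interior_Ici] at hβ; exact (hder β (le_of_lt hβ)).differentiableAt.differentiableWithinAt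
    · intro β hβ
      rw [interior_Ici] at hβ
      have hβ' : 4 ≤ β := le_of_lt hβ
      rw [(hder β hβ').deriv]
      have h0 : 0 < β := by linarith
      have h1 := (pair_zero hh (β := β) (by linarith)).trans (X_div_le hβ')
      have h2 : ∑ ρ ∈ ZT T, (mu ρ:ℝ) * (2*β/(β^2+ρ.im^2)) = β * ∑ ρ ∈ ZT T, (mu ρ:ℝ) * (2/(β^2+ρ.im^2)) := by
        rw [Finset.mul_sum]
        apply Finset.sum_congr rfl
        intro ρ _
        ring
      rw [h2] at h1
      have := le_of_mul_le_mul_left h1 h0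
      linarith
  have h1 := hanti (Set.self_mem_Ici) (Set.mem_Ici.2 hβ) hβ
  simp only at h1
  have h2 : 2 * ∑ ρ ∈ ZT T, (mu ρ:ℝ) * (Real.arctan (4/ρ.im)/ρ.im) ≤ (17/9) * (logDeriv Xi ((1/2+4:ℝ):ℂ)).re := by
    refine le_trans ?_ (mul_le_mul_of_nonneg_left (pair_zero hh (β := 4) (by norm_num)) (by norm_num))
    rw [Finset.mul_sum, Finset.mul_sum]
    apply Finset.sum_le_sum
    intro ρ hρ
    obtain ⟨hX, h0, _⟩ := mem_ZT.1 hρ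
    have h18 := im_sq_ge hRH hX
    have ha : Real.arctan (4/ρ.im) ≤ 4/ρ.im := arctan_le_self (by positivity)
    have hb : Real.arctan (4/ρ.im)/ρ.im ≤ 4/ρ.im^2 := by
      rw [div_le_iff₀ h0]
      refine ha.trans (le_of_eq ?_)
      field_simp
    have hc : 2*(4/ρ.im^2) ≤ (17/9) * (2*4/(4^2+ρ.im^2)) := by
      rw [mul_div_assoc', mul_div_assoc', div_le_div_iff₀ (by positivity) (by positivity)]
      nlinarith
    have hm : (0:ℝ) ≤ mu ρ := by positivity
    nlinarith [mul_le_mul_of_nonneg_left (hc) hm, mul_le_mul_of_nonneg_left hb hm]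
  have h3 : (logDeriv Xi ((1/2+4:ℝ):ℂ)).re ≤ 0.234 := by
    refine (X_real_le (by norm_num)).trans ?_
    have : Real.log ((1/2+4)/(2*π)) ≤ -0.33 := by
      rw [Real.log_le_iff_le_exp (by positivity), Real.exp_neg]
      have h := Real.exp_bound' (x := 0.33) (by norm_num) (by norm_num) (n := 4) (by norm_num)
      norm_num [Finset.sum_range_succ, Nat.factorial] at h
      have hpos := Real.exp_pos 0.33
      rw [div_le_iff₀ (by positivity), ← div_eq_inv_mul, le_div_iff₀ (by norm_num; norm_num at hpos; exact hpos)]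
      norm_num
      linarith
    norm_num at this ⊢
    linarith
  have h4 : -Pp 4 ≤ 0.4555 := by
    rw [Pp]
    have : -0.134 ≤ Real.log (1-1/(2*4)) := by
      rw [Real.le_log_iff_exp_le (by norm_num), Real.exp_neg]
      have h := Real.quadratic_le_exp_of_nonneg (x := 0.134) (by norm_num)
      rw [inv_le_comm₀ (Real.exp_pos _) (by norm_num)]
      norm_num at h ⊢
      linarith
    have h6 := sq_nonneg (Real.log (4/(2*π)))
    norm_num at this ⊢
    linarith
  have h5 : Pp β0 ≤ (1/4)*(Real.log (β0/(2*π)))^2 := by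
    rw [Pp]
    have a : 0 < 1/(2*β0) := by positivity
    have b : 1/(2*β0) < 1 := by rw [div_lt_one (by linarith)]; linarith
    have : Real.log (1 - 1/(2*β0)) ≤ 0 := Real.log_nonpos (by linarith) (by linarith)
    have c : 0 < 3/(4*β0) := by positivity
    linarith
  have h3' : (17/9) * (logDeriv Xi ((1/2+4:ℝ):ℂ)).re ≤ (17/9)*0.234 := mul_le_mul_of_nonneg_left h3 (by norm_num)
  norm_num at *
  linarith

end PB

namespace PB
open Filter Topology Metric MeasureTheory
open scoped ComplexConjugate

open ArithmeticFunction in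
lemma LSeries_tiny {s : ℂ} (hs : 32 ≤ s.re) :
    ‖LSeries (fun n => (vonMangoldt n : ℂ)) s‖ ≤ 1/10^9 := by
  have hsum := LSeriesSummable_vonMangoldt (s := (2:ℂ)) (by simp)
  have e : (LSeries (fun n => (vonMangoldt n : ℂ)) (2:ℂ)).re
      = ∑' n, (LSeries.term (fun n => (vonMangoldt n : ℂ)) (2:ℂ) n).re := by
    unfold LSeries
    exact Complex.re_tsum hsum
  have hr : ∀ n : ℕ, ‖LSeries.term (fun n => (vonMangoldt n : ℂ)) (2:ℂ) n‖
      = (LSeries.term (fun n => (vonMangoldt n : ℂ)) (2:ℂ) n).re := by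
    intro n
    rcases Nat.eq_zero_or_pos n with h | h
    · simp [h]
    · rw [LSeries.term_of_ne_zero h.ne', show (2:ℂ) = ((2:ℝ):ℂ) by simp, show (n:ℂ) = ((n:ℝ):ℂ) by simp, ← Complex.ofReal_cpow (by positivity),
        ← Complex.ofReal_div, Complex.norm_real, Complex.ofReal_re, Real.norm_of_nonneg]
      have := vonMangoldt_nonneg (n := n)
      positivity
  have h2 := LSeries_two_le
  rw [e] at h2
  have hsm : Summable fun n => (LSeries.term (fun n => (vonMangoldt n : ℂ)) (2:ℂ) n).re := (hsum.norm).congr hr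
  have : ‖LSeries (fun n => (vonMangoldt n : ℂ)) s‖ ≤ (1/2^30) * ∑' n, (LSeries.term (fun n => (vonMangoldt n : ℂ)) (2:ℂ) n).re := by
    unfold LSeries
    refine tsum_of_norm_bounded (g := fun n => (1/2^30) * (LSeries.term (fun n => (vonMangoldt n : ℂ)) (2:ℂ) n).re) (hsm.hasSum.mul_left _) ?_
    intro n
    rw [← hr, LSeries.norm_term_eq, LSeries.norm_term_eq]
    rcases Nat.lt_or_ge n 2 with h | h
    · interval_cases n <;> simp
    · rw [if_neg (by omega), if_neg (by omega)]
      have hn : (2:ℝ) ≤ n := by exact_mod_cast h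
      have hn0 : (0:ℝ) < n := by linarith
      have h3 : (2:ℝ)^30 * (n:ℝ)^(2:ℝ) ≤ (n:ℝ)^s.re := by
        have a1 : (n:ℝ)^(32:ℝ) ≤ (n:ℝ)^s.re := Real.rpow_le_rpow_of_exponent_le (by linarith) hs
        have a2 : (n:ℝ)^(32:ℝ) = (n:ℝ)^30 * (n:ℝ)^(2:ℝ) := by
          rw [← Real.rpow_natCast, ← Real.rpow_add hn0]; norm_num
        have a3 : (2:ℝ)^30 ≤ (n:ℝ)^30 := pow_le_pow_left₀ (by norm_num) hn 30
        have a4 : (0:ℝ) ≤ (n:ℝ)^(2:ℝ) := by positivity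
        exact (mul_le_mul_of_nonneg_right a3 a4).trans (a2 ▸ a1)
      have h4 : (0:ℝ) < (n:ℝ)^(2:ℝ) := by positivity
      rw [show (2:ℂ).re = 2 by simp, div_mul_div_comm, one_mul]
      exact div_le_div_of_nonneg_left (norm_nonneg _) (by positivity) h3
  refine this.trans ?_
  norm_num at h2 ⊢
  linarith

/-- Upper bound for the logarithmic derivative on the line with real part 60.5. -/
lemma X_tau_le {τ : ℝ} (hτ : 0 ≤ τ) :
    (logDeriv Xi ((1/2 + 60 : ℝ) + τ * Complex.I)).re ≤ Real.log ((τ+200)/(2*π))/2 + 1/10^9 := by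
  have hp := Real.pi_pos
  set s : ℂ := ((1/2 + 60 : ℝ) + τ * Complex.I) with hs
  have hre : s.re = 60.5 := by simp [hs]; norm_num
  have him : s.im = τ := by simp [hs]
  rw [logDeriv_Xi_re_eq (by rw [hre]; norm_num)]
  have h1 : -(LSeries (fun n => (ArithmeticFunction.vonMangoldt n : ℂ)) s).re ≤ 1/10^9 := by
    have a := LSeries_tiny (s := s) (by rw [hre]; norm_num)
    have b := (abs_le.1 (Complex.abs_re_le_norm (LSeries (fun n => (ArithmeticFunction.vonMangoldt n : ℂ)) s))).1
    linarith
  set z : ℂ := s/2 + 1 with hz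
  have hzre : z.re = 31.25 := by simp [hz, hre]; norm_num
  have hzim : z.im = τ/2 := by simp [hz, him]
  have hzu : ‖z‖ ≤ (τ+62.5)/2 := by
    have := Complex.norm_le_abs_re_add_abs_im z
    rw [hzre, hzim, abs_of_nonneg (by norm_num), abs_of_nonneg (by linarith)] at this
    norm_num at this ⊢
    linarith
  have hzl : (τ+62.5)/4 ≤ ‖z‖ := by
    have a := Complex.abs_re_le_norm z
    have b := Complex.abs_im_le_norm z
    rw [hzre, abs_of_nonneg (by norm_num)] at a
    rw [hzim, abs_of_nonneg (by linarith)] at b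
    norm_num at a b ⊢
    linarith
  have hz0 : 0 < ‖z‖ := by linarith
  have h2 : (Complex.digamma z).re ≤ Real.log ‖z‖ + 1/‖z‖ + 1/‖z‖^2 := by
    have a := norm_digamma_sub_log_le (z := z) (by rw [hzre]; norm_num)
    have b := (abs_le.1 (Complex.abs_re_le_norm (Complex.digamma z - Complex.log z))).2
    rw [Complex.sub_re, Complex.log_re] at b
    linarith
  have h3 : (1/(s-1)).re ≤ 2/(τ+62.5) := by
    rw [one_div, Complex.inv_re, Complex.normSq_apply]
    simp only [Complex.sub_re, Complex.sub_im, Complex.one_re, Complex.one_im, hre, him]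
    rw [div_le_div_iff₀ (by positivity) (by positivity)]
    nlinarith [sq_nonneg (τ-15)]
  have h4 : Real.log ‖z‖ ≤ Real.log ((τ+62.5)/2) := Real.log_le_log hz0 hzu
  have h5 : 1/‖z‖ ≤ 4/(τ+62.5) := by
    rw [div_le_div_iff₀ hz0 (by positivity)]; linarith
  have h6 : 1/‖z‖^2 ≤ 4/(τ+62.5) := by
    have : 1 ≤ ‖z‖ := by linarith
    refine le_trans ?_ h5
    exact one_div_le_one_div_of_le hz0 (by nlinarith)
  have h7 : Real.log ((τ+200)/(2*π)) = Real.log ((τ+200)/2) - Real.log π := by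
    rw [← Real.log_div (by positivity) hp.ne', div_div]
  have h8 : Real.log ((τ+62.5)/2) + 137.5/(τ+200) ≤ Real.log ((τ+200)/2) := by
    have a := Real.log_le_sub_one_of_pos (x := (τ+62.5)/(τ+200)) (by positivity)
    have b : Real.log ((τ+62.5)/(τ+200)) = Real.log ((τ+62.5)/2) - Real.log ((τ+200)/2) := by
      rw [← Real.log_div (by positivity) (by positivity)]
      congr 1
      field_simp
    have c : (τ+62.5)/(τ+200) - 1 = -(137.5/(τ+200)) := by field_simp; ring
    linarith
  rw [h7]
  have h9 : 2/(τ+62.5) + 4/(τ+62.5) ≤ 137.5/(τ+200)/2 := by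
    rw [← add_div, div_div, div_le_div_iff₀ (by positivity) (by positivity)]
    linarith
  linarith

end PB

namespace PB
open Filter Topology Metric MeasureTheory
open scoped ComplexConjugate

noncomputable def qq (v : ℝ) : ℝ := ∫ u in (0:ℝ)..1, 1/(1+v^2*u^2)

lemma qq_cont : Continuous qq := by
  unfold qq
  apply intervalIntegral.continuous_parametric_intervalIntegral_of_continuous'
  apply Continuous.div continuous_const (by fun_prop)
  intro p; positivity

lemma qq_ii (v a b : ℝ) : IntervalIntegrable (fun u : ℝ => 1/(1+v^2*u^2)) volume a b := by
  apply Continuous.intervalIntegrable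
  apply Continuous.div continuous_const (by fun_prop)
  intro p; positivity

lemma qq_mul (v : ℝ) : v * qq v = Real.arctan v := by
  have hd : ∀ u ∈ Set.uIcc (0:ℝ) 1, HasDerivAt (fun u : ℝ => Real.arctan (v*u)) (v*(1/(1+v^2*u^2))) u := by
    intro u _
    refine (((hasDerivAt_id u).const_mul v).arctan).congr_deriv ?_
    simp only [id]
    rw [mul_pow]; ring
  have := intervalIntegral.integral_eq_sub_of_hasDerivAt hd ((qq_ii v 0 1).const_mul v)
  rw [intervalIntegral.integral_const_mul] at this
  simpa [qq] using this

lemma qq_anti : AntitoneOn qq (Set.Ici 0) := by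
  intro a ha b hb hab
  unfold qq
  apply intervalIntegral.integral_mono_on (by norm_num) (qq_ii _ _ _) (qq_ii _ _ _)
  intro u _
  have : a^2 ≤ b^2 := pow_le_pow_left₀ ha hab 2
  apply one_div_le_one_div_of_le (by positivity)
  nlinarith [sq_nonneg u]

lemma qq_zero : qq 0 = 1 := by simp [qq]

lemma qq_le_one {v : ℝ} (hv : 0 ≤ v) : qq v ≤ 1 := by
  have := qq_anti Set.self_mem_Ici (Set.mem_Ici.2 hv) hv
  rwa [qq_zero] at this

lemma qq_nonneg {v : ℝ} : 0 ≤ qq v := by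
  unfold qq
  apply intervalIntegral.integral_nonneg (by norm_num)
  intro u _; positivity

lemma qq_eq {v : ℝ} (hv : 0 < v) : qq v = Real.arctan v / v := by
  rw [← qq_mul]; field_simp

lemma qq_ge {v : ℝ} (hv : 0 < v) : 1 - v^2/3 ≤ qq v := by
  rw [qq_eq hv, le_div_iff₀ hv]
  have := arctan_ge hv.le
  nlinarith

lemma qq_recip {v : ℝ} (hv : 0 < v) : qq v + qq (1/v) / v^2 = (π/2)/v := by
  rw [qq_eq hv, qq_eq (by positivity), one_div, Real.arctan_inv_of_pos hv]
  field_simp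
  ring

noncomputable def AA (v : ℝ) : ℝ := ∫ u in (0:ℝ)..v, qq u
noncomputable def BL (v : ℝ) : ℝ := ∫ u in (0:ℝ)..v, qq u * Real.log u

lemma qlog_ii (a b : ℝ) : IntervalIntegrable (fun u => qq u * Real.log u) volume a b := by
  have := (intervalIntegral.intervalIntegrable_log' (a := a) (b := b)).continuousOn_mul qq_cont.continuousOn
  exact this

lemma AA_deriv (v : ℝ) : HasDerivAt AA (qq v) v :=
  intervalIntegral.integral_hasDerivAt_right (qq_cont.intervalIntegrable _ _)
    (qq_cont.stronglyMeasurableAtFilter _ _) qq_cont.continuousAt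

lemma BL_deriv {v : ℝ} (hv : 0 < v) : HasDerivAt BL (qq v * Real.log v) v := by
  apply intervalIntegral.integral_hasDerivAt_right (qlog_ii _ _)
  · have : ContinuousOn (fun u => qq u * Real.log u) (Set.Ioi 0) :=
      qq_cont.continuousOn.mul (Real.continuousOn_log.mono (fun x hx => (Set.mem_Ioi.1 hx).ne'))
    exact this.stronglyMeasurableAtFilter isOpen_Ioi _ hv
  · exact qq_cont.continuousAt.mul (Real.continuousAt_log hv.ne')

lemma inv_deriv {v : ℝ} (hv : 0 < v) : HasDerivAt (fun v : ℝ => 1/v) (-(1/v^2)) v := by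
  have := hasDerivAt_inv hv.ne'
  simpa using this

lemma const_of_deriv {F F' : ℝ → ℝ} (h : ∀ v, 1 ≤ v → HasDerivAt F (F' v) v) (h0 : ∀ v, 1 ≤ v → F' v ≤ 0) {V : ℝ} (hV : 1 ≤ V) :
    F V ≤ F 1 := by
  have : AntitoneOn F (Set.Ici 1) := by
    apply antitoneOn_of_deriv_nonpos (convex_Ici 1)
    · intro y hy; exact (h y hy).continuousAt.continuousWithinAt
    · intro y hy; rw [interior_Ici] at hy; exact (h y (le_of_lt hy)).differentiableAt.differentiableWithinAt
    · intro y hy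
      rw [interior_Ici] at hy
      rw [(h y (le_of_lt hy)).deriv]
      exact h0 y (le_of_lt hy)
  exact this Set.self_mem_Ici (Set.mem_Ici.2 hV) hV

lemma AA_le_self {v : ℝ} (hv : 0 ≤ v) : AA v ≤ v := by
  have : AA v ≤ ∫ u in (0:ℝ)..v, (1:ℝ) := by
    apply intervalIntegral.integral_mono_on hv (qq_cont.intervalIntegrable _ _) (by simp)
    intro u hu; exact qq_le_one hu.1
  simpa using this

lemma AA_le {V : ℝ} (hV : 1 ≤ V) : AA V ≤ (π/2)*Real.log V + 1/V := by
  have hd : ∀ v : ℝ, 1 ≤ v → HasDerivAt (fun v => AA v - AA (1/v) - (π/2)*Real.log v) (qq v - qq (1/v) * (-(1/v^2)) - (π/2)*v⁻¹) v := by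
    intro v hv
    have h0 : 0 < v := by linarith
    exact ((AA_deriv v).sub ((AA_deriv (1/v)).comp v (inv_deriv h0))).sub ((Real.hasDerivAt_log h0.ne').const_mul _)
  have := const_of_deriv hd (by
    intro v hv
    have := qq_recip (v := v) (by linarith)
    apply le_of_eq
    rw [div_eq_mul_one_div, div_eq_mul_inv (π/2)] at this
    linarith) hV
  simp only [div_one, sub_self, Real.log_one, mul_zero] at this
  have := AA_le_self (v := 1/V) (by positivity)
  linarith

lemma BL_recip {V : ℝ} (hV : 1 ≤ V) : BL V ≤ 2 * BL 1 + (π/4)*(Real.log V)^2 - BL (1/V) := by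
  have hd : ∀ v : ℝ, 1 ≤ v → HasDerivAt (fun v => BL v + BL (1/v) - (π/4)*(Real.log v)^2) (qq v * Real.log v + (qq (1/v) * Real.log (1/v)) * (-(1/v^2)) - (π/4)*(2*Real.log v * v⁻¹)) v := by
    intro v hv
    have h0 : 0 < v := by linarith
    refine (((BL_deriv h0).add ((BL_deriv (v := 1/v) (by positivity)).comp v (inv_deriv h0))).sub (((Real.hasDerivAt_log h0.ne').pow 2).const_mul _)).congr_deriv ?_
    simp
  have := const_of_deriv hd (by
    intro v hv
    have := qq_recip (v := v) (by linarith)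
    apply le_of_eq
    rw [div_eq_mul_one_div, div_eq_mul_inv (π/2)] at this
    rw [one_div v, Real.log_inv]
    rw [one_div v] at this
    linear_combination (Real.log v) * this) hV
  simp only [div_one, Real.log_one] at this
  norm_num at this ⊢
  linarith

lemma neg_BL_le {v : ℝ} (hv : 0 < v) (hv1 : v ≤ 1) : -BL v ≤ v - v * Real.log v := by
  have : -BL v ≤ ∫ u in (0:ℝ)..v, -Real.log u := by
    rw [BL, ← intervalIntegral.integral_neg]
    apply intervalIntegral.integral_mono_on hv.le (qlog_ii _ _).neg intervalIntegral.intervalIntegrable_log'.neg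
    intro u hu
    have h1 : Real.log u ≤ 0 := Real.log_nonpos hu.1 (hu.2.trans hv1)
    have h2 := qq_le_one hu.1
    change -(qq u * Real.log u) ≤ -Real.log u
    nlinarith
  rw [intervalIntegral.integral_neg, integral_log] at this
  simp at this
  linarith

lemma int_sq_log {a : ℝ} (ha : 0 < a) : IntervalIntegrable (fun u : ℝ => u^2 * Real.log u) volume 0 a ∧ ∫ u in (0:ℝ)..a, u^2 * Real.log u = a^3/3*Real.log a - a^3/9 := by
  have hii : IntervalIntegrable (fun u : ℝ => u^2 * Real.log u) volume 0 a :=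
    (intervalIntegral.intervalIntegrable_log' (a := 0) (b := a)).continuousOn_mul (by fun_prop)
  refine ⟨hii, ?_⟩
  have := intervalIntegral.integral_eq_sub_of_hasDerivAt_of_le (f := fun u : ℝ => u^2/3*(u*Real.log u) - u^3/9) (f' := fun u : ℝ => u^2 * Real.log u) ha.le ?_ ?_ hii
  · rw [this]; simp; ring
  · apply Continuous.continuousOn
    have := Real.continuous_mul_log
    fun_prop
  · intro u hu
    have h0 : u ≠ 0 := hu.1.ne'
    have h1 := ((((hasDerivAt_id u).pow 2).div_const 3).mul ((hasDerivAt_id u).mul (Real.hasDerivAt_log h0))).sub (((hasDerivAt_id u).pow 3).div_const 9)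
    refine h1.congr_deriv ?_
    simp
    field_simp
    ring

lemma BL_one_le : BL 1 ≤ -1 + 1/27 := by
  have h := int_sq_log (a := 1) one_pos
  have : BL 1 ≤ ∫ u in (0:ℝ)..1, (Real.log u - (1/3)*(u^2*Real.log u)) := by
    apply intervalIntegral.integral_mono_on (by norm_num) (qlog_ii _ _) (intervalIntegral.intervalIntegrable_log'.sub (h.1.const_mul _))
    intro u hu
    rcases hu.1.eq_or_lt with h0 | h0
    · simp [← h0]
    have h1 : Real.log u ≤ 0 := Real.log_nonpos hu.1 hu.2
    have h2 := qq_ge h0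
    nlinarith
  rw [intervalIntegral.integral_sub intervalIntegral.intervalIntegrable_log' (h.1.const_mul _), intervalIntegral.integral_const_mul, h.2, integral_log] at this
  norm_num at this ⊢
  linarith

lemma BL_le {V : ℝ} (hV : 1 ≤ V) : BL V ≤ 2 * (-1 + 1/27) + (π/4)*(Real.log V)^2 + (1 + Real.log V)/V := by
  have h1 := BL_recip hV
  have h2 := BL_one_le
  have h3 := neg_BL_le (v := 1/V) (by positivity) (by rw [div_le_one (by linarith)]; exact hV)
  rw [one_div, Real.log_inv] at h3
  rw [one_div] at h1
  rw [div_eq_mul_inv (1+Real.log V)]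
  linarith

end PB

namespace PB
open Filter Topology Metric MeasureTheory
open scoped ComplexConjugate

noncomputable def pk (b γ τ : ℝ) : ℝ := b/(b^2+(τ-γ)^2) + b/(b^2+(τ+γ)^2)

lemma pk_cont {b : ℝ} (hb : 0 < b) (γ : ℝ) : Continuous (pk b γ) := by
  unfold pk
  apply Continuous.add
  · exact Continuous.div continuous_const (by fun_prop) (fun τ => by positivity)
  · exact Continuous.div continuous_const (by fun_prop) (fun τ => by positivity)

lemma pk_nonneg {b : ℝ} (hb : 0 < b) (γ τ : ℝ) : 0 ≤ pk b γ τ := by unfold pk; positivity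

lemma pk_int {b γ Δ : ℝ} (hb : 0 < b) (hγ : 0 < γ) : 2*Real.arctan (Δ/b) ≤ ∫ τ in (0:ℝ)..(γ+Δ), pk b γ τ := by
  have hd : ∀ τ ∈ Set.uIcc (0:ℝ) (γ+Δ), HasDerivAt (fun τ => Real.arctan ((τ-γ)/b) + Real.arctan ((τ+γ)/b)) (pk b γ τ) τ := by
    intro τ _
    have h1 := (((hasDerivAt_id τ).sub_const γ).div_const b).arctan
    have h2 := (((hasDerivAt_id τ).add_const γ).div_const b).arctan
    refine (h1.add h2).congr_deriv ?_
    simp only [id, pk]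
    have : b^2+(τ-γ)^2 ≠ 0 := by positivity
    have : b^2+(τ+γ)^2 ≠ 0 := by positivity
    have : 1+((τ-γ)/b)^2 ≠ 0 := by positivity
    have : 1+((τ+γ)/b)^2 ≠ 0 := by positivity
    congr 1 <;> field_simp
  rw [intervalIntegral.integral_eq_sub_of_hasDerivAt hd ((pk_cont hb γ).intervalIntegrable _ _)]
  have e1 : (0 - γ)/b = -(γ/b) := by ring
  have e2 : (0 + γ)/b = γ/b := by ring
  have e3 : (γ+Δ-γ)/b = Δ/b := by ring
  rw [e1, e2, e3, Real.arctan_neg]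
  have : Real.arctan (Δ/b) ≤ Real.arctan ((γ+Δ+γ)/b) := by
    apply Real.arctan_mono
    apply div_le_div_of_nonneg_right _ hb.le
    linarith
  linarith

lemma smooth_sum {T Δ : ℝ} (hT0 : 0 < T) (hΔ : 0 ≤ Δ) (hh : ∀ ρ ∈ ZT T, ρ.re = 1/2) {f : ℝ → ℝ} (hf : Continuous f)
    (hanti : AntitoneOn f (Set.Ici 0)) (hf0 : ∀ y, 0 ≤ y → y ≤ T → 0 ≤ f y) :
    2*Real.arctan (Δ/60) * ∑ ρ ∈ ZT T, (mu ρ:ℝ) * f ρ.im ≤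
      ∫ τ in (0:ℝ)..(T+Δ), f (max (τ-Δ) 0) * (Real.log ((τ+200)/(2*π))/2 + 1/10^9) := by
  have hp := Real.pi_pos
  have hfc : Continuous fun τ => f (max (τ-Δ) 0) := by fun_prop
  have hpos : ∀ τ ∈ Set.Icc (0:ℝ) (T+Δ), 0 ≤ f (max (τ-Δ) 0) := fun τ hτ =>
    hf0 _ (le_max_right _ _) (max_le (by linarith [hτ.2]) hT0.le)
  have h1 : ∀ ρ ∈ ZT T, 2*Real.arctan (Δ/60) * f ρ.im ≤ ∫ τ in (0:ℝ)..(T+Δ), f (max (τ-Δ) 0) * pk 60 ρ.im τ := by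
    intro ρ hρ
    obtain ⟨_, h0, hT⟩ := mem_ZT.1 hρ
    have hk := pk_cont (b := 60) (by norm_num) ρ.im
    have a1 : ∫ τ in (0:ℝ)..(ρ.im+Δ), f ρ.im * pk 60 ρ.im τ ≤ ∫ τ in (0:ℝ)..(ρ.im+Δ), f (max (τ-Δ) 0) * pk 60 ρ.im τ := by
      apply intervalIntegral.integral_mono_on (by linarith) ((continuous_const.mul hk).intervalIntegrable _ _) ((hfc.mul hk).intervalIntegrable _ _)
      intro τ hτ
      apply mul_le_mul_of_nonneg_right _ (pk_nonneg (by norm_num) _ _)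
      exact hanti (Set.mem_Ici.2 (le_max_right _ _)) (Set.mem_Ici.2 h0.le) (max_le (by linarith [hτ.2]) h0.le)
    have a2 : ∫ τ in (0:ℝ)..(ρ.im+Δ), f (max (τ-Δ) 0) * pk 60 ρ.im τ ≤ ∫ τ in (0:ℝ)..(T+Δ), f (max (τ-Δ) 0) * pk 60 ρ.im τ := by
      apply intervalIntegral.integral_mono_interval le_rfl (by linarith) (by linarith) _ ((hfc.mul hk).intervalIntegrable _ _)
      rw [Filter.EventuallyLE, ae_restrict_iff' measurableSet_Ioc]
      filter_upwards with τ hτ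
      exact mul_nonneg (hpos τ ⟨hτ.1.le, hτ.2⟩) (pk_nonneg (by norm_num) _ _)
    rw [intervalIntegral.integral_const_mul] at a1
    have a3 := mul_le_mul_of_nonneg_left (pk_int (b := 60) (Δ := Δ) (by norm_num) h0) (hf0 _ h0.le hT)
    linarith
  have h2 : 2*Real.arctan (Δ/60) * ∑ ρ ∈ ZT T, (mu ρ:ℝ) * f ρ.im ≤ ∑ ρ ∈ ZT T, ∫ τ in (0:ℝ)..(T+Δ), (mu ρ:ℝ) * (f (max (τ-Δ) 0) * pk 60 ρ.im τ) := by
    rw [Finset.mul_sum]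
    apply Finset.sum_le_sum
    intro ρ hρ
    rw [intervalIntegral.integral_const_mul]
    have := mul_le_mul_of_nonneg_left (h1 ρ hρ) (Nat.cast_nonneg (α := ℝ) (mu ρ))
    linarith
  refine h2.trans ?_
  rw [← intervalIntegral.integral_finsetSum]
  · apply intervalIntegral.integral_mono_on (by linarith)
    · apply Continuous.intervalIntegrable
      apply continuous_finsetSum
      intro ρ _
      exact continuous_const.mul (hfc.mul (pk_cont (by norm_num) _))
    · apply ContinuousOn.intervalIntegrable
      apply hfc.continuousOn.mul
      apply ContinuousOn.add _ continuousOn_const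
      apply ContinuousOn.div_const
      apply ContinuousOn.log (by fun_prop)
      intro τ hτ
      rw [Set.uIcc_of_le (by linarith)] at hτ
      have := hτ.1
      positivity
    · intro τ hτ
      have a := (pair_sum_le (b := 60) (τ := τ) hh (by norm_num)).trans (X_tau_le hτ.1)
      have b := mul_le_mul_of_nonneg_left a (hpos τ hτ)
      refine le_trans (le_of_eq ?_) b
      rw [Finset.mul_sum]
      apply Finset.sum_congr rfl
      intro ρ _
      rw [pk]; ring
  · intro ρ _
    exact (continuous_const.mul (hfc.mul (pk_cont (by norm_num) _))).intervalIntegrable _ _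

end PB

namespace PB
open Filter Topology Metric MeasureTheory
open scoped ComplexConjugate

lemma int_log_shift {T D : ℝ} (hT : 0 < T) (hD : 0 < D) (hTD : Real.log ((T+D)/D) ≤ 16) :
    IntervalIntegrable (fun y : ℝ => Real.log (y+D) - Real.log y) volume 0 T ∧
    ∫ y in (0:ℝ)..T, (Real.log (y+D) - Real.log y) ≤ 17*D := by
  have hi : IntervalIntegrable (fun y : ℝ => Real.log (y+D)) volume 0 T := by
    apply ContinuousOn.intervalIntegrable
    apply ContinuousOn.log (by fun_prop)
    intro τ hτ
    rw [Set.uIcc_of_le (by linarith)] at hτ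
    have := hτ.1
    positivity
  refine ⟨hi.sub intervalIntegral.intervalIntegrable_log', ?_⟩
  rw [intervalIntegral.integral_sub hi intervalIntegral.intervalIntegrable_log',
    intervalIntegral.integral_comp_add_right (fun y => Real.log y) D, integral_log, integral_log]
  rw [Real.log_div (by positivity) (by positivity)] at hTD
  have h1 : Real.log (T+D) ≤ Real.log T + D/T := by
    have e : T + D = T*(1+D/T) := by field_simp
    rw [e, Real.log_mul (by positivity) (by positivity)]
    have := Real.log_le_sub_one_of_pos (x := 1+D/T) (by positivity)
    linarith
  have h2 : T*Real.log (T+D) ≤ T*Real.log T + D := by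
    have := mul_le_mul_of_nonneg_left h1 hT.le
    have e : T*(Real.log T + D/T) = T*Real.log T + D := by field_simp
    linarith
  have h3 : D*(Real.log (T+D) - Real.log D) ≤ D*16 := mul_le_mul_of_nonneg_left hTD hD.le
  simp
  nlinarith

lemma int_eval {T : ℝ} (hT0 : 3*10^12 ≤ T) (hT1 : T ≤ 31*10^11) {f : ℝ → ℝ} (hf : Continuous f)
    (hanti : AntitoneOn f (Set.Ici 0)) (hf0 : ∀ y, 0 ≤ y → y ≤ T → 0 ≤ f y) :
    ∫ τ in (0:ℝ)..(T+600000), f (max (τ-600000) 0) * (Real.log ((τ+200)/(2*π))/2 + 1/10^9)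
      ≤ f 0 * (6*600000 + 17*600200/2 + T/10^9) + (1/2)*∫ y in (0:ℝ)..T, f y * (Real.log y - Real.log (2*π)) := by
  have hp := Real.pi_pos
  have hp1 := Real.pi_gt_d4
  have hT : 0 < T := by linarith
  have h00 := hf0 0 le_rfl hT.le
  have hfc : Continuous fun τ => f (max (τ-600000) 0) := by fun_prop
  have hii : ∀ a b : ℝ, 0 ≤ a → a ≤ b → IntervalIntegrable (fun τ => f (max (τ-600000) 0) * (Real.log ((τ+200)/(2*π))/2 + 1/10^9)) volume a b := by
    intro a b ha hab
    apply ContinuousOn.intervalIntegrable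
    apply hfc.continuousOn.mul
    apply ContinuousOn.add _ continuousOn_const
    apply ContinuousOn.div_const
    apply ContinuousOn.log (by fun_prop)
    intro τ hτ
    rw [Set.uIcc_of_le hab] at hτ
    have := ha.trans hτ.1
    positivity
  rw [← intervalIntegral.integral_add_adjacent_intervals (hii 0 600000 le_rfl (by norm_num)) (hii 600000 (T+600000) (by norm_num) (by linarith))]
  have h1 : ∫ τ in (0:ℝ)..600000, f (max (τ-600000) 0) * (Real.log ((τ+200)/(2*π))/2 + 1/10^9) ≤ f 0 * (6*600000) := by
    have : ∫ τ in (0:ℝ)..600000, f (max (τ-600000) 0) * (Real.log ((τ+200)/(2*π))/2 + 1/10^9) ≤ ∫ τ in (0:ℝ)..600000, f 0 * 6 := by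
      apply intervalIntegral.integral_mono_on (by norm_num) (hii 0 600000 le_rfl (by norm_num)) (by simp)
      intro τ hτ
      rw [max_eq_right (by linarith [hτ.2])]
      apply mul_le_mul_of_nonneg_left _ h00
      have a : Real.log ((τ+200)/(2*π)) ≤ 11.9 := by
        have b0 := hτ.1
        rw [Real.log_le_iff_le_exp (by positivity)]
        have b : (τ+200)/(2*π) ≤ 100000 := by
          rw [div_le_iff₀ (by positivity)]
          linarith [hτ.2]
        have c : (2.7:ℝ)^11 ≤ Real.exp 11 := by
          have := Real.exp_one_gt_d9
          have e : Real.exp 11 = Real.exp 1^11 := by rw [← Real.exp_nat_mul]; norm_num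
          rw [e]
          exact pow_le_pow_left₀ (by norm_num) (by linarith) 11
        have d : Real.exp 11.9 = Real.exp 11 * Real.exp 0.9 := by rw [← Real.exp_add]; norm_num
        have e := Real.quadratic_le_exp_of_nonneg (x := 0.9) (by norm_num)
        rw [d]
        have : (2.7:ℝ)^11 * 2.305 ≤ Real.exp 11 * Real.exp 0.9 := by
          apply mul_le_mul c _ (by norm_num) (Real.exp_pos _).le
          refine le_trans (by norm_num) e
        refine b.trans (le_trans (by norm_num) this)
      linarith
    refine this.trans (le_of_eq ?_)
    rw [intervalIntegral.integral_const, smul_eq_mul]; ring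
  have h2 : ∫ τ in (600000:ℝ)..(T+600000), f (max (τ-600000) 0) * (Real.log ((τ+200)/(2*π))/2 + 1/10^9)
      = ∫ y in (0:ℝ)..T, f y * (Real.log ((y+600200)/(2*π))/2 + 1/10^9) := by
    have := intervalIntegral.integral_comp_add_right (a := 0) (b := T) (fun τ => f (max (τ-600000) 0) * (Real.log ((τ+200)/(2*π))/2 + 1/10^9)) 600000
    rw [zero_add] at this
    rw [← this]
    apply intervalIntegral.integral_congr
    intro y hy
    rw [Set.uIcc_of_le hT.le] at hy
    simp only
    rw [add_sub_cancel_right, max_eq_left hy.1, add_assoc]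
    norm_num
  obtain ⟨s1, s2⟩ := int_log_shift (T := T) (D := 600200) hT (by norm_num) (by
    rw [Real.log_le_iff_le_exp (by positivity)]
    have c : (2.7:ℝ)^16 ≤ Real.exp 16 := by
      have := Real.exp_one_gt_d9
      have e : Real.exp 16 = Real.exp 1^16 := by rw [← Real.exp_nat_mul]; norm_num
      rw [e]
      exact pow_le_pow_left₀ (by norm_num) (by linarith) 16
    refine le_trans ?_ c
    rw [div_le_iff₀ (by norm_num)]
    norm_num
    linarith)
  have hm : IntervalIntegrable (fun y => f y * (Real.log y - Real.log (2*π))) volume 0 T := by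
    have := (intervalIntegral.intervalIntegrable_log' (a := 0) (b := T)).sub (intervalIntegrable_const (c := Real.log (2*π)) (μ := volume))
    exact this.continuousOn_mul hf.continuousOn
  have h3 : ∫ y in (0:ℝ)..T, f y * (Real.log ((y+600200)/(2*π))/2 + 1/10^9) ≤
      ∫ y in (0:ℝ)..T, ((1/2)*(f y * (Real.log y - Real.log (2*π))) + ((f 0/2)*(Real.log (y+600200) - Real.log y) + f 0/10^9)) := by
    apply intervalIntegral.integral_mono_on_of_le_Ioo hT.le
    · apply ContinuousOn.intervalIntegrable
      apply hf.continuousOn.mul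
      apply ContinuousOn.add _ continuousOn_const
      apply ContinuousOn.div_const
      apply ContinuousOn.log (by fun_prop)
      intro τ hτ
      rw [Set.uIcc_of_le hT.le] at hτ
      have := hτ.1
      positivity
    · exact (hm.const_mul _).add ((s1.const_mul _).add intervalIntegrable_const)
    · intro y hy
      have hy0 : 0 < y := hy.1
      have a := hf0 y hy0.le hy.2.le
      have b : f y ≤ f 0 := hanti Set.self_mem_Ici (Set.mem_Ici.2 hy0.le) hy0.le
      have c : 0 ≤ Real.log (y+600200) - Real.log y := sub_nonneg.2 (Real.log_le_log hy0 (by linarith))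
      rw [Real.log_div (by positivity) (by positivity)]
      nlinarith
  rw [intervalIntegral.integral_add (hm.const_mul _) ((s1.const_mul _).add intervalIntegrable_const),
    intervalIntegral.integral_add (s1.const_mul _) intervalIntegrable_const,
    intervalIntegral.integral_const_mul, intervalIntegral.integral_const_mul, intervalIntegral.integral_const, smul_eq_mul] at h3
  rw [h2]
  have s3 := mul_le_mul_of_nonneg_left s2 (show 0 ≤ f 0/2 by linarith)
  have : f 0 * (6*600000 + 17*600200/2 + T/10^9) = f 0*(6*600000) + (f 0/2*(17*600200) + (T-0)*(f 0/10^9)) := by ring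
  rw [this]
  linarith

end PB

namespace PB
open Filter Topology Metric MeasureTheory
open scoped ComplexConjugate

lemma log3000 : 8.006 ≤ Real.log 3000 ∧ Real.log 3000 ≤ 8.007 := by
  have e8 : Real.exp 8 = Real.exp 1^8 := by rw [← Real.exp_nat_mul]; norm_num
  have l1 := Real.exp_one_gt_d9
  have l2 := Real.exp_one_lt_d9
  constructor
  · rw [Real.le_log_iff_exp_le (by norm_num)]
    have d : Real.exp 8.006 = Real.exp 8 * Real.exp 0.006 := by rw [← Real.exp_add]; norm_num
    have h := Real.exp_bound' (x := 0.006) (by norm_num) (by norm_num) (n := 2) (by norm_num)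
    norm_num [Finset.sum_range_succ, Nat.factorial] at h
    have a : Real.exp 8 ≤ 2.7182818286^8 := by rw [e8]; exact pow_le_pow_left₀ (Real.exp_pos _).le l2.le 8
    rw [d]
    have := mul_le_mul a (show Real.exp 0.006 ≤ 1.0061 by norm_num; linarith) (Real.exp_pos _).le (by norm_num)
    exact this.trans (by norm_num)
  · rw [Real.log_le_iff_le_exp (by norm_num)]
    have d : Real.exp 8.007 = Real.exp 8 * Real.exp 0.007 := by rw [← Real.exp_add]; norm_num
    have h := Real.add_one_le_exp 0.007
    have a : 2.7182818283^8 ≤ Real.exp 8 := by rw [e8]; exact pow_le_pow_left₀ (by norm_num) l1.le 8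
    rw [d]
    have := mul_le_mul a h (by norm_num) (Real.exp_pos _).le
    exact le_trans (by norm_num) this

lemma logT {T : ℝ} (hT0 : 3*10^12 ≤ T) (hT1 : T ≤ 3*10^12+3) : 26.89 ≤ Real.log (T/(2*π)) ∧ Real.log (T/(2*π)) ≤ 26.892 := by
  have hp := Real.pi_pos
  have hp1 := Real.pi_gt_d4
  have hp2 := Real.pi_lt_d4
  have hT : 0 < T := by linarith
  have e27 : Real.exp 27 = Real.exp 1^27 := by rw [← Real.exp_nat_mul]; norm_num
  have l1 := Real.exp_one_gt_d9
  have l2 := Real.exp_one_lt_d9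
  constructor
  · rw [Real.le_log_iff_exp_le (by positivity)]
    have d : Real.exp 26.89 = Real.exp 27 * (Real.exp 0.11)⁻¹ := by rw [← Real.exp_neg, ← Real.exp_add]; norm_num
    have h := Real.quadratic_le_exp_of_nonneg (x := 0.11) (by norm_num)
    have a : Real.exp 27 ≤ 2.7182818286^27 := by rw [e27]; exact pow_le_pow_left₀ (Real.exp_pos _).le l2.le 27
    have b : (Real.exp 0.11)⁻¹ ≤ (1.116)⁻¹ := by
      apply inv_anti₀ (by norm_num)
      norm_num at h ⊢; linarith
    rw [d]
    refine (mul_le_mul a b (by positivity) (by norm_num)).trans ?_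
    rw [le_div_iff₀ (by positivity)]
    have : 2.7182818286^27 * (1.116:ℝ)⁻¹ * (2*π) ≤ 2.7182818286^27 * (1.116:ℝ)⁻¹ * (2*3.1416) := by gcongr
    exact this.trans (le_trans (by norm_num) hT0)
  · rw [Real.log_le_iff_le_exp (by positivity)]
    have d : Real.exp 26.892 = Real.exp 27 * (Real.exp 0.108)⁻¹ := by rw [← Real.exp_neg, ← Real.exp_add]; norm_num
    have h := Real.exp_bound' (x := 0.108) (by norm_num) (by norm_num) (n := 3) (by norm_num)
    norm_num [Finset.sum_range_succ, Nat.factorial] at h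
    have a : 2.7182818283^27 ≤ Real.exp 27 := by rw [e27]; exact pow_le_pow_left₀ (by norm_num) l1.le 27
    have b : (1.1142:ℝ)⁻¹ ≤ (Real.exp 0.108)⁻¹ := by
      apply inv_anti₀ (Real.exp_pos _)
      norm_num at h ⊢; linarith
    rw [d]
    refine le_trans ?_ (mul_le_mul a b (by positivity) (Real.exp_pos _).le)
    rw [div_le_iff₀ (by positivity)]
    have : 2.7182818283^27 * (1.1142:ℝ)⁻¹ * (2*3.1415) ≤ 2.7182818283^27 * (1.1142:ℝ)⁻¹ * (2*π) := by gcongr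
    refine le_trans (hT1.trans (by norm_num)) this

noncomputable def ff (T y : ℝ) : ℝ := (2/(π*(T/3000))) * qq (y/(T/3000)) + 0.2/T - 1.199*y^2/T^3

lemma ff_cont (T : ℝ) : Continuous (ff T) := by
  unfold ff
  have := qq_cont
  fun_prop

lemma ff_anti {T : ℝ} (hT : 0 < T) : AntitoneOn (ff T) (Set.Ici 0) := by
  have hp := Real.pi_pos
  intro a ha b hb hab
  have ha : 0 ≤ a := ha
  unfold ff
  have h1 : qq (b/(T/3000)) ≤ qq (a/(T/3000)) := by
    apply qq_anti (Set.mem_Ici.2 (by positivity)) (Set.mem_Ici.2 (by have : 0 ≤ b := hb; positivity))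
    gcongr
  have h2 : (2/(π*(T/3000))) * qq (b/(T/3000)) ≤ (2/(π*(T/3000))) * qq (a/(T/3000)) := by gcongr
  have h3 : 1.199*a^2/T^3 ≤ 1.199*b^2/T^3 := by gcongr
  linarith

lemma ff_eq {T y : ℝ} (hT : 0 < T) (hy : 0 < y) : ff T y = (2/π) * (Real.arctan (y/(T/3000))/y) + 0.2/T - 1.199*y^2/T^3 := by
  have hp := Real.pi_pos
  rw [ff, qq_eq (by positivity)]
  congr 2
  field_simp

lemma ff_nonneg {T : ℝ} (hT : 0 < T) : ∀ y, 0 ≤ y → y ≤ T → 0 ≤ ff T y := by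
  intro y h0 h1
  have hp := Real.pi_pos
  have hp1 := Real.pi_gt_d4
  refine le_trans ?_ (ff_anti hT (Set.mem_Ici.2 h0) (Set.mem_Ici.2 hT.le) h1)
  rw [ff_eq hT hT]
  have e : T/(T/3000) = (1/3000)⁻¹ := by field_simp
  rw [e, Real.arctan_inv_of_pos (by norm_num)]
  have a := arctan_le_self (x := 1/3000) (by norm_num)
  have e2 : (2/π) * ((π/2 - Real.arctan (1/3000))/T) + 0.2/T - 1.199*T^2/T^3 = (1 - (2/π)*Real.arctan (1/3000) + 0.2 - 1.199)/T := by
    field_simp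
  rw [e2]
  apply div_nonneg _ hT.le
  have b : (2/π) * Real.arctan (1/3000) ≤ 1*(1/3000) := by
    apply mul_le_mul _ a (Real.arctan_nonneg.2 (by norm_num)) (by norm_num)
    rw [div_le_one hp]; linarith
  linarith

lemma ff_main {T : ℝ} (hT : 0 < T) : ∫ y in (0:ℝ)..T, ff T y * (Real.log y - Real.log (2*π)) =
    (2/π)*(BL 3000 + (Real.log (T/(2*π)) - Real.log 3000) * AA 3000) + 0.2*(Real.log (T/(2*π)) - 1) - 1.199*(Real.log (T/(2*π))/3 - 1/9) := by
  have hp := Real.pi_pos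
  set c := Real.log (2*π) with hc
  set β := T/3000 with hβ
  have hβ0 : 0 < β := by positivity
  have hL : Real.log (T/(2*π)) = Real.log T - c := by rw [Real.log_div (by positivity) (by positivity)]
  have hl : IntervalIntegrable (fun y : ℝ => Real.log y - c) volume 0 T :=
    (intervalIntegral.intervalIntegrable_log' (a := 0) (b := T)).sub intervalIntegrable_const
  have hq : Continuous fun y => qq (y/β) := by have := qq_cont; fun_prop
  have i1 : IntervalIntegrable (fun y : ℝ => (2/(π*β)) * (qq (y/β) * (Real.log y - c))) volume 0 T :=
    (hl.continuousOn_mul hq.continuousOn).const_mul _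
  have i2 : IntervalIntegrable (fun y : ℝ => (0.2/T) * (Real.log y - c)) volume 0 T := hl.const_mul _
  obtain ⟨s1, s2⟩ := int_sq_log hT
  have i4 : IntervalIntegrable (fun y : ℝ => c*y^2) volume 0 T := (by fun_prop : Continuous fun y : ℝ => c*y^2).intervalIntegrable _ _
  have i3 : IntervalIntegrable (fun y : ℝ => (1.199/T^3) * (y^2*Real.log y - c*y^2)) volume 0 T := (s1.sub i4).const_mul _
  have e : ∀ y, ff T y * (Real.log y - c) = (2/(π*β)) * (qq (y/β) * (Real.log y - c)) + (0.2/T) * (Real.log y - c) - (1.199/T^3) * (y^2*Real.log y - c*y^2) := by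
    intro y; rw [ff]; ring
  simp_rw [e]
  rw [intervalIntegral.integral_sub (i1.add i2) i3, intervalIntegral.integral_add i1 i2, intervalIntegral.integral_const_mul,
    intervalIntegral.integral_const_mul, intervalIntegral.integral_const_mul, intervalIntegral.integral_sub s1 i4, s2,
    intervalIntegral.integral_sub intervalIntegral.intervalIntegrable_log' intervalIntegrable_const, integral_log,
    intervalIntegral.integral_const_mul, integral_pow, intervalIntegral.integral_const]
  have e1 : ∫ y in (0:ℝ)..T, qq (y/β) * (Real.log y - c) = β * (BL 3000 + (Real.log T - c - Real.log 3000) * AA 3000) := by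
    have a1 : ∫ y in (0:ℝ)..T, qq (y/β) * (Real.log y - c) = ∫ y in (0:ℝ)..T, (fun v => qq v * Real.log v + (Real.log T - c - Real.log 3000) * qq v) (y/β) := by
      apply intervalIntegral.integral_congr_ae
      filter_upwards with y hy
      rw [Set.uIoc_of_le hT.le] at hy
      have hy0 : 0 < y := hy.1
      rw [Real.log_div hy0.ne' hβ0.ne', hβ, Real.log_div hT.ne' (by norm_num)]
      ring
    rw [a1, intervalIntegral.integral_comp_div (fun v => qq v * Real.log v + (Real.log T - c - Real.log 3000) * qq v) hβ0.ne', smul_eq_mul, intervalIntegral.integral_add (qlog_ii _ _) ((qq_cont.intervalIntegrable _ _).const_mul _),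
      intervalIntegral.integral_const_mul]
    have a2 : T/β = 3000 := by rw [hβ]; field_simp
    rw [a2, zero_div, AA, BL]
  rw [e1, hL]
  simp
  field_simp
  ring

lemma zero_sum (hRH : RHT) {T : ℝ} (hT0 : 3*10^12 ≤ T) (hT1 : T ≤ 3*(10:ℝ)^12+1+π/3) :
    2 * ∑ ρ ∈ ZT T, (mu ρ:ℝ) * (1.00001 * (1/ρ.im + 0.2/T - 1.199*ρ.im^2/T^3)) ≤ 113.6 := by
  have hp := Real.pi_pos
  have hp1 := Real.pi_gt_d4
  have hp2 := Real.pi_lt_d4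
  have hT : 0 < T := by linarith
  have hh := ZT_half hRH hT1
  set L0 := Real.log (T/(2*π)) with hL0
  set ℓ := Real.log 3000 with hℓ
  obtain ⟨b1, b2⟩ := logT hT0 (by linarith)
  obtain ⟨b3, b4⟩ := log3000
  rw [← hL0] at b1 b2
  rw [← hℓ] at b3 b4
  have hΛ : Real.log (T/3000/(2*π)) = L0 - ℓ := by
    rw [hL0, hℓ, ← Real.log_div (by positivity) (by norm_num)]
    congr 1; field_simp
  have h1 := part1 hRH hT1 (β0 := T/3000) (by linarith)
  rw [hΛ] at h1
  have h2 := (smooth_sum hT (Δ := 600000) (by norm_num) hh (ff_cont T) (ff_anti hT) (ff_nonneg hT)).trans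
    (int_eval hT0 (by linarith) (ff_cont T) (ff_anti hT) (ff_nonneg hT))
  rw [ff_main hT, ← hL0, ← hℓ] at h2
  set S1 := ∑ ρ ∈ ZT T, (mu ρ:ℝ) * (Real.arctan (T/3000/ρ.im)/ρ.im) with hS1
  set S2 := ∑ ρ ∈ ZT T, (mu ρ:ℝ) * ff T ρ.im with hS2
  have hS2n : 0 ≤ S2 := Finset.sum_nonneg (fun ρ hρ => by
    obtain ⟨_, h0, hT⟩ := mem_ZT.1 hρ
    exact mul_nonneg (Nat.cast_nonneg _) (ff_nonneg (by linarith) _ h0.le hT))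
  have hsplit : 2 * ∑ ρ ∈ ZT T, (mu ρ:ℝ) * (1.00001 * (1/ρ.im + 0.2/T - 1.199*ρ.im^2/T^3)) = 1.00001*((2/π)*(2*S1) + 2*S2) := by
    rw [hS1, hS2, Finset.mul_sum, Finset.mul_sum, Finset.mul_sum, Finset.mul_sum, ← Finset.sum_add_distrib, Finset.mul_sum]
    apply Finset.sum_congr rfl
    intro ρ hρ
    have h0 := (mem_ZT.1 hρ).2.1
    rw [ff_eq hT h0]
    have e : T/3000/ρ.im = (ρ.im/(T/3000))⁻¹ := by rw [inv_div]
    rw [e, Real.arctan_inv_of_pos (by positivity)]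
    have e2 : 1/ρ.im = (2/π)*((π/2 - Real.arctan (ρ.im/(T/3000)))/ρ.im) + (2/π)*(Real.arctan (ρ.im/(T/3000))/ρ.im) := by
      field_simp
      ring
    rw [e2]
    ring
  rw [hsplit]
  -- part one
  have q1 : 2*S1 ≤ 90.071 := by
    have : (L0-ℓ)^2 ≤ 18.886^2 := pow_le_pow_left₀ (by linarith) (by linarith) 2
    norm_num at this h1 ⊢
    linarith
  have hpi : 2/π ≤ 0.63664 := by rw [div_le_iff₀ hp]; linarith
  have hpi0 : 0.6366 ≤ 2/π := by rw [le_div_iff₀ hp]; linarith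
  have q2 : (2/π)*(2*S1) ≤ 57.345 := by
    have : 0 ≤ S1 := Finset.sum_nonneg (fun ρ hρ => by
      obtain ⟨_, h0, hT⟩ := mem_ZT.1 hρ
      exact mul_nonneg (Nat.cast_nonneg _) (div_nonneg (Real.arctan_nonneg.2 (by positivity)) h0.le))
    nlinarith
  -- part two
  have hA : AA 3000 ≤ (π/2)*ℓ + 1/3000 := AA_le (by norm_num)
  have hB : BL 3000 ≤ 2*(-1+1/27) + (π/4)*ℓ^2 + (1+ℓ)/3000 := BL_le (by norm_num)
  have hM : (2/π)*(BL 3000 + (L0-ℓ)*AA 3000) ≤ L0*ℓ - ℓ^2/2 - 1.21 := by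
    have a1 : (L0-ℓ)*AA 3000 ≤ (L0-ℓ)*((π/2)*ℓ + 1/3000) := mul_le_mul_of_nonneg_left hA (by linarith)
    have a2 : (2/π)*(BL 3000 + (L0-ℓ)*AA 3000) ≤ (2/π)*((2*(-1+1/27) + (π/4)*ℓ^2 + (1+ℓ)/3000) + (L0-ℓ)*((π/2)*ℓ + 1/3000)) :=
      mul_le_mul_of_nonneg_left (by linarith) (by positivity)
    have a3 : (2/π)*((2*(-1+1/27) + (π/4)*ℓ^2 + (1+ℓ)/3000) + (L0-ℓ)*((π/2)*ℓ + 1/3000)) = L0*ℓ - ℓ^2/2 + (2/π)*(-52/27 + (1+L0)/3000) := by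
      field_simp; ring
    have a4 : (2/π)*(-52/27 + (1+L0)/3000) ≤ -1.21 := by nlinarith
    linarith
  have hLl : L0*ℓ - ℓ^2/2 ≤ 183.27 := by nlinarith
  have hf0 : ff T 0 * (6*600000 + 17*600200/2 + T/10^9) ≤ 0.01 := by
    have e : ff T 0 = ((2/π)*3000 + 0.2)/T := by
      rw [ff, zero_div, qq_zero]; field_simp; ring
    rw [e, div_mul_eq_mul_div, div_le_iff₀ hT]
    nlinarith
  have harc : π/2 - 1/10000 ≤ Real.arctan (600000/60) := by
    have e : (600000:ℝ)/60 = (1/10000)⁻¹ := by norm_num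
    rw [e, Real.arctan_inv_of_pos (by norm_num)]
    have := arctan_le_self (x := 1/10000) (by norm_num)
    linarith
  have q3 : 2*S2*3.1413 ≤ 2*88.325 := by
    have : 2*3.1413/2*S2 ≤ 2*Real.arctan (600000/60)*S2 := mul_le_mul_of_nonneg_right (by linarith) hS2n
    linarith
  linarith

end PB

namespace PB
open Filter Topology Metric MeasureTheory
open scoped ComplexConjugate

lemma exp_recip_le {l : ℝ} (h0 : 0 < l) (h1 : l ≤ 1/100) : 1/(Real.exp l - 1) ≤ 1/l - 1/2 + l/11 := by
  have h : l + l^2/2 + l^3/6 ≤ Real.exp l - 1 := by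
    have := Real.sum_le_exp_of_nonneg h0.le 4
    norm_num [Finset.sum_range_succ, Nat.factorial] at this
    linarith
  have hp : 0 < l + l^2/2 + l^3/6 := by positivity
  refine (one_div_le_one_div_of_le hp h).trans ?_
  rw [div_le_iff₀ hp]
  have e : (1/l - 1/2 + l/11)*(l + l^2/2 + l^3/6) = 1 + l^2*((1/11-1/12) + l*(1/22-1/12) + l^2/66) := by field_simp; ring
  rw [e]
  have : 0 ≤ l^2*((1/11-1/12) + l*(1/22-1/12) + l^2/66) := by
    apply mul_nonneg (sq_nonneg l)
    nlinarith [sq_nonneg l]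
  linarith

lemma exp_recip_ge {l : ℝ} (h0 : 0 < l) (h1 : l ≤ 1/100) : 1/l - 1/2 ≤ 1/(Real.exp l - 1) := by
  have hp : 0 < Real.exp l - 1 := by linarith [Real.add_one_lt_exp h0.ne']
  have h : Real.exp l - 1 ≤ l + l^2/2 + l^3*(2/9) := by
    have := Real.exp_bound' h0.le (by linarith) (n := 3) (by norm_num)
    norm_num [Finset.sum_range_succ, Nat.factorial] at this
    linarith
  rw [le_div_iff₀ hp]
  have h2 : 0 ≤ 1/l - 1/2 := by
    have : 2 ≤ 1/l := by rw [le_div_iff₀ h0]; linarith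
    linarith
  refine (mul_le_mul_of_nonneg_left h h2).trans ?_
  have e : (1/l - 1/2)*(l + l^2/2 + l^3*(2/9)) = 1 - l^2*(1/36 + l/9) := by field_simp; ring
  rw [e]
  have : 0 ≤ l^2*(1/36 + l/9) := by positivity
  linarith

noncomputable def SS (ε x : ℝ) : ℝ := ∑ n ∈ Icc 1 ⌊x⌋₊, ArithmeticFunction.vonMangoldt n/(n:ℝ)*Real.exp (-ε*(Real.log x - Real.log n))

lemma assemble0 (hRH : RHT) {T x ε : ℝ} (hT0 : 3*(10:ℝ)^12+π/3+1/2 ≤ T) (hT1 : T ≤ 3*(10:ℝ)^12+π/3+1)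
    (hd : ∀ ρ, Xi ρ = 0 → 1/92 ≤ |ρ.im - T|) (hε : 0 < ε) (hε1 : ε ≤ 1) (hx : 10^4 ≤ x) (hL : 2 < Real.log x) :
    |SS ε x - (1 - Real.exp (-ε*Real.log x))/ε - (gg (1-ε:ℝ)).re*Real.exp (-ε*Real.log x)| ≤
      π/T + 3.6/T^2 + (113.6*Real.exp (-Real.log x/2) + 3060/T^2*(1/(Real.log x-2)^2) + 16210*Real.exp (-2*Real.log x)) := by
  have hp := Real.pi_pos
  have hp1 := Real.pi_gt_d4
  have hp2 := Real.pi_lt_d4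
  have hT : 0 < T := by linarith
  set l : ℝ := 2*π*ε/T with hl
  have hl0 : 0 < l := by positivity
  have hlε : l*T/(2*π) = ε := by rw [hl]; field_simp
  have hl1 : l ≤ 1/100 := by
    rw [hl, div_le_iff₀ hT]
    nlinarith
  have hZ := ZT_half (T := T) hRH (by linarith)
  have hzs := zero_sum hRH (T := T) (by linarith) (by linarith)
  have key : ∀ j : ℝ, (j = 0 ∨ j = 1) → |Dd l j T (Real.log x) 0 - (gg (1-ε:ℝ)).re*Real.exp (-ε*Real.log x)| ≤
      113.6*Real.exp (-Real.log x/2) + 3060/T^2*(1/(Real.log x-2)^2) + 16210*Real.exp (-2*Real.log x) := by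
    intro j hj
    have h := E2 (l := l) (j := j) (T := T) (L := Real.log x) hRH hj (by linarith) (by linarith) (by linarith) hd hl0 hl1 (by rw [hlε]; exact hε1) hL
    rw [hlε] at h
    refine h.trans ?_
    have hsum : (4*π/T)*(∑ ρ ∈ ZT T, (mu ρ:ℝ)*‖Kz l j T ρ‖) ≤ 113.6 := by
      refine le_trans ?_ hzs
      have e : (4*π/T)*(∑ ρ ∈ ZT T, (mu ρ:ℝ)*‖Kz l j T ρ‖) = 2*∑ ρ ∈ ZT T, (mu ρ:ℝ)*(2*π/T*‖Kz l j T ρ‖) := by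
        rw [Finset.mul_sum, Finset.mul_sum]
        apply Finset.sum_congr rfl
        intro ρ _
        ring
      rw [e]
      apply mul_le_mul_of_nonneg_left _ (by norm_num)
      apply Finset.sum_le_sum
      intro ρ hρ
      apply mul_le_mul_of_nonneg_left _ (Nat.cast_nonneg _)
      obtain ⟨hX, h0, h1⟩ := mem_ZT.1 hρ
      refine Kz_bound' hj (by linarith) hl0 (by rw [hlε]; exact hε1) (hZ ρ hρ) h0 (lt_of_le_of_ne h1 ?_)
      intro h2
      have := hd ρ hX
      rw [h2, sub_self, abs_zero] at this
      norm_num at this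
    have := mul_le_mul_of_nonneg_right hsum (Real.exp_pos (-Real.log x/2)).le
    linarith
  have k0 := abs_le.1 (key 0 (Or.inl rfl))
  have k1 := abs_le.1 (key 1 (Or.inr rfl))
  have e0 := E1 (j := 0) (T := T) (l := l) (x := x) (Or.inl rfl) hT hl0 (by linarith)
  have e1 := E1 (j := 1) (T := T) (l := l) (x := x) (Or.inr rfl) hT hl0 (by linarith)
  rw [hlε] at e0 e1
  have hS : SS ε x = ∑ n ∈ Icc 1 ⌊x⌋₊, ArithmeticFunction.vonMangoldt n/(n:ℝ)*Real.exp (-ε*(Real.log x - Real.log n)) := rfl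
  rw [← hS] at e0 e1
  have r1 := exp_recip_le hl0 hl1
  have r0 := exp_recip_ge hl0 hl1
  have m1 : 2*π/T*((2*1-1)*(1/(Real.exp l - 1) + 1 - 1/l)) ≤ π/T + 3.6/T^2 := by
    have a : 2*π/T*((2*1-1)*(1/(Real.exp l - 1) + 1 - 1/l)) ≤ 2*π/T*(1/2 + l/11) :=
      mul_le_mul_of_nonneg_left (by linarith) (by positivity)
    have b : 2*π/T*(1/2 + l/11) = π/T + (4*π^2*ε/11)/T^2 := by rw [hl]; field_simp; ring
    have c : (4*π^2*ε/11)/T^2 ≤ 3.6/T^2 := by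
      apply div_le_div_of_nonneg_right _ (by positivity)
      have : π^2 ≤ 3.1416^2 := pow_le_pow_left₀ hp.le hp2.le 2
      nlinarith [sq_nonneg π]
    linarith
  have m0 : 2*π/T*((2*0-1)*(1/(Real.exp l - 1) + 0 - 1/l)) ≤ π/T := by
    have a : 2*π/T*((2*0-1)*(1/(Real.exp l - 1) + 0 - 1/l)) ≤ 2*π/T*(1/2) :=
      mul_le_mul_of_nonneg_left (by linarith) (by positivity)
    have b : 2*π/T*(1/2) = π/T := by ring
    linarith
  have hT2 : 0 ≤ 3.6/T^2 := by positivity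
  rw [abs_le]
  constructor <;> linarith

lemma exp_log_half {x : ℝ} (hx : 0 < x) : Real.exp (-Real.log x/2) = 1/Real.sqrt x := by
  rw [Real.sqrt_eq_rpow, Real.rpow_def_of_pos hx, one_div, ← Real.exp_neg]
  congr 1; ring

lemma exp_log_two {x : ℝ} (hx : 0 < x) : Real.exp (-2*Real.log x) = 1/x^2 := by
  rw [neg_mul, Real.exp_neg, two_mul, Real.exp_add, Real.exp_log hx, one_div, sq]

lemma log_ge_of_pow {x : ℝ} (hx : 10^4 ≤ x) : 9 ≤ Real.log x := by
  rw [Real.le_log_iff_exp_le (by linarith)]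
  have e : Real.exp 9 = Real.exp 1^9 := by rw [← Real.exp_nat_mul]; norm_num
  have : Real.exp 1^9 ≤ 2.7183^9 := pow_le_pow_left₀ (Real.exp_pos _).le (by linarith [Real.exp_one_lt_d9]) 9
  rw [e]
  refine this.trans (le_trans (by norm_num) hx)

lemma log_ge_of_pow36 {x : ℝ} (hx : 10^36 ≤ x) : 82 ≤ Real.log x := by
  rw [Real.le_log_iff_exp_le (by linarith)]
  have e : Real.exp 82 = Real.exp 1^82 := by rw [← Real.exp_nat_mul]; norm_num
  have : Real.exp 1^82 ≤ 2.7183^82 := pow_le_pow_left₀ (Real.exp_pos _).le (by linarith [Real.exp_one_lt_d9]) 82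
  rw [e]
  refine this.trans (le_trans (by norm_num) hx)

lemma assemble (hRH : RHT) {x ε : ℝ} (hε : 0 < ε) (hε1 : ε ≤ 1) (hx : 10^4 ≤ x) :
    |SS ε x - (1 - Real.exp (-ε*Real.log x))/ε - (gg (1-ε:ℝ)).re*Real.exp (-ε*Real.log x)| ≤
      π/(3*(10:ℝ)^12) + 113.62/Real.sqrt x := by
  obtain ⟨T, hT0, hT1, hd⟩ := exists_T hRH
  have hp := Real.pi_pos
  have hp1 := Real.pi_gt_d4
  have hp2 := Real.pi_lt_d4
  have hx0 : 0 < x := by linarith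
  have hT : 0 < T := by linarith
  have h9 := log_ge_of_pow hx
  refine (assemble0 hRH hT0 hT1 hd hε hε1 hx (by linarith)).trans ?_
  rw [exp_log_half hx0, exp_log_two hx0]
  set N : ℝ := 3*(10:ℝ)^12 with hN
  have hs : 100 ≤ Real.sqrt x := by
    apply Real.le_sqrt_of_sq_le; linarith
  have hs0 : 0 < Real.sqrt x := by linarith
  have hsx : Real.sqrt x^2 = x := Real.sq_sqrt hx0.le
  have c1 : 16210*(1/x^2) ≤ 0.01621*(1/Real.sqrt x) := by
    rw [mul_one_div, mul_one_div, div_le_div_iff₀ (by positivity) hs0]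
    have : x^2 = Real.sqrt x^3*Real.sqrt x := by nth_rewrite 1 [← hsx]; ring
    have h3 : (100:ℝ)^3 ≤ Real.sqrt x^3 := pow_le_pow_left₀ (by norm_num) hs 3
    rw [this]
    nlinarith
  have c2 : π/T + 4.08/T^2 ≤ π/N := by
    have hN0 : (0:ℝ) < N := by rw [hN]; norm_num
    have e : π/N - π/T = π*(T-N)/(N*T) := by field_simp
    have : 4.08/T^2 ≤ π*(T-N)/(N*T) := by
      rw [div_le_div_iff₀ (by positivity) (by positivity)]
      have a : 4.08*N ≤ π*(T-N)*T := by
        have b : 1.5 ≤ T - N := by rw [hN]; linarith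
        have c : 4.08 ≤ π*(T-N) := by nlinarith
        have d : N ≤ T := by linarith
        nlinarith
      nlinarith
    linarith
  have c3 : 3.6/T^2 + 3060/T^2*(1/(Real.log x-2)^2) ≤ 4.08/T^2 + 0.001*(1/Real.sqrt x) := by
    rcases le_or_gt (10^36) x with h | h
    · have h82 := log_ge_of_pow36 h
      have : 1/(Real.log x-2)^2 ≤ 1/80^2 := one_div_le_one_div_of_le (by norm_num) (pow_le_pow_left₀ (by norm_num) (by linarith) 2)
      have a : 3060/T^2*(1/(Real.log x-2)^2) ≤ 3060/T^2*(1/80^2) := mul_le_mul_of_nonneg_left this (by positivity)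
      have b : 3.6/T^2 + 3060/T^2*(1/80^2) ≤ 4.08/T^2 := by
        rw [div_mul_eq_mul_div, ← add_div]
        apply div_le_div_of_nonneg_right _ (by positivity)
        norm_num
      have : 0 ≤ 0.001*(1/Real.sqrt x) := by positivity
      linarith
    · have hs2 : Real.sqrt x ≤ 10^18 := by
        rw [Real.sqrt_le_left (by norm_num)]; norm_num at h ⊢; exact h.le
      have : 1/(Real.log x-2)^2 ≤ 1/7^2 := one_div_le_one_div_of_le (by norm_num) (pow_le_pow_left₀ (by norm_num) (by linarith) 2)
      have a : 3060/T^2*(1/(Real.log x-2)^2) ≤ 3060/T^2*(1/7^2) := mul_le_mul_of_nonneg_left this (by positivity)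
      have b : 3060/T^2*(1/7^2) ≤ 0.001*(1/10^18) := by
        rw [div_mul_eq_mul_div, div_le_iff₀ (by positivity)]
        have : (3*(10:ℝ)^12)^2 ≤ T^2 := pow_le_pow_left₀ (by norm_num) (by linarith) 2
        nlinarith
      have c : 1/10^18 ≤ 1/Real.sqrt x := one_div_le_one_div_of_le hs0 hs2
      have d : 3.6/T^2 ≤ 4.08/T^2 := div_le_div_of_nonneg_right (by norm_num) (by positivity)
      linarith
  have e : 113.62/Real.sqrt x = 113.62*(1/Real.sqrt x) := by ring
  rw [e]
  have : 0 < 1/Real.sqrt x := by positivity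
  linarith

end PB

namespace PB
open Filter Topology Metric MeasureTheory
open scoped ComplexConjugate

lemma SS_one {x : ℝ} (hx : 0 < x) :
    SS 1 x = (∑ n ∈ Icc 1 ⌊x⌋₊, ArithmeticFunction.vonMangoldt n) / x := by
  unfold SS
  rw [Finset.sum_div]
  refine Finset.sum_congr rfl fun n hn => ?_
  have hn0 : (0:ℝ) < n := by
    have := (Finset.mem_Icc.1 hn).1
    exact_mod_cast this
  have : Real.exp (-1 * (Real.log x - Real.log n)) = n / x := by
    rw [show -1 * (Real.log x - Real.log n) = Real.log n - Real.log x by ring, Real.exp_sub,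
      Real.exp_log hn0, Real.exp_log hx]
  rw [this]
  field_simp

lemma large_psi (hRH : RHT) {x : ℝ} (hx : 10^4 ≤ x) :
    |(∑ n ∈ Icc 1 ⌊x⌋₊, ArithmeticFunction.vonMangoldt n) - x|
      ≤ π/(3*(10:ℝ)^12)*x + 113.67*Real.sqrt x := by
  have hx0 : 0 < x := by linarith
  have h := assemble hRH one_pos le_rfl hx
  rw [SS_one hx0] at h
  have he : Real.exp (-1 * Real.log x) = 1 / x := by
    rw [neg_one_mul, Real.exp_neg, Real.exp_log hx0, one_div]
  have hg : (gg ((1 - 1 : ℝ) : ℂ)).re = 1 - Real.log (2*π) := by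
    rw [sub_self, Complex.ofReal_zero, gg_zero]
    rw [Complex.sub_re, Complex.one_re, Complex.ofReal_re]
  rw [he, hg, Real.log_mul two_ne_zero Real.pi_ne_zero] at h
  set P := ∑ n ∈ Icc 1 ⌊x⌋₊, ArithmeticFunction.vonMangoldt n
  have hs : Real.sqrt x * Real.sqrt x = x := Real.mul_self_sqrt hx0.le
  have hs0 : 100 ≤ Real.sqrt x := Real.le_sqrt_of_sq_le (by norm_num at hx ⊢; linarith)
  have hl2 : Real.log 2 < 0.7 := by have := Real.log_two_lt_d9; linarith
  have hl2' : 0 < Real.log 2 := Real.log_pos (by norm_num)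
  have hp1 := log_pi_le
  have hp2 := one_le_log_pi
  have key : P / x - (1 - 1/x)/1 - (1 - (Real.log 2 + Real.log π)) * (1/x)
      = (P - x + (Real.log 2 + Real.log π)) / x := by field_simp; ring
  rw [key, abs_div, abs_of_pos hx0, div_le_iff₀ hx0] at h
  have h3 : (π/(3*(10:ℝ)^12) + 113.62/Real.sqrt x) * x
      = π/(3*(10:ℝ)^12)*x + 113.62*Real.sqrt x := by
    rw [add_mul]
    congr 1
    rw [div_mul_eq_mul_div, div_eq_iff (by positivity)]
    linarith
  rw [h3] at h
  rw [abs_le] at h ⊢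
  constructor <;> linarith [h.1, h.2]

lemma large_sum (hRH : RHT) {x : ℝ} (hx : 10^4 ≤ x) :
    |(∑ n ∈ Icc 1 ⌊x⌋₊, ArithmeticFunction.vonMangoldt n / n)
        - (Real.log x - Real.eulerMascheroniConstant)|
      ≤ π/(3*(10:ℝ)^12) + 113.67/Real.sqrt x := by
  have hx0 : 0 < x := by linarith
  have hs0 : 0 < Real.sqrt x := Real.sqrt_pos.2 hx0
  have t1 : Tendsto (fun ε : ℝ => SS ε x) (𝓝[>] 0)
      (𝓝 (∑ n ∈ Icc 1 ⌊x⌋₊, ArithmeticFunction.vonMangoldt n / n)) := by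
    have : Continuous (fun ε : ℝ => SS ε x) := by
      unfold SS
      fun_prop
    have h := (this.tendsto 0).mono_left (nhdsWithin_le_nhds (s := Set.Ioi 0))
    simpa [SS] using h
  have t2 : Tendsto (fun ε : ℝ => (1 - Real.exp (-ε*Real.log x))/ε) (𝓝[>] 0) (𝓝 (Real.log x)) := by
    have hd : HasDerivAt (fun ε : ℝ => 1 - Real.exp (-ε*Real.log x)) (Real.log x) 0 := by
      have h1 : HasDerivAt (fun ε : ℝ => -ε*Real.log x) (-1*Real.log x) 0 :=
        ((hasDerivAt_id (0:ℝ)).neg).mul_const _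
      have := (h1.exp).const_sub 1
      simpa using this
    have h := (hd.tendsto_slope).mono_left
      (nhdsWithin_mono 0 (fun y (hy : 0 < y) => (ne_of_gt hy : y ≠ 0)))
    refine h.congr fun ε => ?_
    simp [slope_def_field]
  have t3 : Tendsto (fun ε : ℝ => Real.exp (-ε*Real.log x)) (𝓝[>] 0) (𝓝 1) := by
    have : Continuous (fun ε : ℝ => Real.exp (-ε*Real.log x)) := by fun_prop
    have h := (this.tendsto 0).mono_left (nhdsWithin_le_nhds (s := Set.Ioi 0))
    simpa using h
  have t4 : Tendsto (fun ε : ℝ => (gg ((1-ε:ℝ):ℂ)).re) (𝓝[>] 0)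
      (𝓝 (-Real.eulerMascheroniConstant)) := by
    have hc : ContinuousAt gg (((1-0:ℝ)):ℂ) := by
      rw [sub_zero, Complex.ofReal_one]
      exact (gg_diffAt (riemannZeta₁_ne (by simp))).continuousAt
    have h1 : ContinuousAt (fun ε : ℝ => (gg ((1-ε:ℝ):ℂ)).re) 0 := by
      refine Complex.continuous_re.continuousAt.comp ?_
      refine ContinuousAt.comp (f := fun ε : ℝ => ((1-ε:ℝ):ℂ)) hc ?_
      exact (Complex.continuous_ofReal.comp (continuous_const.sub continuous_id)).continuousAt
    have h := h1.tendsto.mono_left (nhdsWithin_le_nhds (s := Set.Ioi 0))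
    rw [sub_zero, Complex.ofReal_one, gg_one, Complex.neg_re, Complex.ofReal_re] at h
    exact h
  have t := ((t1.sub t2).sub (t4.mul t3)).abs
  have hb := le_of_tendsto t (b := π/(3*(10:ℝ)^12) + 113.62/Real.sqrt x) (by
    filter_upwards [Ioo_mem_nhdsGT (zero_lt_one (α := ℝ))] with ε hε
    exact assemble hRH hε.1 hε.2.le hx)
  have e : ∀ S : ℝ, S - Real.log x - -Real.eulerMascheroniConstant * 1
    = S - (Real.log x - Real.eulerMascheroniConstant) := fun S => by ring
  rw [e] at hb
  refine hb.trans ?_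
  gcongr
  norm_num

lemma log_fact_eq (N : ℕ) :
    ∑ n ∈ Icc 1 N, ArithmeticFunction.vonMangoldt n * ((N / n : ℕ) : ℝ) = Real.log N.factorial := by
  have h := ArithmeticFunction.sum_Ioc_mul_zeta_eq_sum ArithmeticFunction.vonMangoldt N
  rw [ArithmeticFunction.vonMangoldt_mul_zeta] at h
  have e : Icc 1 N = Ioc 0 N := rfl
  rw [e, ← h]
  clear h e
  induction N with
  | zero => simp
  | succ k ih =>
    rw [Finset.sum_Ioc_succ_top (Nat.zero_le k), ih, Nat.factorial_succ, Nat.cast_mul,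
      Real.log_mul (by positivity) (by positivity), ArithmeticFunction.log_apply]
    ring

lemma log_fact_le {N : ℕ} (hN : 1 ≤ N) :
    Real.log N.factorial ≤ (N+1) * Real.log N - N + 1 := by
  induction N, hN using Nat.le_induction with
  | base => simp
  | succ k hk ih =>
    have hk0 : (0:ℝ) < k := by exact_mod_cast hk
    rw [Nat.factorial_succ, Nat.cast_mul, Real.log_mul (by positivity) (by positivity)]
    push_cast
    have h1 := Real.one_sub_inv_le_log_of_pos (show (0:ℝ) < (k+1)/k by positivity)
    rw [Real.log_div (by positivity) (by positivity)] at h1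
    have h2 : 1 - (((k:ℝ)+1)/k)⁻¹ = 1/(k+1) := by field_simp; ring
    rw [h2, div_le_iff₀ (by positivity)] at h1
    nlinarith

lemma mertens_lower {N : ℕ} (hN : 1 ≤ N) :
    Real.log N - 1 ≤ ∑ n ∈ Icc 1 N, ArithmeticFunction.vonMangoldt n / (n:ℝ) := by
  have h1 : Real.log N.factorial ≤ N * ∑ n ∈ Icc 1 N, ArithmeticFunction.vonMangoldt n / (n:ℝ) := by
    rw [← log_fact_eq, Finset.mul_sum]
    refine Finset.sum_le_sum fun n hn => ?_
    have : ((N / n : ℕ) : ℝ) ≤ (N:ℝ) / n := Nat.cast_div_le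
    calc _ ≤ ArithmeticFunction.vonMangoldt n * ((N:ℝ)/n) :=
          mul_le_mul_of_nonneg_left this ArithmeticFunction.vonMangoldt_nonneg
      _ = _ := by ring
  have h2 := Stirling.le_log_factorial_stirling (n := N) (by omega)
  have hN0 : (0:ℝ) < N := by exact_mod_cast hN
  have h3 : 0 ≤ Real.log N := Real.log_natCast_nonneg N
  have h4 : 0 ≤ Real.log (2*π) := Real.log_nonneg (by have := Real.pi_gt_three; linarith)
  by_contra! hc
  have := mul_lt_mul_of_pos_left hc hN0
  linarith

lemma mertens_upper {N : ℕ} (hN : 1 ≤ N) :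
    (N:ℝ) * (∑ n ∈ Icc 1 N, ArithmeticFunction.vonMangoldt n / (n:ℝ)) ≤
      (N+1) * Real.log N - N + 1 + ∑ n ∈ Icc 1 N, ArithmeticFunction.vonMangoldt n := by
  refine le_trans ?_ (add_le_add_left (log_fact_le hN) _)
  rw [← log_fact_eq, Finset.mul_sum, ← Finset.sum_add_distrib]
  refine Finset.sum_le_sum fun n hn => ?_
  have hn0 : 0 < n := (Finset.mem_Icc.1 hn).1
  have hn1 : (0:ℝ) < n := by exact_mod_cast hn0
  have : (N:ℝ) / n ≤ ((N / n : ℕ) : ℝ) + 1 := by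
    rw [div_le_iff₀ hn1]
    have := (Nat.lt_div_mul_add (a := N) hn0).le
    have h' : (N:ℝ) ≤ ((N / n * n + n : ℕ) : ℝ) := by exact_mod_cast this
    push_cast at h'
    linarith
  calc _ = ArithmeticFunction.vonMangoldt n * ((N:ℝ)/n) := by ring
    _ ≤ ArithmeticFunction.vonMangoldt n * (((N / n : ℕ) : ℝ) + 1) :=
          mul_le_mul_of_nonneg_left this ArithmeticFunction.vonMangoldt_nonneg
    _ = _ := by ring

lemma log_four_le : Real.log 4 ≤ 1.3863 := by
  rw [show (4:ℝ) = 2^2 by norm_num, Real.log_pow]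
  have := Real.log_two_lt_d9
  push_cast; linarith

lemma psi_small {y : ℝ} (h2 : 2 ≤ y) (hy : y ≤ 10^4) :
    Chebyshev.psi y ≤ 1.3863*y + 1.3863*Real.sqrt y + 336 := by
  have hy0 : 0 ≤ y := by linarith
  have hl4 := log_four_le
  have hN : ⌊Real.log y / Real.log 2⌋₊ ≤ 13 := by
    apply Nat.lt_succ_iff.1
    have hl : 0 < Real.log 2 := Real.log_pos (by norm_num)
    rw [Nat.floor_lt (div_nonneg (Real.log_nonneg (by linarith)) hl.le), div_lt_iff₀ hl]
    rw [← Real.log_pow]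
    exact Real.log_lt_log (by linarith) (by norm_num at hy ⊢; linarith)
  rw [Chebyshev.psi_eq_theta_add_sum_theta' h2 hN,
    ← Finset.add_sum_Ioc_eq_sum_Icc (by norm_num : 2 ≤ 13)]
  have a1 : ∀ z : ℝ, 0 ≤ z → Chebyshev.theta z ≤ 1.3863 * z := fun z hz =>
    (Chebyshev.theta_le_log4_mul_x hz).trans (mul_le_mul_of_nonneg_right hl4 hz)
  have a2 : Chebyshev.theta (y ^ ((1:ℝ)/(2:ℕ))) ≤ 1.3863 * Real.sqrt y := by
    rw [Real.sqrt_eq_rpow]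
    exact_mod_cast a1 _ (by positivity)
  have a3 : ∑ n ∈ Ioc 2 13, Chebyshev.theta (y ^ ((1:ℝ)/(n:ℕ))) ≤ ∑ n ∈ Ioc 2 13, (1.3863*22:ℝ) := by
    refine Finset.sum_le_sum fun n hn => ?_
    have hn3 : 3 ≤ n := (Finset.mem_Ioc.1 hn).1
    refine (a1 _ (by positivity)).trans (mul_le_mul_of_nonneg_left ?_ (by norm_num))
    have hn3' : (3:ℝ) ≤ n := by exact_mod_cast hn3
    calc y ^ ((1:ℝ)/(n:ℕ)) ≤ y ^ ((1:ℝ)/3) :=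
          Real.rpow_le_rpow_of_exponent_le (by linarith) (one_div_le_one_div_of_le (by norm_num) hn3')
      _ ≤ ((22:ℝ)^(3:ℝ)) ^ ((1:ℝ)/3) := Real.rpow_le_rpow hy0 (by norm_num at hy ⊢; linarith) (by norm_num)
      _ = 22 := by rw [← Real.rpow_mul (by norm_num)]; norm_num
  have a4 : ∑ n ∈ Ioc 2 13, (1.3863*22:ℝ) ≤ 336 := by
    rw [Finset.sum_const, Nat.card_Ioc]; norm_num
  linarith [a1 y hy0]

lemma psi_eq (x : ℝ) : ∑ n ∈ Icc 1 ⌊x⌋₊, ArithmeticFunction.vonMangoldt n = Chebyshev.psi x := rfl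

lemma small_psi {x : ℝ} (h1 : 1 ≤ x) (hx : x ≤ 10^4) :
    |(∑ n ∈ Icc 1 ⌊x⌋₊, ArithmeticFunction.vonMangoldt n) - x|
      ≤ π/(3*(10:ℝ)^12)*x + 113.67*Real.sqrt x := by
  rw [psi_eq]
  have hp : 0 ≤ π/(3*(10:ℝ)^12)*x := by positivity
  have hx0 : 0 ≤ x := by linarith
  have h0 := Chebyshev.psi_nonneg x
  have hl4 := log_four_le
  set u := Real.sqrt x with hu
  have hs : u * u = x := Real.mul_self_sqrt hx0
  have hu1 : 1 ≤ u := Real.one_le_sqrt.2 h1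
  have hu2 : u ≤ 100 := Real.sqrt_le_iff.2 ⟨by norm_num, by norm_num at hx ⊢; linarith⟩
  rw [abs_le]
  constructor
  · nlinarith
  · rcases le_total u 5 with h5 | h5
    · have := Chebyshev.psi_le_const_mul_self hx0
      nlinarith
    · have := psi_small (y := x) (by nlinarith) hx
      rw [← hu] at this
      nlinarith [mul_nonneg (sub_nonneg.2 h5) (sub_nonneg.2 hu2)]

lemma small_sum {x : ℝ} (h1 : 1 ≤ x) (hx : x ≤ 10^4) :
    |(∑ n ∈ Icc 1 ⌊x⌋₊, ArithmeticFunction.vonMangoldt n / n)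
        - (Real.log x - Real.eulerMascheroniConstant)|
      ≤ π/(3*(10:ℝ)^12) + 113.67/Real.sqrt x := by
  have hp : 0 ≤ π/(3*(10:ℝ)^12) := by positivity
  have hx0 : 0 ≤ x := by linarith
  have hl4 := log_four_le
  set N := ⌊x⌋₊ with hN
  have hN1 : 1 ≤ N := Nat.le_floor (by exact_mod_cast h1)
  have hNx : (N:ℝ) ≤ x := Nat.floor_le hx0
  have hxN : x < N + 1 := Nat.lt_floor_add_one x
  have hN1' : (1:ℝ) ≤ N := by exact_mod_cast hN1
  set u := Real.sqrt x with hu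
  have hs : u * u = x := Real.mul_self_sqrt hx0
  have hu1 : 1 ≤ u := Real.one_le_sqrt.2 h1
  have hu2 : u ≤ 100 := Real.sqrt_le_iff.2 ⟨by norm_num, by norm_num at hx ⊢; linarith⟩
  have g1 := Real.one_half_lt_eulerMascheroniConstant
  have g2 := Real.eulerMascheroniConstant_lt_two_thirds
  have lo := mertens_lower hN1
  have up := mertens_upper hN1
  have hpe : ∑ n ∈ Icc 1 N, ArithmeticFunction.vonMangoldt n = Chebyshev.psi N := by
    rw [← psi_eq, Nat.floor_natCast]
  rw [hpe] at up
  set S := ∑ n ∈ Icc 1 N, ArithmeticFunction.vonMangoldt n / (n:ℝ)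
  have hlogN : Real.log N ≤ Real.log x := Real.log_le_log (by linarith) hNx
  have hlogx : Real.log x ≤ Real.log N + 0.6932 := by
    have : Real.log x ≤ Real.log (2*N) := Real.log_le_log (by linarith) (by linarith)
    rw [Real.log_mul (by norm_num) (by positivity)] at this
    have := Real.log_two_lt_d9
    linarith
  have hr : 1.1367 ≤ 113.67/u := by
    rw [le_div_iff₀ (by linarith)]; linarith
  rw [abs_le]
  constructor
  · -- lower bound: the error is at least `-1.2`, refined when `x` is large
    rcases le_total u 50 with h5 | h5
    · have hr' : 2 ≤ 113.67/u := by
        rw [le_div_iff₀ (by linarith)]; linarith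
      linarith
    · have hd := Real.log_le_sub_one_of_pos (show 0 < x / N by positivity)
      rw [Real.log_div (by linarith) (by linarith)] at hd
      have : x / N ≤ 1.1 := by
        rw [div_le_iff₀ (by linarith)]; nlinarith
      linarith
  · suffices S - Real.log N + Real.eulerMascheroniConstant ≤ 113.67/u by linarith
    have hNpos : (0:ℝ) < N := by linarith
    have hlN : Real.log N ≤ N - 1 := Real.log_le_sub_one_of_pos hNpos
    rcases le_total u 5 with h5 | h5
    · have hr' : 22 ≤ 113.67/u := by
        rw [le_div_iff₀ (by linarith)]; linarith
      have hq := Chebyshev.psi_le_const_mul_self hNpos.le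
      have : (N:ℝ) * (S - Real.log N) ≤ N * 6 := by nlinarith
      have := le_of_mul_le_mul_left this hNpos
      linarith
    · have hN10 : (N:ℝ) ≤ 10^4 := hNx.trans hx
      have hq := psi_small (y := N) (by nlinarith) hN10
      have hsq : Real.sqrt N ≤ u := Real.sqrt_le_sqrt hNx
      have hl10 : Real.log N ≤ 10 := by
        rw [Real.log_le_iff_le_exp hNpos]
        have h1 := Real.exp_one_gt_d9
        have h2 : Real.exp 10 = (Real.exp 1)^10 := by rw [← Real.exp_nat_mul]; norm_num
        have h3 : (2.7:ℝ)^10 ≤ (Real.exp 1)^10 := pow_le_pow_left₀ (by norm_num) (by linarith) 10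
        rw [h2]
        refine le_trans ?_ h3
        norm_num at hN10 ⊢; linarith
      have a1 : (N:ℝ) * (S - Real.log N + Real.eulerMascheroniConstant) ≤
          1.0530 * N + 1.3863 * u + 347 := by nlinarith
      have a2 : 1.0530 * N + 1.3863 * u + 347 ≤ N * (113.67/u) := by
        have hNu : u*u - 1 ≤ N := by linarith
        have a3 : 1.3863 * u + 347 ≤ (u*u-1) * (113.67/u - 1.0530) := by
          have : (u*u-1) * (113.67/u - 1.0530) = ((u*u-1) * (113.67 - 1.0530*u))/u := by
            field_simp
          rw [this, le_div_iff₀ (by linarith)]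
          nlinarith [mul_nonneg (sub_nonneg.2 h5) (sub_nonneg.2 hu2),
            mul_nonneg (mul_nonneg (sub_nonneg.2 h5) (sub_nonneg.2 hu2)) (sub_nonneg.2 h5)]
        have a4 : (u*u-1) * (113.67/u - 1.0530) ≤ N * (113.67/u - 1.0530) :=
          mul_le_mul_of_nonneg_right hNu (by linarith)
        linarith
      exact le_of_mul_le_mul_left (a1.trans a2) hNpos
end PB

theorem stmt_1
    (hRH : ∀ ρ : ℂ, riemannZeta ρ = 0 → 0 < ρ.im →
      ρ.im ≤ 3 * (10 : ℝ) ^ 12 + 1 + π / 3 → ρ.re = 1 / 2)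
    (x : ℝ) (hx : 1 ≤ x) :
    |chebyshevPsi x - x| ≤ π / (3 * (10 : ℝ) ^ 12) * x + 113.67 * Real.sqrt x
    ∧
    |(∑ n ∈ Finset.Icc 1 ⌊x⌋₊, ArithmeticFunction.vonMangoldt n / n)
        - (Real.log x - Real.eulerMascheroniConstant)|
      ≤ π / (3 * (10 : ℝ) ^ 12) + 113.67 / Real.sqrt x := by
  have hR : PB.RHT := fun ρ h1 h2 h3 => hRH ρ (PB.Xi_zero_zeta h1) h2 h3
  unfold chebyshevPsi
  rcases le_total x (10^4) with h | h
  · exact ⟨PB.small_psi hx h, PB.small_sum hx h⟩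
  · exact ⟨PB.large_psi hR h, PB.large_sum hR h⟩
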